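/- In Setting (⋆), the relative entropy satisfies for every t ∈ [0,T]: H(f_t | g_t) ≤ H(f₀ | g₀) · exp( 𝒞 ∫₀ᵗ (K_{g1}(s)² + K_{g3}(s)²) ds ), where 𝒞 = C_γ (1 + M_f² + M_g²)(1 + c₀^{−1}), the constant C_γ depends only on γ, and c₀ > 0 depends only on γ and on upper bounds on the energy and entropy of f₀. -/

import Mathlib

noncomputable section

open MeasureTheory Real
open scoped ENNReal RealInnerProductSpace

abbrev V3 : Type := EuclideanSpace ℝ (Fin 3)

abbrev Mat3 : Type := Matrix (Fin 3) (Fin 3) ℝ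

def jap (v : V3) : ℝ := Real.sqrt (1 + ‖v‖ ^ 2)

def esingle (i : Fin 3) : V3 := EuclideanSpace.single i (1 : ℝ)

def proj (z : V3) : Mat3 := fun i j =>
  (if i = j then (1 : ℝ) else 0) - (z i / ‖z‖) * (z j / ‖z‖)

def landauKernel (γ : ℝ) (z : V3) : Mat3 := fun i j => ‖z‖ ^ (γ + 2) * proj z i j

def cutoffKernel (γ : ℝ) (z : V3) : Mat3 := fun i j => jap z ^ γ * ‖z‖ ^ 2 * proj z i j

def bilin (A : Mat3) (w z : V3) : ℝ := ∑ i, ∑ j, A i j * w i * z j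

def quadForm (A : Mat3) (w : V3) : ℝ := bilin A w w

def matDot (A B : Mat3) : ℝ := ∑ i, ∑ j, A i j * B i j

def matNorm (A : Mat3) : ℝ := Real.sqrt (∑ i, ∑ j, (A i j) ^ 2)

def entropy (f : V3 → ℝ) : ℝ := ∫ v, f v * Real.log (f v)

def relEntropy (f g : V3 → ℝ) : ℝ≥0∞ :=
  ∫⁻ v, ENNReal.ofReal ((f v / g v * Real.log (f v / g v) - f v / g v + 1) * g v)

def hess (φ : V3 → ℝ) (v : V3) : Mat3 := fun i j =>
  iteratedFDeriv ℝ 2 φ v ![esingle i, esingle j]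

def hessW (φ : V3 → ℝ) (s : Set V3) (v : V3) : Mat3 := fun i j =>
  iteratedFDerivWithin ℝ 2 φ s v ![esingle i, esingle j]

def logGrad (φ : V3 → ℝ) (v : V3) : V3 := gradient (fun w => Real.log (φ w)) v

def logHess (φ : V3 → ℝ) (v : V3) : Mat3 := hess (fun w => Real.log (φ w)) v

def IsWeakGrad6 (F : V3 × V3 → ℝ) (G : V3 × V3 → V3 × V3) : Prop :=
  ∀ φ : V3 × V3 → ℝ, ContDiff ℝ (⊤ : ℕ∞) φ → HasCompactSupport φ →
    ∀ e : V3 × V3,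
      (∫ p : V3 × V3, F p * fderiv ℝ φ p e) =
        - ∫ p : V3 × V3, (⟪(G p).1, e.1⟫ + ⟪(G p).2, e.2⟫) * φ p

def IsWeakGrad3 (F : V3 → ℝ) (G : V3 → V3) : Prop :=
  ∀ φ : V3 → ℝ, ContDiff ℝ (⊤ : ℕ∞) φ → HasCompactSupport φ →
    ∀ e : V3, (∫ v, F v * fderiv ℝ φ v e) = - ∫ v, ⟪G v, e⟫ * φ v

def dissipation (γ : ℝ) (G : V3 × V3 → V3 × V3) : ℝ≥0∞ :=
  ∫⁻ p : V3 × V3,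
    ENNReal.ofReal (quadForm (landauKernel γ (p.1 - p.2)) ((G p).1 - (G p).2))

structure IsHSolution (γ T : ℝ) (f : ℝ → V3 → ℝ) (fGrad : ℝ → V3 × V3 → V3 × V3) : Prop where
  nonneg : ∀ t ∈ Set.Icc 0 T, ∀ v, 0 ≤ f t v
  integrable : ∀ t ∈ Set.Icc 0 T, Integrable (f t)
  entIntegrable : ∀ t ∈ Set.Icc 0 T, Integrable (fun v => f t v * Real.log (f t v))
  contDistrib : ∀ φ : V3 → ℝ, ContDiff ℝ (⊤ : ℕ∞) φ → HasCompactSupport φ →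
    ContinuousOn (fun t => ∫ v, φ v * f t v) (Set.Icc 0 T)
  mass : ∀ t ∈ Set.Icc 0 T, (∫ v, f t v) = 1
  momentumIntegrable : ∀ t ∈ Set.Icc 0 T, Integrable (fun v => f t v • v)
  momentum : ∀ t ∈ Set.Icc 0 T, (∫ v, f t v • v) = ∫ v, f 0 v • v
  energyIntegrable : ∀ t ∈ Set.Icc 0 T, Integrable (fun v => ‖v‖ ^ 2 * f t v)
  energy : ∀ t ∈ Set.Icc 0 T, (∫ v, ‖v‖ ^ 2 * f t v) = ∫ v, ‖v‖ ^ 2 * f 0 v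
  weakGrad : ∀ᵐ s ∂(volume.restrict (Set.Icc 0 T)),
    IsWeakGrad6 (fun p => Real.sqrt (f s p.1 * f s p.2)) (fGrad s)
  dissipationFinite : ∀ t ∈ Set.Icc 0 T,
    (∫⁻ s in Set.Ioc (0 : ℝ) t, dissipation γ (fGrad s)) < ⊤
  entropyProd : ∀ t ∈ Set.Icc 0 T,
    entropy (f t) + 2 * (∫⁻ s in Set.Ioc (0 : ℝ) t, dissipation γ (fGrad s)).toReal ≤
      entropy (f 0)
  weakForm : ∀ φ : ℝ → V3 → ℝ,
    ContDiff ℝ 2 (fun q : ℝ × V3 => φ q.1 q.2) →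
    HasCompactSupport (fun q : ℝ × V3 => φ q.1 q.2) →
    ∀ t ∈ Set.Icc 0 T,
      (∫ v, φ t v * f t v) - (∫ v, φ 0 v * f 0 v) =
        (∫ s in (0 : ℝ)..t, ∫ v, deriv (fun r => φ r v) s * f s v) -
          ∫ s in (0 : ℝ)..t, ∫ p : V3 × V3,
            bilin (landauKernel γ (p.1 - p.2))
              (gradient (φ s) p.1 - gradient (φ s) p.2)
              ((fGrad s p).1 - (fGrad s p).2) * Real.sqrt (f s p.1 * f s p.2)

def abar (γ : ℝ) (f : V3 → ℝ) (v : V3) : Mat3 := fun i j =>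
  ∫ w, landauKernel γ (v - w) i j * f w

def cbar (γ : ℝ) (f : V3 → ℝ) (v : V3) : ℝ :=
  if γ = -3 then 8 * Real.pi * f v else 2 * (γ + 3) * ∫ w, ‖v - w‖ ^ γ * f w

def cutoffConv (γ : ℝ) (f : V3 → ℝ) (v : V3) : Mat3 := fun i j =>
  ∫ w, cutoffKernel γ (v - w) i j * f w

structure IsClassicalSolution (γ : ℝ) (I : Set ℝ) (g : ℝ → V3 → ℝ) : Prop where
  pos : ∀ t ∈ I, ∀ v, 0 < g t v
  timeC1 : ∀ v, ContDiffOn ℝ 1 (fun t => g t v) I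
  velC2 : ∀ t ∈ I, ContDiff ℝ 2 (g t)
  eqn : ∀ t ∈ I, ∀ v,
    derivWithin (fun s => g s v) I t =
      matDot (abar γ (g t) v) (hess (g t) v) + cbar γ (g t) v * g t v

def rhoExp (γ κ ζ ν : ℝ) : ℝ := max (max (2 * κ) (2 * κ + 2 * γ + 4)) (max (2 * ζ) ν)

structure Setting (γ T : ℝ) where
  f : ℝ → V3 → ℝ
  fGrad : ℝ → V3 × V3 → V3 × V3
  g : ℝ → V3 → ℝ
  κ : ℝ
  ν : ℝ
  ζ : ℝ
  K1 : ℝ → ℝ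
  K2 : ℝ → ℝ
  K3 : ℝ → ℝ
  Mf : ℝ
  Mg : ℝ
  hγ : γ ∈ Set.Ico (-3 : ℝ) 0
  hT : 0 < T
  hf : IsHSolution γ T f fGrad
  hg : IsClassicalSolution γ (Set.Icc 0 T) g
  hκ : 1 ≤ κ
  hν : 1 ≤ ν
  hζ : 0 ≤ ζ
  K1nonneg : ∀ t, 0 ≤ K1 t
  K2nonneg : ∀ t, 0 ≤ K2 t
  K3nonneg : ∀ t, 0 ≤ K3 t
  K1meas : Measurable K1
  K2meas : Measurable K2
  K3meas : Measurable K3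
  K1bound : ∀ t ∈ Set.Icc 0 T, ∀ v, ‖logGrad (g t) v‖ ≤ K1 t * jap v ^ κ
  K2bound : ∀ t ∈ Set.Icc 0 T, ∀ v,
    |derivWithin (fun s => Real.log (g s v)) (Set.Icc 0 T) t| ≤ K2 t * jap v ^ ν
  K3bound : ∀ t ∈ Set.Icc 0 T, ∀ v, matNorm (logHess (g t) v) ≤ K3 t * jap v ^ ζ
  Kint : IntegrableOn (fun t => K2 t + K1 t ^ 2 + K3 t ^ 2) (Set.Icc 0 T)
  fMomentInt : ∀ t ∈ Set.Icc 0 T,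
    Integrable (fun v => jap v ^ (rhoExp γ κ ζ ν - γ) * f t v)
  fMoment : ∀ t ∈ Set.Icc 0 T, (∫ v, jap v ^ (rhoExp γ κ ζ ν - γ) * f t v) ≤ Mf
  gMomentInt : ∀ t ∈ Set.Icc 0 T,
    Integrable (fun v => jap v ^ (rhoExp γ κ ζ ν - γ) * g t v)
  gMoment : ∀ t ∈ Set.Icc 0 T, (∫ v, jap v ^ (rhoExp γ κ ζ ν - γ) * g t v) ≤ Mg

def goodTerm (γ : ℝ) (f g : ℝ → V3 → ℝ) (fGrad : ℝ → V3 × V3 → V3 × V3) (s : ℝ) : ℝ :=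
  2 * ∫ p : V3 × V3,
    quadForm (landauKernel γ (p.1 - p.2))
      (((fGrad s p).1 - (fGrad s p).2) -
        Real.sqrt (f s p.1 * f s p.2) • (logGrad (g s) p.1 - logGrad (g s) p.2))

def landauFlux (γ : ℝ) (g : V3 → ℝ) (v w : V3) : Fin 3 → ℝ := fun i =>
  ∑ j, landauKernel γ (v - w) i j * (g w * (gradient g v) j - g v * (gradient g w) j)

def divDiffFlux (γ : ℝ) (g : V3 → ℝ) (v w : V3) : ℝ :=
  ∑ i, (fderiv ℝ (fun z => landauFlux γ g z w i) v (esingle i) -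
        fderiv ℝ (fun z => landauFlux γ g v z i) w (esingle i))

def badTerm (γ : ℝ) (f g : ℝ → V3 → ℝ) (s : ℝ) : ℝ :=
  (1 / 2) * ∫ p : V3 × V3,
    (f s p.1 - g s p.1) * (f s p.2 - g s p.2) / (g s p.1 * g s p.2) *
      divDiffFlux γ (g s) p.1 p.2

def relFisher (γ : ℝ) (f g : V3 → ℝ) (fGrad3 : V3 → V3) : ℝ :=
  ∫ v, ‖(2 : ℝ) • fGrad3 v - Real.sqrt (f v) • logGrad g v‖ ^ 2 * jap v ^ γ

def gradLogSup (g : ℝ → V3 → ℝ) (κ s : ℝ) : ℝ≥0∞ :=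
  ⨆ v : V3, ENNReal.ofReal (jap v ^ (-κ) * ‖logGrad (g s) v‖)

def dtLogSup (g : ℝ → V3 → ℝ) (T ν s : ℝ) : ℝ≥0∞ :=
  ⨆ v : V3, ENNReal.ofReal
    (jap v ^ (-ν) * |derivWithin (fun r => Real.log (g r v)) (Set.Icc 0 T) s|)

def hessLogSup (g : ℝ → V3 → ℝ) (ζ s : ℝ) : ℝ≥0∞ :=
  ⨆ v : V3, ENNReal.ofReal (jap v ^ (-ζ) * matNorm (logHess (g s) v))

def cube (v₀ : V3) (R : ℝ) : Set V3 := {v | ∀ i, |v i - v₀ i| < R}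

def ccube (R : ℝ) : Set V3 := {v | ∀ i, |v i| ≤ R}

def dCube (v₀ : V3) (R : ℝ) (v : V3) : ℝ :=
  Finset.univ.inf' (Finset.univ_nonempty) fun i : Fin 3 => R - |v i - v₀ i|

def kExp (γ ℓ δ : ℝ) : ℝ := 8 * (max (2 + (ℓ - 2) / (2 + δ)) 1 + (2 - γ) / (2 * δ)) - γ

open Filter (Tendsto atTop)
open Set (Icc Ioc Ico)
theorem aeo {α : Type*} {p : α → Prop} {l : Filter α} (h : ∀ x, p x) : ∀ᶠ x in l, p x := Filter.Eventually.of_forall h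
theorem mll {a b c : ℝ} (h : b ≤ c) (h0 : 0 ≤ a) : a * b ≤ a * c := mul_le_mul_of_nonneg_left h h0
theorem mlr {a b c : ℝ} (h : b ≤ c) (h0 : 0 ≤ a) : b * a ≤ c * a := mul_le_mul_of_nonneg_right h h0
/- Abbreviations for frequent expressions; they are purely textual (hygiene is switched off), so the free
variables refer to the variables of that name at the place of use. -/
set_option hygiene false
notation "aa" => (v - w)
notation "xd" => (x.1 - x.2)
notation "lg" => (logGrad g)
notation "ab" => ‖v - w‖
notation "pv" => (by positivity)
notation "ac" => (by linarith)
notation "ad" => (2 * K1 + K3)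
notation "af" => (2:ℝ)
notation "ag" => ((n : ℝ) + 1)
notation "ah" => (γ + 2)
notation "aj" => (-(5:ℝ) / 2)
notation "ak" => (f v)
notation "al" => (2 : ℝ)
notation "ao" => (l x.1 - l x.2)
notation "ap" => (-γ)
notation "aq" => (√(f x.1) * √(f x.2))
notation "ar" => (0 : V3)
notation "av" => (144 + 160 / c + 128 * (1 + E) ^ 2 / c ^ 2)
notation "aw" => (wt γ 1 aa * Sb aa ξ ξ)
notation "ax" => (γ / 2 - 1)
notation "ay" => (1 + r ^ 2)
notation "az" => (esingle i)
notation "ba" => (logGrad g x.1 - logGrad g x.2)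
notation "bb" => (fun v => jap v ^ p * f v)
notation "bc" => (p / 2)
notation "bd" => (wv f P v w)
notation "be" => (√(f w) • ξ)
notation "bf" => (1 + E)
notation "bg" => ((γ + 3) * wt γ ε aa - γ * (ε * (ε + ab ^ 2) ^ ax))
notation "bh" => (wv f Y x.1 x.2)
notation "bj" => (∫ x, Ik γ f Y lg x)
notation "bk" => (fun v => (G.pos v).le)
notation "bl" => (l v - l w)
notation "bn" => (⊤ : ℕ∞)
notation "bo" => (4 * ad * (jap x.2 ^ p * g x.2))
notation "bp" => ((2 * K1) ^ 2 + K3 ^ 2)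
notation "bq" => (a ^ 2 + b ^ 2)
notation "br" => (4 * π)
notation "bs" => (by norm_num)
notation "bt" => (chi R)
notation "bu" => (-γ / 2)
notation "bv" => (4 * ad)
notation "bw" => (0 - w)
notation "bx" => (K * M)
notation "ca" => (Ioc 0 T)
notation "cf" => (Ioc 0 τ)
notation "cg" => (wv f Y v w)
notation "ch" => (measurable_fst.sub measurable_snd)
notation "ci" => (b x.2 * ZZ p α β x.1 x.2)
notation "cj" => (q.1 - q.2)
notation "ck" => (cl T t)
notation "cn" => (1 + ε)
notation "cp" => ‖Y v‖
notation "cq" => (0 : ℝ)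
notation "ct" => (-3 : ℝ)
notation "cu" => (0:ℝ)
notation "cx" => (∫ x, Dk γ f Y x)
notation "cy" => (4 / c ^ 2)
notation "cz" => (by simp)
notation "da" => (Y v)
notation "db" => ((‖v‖ + R) ^ 2 * √k)
notation "dc" => (wt γ 1 aa * Sb aa ξ (l w))
notation "dd" => (i + 1)
notation "de" => (f w)
notation "df" => (contDiff_const.sub contDiff_id)
notation "dg" => (epn n + ab ^ 2)
notation "dh" => (g x.2 * (wt γ ε xd * fderiv ℝ bt x.1 (So xd ao)))
notation "dj" => (fun v => jap v ^ p * φ v)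
notation "dk" => (jap x.1 ^ p * φ x.1)
notation "dm" => (∫ v, Hd f g v)
notation "dn" => ‖logGrad g v - logGrad g w‖
notation "dp" => (Icc 0 T)
notation "dq" => (∫ w, |f w - g w| * k v w)
notation "dr" => ((γ * (ε + ‖z‖ ^ 2) ^ ax) • (innerSL ℝ z))
notation "ds" => (1 * (1 + ‖ar - w‖ ^ 2) ^ (a / 2 - 1))
notation "dt" => (fun v => ⟪Y v, e⟫)
notation "du" => (e / (2 * (H + B + 1)))
notation "dw" => (-(p - ν))
notation "dx" => (2 * γ + 2)
notation "dy" => ‖l v - l w‖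
notation "dz" => (fun v => fderiv ℝ φ v e)
notation "ea" => (jap v ^ al * jap w ^ al)
notation "eb" => (2 * (1 + R))
notation "ec" => (V3 × V3)
notation "eg" => (logGrad g w)
notation "eh" => ((jap x.1 ^ p * f x.1) * b x.2 + f x.1 * (jap x.2 ^ p * b x.2))
notation "ei" => (hφ0 v)
notation "ej" => (ContinuousLinearMap.lsmul ℝ ℝ)
notation "el" => (Dk γ (F s) (Y s) x)
notation "em" => (g v)
notation "eo" => (∫ v, f v * q v)
notation "ep" => (f v + g v)
notation "er" => (fun v => φ (v, w))
notation "es" => (∫ v, g v)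
notation "et" => (fun v => φ (w, v))
notation "eu" => (wv f (PP f Y lg) v w)
notation "ev" => (γ / 2)
notation "ex" => (x - p)
notation "ey" => (jap v ^ κ * (3 * R))
notation "ez" => (wv f Y x.1 x.2 + (√(f x.1) * √(f x.2) / 2) • ba)
notation "fa" => (logGrad g v)
notation "fc" => (1 + ‖x‖ ^ 2)
notation "fd" => (fun v => jap v ^ p * fb T f t v)
notation "ff" => (2 * s)
notation "fg" => (jap v ^ af * jap w ^ af)
notation "fh" => (wt γ ε aa * qt g v w)
notation "fj" => (4 : ℝ)
notation "fk" => (∫ v, Qk γ f Y lg v)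
notation "fl" => (φ x.1 * (g x.2 * (wt γ ε xd * Sb xd (l x.1) ao)))
notation "fn" => (fb T f)
notation "fo" => ((A.D 0).nn v)
notation "fp" => ‖logGrad g w‖
set_option hygiene true
lemma jap_sq (v : V3) : jap v ^ 2 = 1 + ‖v‖ ^ 2 := sq_sqrt pv
lemma olj (v : V3) : 1 ≤ jap v := by
  unfold jap; rw [one_le_sqrt]; nlinarith [sq_nonneg ‖v‖]
lemma jap_pos (v : V3) : 0 < jap v := lt_of_lt_of_le one_pos (olj v)
lemma nlj (v : V3) : ‖v‖ ≤ jap v := by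
  nlinarith [jap_sq v, norm_nonneg v, jap_pos v]
lemma continuous_jap : Continuous jap := by unfold jap; fun_prop
lemma continuous_jap_rpow (a : ℝ) : Continuous (fun v => jap v ^ a) :=
  continuous_jap.rpow_const (fun v => Or.inl (jap_pos v).ne')
lemma jpp (v : V3) (a : ℝ) : 0 < jap v ^ a := rpow_pos_of_pos (jap_pos v) a
lemma jap_le_one_add (v : V3) : jap v ≤ 1 + ‖v‖ := by
  nlinarith [jap_sq v, norm_nonneg v, jap_pos v]
lemma jpm (v : V3) {a b : ℝ} (h : a ≤ b) : jap v ^ a ≤ jap v ^ b :=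
  rpow_le_rpow_of_exponent_le (olj v) h
lemma ojp (v : V3) {a : ℝ} (h : 0 ≤ a) : 1 ≤ jap v ^ a :=
  one_le_rpow (olj v) h
lemma jap_neg (v : V3) : jap (-v) = jap v := by simp [jap]
def mx (v w : V3) : ℝ := max (jap v) (jap w)
lemma one_le_mx (v w : V3) : 1 ≤ mx v w := (olj v).trans (le_max_left _ _)
lemma mx_pos (v w : V3) : 0 < mx v w := lt_of_lt_of_le one_pos (one_le_mx v w)
lemma jap_le_mx (v w : V3) : jap v ≤ mx v w := le_max_left _ _
lemma jap_le_mx' (v w : V3) : jap w ≤ mx v w := le_max_right _ _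
lemma mx_rpow_mono (v w : V3) {a b : ℝ} (h : a ≤ b) : mx v w ^ a ≤ mx v w ^ b :=
  rpow_le_rpow_of_exponent_le (one_le_mx v w) h
lemma mx_rpow_le (v w : V3) {a : ℝ} (_h : 0 ≤ a) : mx v w ^ a ≤ jap v ^ a + jap w ^ a := by
  unfold mx
  rcases le_total (jap v) (jap w) with h' | h'
  · rw [max_eq_right h']; linarith [jpp v a]
  · rw [max_eq_left h']; linarith [jpp w a]
lemma mx_rpow_le_mul (v w : V3) {a : ℝ} (h : 0 ≤ a) : mx v w ^ a ≤ jap v ^ a * jap w ^ a := by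
  unfold mx
  rcases le_total (jap v) (jap w) with h' | h'
  · rw [max_eq_right h']; nlinarith [jpp w a, ojp v h]
  · rw [max_eq_left h']; nlinarith [jpp v a, ojp w h]
lemma continuous_mx : Continuous (fun p : V3 × V3 => mx p.1 p.2) := by
  unfold mx
  exact (continuous_jap.comp continuous_fst).max (continuous_jap.comp continuous_snd)
lemma norm_sub_le_mx (v w : V3) : ab ≤ 2 * mx v w := by
  have := norm_sub_le v w
  linarith [nlj v, nlj w, jap_le_mx v w, jap_le_mx' v w]
lemma jap_sub_le_mx (v w : V3) : jap aa ≤ 2 * mx v w := by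
  have h1 := jap_sq aa
  have h2 := norm_sub_sq_real v w
  have h3 := norm_sub_le v w
  have h4 : ab ^ 2 ≤ 2 * ‖v‖ ^ 2 + 2 * ‖w‖ ^ 2 := by
    nlinarith [sq_nonneg (‖v‖ - ‖w‖), norm_nonneg aa, norm_nonneg v, norm_nonneg w]
  have h5 := jap_sq v
  have h6 := jap_sq w
  have h7 : jap v ^ 2 ≤ mx v w ^ 2 := pow_le_pow_left₀ (jap_pos v).le (jap_le_mx v w) 2
  have h8 : jap w ^ 2 ≤ mx v w ^ 2 := pow_le_pow_left₀ (jap_pos w).le (jap_le_mx' v w) 2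
  nlinarith [jap_pos aa, mx_pos v w]
lemma peetre (v w : V3) : jap aa ≤ 2 * (jap v * jap w) := by
  refine (jap_sub_le_mx v w).trans ?_
  have := mx_rpow_le_mul v w (a := 1) bs
  simp only [rpow_one] at this
  linarith
lemma peetre' (v w : V3) : jap v ≤ 2 * (jap aa * jap w) := by
  have := peetre aa (-w)
  rwa [sub_neg_eq_add, sub_add_cancel, jap_neg] at this
def wt (γ ε : ℝ) (z : V3) : ℝ := (ε + ‖z‖ ^ 2) ^ ev
lemma wtn {γ ε : ℝ} (hε : 0 ≤ ε) (z : V3) : 0 ≤ wt γ ε z :=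
  rpow_nonneg pv _
lemma wt_one (γ : ℝ) (z : V3) : wt γ 1 z = jap z ^ γ := by
  unfold wt
  rw [← jap_sq, ← rpow_natCast, ← rpow_mul (jap_pos z).le]
  congr 1; push_cast; ring
lemma wt_zero (γ : ℝ) (z : V3) : wt γ 0 z = ‖z‖ ^ γ := by
  unfold wt
  rw [zero_add, ← rpow_natCast, ← rpow_mul (norm_nonneg z)]
  congr 1; push_cast; ring
lemma wt_le {γ ε : ℝ} (hγ : γ ≤ 0) (hε : 0 ≤ ε) {z : V3} (hz : z ≠ 0) : wt γ ε z ≤ wt γ 0 z := by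
  unfold wt
  apply rpow_le_rpow_of_nonpos
  · have := norm_pos_iff.2 hz; positivity
  · linarith
  · linarith
lemma wt_neg (γ ε : ℝ) (z : V3) : wt γ ε (-z) = wt γ ε z := by simp [wt]
lemma mwt (γ ε : ℝ) : Measurable (wt γ ε) := by
  unfold wt; fun_prop
def Sb (z x y : V3) : ℝ := ‖z‖ ^ 2 * ⟪x, y⟫ - ⟪z, x⟫ * ⟪z, y⟫
def So (z x : V3) : V3 := ‖z‖ ^ 2 • x - ⟪z, x⟫ • z
lemma inner_So (z x y : V3) : ⟪x, So z y⟫ = Sb z x y := by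
  simp only [So, Sb, inner_sub_right, inner_smul_right, real_inner_comm z x]; ring
lemma Sb_comm (z x y : V3) : Sb z x y = Sb z y x := by
  simp only [Sb, real_inner_comm x y]; ring
lemma Sb_add_left (z x x' y : V3) : Sb z (x + x') y = Sb z x y + Sb z x' y := by
  simp only [Sb, inner_add_left, inner_add_right]; ring
lemma Sb_sub_left (z x x' y : V3) : Sb z (x - x') y = Sb z x y - Sb z x' y := by
  simp only [Sb, inner_sub_left, inner_sub_right]; ring
lemma Sb_smul_left (z : V3) (c : ℝ) (x y : V3) : Sb z (c • x) y = c * Sb z x y := by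
  simp only [Sb, inner_smul_left, inner_smul_right]; simp; ring
lemma Sb_add_right (z x y y' : V3) : Sb z x (y + y') = Sb z x y + Sb z x y' := by
  simp only [Sb_comm z x, Sb_add_left]
lemma Sb_sub_right (z x y y' : V3) : Sb z x (y - y') = Sb z x y - Sb z x y' := by
  simp only [Sb_comm z x, Sb_sub_left]
lemma Sb_smul_right (z : V3) (c : ℝ) (x y : V3) : Sb z x (c • y) = c * Sb z x y := by
  simp only [Sb_comm z x, Sb_smul_left]
lemma Sb_neg_z (z x y : V3) : Sb (-z) x y = Sb z x y := by simp [Sb]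
lemma Sbn (z x : V3) : 0 ≤ Sb z x x := by
  have := real_inner_mul_inner_self_le z x
  rw [real_inner_self_eq_norm_sq, real_inner_self_eq_norm_sq] at this
  simp only [Sb, real_inner_self_eq_norm_sq]; linarith
lemma Sb_le (z x : V3) : Sb z x x ≤ ‖z‖ ^ 2 * ‖x‖ ^ 2 := by
  simp only [Sb, real_inner_self_eq_norm_sq]; nlinarith [mul_self_nonneg ⟪z, x⟫]
lemma Sb_young (z x y : V3) : Sb z x y ≤ 1 / 2 * Sb z x x + 1 / 2 * Sb z y y := by
  have := Sbn z (x - y)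
  rw [Sb_sub_left, Sb_sub_right, Sb_sub_right, Sb_comm z y x] at this
  linarith
lemma norm_So_le (z x : V3) : ‖So z x‖ ≤ ‖z‖ ^ 2 * ‖x‖ := by
  have h : ‖So z x‖ ^ 2 ≤ (‖z‖ ^ 2 * ‖x‖) ^ 2 := by
    rw [← real_inner_self_eq_norm_sq]
    have e : ⟪So z x, So z x⟫ = ‖z‖ ^ 2 * Sb z x x := by
      rw [inner_So]
      simp only [So, Sb_sub_left, Sb_smul_left]
      have : Sb z z x = 0 := by simp only [Sb, real_inner_self_eq_norm_sq]; ring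
      rw [this]; ring
    rw [e]
    nlinarith [Sb_le z x, sq_nonneg ‖z‖]
  exact abs_le_of_sq_le_sq' h pv |>.2
lemma abs_Sb_le (z x y : V3) : |Sb z x y| ≤ ‖x‖ * (‖z‖ ^ 2 * ‖y‖) := by
  rw [← inner_So]
  exact (abs_real_inner_le_norm _ _).trans
    (mll (norm_So_le z y) (norm_nonneg x))
lemma continuous_Sb : Continuous (fun p : V3 × V3 × V3 => Sb p.1 p.2.1 p.2.2) := by
  unfold Sb; fun_prop
lemma continuous_So : Continuous (fun p : V3 × V3 => So p.1 p.2) := by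
  unfold So; fun_prop
lemma proj_bilin (z x y : V3) :
    ∑ i, ∑ j, proj z i j * x i * y j = ⟪x, y⟫ - (⟪z, x⟫ / ‖z‖) * (⟪z, y⟫ / ‖z‖) := by
  simp only [proj, PiLp.inner_apply, Fin.sum_univ_three]
  simp
  ring
lemma bilin_landau (γ : ℝ) {z : V3} (hz : z ≠ 0) (x y : V3) :
    bilin (landauKernel γ z) x y = wt γ 0 z * Sb z x y := by
  have hn := norm_pos_iff.2 hz
  have : bilin (landauKernel γ z) x y = ‖z‖ ^ ah * ∑ i, ∑ j, proj z i j * x i * y j := by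
    simp only [bilin, landauKernel, Finset.mul_sum, mul_assoc]
  rw [this, proj_bilin, wt_zero, Sb, rpow_add hn, rpow_two]
  field_simp
lemma bilin_cutoff (γ : ℝ) (z x y : V3) :
    bilin (cutoffKernel γ z) x y = wt γ 1 z * Sb z x y := by
  have : bilin (cutoffKernel γ z) x y
      = jap z ^ γ * ‖z‖ ^ 2 * ∑ i, ∑ j, proj z i j * x i * y j := by
    simp only [bilin, cutoffKernel, Finset.mul_sum, mul_assoc]
  rw [this, proj_bilin, wt_one, Sb]
  by_cases hz : z = 0
  · simp [hz]
  have hn := norm_pos_iff.2 hz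
  field_simp
lemma kb_aux {γ : ℝ} (hγ : γ ∈ Ico ct 0) {κ ζ p : ℝ} (hκ : 1 ≤ κ) (_hζ : 0 ≤ ζ)
    (h1 : 2 * κ - γ ≤ p) (h2 : 2 * κ + γ + 4 ≤ p) (h3 : 2 * ζ - γ ≤ p)
    {A B : ℝ} (hA : 0 ≤ A) (hB : 0 ≤ B) {v w u : V3} (hvw : v - w ≠ 0)
    (hu1 : ‖u‖ ≤ A * mx v w ^ κ) (hu2 : ‖u‖ ≤ B * ab * mx v w ^ ζ) :
    mx v w ^ bu * (ab ^ ah * ‖u‖) ≤ 4 * (A + B) * mx v w ^ bc ∧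
    ab ^ ah * ‖u‖ ^ 2 ≤ 4 * (A ^ 2 + B ^ 2) * mx v w ^ p := by
  obtain ⟨g1, g2⟩ := hγ
  have hz := norm_pos_iff.2 hvw
  have hm := mx_pos v w
  have hm1 := one_le_mx v w
  set z := ab with hzdef
  set m := mx v w with hmdef
  have hmp : ∀ a : ℝ, 0 < m ^ a := fun a => rpow_pos_of_pos hm a
  have mono : ∀ {a b : ℝ}, a ≤ b → m ^ a ≤ m ^ b := fun h =>
    rpow_le_rpow_of_exponent_le hm1 h
  have sq1 : ∀ a : ℝ, (m ^ a) ^ 2 = m ^ (2 * a) := fun a => by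
    rw [← rpow_natCast, ← rpow_mul hm.le]; congr 1; push_cast; ring
  have usq : ∀ X : ℝ, ‖u‖ ≤ X → ‖u‖ ^ 2 ≤ X ^ 2 := fun X hX =>
    pow_le_pow_left₀ (norm_nonneg u) hX 2
  have caseA : ∀ θ : ℝ, 0 ≤ θ → z ^ ah ≤ 4 * m ^ θ → -γ / 2 + θ + κ ≤ p / 2 → θ + 2 * κ ≤ p →
      m ^ bu * (z ^ ah * ‖u‖) ≤ 4 * (A + B) * m ^ bc ∧
      z ^ ah * ‖u‖ ^ 2 ≤ 4 * (A ^ 2 + B ^ 2) * m ^ p := by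
    intro θ _ hzt e1 e2
    constructor
    · calc m ^ bu * (z ^ ah * ‖u‖) ≤ m ^ bu * (4 * m ^ θ * (A * m ^ κ)) := by
            gcongr
        _ = 4 * A * m ^ (-γ / 2 + θ + κ) := by
            rw [rpow_add hm, rpow_add hm]; ring
        _ ≤ 4 * (A + B) * m ^ bc := by
            have := mono e1
            gcongr; linarith
    · calc z ^ ah * ‖u‖ ^ 2 ≤ 4 * m ^ θ * (A * m ^ κ) ^ 2 := by
            gcongr
        _ = 4 * A ^ 2 * m ^ (θ + 2 * κ) := by
            rw [mul_pow, sq1, rpow_add hm]; ring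
        _ ≤ 4 * (A ^ 2 + B ^ 2) * m ^ p := by
            have := mono e2
            gcongr; nlinarith [sq_nonneg B]
  by_cases hg : -2 ≤ γ
  · apply caseA ah ac _ ac ac
    have h4 : z ^ ah ≤ (2 * m) ^ ah :=
      rpow_le_rpow hz.le (norm_sub_le_mx v w) ac
    rw [mul_rpow bs hm.le] at h4
    have h5 : al ^ ah ≤ 2 ^ al :=
      rpow_le_rpow_of_exponent_le bs ac
    rw [rpow_two] at h5
    nlinarith [hmp ah]
  push Not at hg
  by_cases hz1 : 1 ≤ z
  · apply caseA 0 le_rfl _ ac ac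
    rw [rpow_zero]
    have := rpow_le_one_of_one_le_of_nonpos hz1 (show γ + 2 ≤ 0 by linarith)
    linarith
  push Not at hz1
  have z3 : z ^ ah * z ≤ 1 := by
    rw [← rpow_add_one hz.ne']
    exact rpow_le_one hz.le hz1.le ac
  have z4 : z ^ ah * z ^ 2 ≤ 1 := by
    have : z ^ ah * z ^ 2 = (z ^ ah * z) * z := by ring
    rw [this]
    have : 0 ≤ z ^ ah * z := by positivity
    nlinarith
  constructor
  · calc m ^ bu * (z ^ ah * ‖u‖) ≤ m ^ bu * (z ^ ah * (B * z * m ^ ζ)) := by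
          gcongr
      _ = (z ^ ah * z) * (B * (m ^ bu * m ^ ζ)) := by ring
      _ ≤ 1 * (B * (m ^ bu * m ^ ζ)) := by
          have := hmp ζ; have := hmp bu; gcongr
      _ = B * m ^ (-γ / 2 + ζ) := by rw [rpow_add hm]; ring
      _ ≤ 4 * (A + B) * m ^ bc := by
          have := mono (show -γ / 2 + ζ ≤ p / 2 by linarith)
          gcongr; linarith
  · calc z ^ ah * ‖u‖ ^ 2 ≤ z ^ ah * (B * z * m ^ ζ) ^ 2 := by
          gcongr
      _ = (z ^ ah * z ^ 2) * (B ^ 2 * m ^ (2 * ζ)) := by rw [mul_pow, mul_pow, sq1]; ring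
      _ ≤ 1 * (B ^ 2 * m ^ (2 * ζ)) := by
          have := hmp (2 * ζ); gcongr
      _ ≤ 4 * (A ^ 2 + B ^ 2) * m ^ p := by
          have := mono (show 2 * ζ ≤ p by linarith)
          rw [one_mul]
          gcongr; nlinarith [sq_nonneg A, sq_nonneg B]
lemma rpow_add_two_eq {γ x : ℝ} (hx : 0 < x) : x ^ ah = x ^ γ * x ^ 2 := by
  rw [rpow_add hx, rpow_two]
lemma kb_cut {γ : ℝ} (hγ : γ ∈ Ico ct 0) (v w : V3) :
    wt γ 1 aa * ab ^ 2 ≤ 4 * mx v w ^ (max ah 0) := by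
  obtain ⟨g1, g2⟩ := hγ
  rw [wt_one]
  have hj := jap_pos aa
  have hm := mx_pos v w
  have h0 : jap aa ^ γ * ab ^ 2 ≤ jap aa ^ ah := by
    rw [rpow_add_two_eq hj]
    have := nlj aa
    gcongr
  refine h0.trans ?_
  rcases le_total ah 0 with h | h
  · rw [max_eq_right h, rpow_zero]
    have := rpow_le_one_of_one_le_of_nonpos (olj aa) h
    linarith
  · rw [max_eq_left h]
    have h4 : jap aa ^ ah ≤ (2 * mx v w) ^ ah :=
      rpow_le_rpow hj.le (jap_sub_le_mx v w) h
    rw [mul_rpow bs hm.le] at h4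
    have h5 : al ^ ah ≤ 2 ^ al :=
      rpow_le_rpow_of_exponent_le bs ac
    rw [rpow_two] at h5
    nlinarith [rpow_pos_of_pos hm ah]
lemma integrable_gauss : Integrable (fun v : V3 => exp (-‖v‖ ^ 2)) := by
  have := GaussianFourier.integrable_cexp_neg_mul_sq_norm_add (V := V3) (b := 1) cz 0 0
  have h2 := this.norm
  refine h2.congr (aeo fun v => ?_)
  simp [Complex.norm_exp]
  norm_cast
structure Dens (E Hb : ℝ) (f : V3 → ℝ) : Prop where
  meas : Measurable f
  nn : ∀ v, 0 ≤ f v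
  int : Integrable f
  mass : (∫ v, f v) = 1
  enInt : Integrable (fun v => ‖v‖ ^ 2 * f v)
  en : (∫ v, ‖v‖ ^ 2 * f v) ≤ E
  entInt : Integrable (fun v => f v * log ak)
  ent : (∫ v, f v * log ak) ≤ Hb
lemma neg_xlogx_le {x : ℝ} (hx : 0 ≤ x) (a : ℝ) : -(x * log x) ≤ a * x + exp (-a) := by
  rcases hx.eq_or_lt with rfl | hx
  · simp; positivity
  have h := add_one_le_exp (-a - log x)
  have h2 : exp (-a - log x) * x = exp (-a) := by
    rw [exp_sub, exp_log hx]; field_simp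
  nlinarith
def CUI (E Hb : ℝ) : ℝ := Hb + E + ∫ v : V3, exp (-‖v‖ ^ 2)
lemma Dens.tail_k {E Hb : ℝ} {f : V3 → ℝ} (h : Dens E Hb f) {k : ℝ} (hk : 1 < k) :
    (∫ v in {v | k < f v}, f v) * log k ≤ CUI E Hb := by
  have hms : MeasurableSet {v | k < f v} := measurableSet_lt measurable_const h.meas
  have hI := (h.entInt.add h.enInt).add integrable_gauss
  have hpt : ∀ v, 0 ≤ f v * log ak + ‖v‖ ^ 2 * f v + exp (-‖v‖ ^ 2) := fun v => by
    have := neg_xlogx_le (h.nn v) (‖v‖ ^ 2); linarith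
  have h1 : (∫ v, (f v * log ak + ‖v‖ ^ 2 * f v + exp (-‖v‖ ^ 2))) ≤ CUI E Hb := by
    have e1 := integral_add (h.entInt.add h.enInt) integrable_gauss
    have e2 := integral_add h.entInt h.enInt
    simp only [Pi.add_apply] at e1 e2
    rw [e1, e2, CUI]
    have := h.en; have := h.ent
    linarith
  refine le_trans ?_ h1
  rw [← integral_mul_const]
  refine le_trans (integral_mono_of_nonneg ?_ hI.integrableOn ?_)
    (setIntegral_le_integral hI (aeo hpt))
  · exact aeo fun v => mul_nonneg (h.nn v) (log_nonneg hk.le)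
  · refine (ae_restrict_mem hms).mono fun v hv => ?_
    have hv' : k < f v := hv
    have : log k ≤ log ak := log_le_log ac hv'.le
    have h2 := mll this (h.nn v)
    have : 0 ≤ ‖v‖ ^ 2 * f v := mul_nonneg (sq_nonneg _) (h.nn v)
    have := exp_pos (-‖v‖ ^ 2)
    simp only [Pi.add_apply]
    linarith
lemma Dens.tail_R {E Hb : ℝ} {f : V3 → ℝ} (h : Dens E Hb f) {R : ℝ} (hR : 0 < R) :
    (∫ v in {v | R < ‖v‖}, f v) * R ^ 2 ≤ E := by
  have hms : MeasurableSet {v : V3 | R < ‖v‖} := measurableSet_lt measurable_const (by fun_prop)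
  refine le_trans ?_ h.en
  rw [← integral_mul_const]
  have hpt : ∀ v, 0 ≤ ‖v‖ ^ 2 * f v := fun v => mul_nonneg (sq_nonneg _) (h.nn v)
  refine le_trans (integral_mono_of_nonneg ?_ h.enInt.integrableOn ?_)
    (setIntegral_le_integral h.enInt (aeo hpt))
  · exact aeo fun v => mul_nonneg (h.nn v) pv
  · refine (ae_restrict_mem hms).mono fun v hv => ?_
    have hv' : R < ‖v‖ := hv
    have : R ^ 2 ≤ ‖v‖ ^ 2 := pow_le_pow_left₀ hR.le hv'.le 2
    have h2 := mll this (h.nn v)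
    simp only
    linarith
lemma slab_volume {R : ℝ} (hR : 0 < R) {N : ℕ} (hN : 0 < N) {η : V3} (hη : ‖η‖ = 1) (v : V3) :
    (N : ℝ) * (volume {w : V3 | ‖w‖ ≤ R ∧ |⟪v - w, η⟫| < R / (2 * N)}).toReal
      ≤ (volume (Metric.closedBall ar (2 * R))).toReal := by
  have hN' : cq < N := by exact_mod_cast hN
  set d := R / (2 * N) with hd
  have hdpos : 0 < d := by positivity
  set A := {w : V3 | ‖w‖ ≤ R ∧ |⟪v - w, η⟫| < d} with hA
  have hAm : MeasurableSet A := (measurableSet_le (f := fun w : V3 => ‖w‖) (g := fun _ => R)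
    (by fun_prop) measurable_const).inter (measurableSet_lt (f := fun w : V3 => |⟪v - w, η⟫|)
      (g := fun _ => d) (by fun_prop) measurable_const)
  let B : ℕ → Set V3 := fun i => (fun w => w + (-(2 * d * i)) • η) ⁻¹' A
  have hBm : ∀ i ∈ Finset.range N, MeasurableSet (B i) := fun i _ =>
    hAm.preimage (by fun_prop)
  have hBv : ∀ i, volume (B i) = volume A := fun i => measure_preimage_add_right volume _ A
  have hin : ⟪η, η⟫ = (1 : ℝ) := by rw [real_inner_self_eq_norm_sq, hη]; norm_num
  have hdis : Set.PairwiseDisjoint (↑(Finset.range N)) B := by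
    intro i _ j _ hij
    rw [Function.onFun, Set.disjoint_left]
    rintro w ⟨_, h1⟩ ⟨_, h2⟩
    have e : ∀ i : ℕ, ⟪v - (w + (-(2 * d * i)) • η), η⟫ = ⟪v - w, η⟫ + 2 * d * i := fun i => by
      rw [inner_sub_left, inner_sub_left, inner_add_left, inner_smul_left, hin]; simp; ring
    rw [e] at h1 h2
    have h3 : |2 * d * ((i : ℝ) - j)| < 2 * d := by
      rw [abs_lt] at *
      constructor <;> nlinarith
    rw [abs_mul, abs_of_pos (by positivity : 0 < 2 * d)] at h3
    have h4 : |(i : ℝ) - j| < 1 := by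
      by_contra hc; push Not at hc; nlinarith
    have h5 : |(i : ℤ) - j| < 1 := by exact_mod_cast h4
    rw [Int.abs_lt_one_iff] at h5
    omega
  have hsub : (⋃ i ∈ Finset.range N, B i) ⊆ Metric.closedBall ar (2 * R) := by
    intro w hw
    simp only [Set.mem_iUnion] at hw
    obtain ⟨i, hi, hw1, _⟩ := hw
    rw [Finset.mem_range] at hi
    simp only [Metric.mem_closedBall, dist_zero_right]
    have : w = (w + (-(2 * d * i)) • η) + (2 * d * i) • η := by
      rw [neg_smul]; abel
    rw [this]
    refine (norm_add_le _ _).trans ?_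
    rw [norm_smul, hη, mul_one, norm_eq_abs, abs_of_nonneg pv]
    have hi' : (i : ℝ) ≤ N := by exact_mod_cast hi.le
    have : 2 * d * i ≤ 2 * d * N := by gcongr
    have e : 2 * d * N = R := by rw [hd]; field_simp
    linarith
  have key := measure_mono (μ := volume) hsub
  rw [measure_biUnion_finset hdis hBm] at key
  simp only [hBv, Finset.sum_const, Finset.card_range, nsmul_eq_mul] at key
  have := ENNReal.toReal_mono (measure_closedBall_lt_top.ne) key
  simpa using this
lemma exists_unit_perp (ξ : V3) : ∃ η : V3, ‖η‖ = 1 ∧ ⟪ξ, η⟫ = cq := by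
  have h2 : ∃ x : V3, x ≠ 0 ∧ ⟪ξ, x⟫ = cq := by
    by_cases h : ξ 0 = 0 ∧ ξ 1 = 0
    · refine ⟨EuclideanSpace.single 0 1, ?_, ?_⟩
      · intro h0; have := congrArg (fun x : V3 => x 0) h0; simp at this
      · simp [PiLp.inner_apply, Fin.sum_univ_three, h.1]
    · refine ⟨!₂[-ξ 1, ξ 0, 0], ?_, ?_⟩
      · intro h0
        have a0 := congrArg (fun x : V3 => x 0) h0
        have a1 := congrArg (fun x : V3 => x 1) h0
        simp at a0 a1
        exact h ⟨a1, a0⟩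
      · simp [PiLp.inner_apply, Fin.sum_univ_three]; ring
  obtain ⟨x, hx, hxi⟩ := h2
  have hn := norm_pos_iff.2 hx
  refine ⟨(‖x‖⁻¹) • x, ?_, ?_⟩
  · rw [norm_smul, norm_inv, norm_norm, inv_mul_cancel₀ hn.ne']
  · rw [inner_smul_right, hxi, mul_zero]
lemma Sb_ge_perp {ξ η : V3} (hη : ‖η‖ = 1) (h : ⟪ξ, η⟫ = cq) (z : V3) :
    ⟪z, η⟫ ^ 2 * ‖ξ‖ ^ 2 ≤ Sb z ξ ξ := by
  by_cases hξ : ξ = 0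
  · simp [hξ, Sb]
  have hn := norm_pos_iff.2 hξ
  have key := Sbn ξ (z - ⟪z, η⟫ • η)
  have hin : ⟪η, η⟫ = (1 : ℝ) := by rw [real_inner_self_eq_norm_sq, hη]; norm_num
  have e : Sb ξ (z - ⟪z, η⟫ • η) (z - ⟪z, η⟫ • η) = Sb z ξ ξ - ⟪z, η⟫ ^ 2 * ‖ξ‖ ^ 2 := by
    simp only [Sb, inner_sub_left, inner_sub_right, inner_smul_left, inner_smul_right, h, hin,
      real_inner_self_eq_norm_sq, real_inner_comm z η, real_inner_comm ξ z]
    simp only [real_inner_comm, conj_trivial]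
    ring
  linarith
lemma ellipticity_strong {γ : ℝ} (hγ : γ ∈ Ico ct 0) (E Hb : ℝ) :
    ∃ c₀ R k : ℝ, 0 < c₀ ∧ 0 < R ∧ 0 < k ∧ ∀ f, Dens E Hb f → ∀ v ξ : V3,
      c₀ * jap v ^ γ * ‖ξ‖ ^ 2 ≤
        ∫ w in {w | ‖w‖ ≤ R ∧ f w ≤ k}, wt γ 1 aa * Sb aa ξ ξ * f w := by
  set R := |E| * 4 + 4 with hR
  have hRp : 0 < R := by positivity
  set k := exp (4 * |CUI E Hb| + 4) with hk
  have hkp : 0 < k := exp_pos _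
  have hk1 : 1 < k := by rw [hk, one_lt_exp_iff]; positivity
  set W := (volume (Metric.closedBall ar (2 * R))).toReal with hW
  obtain ⟨N, hN⟩ := exists_nat_gt (4 * k * W)
  have hWn : 0 ≤ W := ENNReal.toReal_nonneg
  have hNp : cq < N := lt_of_le_of_lt pv hN
  have hNp' : 0 < N := by exact_mod_cast hNp
  set d := R / (2 * N) with hd
  have hdp : 0 < d := by positivity
  refine ⟨1 / 4 * d ^ 2 * eb ^ γ, R, k, by positivity, hRp, hkp, ?_⟩
  intro f hf v ξ
  obtain ⟨η, hη, hηξ⟩ := exists_unit_perp ξ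
  set Sl := {w : V3 | ‖w‖ ≤ R ∧ |⟪v - w, η⟫| < d} with hSl
  have hSlm : MeasurableSet Sl := (measurableSet_le (f := fun w : V3 => ‖w‖) (g := fun _ => R)
    (by fun_prop) measurable_const).inter (measurableSet_lt (f := fun w : V3 => |⟪v - w, η⟫|)
      (g := fun _ => d) (by fun_prop) measurable_const)
  set B := {w | ‖w‖ ≤ R ∧ f w ≤ k} with hB
  have hBm : MeasurableSet B := (measurableSet_le (f := fun w : V3 => ‖w‖) (g := fun _ => R)
    (by fun_prop) measurable_const).inter (measurableSet_le hf.meas measurable_const)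
  have hslab := slab_volume hRp hNp' hη v
  rw [← hd, ← hSl, ← hW] at hslab
  have hSlfin : volume Sl ≠ ⊤ := by
    refine ne_top_of_le_ne_top (measure_closedBall_lt_top (x := ar) (r := R)).ne
      (measure_mono ?_)
    intro w hw; simpa using hw.1
  have hm1 : (∫ w in B ∩ Sl, f w) ≤ 1 / 4 := by
    have h1 : (∫ w in B ∩ Sl, f w) ≤ ∫ w in B ∩ Sl, k := by
      apply setIntegral_mono_on hf.int.integrableOn _ (hBm.inter hSlm)
      · intro w hw; exact hw.1.2
      · exact integrableOn_const (ne_top_of_le_ne_top hSlfin (measure_mono Set.inter_subset_right))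
    rw [setIntegral_const, smul_eq_mul, measureReal_def] at h1
    have h2 : (volume (B ∩ Sl)).toReal ≤ (volume Sl).toReal :=
      ENNReal.toReal_mono hSlfin (measure_mono Set.inter_subset_right)
    have h3 : (volume Sl).toReal * k * N ≤ W * k := by nlinarith
    have h4 : (volume Sl).toReal * k * N ≤ 1 / 4 * N := by linarith
    have h5 := le_of_mul_le_mul_right h4 hNp
    nlinarith
  have hm2 : (∫ w in {w | k < f w}, f w) ≤ 1 / 4 := by
    have h1 := hf.tail_k hk1
    rw [hk, log_exp] at h1
    rw [← hk] at h1
    have h2 := le_abs_self (CUI E Hb)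
    have h3 := abs_nonneg (CUI E Hb)
    by_contra hc; push Not at hc
    nlinarith
  have hm3 : (∫ w in {w : V3 | R < ‖w‖}, f w) ≤ 1 / 4 := by
    have h1 := hf.tail_R hRp
    have h2 := le_abs_self E
    have h3 := abs_nonneg E
    by_contra hc; push Not at hc
    have : R ^ 2 ≥ 4 * |E| + 4 := by rw [hR]; nlinarith
    nlinarith
  have hmass : 1 / 4 ≤ ∫ w in B \ Sl, f w := by
    have hc : (1 : ℝ) = ∫ w, f w := hf.mass.symm
    have hcov : ∀ w, f w ≤ (B \ Sl).indicator f w + (B ∩ Sl).indicator f w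
        + {w | k < f w}.indicator f w + {w : V3 | R < ‖w‖}.indicator f w := by
      intro w
      have nn : ∀ s : Set V3, 0 ≤ s.indicator f w := fun s =>
        Set.indicator_nonneg (fun w _ => hf.nn w) w
      by_cases h1 : k < f w
      · have : {w | k < f w}.indicator f w = f w := Set.indicator_of_mem (s := {w | k < f w}) h1 f
        linarith [nn (B \ Sl), nn (B ∩ Sl), nn {w : V3 | R < ‖w‖}]
      by_cases h2 : R < ‖w‖
      · have : {w : V3 | R < ‖w‖}.indicator f w = f w := Set.indicator_of_mem (s := {w : V3 | R < ‖w‖}) h2 f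
        linarith [nn (B \ Sl), nn (B ∩ Sl), nn {w | k < f w}]
      push Not at h1 h2
      by_cases h3 : w ∈ Sl
      · have : (B ∩ Sl).indicator f w = f w := Set.indicator_of_mem (s := B ∩ Sl) ⟨⟨h2, h1⟩, h3⟩ f
        linarith [nn (B \ Sl), nn {w | k < f w}, nn {w : V3 | R < ‖w‖}]
      · have : (B \ Sl).indicator f w = f w := Set.indicator_of_mem (s := B \ Sl) ⟨⟨h2, h1⟩, h3⟩ f
        linarith [nn (B ∩ Sl), nn {w | k < f w}, nn {w : V3 | R < ‖w‖}]
    have m1 := hBm.diff hSlm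
    have m2 := hBm.inter hSlm
    have m3 : MeasurableSet {w | k < f w} := measurableSet_lt measurable_const hf.meas
    have m4 : MeasurableSet {w : V3 | R < ‖w‖} := measurableSet_lt measurable_const (by fun_prop)
    have i1 := hf.int.indicator m1
    have i2 := hf.int.indicator m2
    have i3 := hf.int.indicator m3
    have i4 := hf.int.indicator m4
    have := integral_mono hf.int (((i1.add i2).add i3).add i4) hcov
    have e1 := integral_add ((i1.add i2).add i3) i4
    have e2 := integral_add (i1.add i2) i3
    have e3 := integral_add i1 i2
    simp only [Pi.add_apply] at e1 e2 e3 this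
    rw [e1, e2, e3, integral_indicator m1, integral_indicator m2, integral_indicator m3,
      integral_indicator m4] at this
    linarith
  have hint : IntegrableOn (fun w => wt γ 1 aa * Sb aa ξ ξ * f w) B := by
    have hb : ∀ w ∈ B, ‖wt γ 1 aa * Sb aa ξ ξ * f w‖
        ≤ (4 * (jap v + jap w) ^ (max ah 0) * ‖ξ‖ ^ 2) * f w := by
      intro w _
      rw [norm_mul, norm_of_nonneg (hf.nn w)]
      gcongr
      · exact hf.nn w
      rw [norm_of_nonneg (mul_nonneg (wtn one_pos.le _) (Sbn _ _))]
      calc wt γ 1 aa * Sb aa ξ ξ ≤ wt γ 1 aa * (ab ^ 2 * ‖ξ‖ ^ 2) := by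
            gcongr
            · exact wtn one_pos.le _
            · exact Sb_le _ _
        _ = (wt γ 1 aa * ab ^ 2) * ‖ξ‖ ^ 2 := by ring
        _ ≤ _ := by
          refine mlr ((kb_cut hγ v w).trans ?_) (sq_nonneg _)
          gcongr
          · exact (mx_pos v w).le
          · exact max_le (by linarith [jap_pos w]) (by linarith [jap_pos v])
    refine Integrable.mono' (g := fun w => (4 * (jap v + (1 + R)) ^ (max ah 0) * ‖ξ‖ ^ 2) * f w)
      (hf.int.integrableOn.const_mul _) ?_ ?_
    · apply Measurable.aestronglyMeasurable
      have := hf.meas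
      have := mwt γ 1
      unfold Sb
      fun_prop
    · refine (ae_restrict_mem hBm).mono fun w hw => (hb w hw).trans ?_
      have h1 : jap w ≤ 1 + R := (jap_le_one_add w).trans (by have := hw.1; linarith)
      gcongr
      · exact hf.nn w
      · exact add_nonneg (jap_pos v).le (jap_pos w).le
  have hsub : (∫ w in B \ Sl, wt γ 1 aa * Sb aa ξ ξ * f w)
      ≤ ∫ w in B, wt γ 1 aa * Sb aa ξ ξ * f w := by
    apply setIntegral_mono_set hint
    · exact aeo fun w =>
        mul_nonneg (mul_nonneg (wtn one_pos.le _) (Sbn _ _)) (hf.nn w)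
    · exact aeo fun w hw => hw.1
  refine le_trans ?_ hsub
  have hlow : (∫ w in B \ Sl, (d ^ 2 * eb ^ γ * jap v ^ γ * ‖ξ‖ ^ 2) * f w)
      ≤ ∫ w in B \ Sl, wt γ 1 aa * Sb aa ξ ξ * f w := by
    apply setIntegral_mono_on (hf.int.integrableOn.const_mul _) (hint.mono_set Set.sdiff_subset)
      (hBm.diff hSlm)
    intro w hw
    apply mlr _ (hf.nn w)
    have h1 : d ≤ |⟪v - w, η⟫| := by
      by_contra hc; push Not at hc; exact hw.2 ⟨hw.1.1, hc⟩
    have h2 : d ^ 2 ≤ ⟪v - w, η⟫ ^ 2 := by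
      rw [← sq_abs ⟪v - w, η⟫]; exact pow_le_pow_left₀ hdp.le h1 2
    have h3 := Sb_ge_perp hη hηξ aa
    have h4 : eb ^ γ * jap v ^ γ ≤ wt γ 1 aa := by
      rw [wt_one, ← mul_rpow pv (jap_pos v).le]
      apply rpow_le_rpow_of_nonpos (jap_pos _) _ hγ.2.le
      refine (peetre v w).trans ?_
      have : jap w ≤ 1 + R := (jap_le_one_add w).trans (by have := hw.1.1; linarith)
      have hv := jap_pos v
      nlinarith
    calc d ^ 2 * eb ^ γ * jap v ^ γ * ‖ξ‖ ^ 2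
        = (eb ^ γ * jap v ^ γ) * (d ^ 2 * ‖ξ‖ ^ 2) := by ring
      _ ≤ wt γ 1 aa * (⟪v - w, η⟫ ^ 2 * ‖ξ‖ ^ 2) := by
          gcongr
          exact wtn one_pos.le _
      _ ≤ _ := by
          gcongr
          exact wtn one_pos.le _
  rw [integral_const_mul] at hlow
  refine le_trans ?_ hlow
  have h0 : 0 ≤ d ^ 2 * eb ^ γ * jap v ^ γ * ‖ξ‖ ^ 2 := by
    have := jpp v γ; positivity
  nlinarith
open Filter Topology in
def bmp (n : ℕ) : ContDiffBump ar where
  rIn := 1 / (2 * ag)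
  rOut := 1 / ag
  rIn_pos := by positivity
  rIn_lt_rOut := by
    apply one_div_lt_one_div_of_lt <;> [positivity; (have : cu ≤ n := Nat.cast_nonneg n; linarith)]
def mol (n : ℕ) : V3 → ℝ := (bmp n).normed volume
lemma bmp_tendsto : Tendsto (fun n => (bmp n).rOut) atTop (nhds 0) :=
  tendsto_one_div_add_atTop_nhds_zero_nat
lemma bmp_rOut_le (n : ℕ) : (bmp n).rOut ≤ 1 := by
  show 1 / ag ≤ 1
  rw [div_le_one pv]; linarith [(Nat.cast_nonneg n : cu ≤ n)]
lemma bmp_ratio (n : ℕ) : (bmp n).rOut ≤ 2 * (bmp n).rIn := by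
  show 1 / ag ≤ 2 * (1 / (2 * ag))
  apply le_of_eq; field_simp
def cv (n : ℕ) (g : V3 → ℝ) : V3 → ℝ :=
  convolution (mol n) g ej volume
lemma cv_bound {g : V3 → ℝ} (hg : Continuous g) (hc : HasCompactSupport g) :
    ∃ C : ℝ, ∀ n x, |cv n g x| ≤ C := by
  obtain ⟨C, hC⟩ := hc.exists_bound_of_continuous hg
  refine ⟨3 * C, fun n x => ?_⟩
  have h1 := (bmp n).dist_normed_convolution_le (μ := volume) (x₀ := x) (g := g) (ε := 2 * C)
    hg.aestronglyMeasurable (fun y _ => by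
      rw [dist_eq_norm]
      exact (norm_sub_le _ _).trans (by linarith [hC x, hC y]))
  rw [dist_eq_norm] at h1
  have h2 := norm_sub_norm_le (cv n g x) (g x)
  have h3 := hC x
  rw [← norm_eq_abs]
  unfold cv mol at *
  linarith
lemma cv_support {g : V3 → ℝ} (n : ℕ) {x : V3}
    (hx : x ∉ Metric.cthickening 1 (tsupport g)) : cv n g x = 0 := by
  by_contra h
  have h1 : x ∈ Function.support (cv n g) := h
  have h2 := support_convolution_subset _ h1
  obtain ⟨a, ha, b, hb, rfl⟩ := h2
  apply hx
  have ha' : a ∈ Metric.ball ar (bmp n).rOut := by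
    rw [← (bmp n).support_normed_eq (μ := volume)]; exact ha
  apply Metric.mem_cthickening_of_dist_le (a + b) b 1 _ (subset_tsupport _ hb)
  rw [dist_eq_norm, add_sub_cancel_right]
  have := mem_ball_zero_iff.1 ha'
  linarith [bmp_rOut_le n]
lemma cv_tendsto_integral {F g : V3 → ℝ} (hF : LocallyIntegrable F) (hg : Continuous g)
    (hc : HasCompactSupport g) :
    Tendsto (fun n => ∫ x, F x * cv n g x) atTop (nhds (∫ x, F x * g x)) := by
  obtain ⟨C, hC⟩ := cv_bound hg hc
  set K := Metric.cthickening 1 (tsupport g) with hK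
  have hKc : IsCompact K := IsCompact.cthickening hc
  have hFK : IntegrableOn F K := hF.integrableOn_isCompact hKc
  have hcont : ∀ n, Continuous (cv n g) := fun n =>
    (HasCompactSupport.continuous_convolution_right _ hc
      ((bmp n).continuous_normed (μ := volume)).locallyIntegrable hg)
  apply tendsto_integral_of_dominated_convergence (fun x => K.indicator (fun x => ‖F x‖ * C) x)
  · intro n
    exact hF.aestronglyMeasurable.mul (hcont n).aestronglyMeasurable
  · rw [integrable_indicator_iff hKc.measurableSet]
    exact hFK.norm.mul_const C
  · intro n
    refine aeo fun x => ?_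
    by_cases hx : x ∈ K
    · rw [Set.indicator_of_mem hx, norm_mul]
      exact mll (hC n x) (norm_nonneg _)
    · rw [Set.indicator_of_notMem hx, cv_support n hx]; simp
  · refine aeo fun x => ?_
    exact (ContDiffBump.convolution_tendsto_right_of_continuous (φ := bmp) (μ := volume) bmp_tendsto hg x).const_mul _
lemma cv_contDiff (n : ℕ) {g : V3 → ℝ} (hg : LocallyIntegrable g) :
    ContDiff ℝ bn (cv n g) :=
  (bmp n).hasCompactSupport_normed.contDiff_convolution_left _ (bmp n).contDiff_normed hg
lemma cv_compact (n : ℕ) {g : V3 → ℝ} (hg : HasCompactSupport g) : HasCompactSupport (cv n g) :=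
  (bmp n).hasCompactSupport_normed.convolution _ hg
lemma cv_fderiv (n : ℕ) {g : V3 → ℝ} (hg : ContDiff ℝ 1 g) (hc : HasCompactSupport g) (x e : V3) :
    fderiv ℝ (cv n g) x e = cv n (fun y => fderiv ℝ g y e) x := by
  have h := hc.hasFDerivAt_convolution_right ej (μ := volume)
    ((bmp n).continuous_normed (μ := volume)).locallyIntegrable hg x
  have h2 : fderiv ℝ (cv n g) x = _ := h.fderiv
  rw [h2, convolution_precompR_apply _ ((bmp n).continuous_normed (μ := volume)).locallyIntegrable
    (hc.fderiv ℝ) (hg.continuous_fderiv one_ne_zero)]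
  rfl
structure WG (f : V3 → ℝ) (V : V3 → V3) : Prop where
  lf : LocallyIntegrable f
  lV : LocallyIntegrable V
  wg : IsWeakGrad3 f V
lemma locInt_inner {V : V3 → V3} (h : LocallyIntegrable V) (e : V3) :
    LocallyIntegrable (fun v => ⟪V v, e⟫) := by
  rw [locallyIntegrable_iff] at *
  intro k hk
  exact Integrable.inner_const (h k hk) e
lemma WG.c1 {f : V3 → ℝ} {V : V3 → V3} (h : WG f V) {φ : V3 → ℝ} (hφ : ContDiff ℝ 1 φ)
    (hc : HasCompactSupport φ) (e : V3) :
    (∫ v, f v * fderiv ℝ φ v e) = - ∫ v, ⟪V v, e⟫ * φ v := by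
  have h1 := cv_tendsto_integral h.lf
    (g := fun v => fderiv ℝ φ v e) ((hφ.continuous_fderiv one_ne_zero).clm_apply continuous_const)
    (by
      refine (hc.fderiv ℝ).mono' ?_
      intro v hv
      apply subset_tsupport
      intro h0
      apply hv
      show fderiv ℝ φ v e = 0
      rw [h0]; rfl)
  have h2 := (cv_tendsto_integral (locInt_inner h.lV e) hφ.continuous hc).neg
  refine tendsto_nhds_unique h1 (h2.congr fun n => ?_)
  rw [← h.wg (cv n φ) (cv_contDiff n hφ.continuous.locallyIntegrable) (cv_compact n hc) e]
  congr 1; ext v; rw [cv_fderiv n hφ hc]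
def dvg (Φ : V3 → V3) (v : V3) : ℝ := ∑ i, (fderiv ℝ Φ v az) i
lemma inner_esingle (x : V3) (i : Fin 3) : ⟪x, esingle i⟫ = x i := by
  simp [esingle, EuclideanSpace.inner_single_right]
lemma fderiv_coord {Φ : V3 → V3} {v : V3} (h : DifferentiableAt ℝ Φ v) (i : Fin 3) (e : V3) :
    fderiv ℝ (fun w => Φ w i) v e = (fderiv ℝ Φ v e) i := by
  have := ((EuclideanSpace.proj i : V3 →L[ℝ] ℝ).hasFDerivAt.comp v h.hasFDerivAt).fderiv
  have h2 : fderiv ℝ (fun w => Φ w i) v = _ := this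
  rw [h2]; rfl
lemma coord_contDiff {n : WithTop ℕ∞} {Φ : V3 → V3} (hΦ : ContDiff ℝ n Φ) (i : Fin 3) :
    ContDiff ℝ n (fun v => Φ v i) :=
  (EuclideanSpace.proj i : V3 →L[ℝ] ℝ).contDiff.comp hΦ
lemma coord_cpt {Φ : V3 → V3} (hc : HasCompactSupport Φ) (i : Fin 3) :
    HasCompactSupport (fun v => Φ v i) :=
  hc.comp_left (g := fun x : V3 => x i) rfl
lemma inner_eq_sum (x y : V3) : ⟪x, y⟫ = ∑ i, x i * y i := by
  simp [PiLp.inner_apply, mul_comm]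
lemma locInt_mul_cpt {F : V3 → ℝ} (hF : LocallyIntegrable F) {g : V3 → ℝ} (hg : Continuous g)
    (hc : HasCompactSupport g) : Integrable (fun v => F v * g v) := by
  have := hF.integrable_smul_left_of_hasCompactSupport hg hc
  simpa [smul_eq_mul, mul_comm] using this
lemma cpt_fderiv_apply {φ : V3 → ℝ} (hc : HasCompactSupport φ) (e : V3) :
    HasCompactSupport dz := by
  refine (hc.fderiv ℝ).mono' ?_
  intro v hv
  apply subset_tsupport
  intro h0
  apply hv
  show fderiv ℝ φ v e = 0
  rw [h0]; rfl
lemma WG.ibp_cpt {f : V3 → ℝ} {V : V3 → V3} (h : WG f V) {Φ : V3 → V3} (hΦ : ContDiff ℝ 1 Φ)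
    (hc : HasCompactSupport Φ) :
    (∫ v, ⟪V v, Φ v⟫) = - ∫ v, f v * dvg Φ v := by
  have hd : ∀ v, DifferentiableAt ℝ Φ v := fun v => hΦ.differentiable one_ne_zero v
  have key : ∀ i, (∫ v, f v * (fderiv ℝ Φ v az) i) = - ∫ v, V v i * Φ v i := fun i => by
    have := h.c1 (coord_contDiff hΦ i) (coord_cpt hc i) az
    simpa only [fderiv_coord (hd _), inner_esingle] using this
  have i1 : ∀ i ∈ Finset.univ, Integrable (fun v => V v i * Φ v i) := fun i _ => by
    have := locInt_mul_cpt (locInt_inner h.lV az) (coord_contDiff hΦ i).continuous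
      (coord_cpt hc i)
    simpa only [inner_esingle] using this
  have i2 : ∀ i ∈ Finset.univ, Integrable (fun v => f v * (fderiv ℝ Φ v az) i) :=
    fun i _ => by
    have := locInt_mul_cpt h.lf (g := fun v => fderiv ℝ (fun w => Φ w i) v az)
      (((coord_contDiff hΦ i).continuous_fderiv one_ne_zero).clm_apply continuous_const)
      (cpt_fderiv_apply (coord_cpt hc i) _)
    simpa only [fderiv_coord (hd _)] using this
  simp only [inner_eq_sum, dvg, Finset.mul_sum]
  rw [integral_finsetSum _ i1, integral_finsetSum _ i2, ← Finset.sum_neg_distrib]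
  exact Finset.sum_congr rfl fun i _ => by rw [key i, neg_neg]
def chi0 : ContDiffBump ar := ⟨1, 2, one_pos, one_lt_two⟩
def chi (R : ℝ) (v : V3) : ℝ := chi0 (R⁻¹ • v)
lemma chi_contDiff (R : ℝ) {n : ℕ∞} : ContDiff ℝ n bt :=
  chi0.contDiff.comp (contDiff_const_smul (R⁻¹))
lemma chi_nonneg (R : ℝ) (v : V3) : 0 ≤ chi R v := chi0.nonneg
lemma chi_le_one (R : ℝ) (v : V3) : chi R v ≤ 1 := chi0.le_one
lemma chi_eq_one {R : ℝ} (hR : 0 < R) {v : V3} (h : ‖v‖ ≤ R) : chi R v = 1 := by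
  apply chi0.one_of_mem_closedBall
  rw [mem_closedBall_zero_iff, norm_smul, norm_inv, norm_of_nonneg hR.le]
  show R⁻¹ * ‖v‖ ≤ 1
  rw [inv_mul_le_iff₀ hR]; linarith
lemma chi_eq_zero {R : ℝ} (hR : 0 < R) {v : V3} (h : 2 * R ≤ ‖v‖) : chi R v = 0 := by
  apply chi0.zero_of_le_dist
  rw [dist_zero_right, norm_smul, norm_inv, norm_of_nonneg hR.le]
  show 2 ≤ R⁻¹ * ‖v‖
  rw [le_inv_mul_iff₀ hR]; linarith
lemma chi_cpt {R : ℝ} (hR : 0 < R) : HasCompactSupport bt := by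
  apply HasCompactSupport.of_support_subset_isCompact (isCompact_closedBall ar (2 * R))
  intro v hv
  rw [mem_closedBall_zero_iff]
  by_contra h
  exact hv (chi_eq_zero hR (not_le.1 h).le)
lemma chi_tendsto (v : V3) :
    Tendsto (fun n : ℕ => chi ag v) atTop (nhds 1) := by
  obtain ⟨N, hN⟩ := exists_nat_gt ‖v‖
  refine tendsto_const_nhds.congr' ?_
  filter_upwards [Filter.eventually_ge_atTop N] with n hn
  have : (N : ℝ) ≤ n := by exact_mod_cast hn
  rw [chi_eq_one pv ac]
lemma chi0_fderiv_bound : ∃ C : ℝ, 0 < C ∧ ∀ v : V3, ‖fderiv ℝ chi0 v‖ ≤ C := by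
  obtain ⟨C, hC⟩ := (chi0.hasCompactSupport.fderiv ℝ).exists_bound_of_continuous
    ((chi0.contDiff (n := 1)).continuous_fderiv one_ne_zero)
  exact ⟨max C 1, by positivity, fun v => (hC v).trans (le_max_left _ _)⟩
def Cchi : ℝ := chi0_fderiv_bound.choose
lemma Cchi_pos : 0 < Cchi := chi0_fderiv_bound.choose_spec.1
lemma chi_fderiv (R : ℝ) (v : V3) : fderiv ℝ bt v = R⁻¹ • fderiv ℝ chi0 (R⁻¹ • v) := by
  have := fderiv_comp_smul (R⁻¹) (f := (chi0 : V3 → ℝ)) (x := v)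
  exact this
lemma chi_fderiv_le {R : ℝ} (hR : 0 < R) (v : V3) : ‖fderiv ℝ bt v‖ ≤ Cchi / R := by
  rw [chi_fderiv, norm_smul, norm_inv, norm_of_nonneg hR.le]
  have := chi0_fderiv_bound.choose_spec.2 (R⁻¹ • v)
  rw [div_eq_inv_mul]
  exact mll this pv
lemma dvg_smul {χ : V3 → ℝ} {Φ : V3 → V3} {v : V3} (hχ : DifferentiableAt ℝ χ v)
    (hΦ : DifferentiableAt ℝ Φ v) :
    dvg (fun w => χ w • Φ w) v = χ v * dvg Φ v + fderiv ℝ χ v (Φ v) := by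
  have h1 : fderiv ℝ (fun w => χ w • Φ w) v = χ v • fderiv ℝ Φ v + (fderiv ℝ χ v).smulRight (Φ v) :=
    fderiv_fun_smul hχ hΦ
  have h2 : fderiv ℝ χ v (Φ v) = ∑ i, fderiv ℝ χ v az * Φ v i := by
    have e : Φ v = ∑ i, Φ v i • esingle i := by
      ext j; simp [esingle, Finset.sum_apply, Pi.single_apply]
    conv_lhs => rw [e]
    rw [map_sum]
    exact Finset.sum_congr rfl fun i _ => by rw [map_smul, smul_eq_mul, mul_comm]
  rw [dvg, h2, dvg, Finset.mul_sum, ← Finset.sum_add_distrib]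
  refine Finset.sum_congr rfl fun i _ => ?_
  rw [h1]
  simp
lemma WG.ibp {f : V3 → ℝ} {V : V3 → V3} (h : WG f V) {Φ : V3 → V3} (hΦ : ContDiff ℝ 1 Φ)
    (i1 : Integrable (fun v => ⟪V v, Φ v⟫)) (i2 : Integrable (fun v => f v * dvg Φ v))
    (i3 : Integrable (fun v => f v • Φ v)) :
    (∫ v, ⟪V v, Φ v⟫) = - ∫ v, f v * dvg Φ v := by
  have hd : ∀ v, DifferentiableAt ℝ Φ v := fun v => hΦ.differentiable one_ne_zero v
  have hχd : ∀ (R : ℝ) v, DifferentiableAt ℝ bt v := fun R v =>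
    (chi_contDiff R (n := 1)).differentiable one_ne_zero v
  have e : ∀ n : ℕ, (∫ v, chi ag v * ⟪V v, Φ v⟫) =
      - ∫ v, (chi ag v * (f v * dvg Φ v) + fderiv ℝ (chi ag) v (f v • Φ v)) := by
    intro n
    have hR : cq < n + 1 := by positivity
    have := h.ibp_cpt (Φ := fun w => chi ag w • Φ w)
      ((chi_contDiff _ (n := 1)).smul hΦ) ((chi_cpt hR).smul_right)
    simp only [inner_smul_right, dvg_smul (hχd _ _) (hd _)] at this
    rw [this]
    congr 1; congr 1; ext v; rw [map_smul, smul_eq_mul]; ring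
  have t1 : Tendsto (fun n : ℕ => ∫ v, chi ag v * ⟪V v, Φ v⟫) atTop
      (nhds (∫ v, ⟪V v, Φ v⟫)) := by
    apply tendsto_integral_of_dominated_convergence (fun v => ‖⟪V v, Φ v⟫‖)
    · intro n
      exact (chi_contDiff _ (n := 1)).continuous.aestronglyMeasurable.mul i1.aestronglyMeasurable
    · exact i1.norm
    · intro n; refine aeo fun v => ?_
      rw [norm_mul, norm_of_nonneg (chi_nonneg _ _)]
      exact mul_le_of_le_one_left (norm_nonneg _) (chi_le_one _ _)
    · refine aeo fun v => ?_
      simpa using (chi_tendsto v).mul_const (⟪V v, Φ v⟫)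
  have t2 : Tendsto (fun n : ℕ => ∫ v, (chi ag v * (f v * dvg Φ v)
      + fderiv ℝ (chi ag) v (f v • Φ v))) atTop
      (nhds (∫ v, f v * dvg Φ v)) := by
    apply tendsto_integral_of_dominated_convergence
      (fun v => ‖f v * dvg Φ v‖ + Cchi * ‖f v • Φ v‖)
    · intro n
      refine ((chi_contDiff _ (n := 1)).continuous.aestronglyMeasurable.mul
        i2.aestronglyMeasurable).add ?_
      have hcf : Continuous (fun v => fderiv ℝ (chi ag) v) :=
        (chi_contDiff _ (n := 1)).continuous_fderiv one_ne_zero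
      exact (ContinuousLinearMap.flip (ContinuousLinearMap.apply ℝ ℝ)).aestronglyMeasurable_comp₂
        hcf.aestronglyMeasurable i3.aestronglyMeasurable
    · exact i2.norm.add (i3.norm.const_mul _)
    · intro n; refine aeo fun v => ?_
      have hR : cq < n + 1 := by positivity
      refine (norm_add_le _ _).trans (add_le_add ?_ ?_)
      · rw [norm_mul, norm_of_nonneg (chi_nonneg _ _)]
        exact mul_le_of_le_one_left (norm_nonneg _) (chi_le_one _ _)
      · refine (ContinuousLinearMap.le_opNorm _ _).trans ?_
        gcongr
        refine (chi_fderiv_le hR v).trans ?_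
        apply div_le_self Cchi_pos.le
        linarith [(Nat.cast_nonneg n : cu ≤ n)]
    · refine aeo fun v => ?_
      have a1 := (chi_tendsto v).mul_const (f v * dvg Φ v)
      have a2 : Tendsto (fun n : ℕ => fderiv ℝ (chi ag) v (f v • Φ v))
          atTop (nhds 0) := by
        have b : Tendsto (fun n : ℕ => Cchi * ‖f v • Φ v‖ * (1 / ag))
          atTop (nhds 0) := by
          simpa using (tendsto_one_div_add_atTop_nhds_zero_nat (𝕜 := ℝ)).const_mul (Cchi * ‖f v • Φ v‖)
        refine squeeze_zero_norm (fun n => ?_) b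
        have hR : cq < n + 1 := by positivity
        refine (ContinuousLinearMap.le_opNorm _ _).trans ?_
        refine (mlr (chi_fderiv_le hR v) (norm_nonneg _)).trans ?_
        apply le_of_eq; ring
      simpa using a1.add a2
  refine tendsto_nhds_unique t1 (t2.neg.congr fun n => (e n).symm)
lemma weak_deriv_zero {E : Type*} [NormedAddCommGroup E] [NormedSpace ℝ E] [FiniteDimensional ℝ E]
    [MeasurableSpace E] [BorelSpace E] (μ : Measure E) [μ.IsAddHaarMeasure]
    {F : E → ℝ} (hF : Integrable F μ) {e : E} (he : e ≠ 0)
    (h : ∀ φ : E → ℝ, ContDiff ℝ bn φ → HasCompactSupport φ →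
      (∫ p, F p * fderiv ℝ φ p e ∂μ) = 0) : F =ᵐ[μ] 0 := by
  have hprop : ProperSpace E := FiniteDimensional.proper_real E
  have key : ∀ ψ : E → ℝ, ContDiff ℝ bn ψ → HasCompactSupport ψ →
      (∫ p, F p * ψ (0 - p) ∂μ) = 0 := by
    intro ψ hψ hc
    have hψ1 : ContDiff ℝ 1 ψ := hψ.of_le (by exact_mod_cast le_top)
    set W : E → ℝ := convolution F ψ ej μ with hW
    have hWe : ∀ x, W x = ∫ p, F p * ψ ex ∂μ := fun x => by
      simp [hW, convolution_def]
    have hd : ∀ x, HasFDerivAt W _ x := fun x =>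
      hc.hasFDerivAt_convolution_right ej (μ := μ)
        hF.locallyIntegrable hψ1 x
    have hde : ∀ x, fderiv ℝ W x e = 0 := by
      intro x
      rw [(hd x).fderiv, convolution_precompR_apply _ hF.locallyIntegrable (hc.fderiv ℝ)
        (hψ1.continuous_fderiv one_ne_zero)]
      have h1 := h (fun p => ψ ex) (hψ.comp df)
        (hc.comp_homeomorph (Homeomorph.subLeft x))
      have h2 : ∀ p, fderiv ℝ (fun p => ψ ex) p e = - fderiv ℝ ψ ex e := by
        intro p
        have a : HasFDerivAt (fun p : E => x - p) (-(ContinuousLinearMap.id ℝ E)) p := by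
          simpa using (hasFDerivAt_id p).const_sub x
        have b := ((hψ1.differentiable one_ne_zero ex).hasFDerivAt).comp p a
        have c : fderiv ℝ (fun p => ψ ex) p = _ := b.fderiv
        rw [c]; simp
      simp only [h2, mul_neg, integral_neg, neg_eq_zero] at h1
      simpa [convolution_def] using h1
    have hconst : ∀ t : ℝ, W (t • e) = W 0 := by
      have hdd : ∀ t : ℝ, HasDerivAt (fun t : ℝ => W (t • e)) 0 t := by
        intro t
        have a : HasDerivAt (fun t : ℝ => t • e) e t := by
          simpa using (hasDerivAt_id t).smul_const e
        have b := (hd (t • e)).comp_hasDerivAt t a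
        rw [← (hd (t • e)).fderiv, hde] at b
        exact b
      intro t
      have := is_const_of_deriv_eq_zero (fun t => (hdd t).differentiableAt)
        (fun t => (hdd t).deriv) t 0
      simpa using this
    have hlim : Tendsto (fun n : ℕ => W ((n : ℝ) • e)) atTop (nhds 0) := by
      obtain ⟨C, hC⟩ := hc.exists_bound_of_continuous hψ.continuous
      have : cq = ∫ p, cq ∂μ := by simp
      rw [this]
      simp only [hWe]
      apply tendsto_integral_of_dominated_convergence (fun p => ‖F p‖ * C)
      · intro n
        exact hF.aestronglyMeasurable.mul
          (hψ.continuous.comp (continuous_const.sub continuous_id)).aestronglyMeasurable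
      · exact hF.norm.mul_const C
      · intro n; refine aeo fun p => ?_
        rw [norm_mul]; exact mll (hC _) (norm_nonneg _)
      · refine aeo fun p => ?_
        obtain ⟨r, hr⟩ := hc.isCompact.isBounded.subset_closedBall (0 : E)
        have he' := norm_pos_iff.2 he
        obtain ⟨N, hN⟩ := exists_nat_gt ((r + ‖p‖) / ‖e‖)
        refine tendsto_const_nhds.congr' ?_
        filter_upwards [Filter.eventually_ge_atTop N] with n hn
        have hn' : (N : ℝ) ≤ n := by exact_mod_cast hn
        have : ψ ((n : ℝ) • e - p) = 0 := by
          by_contra hne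
          have h1 := hr (subset_tsupport _ hne)
          rw [mem_closedBall_zero_iff] at h1
          have h2 := norm_sub_norm_le ((n : ℝ) • e) p
          rw [norm_smul, norm_of_nonneg (Nat.cast_nonneg n)] at h2
          rw [div_lt_iff₀ he'] at hN
          nlinarith
        rw [this, mul_zero]
    have hlim2 : Tendsto (fun n : ℕ => W ((n : ℝ) • e)) atTop (nhds (W 0)) := by
      simp only [hconst]; exact tendsto_const_nhds
    rw [← hWe]; exact tendsto_nhds_unique hlim2 hlim
  refine ae_eq_zero_of_integral_contDiff_smul_eq_zero hF.locallyIntegrable fun g hg hgc => ?_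
  have := key (fun p => g (-p)) (hg.comp contDiff_neg) (hgc.comp_homeomorph (Homeomorph.neg E))
  simpa [mul_comm] using this
lemma locInt_prod {a b : V3 → ℝ} (ha : LocallyIntegrable a) (hb : LocallyIntegrable b) :
    LocallyIntegrable (fun p : V3 × V3 => a p.1 * b p.2) := by
  rw [locallyIntegrable_iff]
  intro K hK
  have h1 := hK.image continuous_fst
  have h2 := hK.image continuous_snd
  have h3 : IntegrableOn (fun p : V3 × V3 => a p.1 * b p.2) ((Prod.fst '' K) ×ˢ (Prod.snd '' K)) := by
    unfold IntegrableOn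
    rw [Measure.volume_eq_prod, ← Measure.prod_restrict]
    exact Integrable.mul_prod (ha.integrableOn_isCompact h1) (hb.integrableOn_isCompact h2)
  exact h3.mono_set (fun p hp => ⟨⟨p, hp, rfl⟩, ⟨p, hp, rfl⟩⟩)
lemma cpt_fderiv_apply' {E : Type*} [NormedAddCommGroup E] [NormedSpace ℝ E] {φ : E → ℝ}
    (hc : HasCompactSupport φ) (e : E) :
    HasCompactSupport dz := by
  refine (hc.fderiv ℝ).mono' ?_
  intro v hv
  apply subset_tsupport
  intro h0
  apply hv
  show fderiv ℝ φ v e = 0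
  rw [h0]; rfl
lemma locInt_mul_cpt' {F : V3 × V3 → ℝ} (hF : LocallyIntegrable F) {g : V3 × V3 → ℝ}
    (hg : Continuous g) (hc : HasCompactSupport g) : Integrable (fun v => F v * g v) := by
  have := hF.integrable_smul_left_of_hasCompactSupport hg hc
  simpa [smul_eq_mul, mul_comm] using this
lemma slice_left {φ : V3 × V3 → ℝ} (hφ : ContDiff ℝ bn φ) (hc : HasCompactSupport φ) (w : V3) :
    ContDiff ℝ bn er ∧ HasCompactSupport er ∧
    ∀ v e, fderiv ℝ er v e = fderiv ℝ φ (v, w) (e, 0) := by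
  refine ⟨hφ.comp (contDiff_id.prodMk contDiff_const), ?_, ?_⟩
  · apply HasCompactSupport.of_support_subset_isCompact (hc.isCompact.image continuous_fst)
    intro v hv
    exact ⟨(v, w), subset_tsupport _ hv, rfl⟩
  · intro v e
    have a : HasFDerivAt (fun v : V3 => (v, w)) ((ContinuousLinearMap.id ℝ V3).prod 0) v :=
      (hasFDerivAt_id v).prodMk (hasFDerivAt_const w v)
    have b := ((hφ.differentiable cz (v, w)).hasFDerivAt).comp v a
    have c : fderiv ℝ er v = _ := b.fderiv
    rw [c]; simp
lemma slice_right {φ : V3 × V3 → ℝ} (hφ : ContDiff ℝ bn φ) (hc : HasCompactSupport φ) (w : V3) :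
    ContDiff ℝ bn et ∧ HasCompactSupport et ∧
    ∀ v e, fderiv ℝ et v e = fderiv ℝ φ (w, v) (0, e) := by
  refine ⟨hφ.comp (contDiff_const.prodMk contDiff_id), ?_, ?_⟩
  · apply HasCompactSupport.of_support_subset_isCompact (hc.isCompact.image continuous_snd)
    intro v hv
    exact ⟨(w, v), subset_tsupport _ hv, rfl⟩
  · intro v e
    have a : HasFDerivAt (fun v : V3 => (w, v)) ((0 : V3 →L[ℝ] V3).prod (ContinuousLinearMap.id ℝ V3)) v :=
      (hasFDerivAt_const w v).prodMk (hasFDerivAt_id v)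
    have b := ((hφ.differentiable cz (w, v)).hasFDerivAt).comp v a
    have c : fderiv ℝ et v = _ := b.fderiv
    rw [c]; simp
lemma tensor_test {φ ψ : V3 → ℝ} (hφ : ContDiff ℝ bn φ) (hc : HasCompactSupport φ)
    (hψ : ContDiff ℝ bn ψ) (hcψ : HasCompactSupport ψ) :
    ContDiff ℝ bn (fun p : V3 × V3 => φ p.1 * ψ p.2) ∧
    HasCompactSupport (fun p : V3 × V3 => φ p.1 * ψ p.2) := by
  refine ⟨(hφ.comp contDiff_fst).mul (hψ.comp contDiff_snd), ?_⟩
  apply HasCompactSupport.of_support_subset_isCompact (hc.isCompact.prod hcψ.isCompact)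
  intro p hp
  exact ⟨subset_tsupport _ (left_ne_zero_of_mul hp), subset_tsupport _ (right_ne_zero_of_mul hp)⟩
lemma weakGrad6_split {u : V3 → ℝ} (hu : Integrable u) (hu0 : ¬ (u =ᵐ[volume] 0))
    {G : V3 × V3 → V3 × V3} (hG : IsWeakGrad6 (fun p => u p.1 * u p.2) G) :
    ∃ Y : V3 → V3, WG u Y ∧ ∀ᵐ p : V3 × V3, G p = (u p.2 • Y p.1, u p.1 • Y p.2) := by
  have hF : Integrable (fun p : V3 × V3 => u p.1 * u p.2) := hu.mul_prod hu
  have hFne : ¬ ((fun p : V3 × V3 => u p.1 * u p.2) =ᵐ[volume] 0) := by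
    intro h
    apply hu0
    have h1 : ∀ᵐ x : V3, ∀ᵐ y : V3, u x * u y = 0 := Measure.ae_ae_of_ae_prod h
    by_contra hne
    have h2 : ∃ x, u x ≠ 0 ∧ ∀ᵐ y : V3, u x * u y = 0 := by
      by_contra hc
      apply hne
      filter_upwards [h1] with x hx
      by_contra hx0
      exact hc ⟨x, hx0, hx⟩
    obtain ⟨x, hx, hxy⟩ := h2
    apply hne
    filter_upwards [hxy] with y hy
    exact (mul_eq_zero.1 hy).resolve_left hx
  have ha : ∀ e : V3 × V3, ∀ φ : V3 × V3 → ℝ, ContDiff ℝ bn φ → HasCompactSupport φ →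
      Integrable (fun p => (⟪(G p).1, e.1⟫ + ⟪(G p).2, e.2⟫) * φ p) := by
    intro e φ₀ hφ₀ hc₀
    by_cases he : e = 0
    · simp [he]
    by_contra hni
    have hz : ∀ φ : V3 × V3 → ℝ, ContDiff ℝ bn φ → HasCompactSupport φ →
        ¬ Integrable (fun p => (⟪(G p).1, e.1⟫ + ⟪(G p).2, e.2⟫) * φ p) →
        (∫ p : V3 × V3, (u p.1 * u p.2) * fderiv ℝ φ p e) = 0 := by
      intro φ hφ hc hn
      rw [hG φ hφ hc e, integral_undef hn, neg_zero]
    apply hFne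
    have : (volume : Measure ec).IsAddHaarMeasure := by
      rw [Measure.volume_eq_prod]; infer_instance
    refine weak_deriv_zero volume hF he fun φ hφ hc => ?_
    by_cases hi : Integrable (fun p => (⟪(G p).1, e.1⟫ + ⟪(G p).2, e.2⟫) * φ p)
    · have hs : ¬ Integrable (fun p => (⟪(G p).1, e.1⟫ + ⟪(G p).2, e.2⟫) * (φ + φ₀) p) := by
        intro hs
        apply hni
        refine (hs.sub hi).congr (aeo fun p => ?_)
        simp only [Pi.sub_apply, Pi.add_apply]; ring
      have e1 := hz (φ + φ₀) (hφ.add hφ₀) (hc.add hc₀) hs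
      have e2 := hz _ hφ₀ hc₀ hni
      have e3 : ∀ p, fderiv ℝ (φ + φ₀) p e = fderiv ℝ φ p e + fderiv ℝ φ₀ p e := fun p => by
        rw [fderiv_add (hφ.differentiable cz p) (hφ₀.differentiable cz p)]; rfl
      simp only [e3, mul_add] at e1
      rw [integral_add (locInt_mul_cpt' hF.locallyIntegrable
        ((hφ.continuous_fderiv cz).clm_apply continuous_const) (cpt_fderiv_apply' hc e))
        (locInt_mul_cpt' hF.locallyIntegrable
        ((hφ₀.continuous_fderiv cz).clm_apply continuous_const) (cpt_fderiv_apply' hc₀ e)),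
        e2, add_zero] at e1
      exact e1
    · exact hz φ hφ hc hi
  have hloc : ∀ e : V3 × V3, LocallyIntegrable (fun p => ⟪(G p).1, e.1⟫ + ⟪(G p).2, e.2⟫) := by
    intro e
    rw [locallyIntegrable_iff]
    intro K hK
    obtain ⟨R, hR0, hR⟩ := hK.isBounded.subset_closedBall_lt 0 0
    have := ha e _ (tensor_test (chi_contDiff R (n := ⊤)) (chi_cpt hR0) (chi_contDiff R (n := ⊤)) (chi_cpt hR0)).1
      (tensor_test (chi_contDiff R (n := ⊤)) (chi_cpt hR0) (chi_contDiff R (n := ⊤)) (chi_cpt hR0)).2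
    refine (this.integrableOn (s := K)).congr_fun (fun p hp => ?_) hK.measurableSet
    have h1 := mem_closedBall_zero_iff.1 (hR hp)
    have h2 : chi R p.1 = 1 := chi_eq_one hR0 ((norm_fst_le p).trans h1)
    have h3 : chi R p.2 = 1 := chi_eq_one hR0 ((norm_snd_le p).trans h1)
    simp [h2, h3]
  obtain ⟨ψ, hψ, hcψ, hψ1⟩ : ∃ ψ : V3 → ℝ, ContDiff ℝ bn ψ ∧ HasCompactSupport ψ ∧
      (∫ v, u v * ψ v) = 1 := by
    by_contra hcon
    push Not at hcon
    apply hu0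
    refine ae_eq_zero_of_integral_contDiff_smul_eq_zero hu.locallyIntegrable fun g hg hgc => ?_
    by_contra hne
    have := hcon (fun v => (∫ v, g v • u v)⁻¹ * g v) (contDiff_const.mul hg) hgc.mul_left
    apply this
    have e : ∀ v, u v * ((∫ v, g v • u v)⁻¹ * g v) = (∫ v, g v • u v)⁻¹ * (g v • u v) := fun v => by
      rw [smul_eq_mul]; ring
    simp only [e, integral_const_mul]
    exact inv_mul_cancel₀ hne
  let Yc : Fin 3 → V3 → ℝ := fun i v => ∫ w, (G (v, w)).1 i * ψ w
  have hlocG1 : ∀ i, LocallyIntegrable (fun p => (G p).1 i) := fun i => by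
    have := hloc (esingle i, 0)
    simpa [inner_esingle] using this
  have hlocG2 : ∀ i, LocallyIntegrable (fun p => (G p).2 i) := fun i => by
    have := hloc (0, esingle i)
    simpa [inner_esingle] using this
  have hYcl : ∀ i, LocallyIntegrable (Yc i) := by
    intro i
    rw [locallyIntegrable_iff]
    intro K hK
    have h1 : IntegrableOn (fun p : V3 × V3 => (G p).1 i * ψ p.2) (K ×ˢ tsupport ψ) := by
      have h0 := (hlocG1 i).integrableOn_isCompact (hK.prod hcψ.isCompact)
      obtain ⟨C, hC⟩ := hcψ.exists_bound_of_continuous hψ.continuous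
      refine Integrable.mul_bdd (c := C) h0 (hψ.continuous.comp continuous_snd).aestronglyMeasurable ?_
      exact aeo fun p => hC _
    unfold IntegrableOn at h1
    rw [Measure.volume_eq_prod, ← Measure.prod_restrict] at h1
    have h2 := h1.integral_prod_left
    refine h2.congr (aeo fun v => ?_)
    show ∫ w in tsupport ψ, (G (v, w)).1 i * ψ w = Yc i v
    apply setIntegral_eq_integral_of_forall_compl_eq_zero
    intro w hw
    rw [image_eq_zero_of_notMem_tsupport hw, mul_zero]
  have hYcw : ∀ i, ∀ φ : V3 → ℝ, ContDiff ℝ bn φ → HasCompactSupport φ →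
      (∫ v, u v * fderiv ℝ φ v az) = - ∫ v, Yc i v * φ v := by
    intro i φ hφ hc
    obtain ⟨t1, t2⟩ := tensor_test hφ hc hψ hcψ
    have h1 := hG _ t1 t2 (esingle i, 0)
    have h2 : ∀ p : V3 × V3, fderiv ℝ (fun p : V3 × V3 => φ p.1 * ψ p.2) p (esingle i, 0)
        = fderiv ℝ φ p.1 az * ψ p.2 := by
      rintro ⟨v, w⟩
      rw [← (slice_left t1 t2 w).2.2]
      show fderiv ℝ (fun v => φ v * ψ w) v az = _
      rw [fderiv_mul_const (hφ.differentiable cz v)]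
      simp [mul_comm]
    simp only [h2, inner_esingle, inner_zero_right, add_zero] at h1
    have h3 : (∫ p : V3 × V3, u p.1 * u p.2 * (fderiv ℝ φ p.1 az * ψ p.2))
        = ∫ v, u v * fderiv ℝ φ v az := by
      have : ∀ p : V3 × V3, u p.1 * u p.2 * (fderiv ℝ φ p.1 az * ψ p.2)
        = (u p.1 * fderiv ℝ φ p.1 az) * (u p.2 * ψ p.2) := fun p => by ring
      simp only [this]
      rw [Measure.volume_eq_prod, integral_prod_mul (fun v => u v * fderiv ℝ φ v az) (fun w => u w * ψ w), hψ1, mul_one]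
    rw [← h3, h1]
    congr 1
    have h4 := locInt_mul_cpt' (hlocG1 i) t1.continuous t2
    rw [Measure.volume_eq_prod] at h4 ⊢
    rw [integral_prod _ h4]
    congr 1; ext v
    rw [← integral_mul_const]
    congr 1; ext w; ring
  let Y : V3 → V3 := fun v => WithLp.toLp 2 (fun i => Yc i v)
  have hYi : ∀ v i, Y v i = Yc i v := fun v i => rfl
  have hYl : LocallyIntegrable Y := by
    have : Y = fun v => ∑ i, Yc i v • esingle i := by
      ext v j; rw [hYi]; simp [esingle, Pi.single_apply]
    rw [this]
    have : ∀ i, LocallyIntegrable (fun v => Yc i v • esingle i) := fun i => by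
      have h := hYcl i
      rw [locallyIntegrable_iff] at *
      exact fun K hK => (h K hK).smul_const _
    rw [locallyIntegrable_iff]
    intro K hK
    apply integrable_finsetSum
    intro i _
    exact (locallyIntegrable_iff.1 (this i)) K hK
  have hYw : IsWeakGrad3 u Y := by
    intro φ hφ hc e
    have he : e = ∑ i, e i • esingle i := by ext j; simp [esingle, Pi.single_apply]
    have h1 : ∀ v, u v * fderiv ℝ φ v e = ∑ i, e i * (u v * fderiv ℝ φ v az) := by
      intro v
      conv_lhs => rw [he]
      rw [map_sum, Finset.mul_sum]
      exact Finset.sum_congr rfl fun i _ => by rw [map_smul, smul_eq_mul]; ring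
    have h2 : ∀ v, ⟪Y v, e⟫ * φ v = ∑ i, e i * (Yc i v * φ v) := by
      intro v
      rw [inner_eq_sum, Finset.sum_mul]
      exact Finset.sum_congr rfl fun i _ => by rw [hYi]; ring
    simp only [h1, h2]
    rw [integral_finsetSum, integral_finsetSum, ← Finset.sum_neg_distrib]
    · refine Finset.sum_congr rfl fun i _ => ?_
      rw [integral_const_mul, integral_const_mul, hYcw i φ hφ hc]; ring
    · intro i _
      exact (locInt_mul_cpt (hYcl i) hφ.continuous hc).const_mul _
    · intro i _
      exact (locInt_mul_cpt hu.locallyIntegrable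
        ((hφ.continuous_fderiv cz).clm_apply continuous_const)
        (cpt_fderiv_apply hc _)).const_mul _
  refine ⟨Y, ⟨hu.locallyIntegrable, hYl, hYw⟩, ?_⟩
  have g1 : ∀ i, ∀ᵐ p : V3 × V3, (G p).1 i = Yc i p.1 * u p.2 := by
    intro i
    have hl2 := locInt_prod (hYcl i) hu.locallyIntegrable
    refine ae_eq_of_integral_contDiff_smul_eq (hlocG1 i) hl2 fun φ hφ hc => ?_
    have h1 := hG φ hφ hc (esingle i, 0)
    simp only [inner_esingle, inner_zero_right, add_zero] at h1
    have h2 : (∫ p : V3 × V3, u p.1 * u p.2 * fderiv ℝ φ p (esingle i, 0))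
        = - ∫ p : V3 × V3, (Yc i p.1 * u p.2) * φ p := by
      have j1 := locInt_mul_cpt' hF.locallyIntegrable
        ((hφ.continuous_fderiv cz).clm_apply (continuous_const (y := (esingle i, ar))))
          (cpt_fderiv_apply' hc _)
      have j2 := locInt_mul_cpt' hl2 hφ.continuous hc
      rw [Measure.volume_eq_prod] at j1 j2 ⊢
      rw [integral_prod_symm _ j1, integral_prod_symm _ j2, ← integral_neg]
      congr 1; ext w
      obtain ⟨s1, s2, s3⟩ := slice_left hφ hc w
      have := hYcw i _ s1 s2
      simp only [s3] at this
      have a1 : ∀ v, u v * u w * fderiv ℝ φ (v, w) (esingle i, 0)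
        = u w * (u v * fderiv ℝ φ (v, w) (esingle i, 0)) := fun v => by ring
      have a2 : ∀ v, Yc i v * u w * φ (v, w) = u w * (Yc i v * φ (v, w)) := fun v => by ring
      simp only [a1, a2, integral_const_mul]
      rw [this]; ring
    rw [h2] at h1
    have h3 := neg_injective h1
    simp only [smul_eq_mul, mul_comm (φ _)]
    exact h3.symm
  have g2 : ∀ i, ∀ᵐ p : V3 × V3, (G p).2 i = u p.1 * Yc i p.2 := by
    intro i
    have hl2 := locInt_prod hu.locallyIntegrable (hYcl i)
    refine ae_eq_of_integral_contDiff_smul_eq (hlocG2 i) hl2 fun φ hφ hc => ?_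
    have h1 := hG φ hφ hc (0, esingle i)
    simp only [inner_esingle, inner_zero_right, zero_add] at h1
    have h2 : (∫ p : V3 × V3, u p.1 * u p.2 * fderiv ℝ φ p (0, esingle i))
        = - ∫ p : V3 × V3, (u p.1 * Yc i p.2) * φ p := by
      have j1 := locInt_mul_cpt' hF.locallyIntegrable
        ((hφ.continuous_fderiv cz).clm_apply (continuous_const (y := (ar, esingle i))))
          (cpt_fderiv_apply' hc _)
      have j2 := locInt_mul_cpt' hl2 hφ.continuous hc
      rw [Measure.volume_eq_prod] at j1 j2 ⊢
      rw [integral_prod _ j1, integral_prod _ j2, ← integral_neg]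
      congr 1; ext w
      obtain ⟨s1, s2, s3⟩ := slice_right hφ hc w
      have := hYcw i _ s1 s2
      simp only [s3] at this
      simp only [mul_assoc, integral_const_mul]
      rw [this]; ring
    rw [h2] at h1
    have h3 := neg_injective h1
    simp only [smul_eq_mul, mul_comm (φ _)]
    exact h3.symm
  filter_upwards [ae_all_iff.2 g1, ae_all_iff.2 g2] with p h1 h2
  apply Prod.ext
  · ext i; rw [h1 i]; simp [hYi, mul_comm]
  · ext i; rw [h2 i]; simp [hYi]
def wv (f : V3 → ℝ) (Y : V3 → V3) (v w : V3) : V3 := √de • Y v - √ak • Y w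
structure Stat (γ E Hb : ℝ) (f : V3 → ℝ) (Y : V3 → V3) : Prop where
  dens : Dens E Hb f
  Ym : Measurable Y
  wg : WG (fun v => √ak) Y
  dis : Integrable (fun q : V3 × V3 =>
    wt γ 0 cj * Sb cj (wv f Y q.1 q.2) (wv f Y q.1 q.2))
lemma ae_sub_ne : ∀ᵐ q : V3 × V3, q.1 - q.2 ≠ 0 := by
  have : MeasurableSet {q : V3 × V3 | ¬ (q.1 - q.2 ≠ 0)} := by
    have : IsClosed {q : V3 × V3 | q.1 - q.2 = 0} :=
      isClosed_eq (by fun_prop) continuous_const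
    simpa using this.measurableSet
  rw [ae_iff, Measure.volume_eq_prod, Measure.measure_prod_null this]
  refine aeo fun v => ?_
  have : (Prod.mk v ⁻¹' {q : V3 × V3 | ¬ (q.1 - q.2 ≠ 0)}) = {v} := by
    ext w; simp [sub_eq_zero, eq_comm]
  show volume _ = 0
  rw [this]; simp
lemma ae_sub_ne' (v : V3) : ∀ᵐ w : V3, v - w ≠ 0 := by
  have : ∀ᵐ w : V3, w ≠ v := by simp [ae_iff]
  filter_upwards [this] with w hw h
  exact hw (sub_eq_zero.1 h).symm
lemma mSb {α : Type*} [MeasurableSpace α] {a b c : α → V3} (ha : Measurable a)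
    (hb : Measurable b) (hc : Measurable c) : Measurable (fun x => Sb (a x) (b x) (c x)) :=
  ((ha.norm.pow_const 2).mul (hb.inner hc)).sub ((ha.inner hb).mul (ha.inner hc))
lemma measurable_So {α : Type*} [MeasurableSpace α] {a b : α → V3} (ha : Measurable a)
    (hb : Measurable b) : Measurable (fun x => So (a x) (b x)) :=
  ((ha.norm.pow_const 2).smul hb).sub (Measurable.smul (f := fun x => (⟪a x, b x⟫ : ℝ)) (ha.inner hb) ha)
lemma measurable_wv {f : V3 → ℝ} {Y : V3 → V3} (hf : Measurable f) (hY : Measurable Y) :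
    Measurable (fun q : V3 × V3 => wv f Y q.1 q.2) := by
  unfold wv
  exact ((hf.comp measurable_snd).sqrt.smul (hY.comp measurable_fst)).sub
    ((hf.comp measurable_fst).sqrt.smul (hY.comp measurable_snd))
lemma wt_one_le {γ : ℝ} (hγ : γ ≤ 0) (z : V3) : wt γ 1 z ≤ 1 := by
  rw [wt_one]; exact rpow_le_one_of_one_le_of_nonpos (olj z) hγ
lemma int_wt_mono {γ ε : ℝ} (hγ : γ ≤ 0) (hε : 0 ≤ ε) {W : V3 × V3 → V3} (hW : Measurable W)
    (h : Integrable (fun q : V3 × V3 => wt γ 0 cj * Sb cj (W q) (W q))) :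
    Integrable (fun q : V3 × V3 => wt γ ε cj * Sb cj (W q) (W q)) := by
  refine h.mono' ?_ ?_
  · exact (((mwt γ ε).comp ch).mul
      (mSb ch hW hW)).aestronglyMeasurable
  · filter_upwards [ae_sub_ne] with q hq
    have h1 := Sbn cj (W q)
    rw [norm_of_nonneg (mul_nonneg (wtn hε _) h1)]
    exact mlr (wt_le hγ hε hq) h1
lemma Stat.Y_L2loc {γ E Hb : ℝ} (hγ : γ ∈ Ico ct 0) {f : V3 → ℝ} {Y : V3 → V3}
    (S : Stat γ E Hb f Y) : LocallyIntegrable (fun v => cp ^ 2) := by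
  obtain ⟨c₀, R, k, hc₀, hR, hk, hell⟩ := ellipticity_strong hγ E Hb
  have hW := measurable_wv S.dens.meas S.Ym
  have hd := int_wt_mono hγ.2.le zero_le_one hW S.dis
  set B : Set V3 := {w | ‖w‖ ≤ R ∧ f w ≤ k} with hB
  have hBm : MeasurableSet B := (measurableSet_le measurable_norm measurable_const).inter
    (measurableSet_le S.dens.meas measurable_const)
  have hYB : IntegrableOn Y B := (S.wg.lV.integrableOn_isCompact (isCompact_closedBall ar R)).mono_set
    (fun w hw => by simpa using hw.1)
  set I := ∫ w in B, ‖Y w‖ with hI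
  have hI0 : 0 ≤ I := integral_nonneg fun _ => norm_nonneg _
  set d : V3 → ℝ := fun v => ∫ w, wt γ 1 aa * Sb aa cg cg with hdd
  have hd' := hd
  rw [Measure.volume_eq_prod] at hd'
  have hdint : Integrable d := hd'.integral_prod_left
  let Kv : V3 → ℝ := fun v => (‖v‖ + R) ^ 2 * √k * I
  have key : ∀ᵐ v : V3, cp ^ 2 ≤ 4 / c₀ * jap v ^ ap * (1 / 2 * d v) +
      4 / c₀ * jap v ^ ap * ((Kv v) ^ 2 / c₀ * jap v ^ ap) * f v := by
    filter_upwards [hd'.prod_right_ae] with v hv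
    have hell' := hell f S.dens v da
    have hwt : ∀ w, 0 ≤ wt γ 1 aa := fun w => wtn zero_le_one _
    have hpt : ∀ w ∈ B, wt γ 1 aa * Sb aa da da * f w ≤
        wt γ 1 aa * Sb aa cg cg +
          2 * (√ak * cp * db * ‖Y w‖) := by
      intro w hw
      have e1 : f w * Sb aa da da ≤ Sb aa cg cg
          + 2 * (√ak * √de * Sb aa da (Y w)) := by
        have h0 := mul_nonneg (S.dens.nn v) (Sbn aa (Y w))
        have a := mul_self_sqrt (S.dens.nn v)
        have b := mul_self_sqrt (S.dens.nn w)
        simp only [wv, Sb_sub_left, Sb_sub_right, Sb_smul_left, Sb_smul_right]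
        rw [Sb_comm aa (Y w) da]
        have e2 : √de * (√de * Sb aa da da) = f w * Sb aa da da := by
          rw [← mul_assoc, b]
        have e3 : √ak * (√ak * Sb aa (Y w) (Y w)) = f v * Sb aa (Y w) (Y w) := by
          rw [← mul_assoc, a]
        nlinarith
      have e4 : wt γ 1 aa * (√ak * √de * Sb aa da (Y w))
          ≤ √ak * cp * db * ‖Y w‖ := by
        have b1 := (le_abs_self _).trans (abs_Sb_le aa da (Y w))
        have b2 : ab ≤ ‖v‖ + R := (norm_sub_le _ _).trans (by linarith [hw.1])
        have b3 : √de ≤ √k := sqrt_le_sqrt hw.2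
        have b4 : ab ^ 2 ≤ (‖v‖ + R) ^ 2 := pow_le_pow_left₀ (norm_nonneg _) b2 2
        calc wt γ 1 aa * (√ak * √de * Sb aa da (Y w))
            ≤ wt γ 1 aa * (√ak * √de * (cp * (ab ^ 2 * ‖Y w‖))) := by
              gcongr; exact hwt w
          _ ≤ 1 * (√ak * √k * (cp * ((‖v‖ + R) ^ 2 * ‖Y w‖))) := by
              gcongr; exact wt_one_le hγ.2.le _
          _ = _ := by ring
      have e5 := mll e1 (hwt w)
      nlinarith
    have hint1 : IntegrableOn (fun w => wt γ 1 aa * Sb aa cg cg) B :=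
      Integrable.integrableOn hv
    have hint2 : IntegrableOn (fun w => 2 * (√ak * cp * db * ‖Y w‖)) B :=
      (hYB.norm.const_mul _).const_mul 2
    have hle : (∫ w in B, wt γ 1 aa * Sb aa da da * f w) ≤
        d v + 2 * (√ak * cp * Kv v) := by
      have h1 : (∫ w in B, wt γ 1 aa * Sb aa da da * f w) ≤
        ∫ w in B, (wt γ 1 aa * Sb aa cg cg +
          2 * (√ak * cp * db * ‖Y w‖)) := by
        apply integral_mono_of_nonneg
        · exact aeo fun w =>
            mul_nonneg (mul_nonneg (hwt w) (Sbn _ _)) (S.dens.nn w)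
        · exact hint1.add hint2
        · exact (ae_restrict_mem hBm).mono hpt
      have h2 : (∫ w in B, wt γ 1 aa * Sb aa cg cg) ≤ d v :=
        setIntegral_le_integral hv (aeo fun w =>
            mul_nonneg (hwt w) (Sbn _ _))
      rw [integral_add hint1 hint2, integral_const_mul, integral_const_mul] at h1
      have : √ak * cp * db * I = √ak * cp * Kv v := by
        simp only [Kv]; ring
      rw [this] at h1
      linarith
    have hmain := hell'.trans hle
    have hJ := jpp v γ
    have hJi : jap v ^ ap = (jap v ^ γ)⁻¹ := rpow_neg (jap_pos v).le γ
    rw [hJi]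
    set J := jap v ^ γ
    have hy : 2 * (√ak * cp * Kv v) ≤ c₀ * J / 2 * cp ^ 2 + 2 * (f v * Kv v ^ 2 / (c₀ * J)) := by
      have hs := sq_sqrt (S.dens.nn v)
      have : 0 ≤ (c₀ * J * cp - 2 * (√ak * Kv v)) ^ 2 / (2 * (c₀ * J)) := by positivity
      have e : (c₀ * J * cp - 2 * (√ak * Kv v)) ^ 2 / (2 * (c₀ * J)) =
        c₀ * J / 2 * cp ^ 2 + 2 * (√ak ^ 2 * Kv v ^ 2 / (c₀ * J)) - 2 * (√ak * cp * Kv v) := by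
        field_simp; ring
      rw [e, hs] at this; linarith
    have hfin : c₀ * J / 2 * cp ^ 2 ≤ d v + 2 * (f v * Kv v ^ 2 / (c₀ * J)) := by linarith
    have e6 : 4 / c₀ * J⁻¹ * (1 / 2 * d v) + 4 / c₀ * J⁻¹ * (Kv v ^ 2 / c₀ * J⁻¹) * f v
      = 2 / (c₀ * J) * (d v + 2 * (f v * Kv v ^ 2 / (c₀ * J))) := by field_simp; ring
    rw [e6]
    calc cp ^ 2 = 2 / (c₀ * J) * (c₀ * J / 2 * cp ^ 2) := by field_simp
      _ ≤ _ := by gcongr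
  have hcK : Continuous Kv := by simp only [Kv]; fun_prop
  have l1 : LocallyIntegrable (fun v => 4 / c₀ * jap v ^ ap * (1 / 2 * d v)) := by
    have := (hdint.const_mul (1 / 2)).locallyIntegrable.continuous_smul
      (continuous_const.mul (continuous_jap_rpow ap) : Continuous fun v => 4 / c₀ * jap v ^ ap)
    simpa [smul_eq_mul] using this
  have l2 : LocallyIntegrable (fun v => 4 / c₀ * jap v ^ ap * ((Kv v) ^ 2 / c₀ * jap v ^ ap) * f v) := by
    have := S.dens.int.locallyIntegrable.continuous_smul
      ((continuous_const.mul (continuous_jap_rpow ap)).mul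
        (((hcK.pow 2).div_const c₀).mul (continuous_jap_rpow ap)) :
        Continuous fun v => 4 / c₀ * jap v ^ ap * ((Kv v) ^ 2 / c₀ * jap v ^ ap))
    simpa [smul_eq_mul] using this
  refine (l1.add l2).mono (S.Ym.norm.pow_const 2).aestronglyMeasurable ?_
  filter_upwards [key] with v hv
  rw [norm_of_nonneg (sq_nonneg _)]
  exact hv.trans (le_abs_self _)
lemma cv_apply (n : ℕ) (g : V3 → ℝ) (x : V3) : cv n g x = ∫ t, mol n (x - t) * g t := by
  unfold cv; rw [convolution_lsmul_swap]; simp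
lemma mol_contDiff (n : ℕ) : ContDiff ℝ bn (mol n) := (bmp n).contDiff_normed
lemma mol_cpt (n : ℕ) : HasCompactSupport (mol n) := (bmp n).hasCompactSupport_normed
lemma mol_nonneg (n : ℕ) (x : V3) : 0 ≤ mol n x := (bmp n).nonneg_normed x
lemma mol_integral (n : ℕ) : (∫ x, mol n x) = 1 := (bmp n).integral_normed
lemma mol_integrable (n : ℕ) : Integrable (mol n) :=
  (mol_contDiff n).continuous.integrable_of_hasCompactSupport (mol_cpt n)
lemma cv_hasFDerivAt (n : ℕ) {u : V3 → ℝ} (hu : LocallyIntegrable u) (x e : V3) :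
    fderiv ℝ (cv n u) x e = ∫ t, fderiv ℝ (mol n) (x - t) e * u t := by
  have h1 := (mol_cpt n).hasFDerivAt_convolution_left ej (μ := volume)
    ((mol_contDiff n).of_le (by exact_mod_cast le_top)) hu x
  have h2 : fderiv ℝ (cv n u) x = _ := h1.fderiv
  have hcont : Continuous (fderiv ℝ (mol n)) := (mol_contDiff n).continuous_fderiv cz
  rw [h2, ContinuousLinearMap.precompL, ← convolution_flip]
  rw [show (((ContinuousLinearMap.lsmul ℝ ℝ).flip.precompR V3).flip.flip : ℝ →L[ℝ] (V3 →L[ℝ] ℝ) →L[ℝ] V3 →L[ℝ] ℝ) = (ContinuousLinearMap.lsmul ℝ ℝ : ℝ →L[ℝ] ℝ →L[ℝ] ℝ).flip.precompR V3 from rfl]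
  rw [convolution_precompR_apply _ hu ((mol_cpt n).fderiv ℝ) hcont]
  simp [convolution_def]
lemma WG.cv_fderiv (n : ℕ) {u : V3 → ℝ} {Y : V3 → V3} (h : WG u Y) (x e : V3) :
    fderiv ℝ (cv n u) x e = cv n dt x := by
  rw [cv_hasFDerivAt n h.lf, cv_apply]
  have h1 := h.wg (fun t => mol n (x - t)) ((mol_contDiff n).comp df)
    ((mol_cpt n).comp_homeomorph (Homeomorph.subLeft x)) e
  have h2 : ∀ p, fderiv ℝ (fun p => mol n ex) p e = - fderiv ℝ (mol n) ex e := by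
    intro p
    have a : HasFDerivAt (fun p : V3 => x - p) (-(ContinuousLinearMap.id ℝ V3)) p := by
      simpa using (hasFDerivAt_id p).const_sub x
    have b := (((mol_contDiff n).differentiable cz ex).hasFDerivAt).comp p a
    have c : fderiv ℝ (fun p => mol n ex) p = _ := b.fderiv
    rw [c]; simp
  simp only [h2, mul_neg, integral_neg, neg_inj] at h1
  simp only [mul_comm] at h1 ⊢
  exact h1
lemma corr_continuous {a b : V3 → ℝ} (ha : MemLp a 2 volume) (hb : MemLp b 2 volume) :
    Continuous (fun s : V3 => ∫ x, a x * b (x + s)) := by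
  let F : V3 → C(V3, V3) := fun s => ⟨fun x => x + s, by fun_prop⟩
  have hF : Continuous F := by
    apply ContinuousMap.continuous_of_continuous_uncurry
    show Continuous (fun p : V3 × V3 => p.2 + p.1)
    fun_prop
  have hmp : ∀ s, MeasurePreserving (F s) (volume : Measure V3) volume := fun s =>
    measurePreserving_add_right volume s
  have h1 := Continuous.compMeasurePreservingLp (p := 2)
    (continuous_const (y := hb.toLp b)) hF hmp bs
  have h2 : Continuous (fun s => ⟪ha.toLp a, Lp.compMeasurePreserving (F s) (hmp s) (hb.toLp b)⟫) :=
    continuous_const.inner h1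
  refine h2.congr fun s => ?_
  rw [L2.inner_def]
  apply integral_congr_ae
  rw [Lp.toLp_compMeasurePreserving hb (hmp s)]
  filter_upwards [ha.coeFn_toLp, (hb.comp_measurePreserving (hmp s)).coeFn_toLp] with x h1 h2
  rw [h1, h2]
  simp [F, mul_comm]
lemma cv_L2 {a b : V3 → ℝ} (ha : MemLp a 2 volume) (hb : MemLp b 2 volume) :
    Tendsto (fun n => ∫ x, a x * cv n b x) atTop (nhds (∫ x, a x * b x)) := by
  have hc := corr_continuous ha hb
  have h1 := ContDiffBump.convolution_tendsto_right_of_continuous (μ := (volume : Measure V3))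
    (φ := bmp) bmp_tendsto hc 0
  simp only [add_zero] at h1
  refine h1.congr fun n => ?_
  have e1 : (convolution ((bmp n).normed volume) (fun s : V3 => ∫ x, a x * b (x + s))
      ej volume) 0 = ∫ t, ∫ x, mol n t * (a x * b (x - t)) := by
    rw [convolution_def]
    congr 1; ext t
    rw [integral_const_mul]
    simp [mol, sub_eq_add_neg]
  have e2 : ∀ x, a x * cv n b x = ∫ t, mol n t * (a x * b (x - t)) := by
    intro x
    unfold cv
    rw [convolution_def, ← integral_const_mul]
    congr 1; ext t; simp; ring
  rw [e1]; simp only [e2]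
  apply integral_integral_swap
  have hm : AEStronglyMeasurable (fun q : V3 × V3 => b (q.2 - q.1)) (volume.prod volume) := by
    have := (hb.aestronglyMeasurable.comp_quasiMeasurePreserving
      (quasiMeasurePreserving_sub_of_right_invariant (volume : Measure V3) volume))
    exact this.comp_quasiMeasurePreserving (Measure.measurePreserving_swap).quasiMeasurePreserving
  have hm2 : AEStronglyMeasurable (fun q : V3 × V3 => a q.2) (volume.prod volume) :=
    ha.aestronglyMeasurable.comp_quasiMeasurePreserving Measure.quasiMeasurePreserving_snd
  have hm1 : AEStronglyMeasurable (fun q : V3 × V3 => mol n q.1) (volume.prod volume) :=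
    ((mol_contDiff n).continuous.comp continuous_fst).aestronglyMeasurable
  have i1 : Integrable (fun q : V3 × V3 => mol n q.1 * (a q.2) ^ 2) (volume.prod volume) :=
    (mol_integrable n).mul_prod ha.integrable_sq
  have i2 : Integrable (fun q : V3 × V3 => mol n q.1 * (b (q.2 - q.1)) ^ 2) (volume.prod volume) := by
    have := (Integrable.convolution_integrand ej (mol_integrable n)
      hb.integrable_sq).swap
    simpa [Function.comp_def] using this
  refine (i1.add i2).mono' (hm1.mul (hm2.mul hm)) (aeo fun q => ?_)
  simp only [Function.uncurry, norm_eq_abs, abs_mul, abs_of_nonneg (mol_nonneg n _), Pi.add_apply]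
  rw [← mul_add]
  apply mll _ (mol_nonneg n _)
  have := two_mul_le_add_sq |a q.2| |b (q.2 - q.1)|
  rw [sq_abs, sq_abs] at this
  nlinarith [abs_nonneg (a q.2), abs_nonneg (b (q.2 - q.1))]
lemma cv_congr_ball (n : ℕ) {R : ℝ} {b b' : V3 → ℝ} (h : ∀ x, ‖x‖ ≤ R + 1 → b x = b' x) {x : V3}
    (hx : ‖x‖ ≤ R) : cv n b x = cv n b' x := by
  rw [cv_apply, cv_apply]
  congr 1; ext t
  by_cases ht : ‖t‖ ≤ R + 1
  · rw [h t ht]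
  · have : mol n (x - t) = 0 := by
      by_contra hne
      have h1 : x - t ∈ Function.support (mol n) := hne
      unfold mol at h1
      rw [(bmp n).support_normed_eq (μ := volume), mem_ball_zero_iff] at h1
      have := norm_sub_norm_le t x
      rw [norm_sub_rev] at this
      linarith [bmp_rOut_le n]
    rw [this]; simp
lemma cv_L2loc {a b : V3 → ℝ} {R : ℝ} (ha : MemLp a 2 volume) (ha0 : ∀ x, R < ‖x‖ → a x = 0)
    (hbm : AEStronglyMeasurable b volume) (hb : LocallyIntegrable (fun x => b x ^ 2)) :
    Tendsto (fun n => ∫ x, a x * cv n b x) atTop (nhds (∫ x, a x * b x)) := by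
  set b' : V3 → ℝ := (Metric.closedBall ar (R + 1)).indicator b with hb'
  have hbb : ∀ x, ‖x‖ ≤ R + 1 → b x = b' x := fun x hx => by
    rw [hb', Set.indicator_of_mem (by simpa using hx)]
  have hL : MemLp b' 2 volume := by
    rw [memLp_two_iff_integrable_sq (hbm.indicator Metric.isClosed_closedBall.measurableSet)]
    have h1 := hb.integrableOn_isCompact (isCompact_closedBall ar (R + 1))
    rw [← integrable_indicator_iff Metric.isClosed_closedBall.measurableSet] at h1
    refine h1.congr (aeo fun x => ?_)
    simp only [Set.indicator]
    split_ifs <;> simp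
  have h1 := cv_L2 ha hL
  have e : ∀ x, a x * b x = a x * b' x := fun x => by
    by_cases hx : ‖x‖ ≤ R
    · rw [hbb x ac]
    · rw [ha0 x (not_le.1 hx)]; simp
  have e2 : ∀ n x, a x * cv n b x = a x * cv n b' x := fun n x => by
    by_cases hx : ‖x‖ ≤ R
    · rw [cv_congr_ball n hbb hx]
    · rw [ha0 x (not_le.1 hx)]; simp
  simp only [e, e2]; exact h1
lemma WG.sq {u : V3 → ℝ} {Y : V3 → V3} (h : WG u Y) (hY : LocallyIntegrable (fun v => cp ^ 2))
    (hu : LocallyIntegrable (fun v => u v ^ 2)) : WG (fun v => u v ^ 2) (fun v => (2 * u v) • Y v) := by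
  have hum := h.lf.aestronglyMeasurable
  have hYm := h.lV.aestronglyMeasurable
  refine ⟨hu, ?_, ?_⟩
  · refine (hu.add hY).mono ((hum.const_mul 2).smul hYm) (aeo fun v => ?_)
    rw [norm_smul, norm_mul]
    have := two_mul_le_add_sq ‖u v‖ cp
    rw [norm_eq_abs (u v), sq_abs] at this
    refine le_trans ?_ (le_abs_self _)
    simp only [Pi.add_apply, norm_eq_abs]
    rw [abs_of_pos (by norm_num : cu < 2)]
    linarith
  intro φ hφ hc e
  obtain ⟨R, hR0, hR⟩ := hc.isCompact.isBounded.subset_closedBall_lt 0 0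
  have hφ0 : ∀ x, R < ‖x‖ → φ x = 0 := fun x hx => by
    by_contra hne
    have := mem_closedBall_zero_iff.1 (hR (subset_tsupport _ hne))
    linarith
  have hφd0 : ∀ x, R < ‖x‖ → fderiv ℝ φ x e = 0 := fun x hx => by
    by_contra hne
    have hc' := hR ((tsupport_fderiv_subset ℝ) (subset_tsupport (fderiv ℝ φ) (a := x) (by
      intro h0; apply hne; rw [h0]; rfl)))
    have := mem_closedBall_zero_iff.1 hc'
    linarith
  have hYe : LocallyIntegrable (fun v => ⟪Y v, e⟫ ^ 2) := by
    refine (hY.smul (‖e‖ ^ 2)).mono ((hYm.inner_const).pow 2) (aeo fun v => ?_)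
    rw [norm_of_nonneg (sq_nonneg _)]
    refine le_trans ?_ (le_abs_self _)
    have h1 := abs_real_inner_le_norm da e
    simp only [Pi.smul_apply, smul_eq_mul]
    have := pow_le_pow_left₀ (abs_nonneg _) h1 2
    rw [sq_abs] at this
    nlinarith
  have hL : ∀ (w : V3 → ℝ) (ψ : V3 → ℝ), AEStronglyMeasurable w volume →
      LocallyIntegrable (fun v => w v ^ 2) → Continuous ψ → HasCompactSupport ψ →
      MemLp (fun v => w v * ψ v) 2 volume := by
    intro w ψ hw hw2 hψ hψc
    refine (memLp_two_iff_integrable_sq (hw.mul hψ.aestronglyMeasurable)).2 ?_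
    have := locInt_mul_cpt hw2 (hψ.mul hψ) (hψc.mul_left)
    refine this.congr (aeo fun v => ?_)
    simp only [Pi.mul_apply]; ring
  have hdc : Continuous dz := (hφ.continuous_fderiv cz).clm_apply continuous_const
  have hum2 := (h.lV.aestronglyMeasurable).inner_const (c := e) (𝕜 := ℝ)
  have T1 := cv_L2loc (R := R) (hL u dz hum hu hdc (cpt_fderiv_apply hc e))
    (fun x hx => by rw [hφd0 x hx, mul_zero]) hum hu
  have T2 := cv_L2loc (R := R) (hL u φ hum hu hφ.continuous hc)
    (fun x hx => by rw [hφ0 x hx, mul_zero]) hum2 hYe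
  have T3 := cv_L2loc (R := R) (hL dt φ hum2 hYe hφ.continuous hc)
    (fun x hx => by rw [hφ0 x hx, mul_zero]) hum hu
  have key : ∀ n, (∫ x, u x * fderiv ℝ φ x e * cv n u x) + (∫ x, u x * φ x * cv n dt x)
      = - ∫ x, ⟪Y x, e⟫ * φ x * cv n u x := by
    intro n
    have hcv : ContDiff ℝ 1 (cv n u) := (cv_contDiff n h.lf).of_le (by exact_mod_cast le_top)
    have hφ1 : ContDiff ℝ 1 φ := hφ.of_le (by exact_mod_cast le_top)
    have h1 := h.c1 (hφ1.mul hcv) (hc.mul_right) e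
    have h2 : ∀ x, fderiv ℝ (fun x => φ x * cv n u x) x e
        = fderiv ℝ φ x e * cv n u x + φ x * cv n dt x := by
      intro x
      rw [← h.cv_fderiv n, fderiv_fun_mul (hφ1.differentiable one_ne_zero x)
        (hcv.differentiable one_ne_zero x)]
      simp; ring
    have hcvY : Continuous (cv n dt) := (cv_contDiff n (locInt_inner h.lV e)).continuous
    simp only [h2, mul_add] at h1
    rw [integral_add] at h1
    · simp only [mul_assoc]; exact h1
    · exact locInt_mul_cpt h.lf (hdc.mul hcv.continuous) ((cpt_fderiv_apply hc e).mul_right)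
    · exact locInt_mul_cpt h.lf (hφ.continuous.mul hcvY) (hc.mul_right)
  have L := tendsto_nhds_unique ((T1.add T2).congr key) T3.neg
  have j1 : ∀ v, u v ^ 2 * fderiv ℝ φ v e = u v * fderiv ℝ φ v e * u v := fun v => by ring
  have j2 : ∀ v, ⟪(2 * u v) • Y v, e⟫ * φ v = 2 * (u v * φ v * ⟪Y v, e⟫) := fun v => by
    rw [real_inner_smul_left]; ring
  have j3 : ∀ v, ⟪Y v, e⟫ * φ v * u v = u v * φ v * ⟪Y v, e⟫ := fun v => by ring
  simp only [j1, j2, j3, integral_const_mul] at L ⊢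
  linarith
lemma Stat.wgf {γ E Hb : ℝ} (hγ : γ ∈ Ico ct 0) {f : V3 → ℝ} {Y : V3 → V3}
    (S : Stat γ E Hb f Y) : WG f (fun v => (2 * √ak) • Y v) := by
  have e : (fun v => √ak ^ 2) = f := by ext v; exact sq_sqrt (S.dens.nn v)
  have := S.wg.sq (S.Y_L2loc hγ) (by rw [e]; exact S.dens.int.locallyIntegrable)
  rwa [e] at this
lemma wt_hasFDerivAt {γ ε : ℝ} (hε : 0 < ε) (z : V3) :
    HasFDerivAt (wt γ ε) dr z := by
  have h1 : HasFDerivAt (fun z : V3 => ε + ‖z‖ ^ 2) (al • (innerSL ℝ z)) z := by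
    have := (hasStrictFDerivAt_norm_sq z).hasFDerivAt.const_add ε
    simpa [two_smul] using this
  have hne : ε + ‖z‖ ^ 2 ≠ 0 := by positivity
  have h2 := h1.rpow_const (p := γ / 2) (Or.inl hne)
  have e : (γ * (ε + ‖z‖ ^ 2) ^ ax) • (innerSL ℝ z)
    = (ev * (ε + ‖z‖ ^ 2) ^ ax) • (al • (innerSL ℝ z)) := by
    rw [smul_smul]; congr 1; ring
  rw [e]; exact h2
lemma wt_contDiff {γ ε : ℝ} (hε : 0 < ε) {n : WithTop ℕ∞} : ContDiff ℝ n (wt γ ε) := by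
  unfold wt
  refine ContDiff.rpow_const_of_ne (contDiff_const.add (contDiff_norm_sq ℝ)) fun z => ?_
  positivity
lemma So_contDiff {n : WithTop ℕ∞} {a c : V3 → V3} (ha : ContDiff ℝ n a) (hc : ContDiff ℝ n c) :
    ContDiff ℝ n (fun v => So (a v) (c v)) := by
  unfold So
  exact ((ha.norm_sq ℝ).smul hc).sub ((ha.inner ℝ hc).smul ha)
lemma inner_z_So (z c : V3) : ⟪z, So z c⟫ = 0 := by
  simp only [So, inner_sub_right, real_inner_smul_right, real_inner_self_eq_norm_sq]; ring
lemma dvg_kernel {γ ε : ℝ} (hε : 0 < ε) (w : V3) {c : V3 → V3} {v : V3} (hc : DifferentiableAt ℝ c v) :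
    dvg (fun v => wt γ ε aa • So aa (c v)) v =
      wt γ ε aa * (-2 * ⟪v - w, c v⟫ + ∑ i, (So aa (fderiv ℝ c v az)) i) := by
  set z := v - w with hz
  have hsub : HasFDerivAt (fun v : V3 => v - w) (ContinuousLinearMap.id ℝ V3) v :=
    (hasFDerivAt_id v).sub_const w
  have h1 : HasFDerivAt (fun v => wt γ ε aa)
      dr v := by
    have := (wt_hasFDerivAt (γ := γ) hε z).comp v hsub
    rw [ContinuousLinearMap.comp_id] at this
    exact this
  have hn : HasFDerivAt (fun v : V3 => ab ^ 2) (al • (innerSL ℝ z)) v := by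
    have := ((hasStrictFDerivAt_norm_sq z).hasFDerivAt).comp v hsub
    rw [ContinuousLinearMap.comp_id] at this
    have e : al • (innerSL ℝ z) = (2 : ℕ) • (innerSL ℝ z) := by rw [two_smul, two_smul]
    rw [e]; exact this
  have hi := hsub.inner ℝ hc.hasFDerivAt
  have h2 : HasFDerivAt (fun v => So aa (c v)) _ v :=
    (hn.smul hc.hasFDerivAt).sub (hi.smul hsub)
  have hd2 : fderiv ℝ (fun v => So aa (c v)) v = _ := h2.fderiv
  rw [dvg_smul h1.differentiableAt h2.differentiableAt, h1.fderiv]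
  have e1 : dr (So aa (c v)) = 0 := by
    simp [inner_z_So, ← hz]
  rw [e1, add_zero]
  congr 1
  unfold dvg
  rw [hd2]
  have e2 : ⟪z, c v⟫ = ∑ i, z i * c v i := inner_eq_sum _ _
  have e3 : ∀ i, ⟪z, esingle i⟫ = z i := fun i => inner_esingle _ _
  have e4 : ∀ i, ⟪esingle i, c v⟫ = c v i := fun i => by rw [real_inner_comm]; exact inner_esingle _ _
  have e5 : ∀ i : Fin 3, az i = 1 := fun i => by simp [esingle]
  simp only [_root_.sub_apply, _root_.add_apply, _root_.smul_apply,
    ContinuousLinearMap.smulRight_apply, ContinuousLinearMap.comp_apply, fderivInnerCLM_apply,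
    ContinuousLinearMap.prod_apply, ContinuousLinearMap.id_apply, innerSL_apply_apply, So,
    PiLp.sub_apply, PiLp.add_apply, PiLp.smul_apply, smul_eq_mul, ← hz, e3, e4, e5]
  simp only [Fin.sum_univ_three, e2]
  ring
lemma So_neg_z (z c : V3) : So (-z) c = So z c := by simp [So]
lemma dvg_kernel' {γ ε : ℝ} (hε : 0 < ε) (v c : V3) (w : V3) :
    dvg (fun w => wt γ ε aa • So aa c) w = 2 * (wt γ ε aa * ⟪v - w, c⟫) := by
  have e : (fun w => wt γ ε aa • So aa c) = fun w => wt γ ε (w - v) • So (w - v) c := by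
    ext1 w
    rw [← neg_sub w v, wt_neg, So_neg_z]
  have e0 : ∀ z : V3, So z 0 = 0 := fun z => by simp [So]
  rw [e, dvg_kernel hε v (differentiableAt_const c), ← neg_sub w v, wt_neg, inner_neg_left]
  simp [e0]
  ring
lemma dom_int {F : Type*} [NormedAddCommGroup F] [NormedSpace ℝ F] [MeasurableSpace F] [BorelSpace F]
    [SecondCountableTopology F] {f : V3 → ℝ} {p C : ℝ} (hf : Measurable f)
    (hnn : ∀ v, 0 ≤ f v) (hm : Integrable bb) {Φ : V3 → F} (hΦ : Measurable Φ)
    (hb : ∀ w, ‖Φ w‖ ≤ C * jap w ^ p) : Integrable (fun w => f w • Φ w) := by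
  refine (hm.const_mul C).mono' (hf.smul hΦ).aestronglyMeasurable (aeo fun w => ?_)
  rw [norm_smul, norm_of_nonneg (hnn w)]
  nlinarith [hb w, hnn w]
def NN (γ : ℝ) (l : V3 → V3) (v w : V3) : V3 :=
  (2 * wt γ 1 aa) • aa + wt γ 1 aa • So aa (l w)
lemma norm_NN_le {γ : ℝ} (l : V3 → V3) (v w : V3) :
    ‖NN γ l v w‖ ≤ 2 * (wt γ 1 aa * ab) + wt γ 1 aa * ab ^ 2 * ‖l w‖ := by
  have h0 := wtn (γ := γ) zero_le_one aa
  refine (norm_add_le _ _).trans ?_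
  rw [norm_smul, norm_smul, norm_of_nonneg h0, norm_of_nonneg pv]
  nlinarith [norm_So_le aa (l w)]
lemma measurable_NN {γ : ℝ} {l : V3 → V3} (hl : Measurable l) :
    Measurable (fun q : V3 × V3 => NN γ l q.1 q.2) := by
  have hz : Measurable (fun q : V3 × V3 => q.1 - q.2) := measurable_fst.sub measurable_snd
  have hw := (mwt γ 1).comp hz
  exact ((hw.const_mul 2).smul hz).add (hw.smul (measurable_So hz (hl.comp measurable_snd)))
lemma measurable_NN_right {γ : ℝ} {l : V3 → V3} (hl : Measurable l) (v : V3) :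
    Measurable (fun w : V3 => NN γ l v w) := by
  have hz : Measurable (fun w : V3 => v - w) := measurable_const.sub measurable_id
  have hw := (mwt γ 1).comp hz
  exact ((hw.const_mul 2).smul hz).add (hw.smul (measurable_So hz hl))
lemma wtS_le {γ : ℝ} (hγ : γ ∈ Ico ct 0) (v w : V3) :
    wt γ 1 aa * ab ^ 2 ≤ 4 * ea := by
  refine (kb_cut hγ v w).trans ?_
  have : max ah 0 ≤ 2 := max_le (by linarith [hγ.2]) bs
  have := (mx_rpow_mono v w this).trans (mx_rpow_le_mul v w bs)
  linarith
lemma NN_dom {γ : ℝ} (hγ : γ ∈ Ico ct 0) {l : V3 → V3} {K κ p : ℝ} (hK : 0 ≤ K) (hκ : 1 ≤ κ)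
    (hp : 2 * κ + 2 ≤ p) (hl : ∀ v, ‖l v‖ ≤ K * jap v ^ κ) (v w : V3) :
    ‖NN γ l v w‖ ≤ ((4 * jap v + 4 * K * jap v ^ al)) * jap w ^ p := by
  have h0 := wtn (γ := γ) zero_le_one aa
  have h1 := wt_one_le hγ.2.le aa
  refine (norm_NN_le l v w).trans ?_
  have hz : ab ≤ 2 * (jap v * jap w) := (nlj _).trans (peetre v w)
  have a1 : wt γ 1 aa * ab ≤ 2 * (jap v * jap w) := by nlinarith [norm_nonneg aa]
  have a2 : jap w ≤ jap w ^ p := by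
    have := jpm w (show (1:ℝ) ≤ p by linarith)
    rwa [rpow_one] at this
  have a3 : wt γ 1 aa * ab ^ 2 * ‖l w‖ ≤ 4 * fg * (K * jap w ^ κ) :=
    mul_le_mul (wtS_le hγ v w) (hl w) (norm_nonneg _)
      (mul_nonneg bs (mul_nonneg (jpp _ _).le (jpp _ _).le))
  have a4 : jap w ^ af * jap w ^ κ ≤ jap w ^ p := by
    rw [← rpow_add (jap_pos w)]; exact jpm w ac
  have a5 : 4 * fg * (K * jap w ^ κ) ≤ 4 * K * jap v ^ al * jap w ^ p := by
    have : 0 ≤ 4 * K * jap v ^ af := mul_nonneg pv (jpp _ _).le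
    nlinarith [mll a4 this]
  nlinarith [mll a2 (jap_pos v).le]
def PP (f : V3 → ℝ) (Y l : V3 → V3) (v : V3) : V3 := al • Y v - √ak • l v
lemma wt_Sb_int {γ : ℝ} (hγ : γ ∈ Ico ct 0) {f : V3 → ℝ} {p : ℝ} (hf : Measurable f)
    (hnn : ∀ v, 0 ≤ f v) (hp2 : 2 ≤ p) (hm : Integrable bb) (v ξ : V3) :
    Integrable (fun w => f w * aw) := by
  have hz : Measurable (fun w : V3 => v - w) := measurable_const.sub measurable_id
  refine dom_int (C := 4 * jap v ^ af * ‖ξ‖ ^ 2) hf hnn hm (Φ := fun w => wt γ 1 aa * Sb aa ξ ξ)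
    (((mwt γ 1).comp hz).mul (mSb hz measurable_const measurable_const)) fun w => ?_
  have h0 := wtn (γ := γ) zero_le_one aa
  rw [norm_of_nonneg (mul_nonneg h0 (Sbn _ _))]
  have h1 := mll (Sb_le aa ξ) h0
  have h2 := mlr (wtS_le hγ v w) (sq_nonneg ‖ξ‖)
  have h3 : 4 * fg * ‖ξ‖ ^ 2 ≤ 4 * jap v ^ af * ‖ξ‖ ^ 2 * jap w ^ p := by
    have : 0 ≤ 4 * jap v ^ af * ‖ξ‖ ^ 2 := by have := (jpp v 2).le; positivity
    nlinarith [mll (jpm w hp2) this]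
  linarith
lemma fisher_pt {γ E Hb : ℝ} (hγ : γ ∈ Ico ct 0) {f : V3 → ℝ} {Y : V3 → V3}
    (S : Stat γ E Hb f Y) {l : V3 → V3} (hlm : Measurable l) {K κ p c₀ : ℝ} (hK : 0 ≤ K) (hκ : 1 ≤ κ)
    (hp : 2 * κ + 2 ≤ p) (hl : ∀ v, ‖l v‖ ≤ K * jap v ^ κ)
    (hm : Integrable bb) (hc : 0 < c₀)
    (hell : ∀ v ξ, c₀ * jap v ^ γ * ‖ξ‖ ^ 2 ≤ ∫ w, f w * aw)
    (hX : Integrable (fun q : V3 × V3 => wt γ 1 cj *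
      Sb cj (wv f (PP f Y l) q.1 q.2) (wv f (PP f Y l) q.1 q.2))) :
    ∀ᵐ v, c₀ * jap v ^ γ * ‖PP f Y l v‖ ^ 2 ≤
      4 / c₀ * (f v * jap v ^ ap * ‖∫ w, f w • NN γ l v w‖ ^ 2) +
      2 * ∫ w, wt γ 1 aa * Sb aa (wv f (PP f Y l) v w) (wv f (PP f Y l) v w) := by
  have hfm := S.dens.meas
  have hnn := S.dens.nn
  set P := PP f Y l with hP
  have hPm : Measurable P := (S.Ym.const_smul af).sub (hfm.sqrt.smul hlm)
  filter_upwards [hX.prod_right_ae] with v hv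
  set ξ := P v with hξ
  set d := ∫ w, wt γ 1 aa * Sb aa bd bd with hd
  have hw0 : ∀ w, 0 ≤ wt γ 1 aa := fun w => wtn zero_le_one _
  have hd0 : 0 ≤ d := integral_nonneg fun w => mul_nonneg (hw0 w) (Sbn _ _)
  have hA := wt_Sb_int hγ hfm hnn (by linarith : 2 ≤ p) hm v ξ
  have hj := jpp v γ
  have hjn : jap v ^ ap = (jap v ^ γ)⁻¹ := rpow_neg (jap_pos v).le γ
  have hz : Measurable (fun w : V3 => v - w) := measurable_const.sub measurable_id
  have hwm : Measurable (fun w => wt γ 1 aa) := (mwt γ 1).comp hz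
  rcases (hnn v).eq_or_lt with h0 | hpos
  · have e : ∀ w, wt γ 1 aa * Sb aa bd bd
        = f w * aw := fun w => by
      have : wv f P v w = √de • ξ := by simp [wv, ← h0, hξ]
      rw [this, Sb_smul_left, Sb_smul_right, ← mul_assoc (√de), mul_self_sqrt (hnn w)]; ring
    have := hell v ξ
    simp only [← e] at this
    have hpos : 0 ≤ 4 / c₀ * (f v * jap v ^ ap * ‖∫ w, f w • NN γ l v w‖ ^ 2) := by
      rw [← h0]; simp
    linarith
  · have hs : 0 < √ak := sqrt_pos.2 hpos
    have emix : ∀ w, √ak * (wt γ 1 aa * Sb aa ξ (√de • P w)) =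
        f w * aw -
          wt γ 1 aa * Sb aa be bd := fun w => by
      simp only [wv, Sb_sub_right, Sb_smul_left, Sb_smul_right, ← hξ]
      have := mul_self_sqrt (hnn w)
      linear_combination aw * this
    have esq : ∀ w, Sb aa be be = f w * Sb aa ξ ξ := fun w => by
      rw [Sb_smul_left, Sb_smul_right, ← mul_assoc, mul_self_sqrt (hnn w)]
    have hyoung : ∀ w, |wt γ 1 aa * Sb aa be bd| ≤
        1 / 2 * (f w * aw) +
        1 / 2 * (wt γ 1 aa * Sb aa bd bd) := fun w => by
      rw [abs_mul, abs_of_nonneg (hw0 w)]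
      have h1 := Sb_young aa be bd
      have h2 := Sb_young aa be (-wv f P v w)
      have e1 : Sb aa be (-wv f P v w) = - Sb aa be bd := by
        rw [← neg_one_smul ℝ, Sb_smul_right]; ring
      have e2 : Sb aa (-wv f P v w) (-wv f P v w) = Sb aa bd bd := by
        rw [← neg_one_smul ℝ, Sb_smul_right, Sb_smul_left]; ring
      rw [e1, e2] at h2
      rw [esq] at h1 h2
      have := abs_le.2 ⟨by linarith, h1⟩
      nlinarith [mll this (hw0 w)]
    have hwvm : Measurable (fun w => wv f P v w) :=
      (measurable_wv hfm hPm).comp (measurable_const.prodMk measurable_id)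
    have hmixm : Measurable (fun w => wt γ 1 aa * Sb aa be bd) :=
      hwm.mul (mSb hz (hfm.sqrt.smul measurable_const) hwvm)
    have imix : Integrable (fun w => wt γ 1 aa * Sb aa be bd) :=
      ((hA.const_mul (1/2)).add (hv.const_mul (1/2))).mono' hmixm.aestronglyMeasurable
        (aeo fun w => by simpa using hyoung w)
    have iP : Integrable (fun w => wt γ 1 aa * Sb aa ξ (√de • P w)) := by
      have := ((hA.sub imix).const_mul (√ak)⁻¹)
      refine this.congr (aeo fun w => ?_)
      simp only [Pi.sub_apply]
      rw [← emix w]; field_simp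
    have hN : Integrable (fun w => f w • NN γ l v w) :=
      dom_int hfm hnn hm (measurable_NN_right hlm v)
        (NN_dom hγ hK hκ hp hl v)
    have hN0 : Integrable (fun w => f w • NN γ (fun _ => 0) v w) :=
      dom_int hfm hnn hm (measurable_NN_right measurable_const v)
        (NN_dom hγ hK hκ hp (by intro v; simpa using mul_nonneg hK (jpp v κ).le) v)
    have eN : ∀ w, ⟪ξ, f w • NN γ l v w⟫ = f w * (2 * (wt γ 1 aa * ⟪v - w, ξ⟫)) +
        f w * dc := fun w => by
      simp only [NN, real_inner_smul_right, inner_add_right, inner_So, real_inner_comm ξ aa]; ring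
    have eN0 : ∀ w, ⟪ξ, f w • NN γ (fun _ => 0) v w⟫ = f w * (2 * (wt γ 1 aa * ⟪v - w, ξ⟫)) := fun w => by
      have : So aa 0 = 0 := by simp [So]
      simp only [NN, real_inner_smul_right, inner_add_right, this, smul_zero, inner_zero_right, real_inner_comm ξ aa]; ring
    have i1 := hN.const_inner (𝕜 := ℝ) ξ
    have i10 := hN0.const_inner (𝕜 := ℝ) ξ
    have il : Integrable (fun w => f w * dc) := by
      refine (i1.sub i10).congr (aeo fun w => ?_)
      simp only [Pi.sub_apply, eN, eN0]; ring
    have ediv : ∀ w, f w * dvg (fun w => wt γ 1 aa • So aa ξ) w = ⟪ξ, f w • NN γ (fun _ => 0) v w⟫ := fun w => by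
      rw [dvg_kernel' one_pos, eN0]
    have eV : ∀ w, ⟪(2 * √de) • Y w, wt γ 1 aa • So aa ξ⟫ =
        wt γ 1 aa * Sb aa ξ (√de • P w) + f w * dc := fun w => by
      rw [real_inner_smul_right, inner_So, Sb_comm]
      simp only [hP, PP, Sb_sub_right, Sb_smul_right]
      have := mul_self_sqrt (hnn w)
      linear_combination dc * this
    have hibp := (S.wgf hγ).ibp (Φ := fun w => wt γ 1 aa • So aa ξ)
      (((wt_contDiff one_pos).comp df).smul
        (So_contDiff df contDiff_const))
      (by simp only [eV]; exact iP.add il) (by simp only [ediv]; exact i10)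
      (by
        refine dom_int (C := 4 * jap v ^ af * ‖ξ‖) hfm hnn hm (hwm.smul (measurable_So hz measurable_const)) fun w => ?_
        rw [norm_smul, norm_of_nonneg (hw0 w)]
        have h1 := mll (norm_So_le aa ξ) (hw0 w)
        have h2 := mlr (wtS_le hγ v w) (norm_nonneg ξ)
        have h3 : 4 * fg * ‖ξ‖ ≤ 4 * jap v ^ af * ‖ξ‖ * jap w ^ p := by
          have : 0 ≤ 4 * jap v ^ af * ‖ξ‖ := by have := (jpp v 2).le; positivity
          nlinarith [mll (jpm w (by linarith : af ≤ p)) this]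
        linarith)
    simp only [eV, ediv] at hibp
    rw [integral_add iP il] at hibp
    have hNN : ⟪ξ, ∫ w, f w • NN γ l v w⟫ = (∫ w, ⟪ξ, f w • NN γ (fun _ => 0) v w⟫) +
        ∫ w, f w * dc := by
      rw [← integral_inner hN, ← integral_add i10 il]
      congr 1; ext w; rw [eN, eN0]
    have hPint : (∫ w, wt γ 1 aa * Sb aa ξ (√de • P w)) = - ⟪ξ, ∫ w, f w • NN γ l v w⟫ := by
      rw [hNN]; linarith
    have hI : √ak * (∫ w, wt γ 1 aa * Sb aa ξ (√de • P w)) =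
        (∫ w, f w * aw) -
          ∫ w, wt γ 1 aa * Sb aa be bd := by
      rw [← integral_const_mul, ← integral_sub hA imix]
      congr 1; ext w; exact emix w
    have hle : (∫ w, wt γ 1 aa * Sb aa be bd) ≤
        1 / 2 * (∫ w, f w * aw) + 1 / 2 * d := by
      rw [hd, ← integral_const_mul, ← integral_const_mul, ← integral_add (hA.const_mul _) (hv.const_mul _)]
      exact integral_mono imix ((hA.const_mul _).add (hv.const_mul _)) fun w => (le_abs_self _).trans (hyoung w)
    set N := ∫ w, f w • NN γ l v w with hNdef
    have hcs : - ⟪ξ, N⟫ ≤ ‖ξ‖ * ‖N‖ := by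
      have := abs_real_inner_le_norm ξ N
      linarith [neg_abs_le ⟪ξ, N⟫]
    rw [hPint] at hI
    have hell' := hell v ξ
    have key : √ak * (‖ξ‖ * ‖N‖) ≤ c₀ / 4 * jap v ^ γ * ‖ξ‖ ^ 2 + 1 / c₀ * (f v * jap v ^ ap * ‖N‖ ^ 2) := by
      rw [hjn]
      have hsq := sq_sqrt (hnn v)
      have : 0 ≤ (c₀ * jap v ^ γ * ‖ξ‖ / 2 - √ak * ‖N‖) ^ 2 / (c₀ * jap v ^ γ) := by positivity
      have e : (c₀ * jap v ^ γ * ‖ξ‖ / 2 - √ak * ‖N‖) ^ 2 / (c₀ * jap v ^ γ) =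
        c₀ / 4 * jap v ^ γ * ‖ξ‖ ^ 2 + 1 / c₀ * (√ak ^ 2 * (jap v ^ γ)⁻¹ * ‖N‖ ^ 2) - √ak * (‖ξ‖ * ‖N‖) := by
        field_simp; ring
      rw [e, hsq] at this; linarith
    have := mll hcs hs.le
    have e4 : 4 / c₀ * (f v * jap v ^ ap * ‖N‖ ^ 2) = 4 * (1 / c₀ * (f v * jap v ^ ap * ‖N‖ ^ 2)) := by ring
    rw [e4]
    nlinarith
structure Par (γ κ ζ ν p : ℝ) : Prop where
  hγ : γ ∈ Ico ct 0
  hκ : 1 ≤ κ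
  hζ : 0 ≤ ζ
  hν : 1 ≤ ν
  p1 : 2 * κ - γ ≤ p
  p2 : 2 * κ + γ + 4 ≤ p
  p3 : 2 * ζ - γ ≤ p
  p4 : ν - γ ≤ p
lemma Par.p0 {γ κ ζ ν p : ℝ} (h : Par γ κ ζ ν p) : 2 * κ + 2 ≤ p := by linarith [h.p1, h.p2]
lemma grad_contDiff {φ : V3 → ℝ} (h : ContDiff ℝ 2 φ) : ContDiff ℝ 1 (gradient φ) := by
  have h1 : ContDiff ℝ 1 (fderiv ℝ φ) := h.fderiv_right bs
  exact ((InnerProductSpace.toDual ℝ V3).symm.toContinuousLinearEquiv.contDiff).comp h1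
lemma inner_fderiv_grad {φ : V3 → ℝ} (h : ContDiff ℝ 2 φ) (v x y : V3) :
    ⟪fderiv ℝ (gradient φ) v x, y⟫ = fderiv ℝ (fderiv ℝ φ) v x y := by
  have h1 : DifferentiableAt ℝ (fderiv ℝ φ) v :=
    (h.fderiv_right (m := 1) bs).differentiable one_ne_zero v
  have h2 : DifferentiableAt ℝ (gradient φ) v := (grad_contDiff h).differentiable one_ne_zero v
  have e1 := (h2.hasFDerivAt.inner ℝ (hasFDerivAt_const y v)).fderiv
  have e2 := (h1.hasFDerivAt.clm_apply (hasFDerivAt_const y v)).fderiv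
  have e : (fun w => ⟪gradient φ w, y⟫) = fun w => fderiv ℝ φ w y := by
    ext w; exact inner_gradient_left
  rw [e, e2] at e1
  have := congrArg (fun T => T x) e1
  simp at this
  exact this.symm
lemma hess_eq {φ : V3 → ℝ} (h : ContDiff ℝ 2 φ) (v : V3) (i j : Fin 3) :
    hess φ v i j = (fderiv ℝ (gradient φ) v az) j := by
  rw [← inner_esingle, inner_fderiv_grad h]
  simp [hess, iteratedFDeriv_two_apply]
lemma norm_fderiv_grad_le {φ : V3 → ℝ} (h : ContDiff ℝ 2 φ) (v : V3) :
    ‖fderiv ℝ (gradient φ) v‖ ≤ matNorm (hess φ v) := by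
  refine ContinuousLinearMap.opNorm_le_bound _ (sqrt_nonneg _) fun x => ?_
  have e : fderiv ℝ (gradient φ) v x = ∑ i, x i • fderiv ℝ (gradient φ) v az := by
    conv_lhs => rw [show x = ∑ i, x i • esingle i by
      ext j; simp [esingle, Pi.single_apply]]
    simp
  have e2 : ∀ j, (fderiv ℝ (gradient φ) v x) j = ∑ i, x i * hess φ v i j := fun j => by
    rw [e]; simp [hess_eq h]
  have e3 : matNorm (hess φ v) * ‖x‖ = √((∑ i, ∑ j, (hess φ v i j) ^ 2) * ∑ i, ‖x i‖ ^ 2) := by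
    rw [matNorm, EuclideanSpace.norm_eq x, sqrt_mul]
    exact Finset.sum_nonneg fun i _ => Finset.sum_nonneg fun j _ => sq_nonneg _
  rw [e3, EuclideanSpace.norm_eq]
  refine sqrt_le_sqrt ?_
  rw [Finset.sum_comm, Finset.sum_mul]
  refine Finset.sum_le_sum fun j _ => ?_
  rw [norm_eq_abs, sq_abs, e2, mul_comm]
  simp only [norm_eq_abs, sq_abs]
  exact Finset.sum_mul_sq_le_sq_mul_sq _ _ _
structure GS (γ κ ζ ν p K1 K2 K3 : ℝ) (g q : V3 → ℝ) : Prop where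
  par : Par γ κ ζ ν p
  pos : ∀ v, 0 < g v
  c2 : ContDiff ℝ 2 g
  K1n : 0 ≤ K1
  K2n : 0 ≤ K2
  K3n : 0 ≤ K3
  lb : ∀ v, ‖logGrad g v‖ ≤ K1 * jap v ^ κ
  Lb : ∀ v, matNorm (logHess g v) ≤ K3 * jap v ^ ζ
  mom : Integrable (fun v => jap v ^ p * g v)
  qb : ∀ v, |q v| ≤ K2 * jap v ^ ν
  eq : ∀ v, q v * g v = matDot (abar γ g v) (hess g v) + cbar γ g v * g v
namespace GS
variable {γ κ ζ ν p K1 K2 K3 : ℝ} {g q : V3 → ℝ}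
local notation "𝔾" => GS γ κ ζ ν p K1 K2 K3 g q
lemma logC2 (G : 𝔾) : ContDiff ℝ 2 (fun w => log (g w)) :=
  G.c2.log fun v => (G.pos v).ne'
lemma lC1 (G : 𝔾) : ContDiff ℝ 1 lg := grad_contDiff G.logC2
lemma gradg (G : 𝔾) (v : V3) : gradient g v = g v • logGrad g v := by
  refine ext_inner_right ℝ fun y => ?_
  have hd : DifferentiableAt ℝ g v := G.c2.differentiable two_ne_zero v
  rw [inner_gradient_left, real_inner_smul_left, logGrad, inner_gradient_left]
  have := (hd.hasFDerivAt.log (G.pos v).ne').fderiv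
  rw [this]
  have := (G.pos v).ne'
  simp [smul_eq_mul]
  field_simp
lemma fderivg (G : 𝔾) (v e : V3) : fderiv ℝ g v e = ⟪g v • logGrad g v, e⟫ := by
  rw [← G.gradg, inner_gradient_left]
lemma hessg (G : 𝔾) (v : V3) (i j : Fin 3) :
    hess g v i j = g v * ((fderiv ℝ lg v az) j + logGrad g v i * logGrad g v j) := by
  rw [hess_eq G.c2]
  have hd : DifferentiableAt ℝ g v := G.c2.differentiable two_ne_zero v
  have hl : DifferentiableAt ℝ lg v := G.lC1.differentiable one_ne_zero v
  have e : gradient g = fun v => g v • logGrad g v := by ext1 v; exact G.gradg v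
  have e2 : fderiv ℝ (fun v => g v • logGrad g v) v = _ := (hd.hasFDerivAt.smul hl.hasFDerivAt).fderiv
  rw [e, e2]
  simp [G.fderivg, real_inner_smul_left, inner_esingle]
  ring
lemma lip (G : 𝔾) (v w : V3) :
    dn ≤ K3 * ab * mx v w ^ ζ := by
  set r := max ‖v‖ ‖w‖
  have hb : ∀ x ∈ Metric.closedBall ar r, ‖fderiv ℝ lg x‖ ≤ K3 * mx v w ^ ζ := fun x hx => by
    refine ((norm_fderiv_grad_le G.logC2 x).trans (G.Lb x)).trans ?_
    refine mll ?_ G.K3n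
    refine rpow_le_rpow (jap_pos x).le ?_ G.par.hζ
    rw [mem_closedBall_zero_iff] at hx
    rcases le_max_iff.1 hx with h | h
    · refine le_max_of_le_left (sqrt_le_sqrt ?_); gcongr
    · refine le_max_of_le_right (sqrt_le_sqrt ?_); gcongr
  have := (convex_closedBall ar r).norm_image_sub_le_of_norm_fderiv_le
    (fun x _ => G.lC1.differentiable one_ne_zero x) hb
    (x := w) (y := v) (by simp [r]) (by simp [r])
  linarith
lemma ub (G : 𝔾) (v w : V3) :
    dn ≤ (2 * K1) * mx v w ^ κ := by
  have hk : 0 ≤ κ := by linarith [G.par.hκ]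
  have h1 := (G.lb v).trans (mll (rpow_le_rpow (jap_pos v).le (jap_le_mx v w) hk) G.K1n)
  have h2 := (G.lb w).trans (mll (rpow_le_rpow (jap_pos w).le (jap_le_mx' v w) hk) G.K1n)
  linarith [norm_sub_le fa eg]
lemma kb (G : 𝔾) {v w : V3} (hvw : v - w ≠ 0) :
    mx v w ^ bu * (wt γ 0 aa * ab ^ 2 * dn) ≤ 4 * ad * mx v w ^ bc ∧
    wt γ 0 aa * ab ^ 2 * dn ^ 2 ≤ 4 * bp * mx v w ^ p := by
  have := kb_aux G.par.hγ G.par.hκ G.par.hζ G.par.p1 G.par.p2 G.par.p3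
    (mul_nonneg two_pos.le G.K1n) G.K3n hvw (G.ub v w) (G.lip v w)
  rwa [rpow_add_two_eq (norm_pos_iff.2 hvw), ← wt_zero] at this
lemma gcont (G : 𝔾) : Continuous g := G.c2.continuous
lemma lcont (G : 𝔾) : Continuous lg := G.lC1.continuous
lemma wg (G : 𝔾) : WG g (fun v => g v • logGrad g v) := by
  refine ⟨G.gcont.locallyIntegrable, (G.gcont.smul G.lcont).locallyIntegrable, fun φ hφ hc e => ?_⟩
  have hφ1 : ContDiff ℝ 1 φ := hφ.of_le (by exact_mod_cast le_top)
  have hcd := hφ1.continuous_fderiv one_ne_zero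
  have hdc : HasCompactSupport dz := hc.fderiv_apply (𝕜 := ℝ) e
  have c1 : Continuous (fun v => fderiv ℝ g v e) :=
    ((G.c2.continuous_fderiv two_ne_zero).clm_apply continuous_const)
  rw [integral_mul_fderiv_eq_neg_fderiv_mul_of_integrable
    ((c1.mul hφ1.continuous).integrable_of_hasCompactSupport hc.mul_left)
    ((G.gcont.mul (hcd.clm_apply continuous_const)).integrable_of_hasCompactSupport hdc.mul_left)
    ((G.gcont.mul hφ1.continuous).integrable_of_hasCompactSupport hc.mul_left)
    (fun x _ => G.c2.differentiable two_ne_zero x) (fun x _ => hφ1.differentiable one_ne_zero x)]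
  simp only [G.fderivg]
lemma momle {f : V3 → ℝ} (hf : Measurable f) (hnn : ∀ v, 0 ≤ f v) {p a : ℝ} (hm : Integrable bb)
    (ha : a ≤ p) : Integrable (fun v => jap v ^ a * f v) := by
  have := dom_int (C := 1) hf hnn hm (Φ := fun v => jap v ^ a) (continuous_jap_rpow a).measurable
    (fun w => by rw [norm_of_nonneg (jpp w a).le, one_mul]; exact jpm w ha)
  exact this.congr (aeo fun v => by simp [mul_comm])
end GS
def hloc (a : ℝ) (z : V3) : ℝ := (Metric.ball ar 1).indicator (fun z => ‖z‖ ^ a) z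
lemma hloc_int {a : ℝ} (ha : -3 < a) : Integrable (hloc a) := by
  unfold hloc
  rw [integrable_indicator_iff Metric.isOpen_ball.measurableSet]
  refine (integrableOn_fun_norm_addHaar (volume : Measure V3) (f := fun r : ℝ => r ^ a)).2 ?_
  have h1 := (intervalIntegral.intervalIntegrable_rpow' (a := 0) (b := 1) (r := a + 2) ac).1
  refine (h1.mono_set Set.Ioo_subset_Ioc_self).congr_fun (fun y hy => ?_) measurableSet_Ioo
  simp only [finrank_euclideanSpace, Fintype.card_fin, smul_eq_mul]
  rw [rpow_add hy.1, mul_comm]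
  norm_num
lemma sing_pt {a : ℝ} (ha2 : a ≤ 2) {G : V3 → ℝ} (hnn : ∀ v, 0 ≤ G v) {M : ℝ} {v : V3}
    (hM : ∀ w, ab < 1 → G w ≤ M) (w : V3) :
    ab ^ a * G w ≤ M * hloc a aa + 4 * jap v ^ af * (jap w ^ af * G w) := by
  have hj : 0 ≤ 4 * jap v ^ af * (jap w ^ af * G w) := by
    have := jpp v 2; have := jpp w 2; have := hnn w; positivity
  by_cases h : ab < 1
  · have e : hloc a aa = ab ^ a := Set.indicator_of_mem (by simpa using h) _
    rw [e]
    nlinarith [hM w h, rpow_nonneg (norm_nonneg aa) a]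
  · have e : hloc a aa = 0 := Set.indicator_of_notMem (by simpa using h) _
    rw [e, mul_zero, zero_add]
    have h1 : ab ^ a ≤ ab ^ af := rpow_le_rpow_of_exponent_le (not_lt.1 h) ha2
    have h2 : ab ^ af ≤ 4 * jap v ^ af * jap w ^ af := by
      have := (nlj _).trans (peetre v w)
      calc ab ^ af ≤ (2 * (jap v * jap w)) ^ af := rpow_le_rpow (norm_nonneg _) this bs
        _ = _ := by simp only [rpow_two]; ring
    nlinarith [mlr (h1.trans h2) (hnn w)]
lemma sing {a : ℝ} (ha : -3 < a) (ha2 : a ≤ 2) {G : V3 → ℝ} (hc : Continuous G) (hnn : ∀ v, 0 ≤ G v)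
    (hG : Integrable (fun v => jap v ^ af * G v)) (R : ℝ) :
    (∀ v, ‖v‖ ≤ R → Integrable (fun w => ab ^ a * G w)) ∧
    ∃ C, ∀ v, ‖v‖ ≤ R → (∫ w, ab ^ a * G w) ≤ C := by
  obtain ⟨M, hM⟩ := (isCompact_closedBall ar (R + 1)).bddAbove_image hc.continuousOn
  have hM' : ∀ v, ‖v‖ ≤ R → ∀ w, ab < 1 → G w ≤ M := fun v hv w hw => by
    refine hM (Set.mem_image_of_mem _ ?_)
    rw [mem_closedBall_zero_iff]
    have := norm_sub_norm_le w v
    rw [norm_sub_rev] at this; linarith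
  have hi : ∀ v : V3, Integrable (fun w => M * hloc a aa + 4 * jap v ^ af * (jap w ^ af * G w)) := fun v =>
    (((hloc_int ha).comp_sub_left v).const_mul M).add (hG.const_mul _)
  have hint : ∀ v, ‖v‖ ≤ R → Integrable (fun w => ab ^ a * G w) := fun v hv => by
    refine (hi v).mono' ((((measurable_const.sub measurable_id).norm.pow_const a).mul hc.measurable).aestronglyMeasurable)
      (aeo fun w => ?_)
    rw [norm_of_nonneg (mul_nonneg (rpow_nonneg (norm_nonneg _) _) (hnn w))]
    exact sing_pt ha2 hnn (hM' v hv) w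
  refine ⟨hint, M * (∫ z, hloc a z) + 4 * (1 + R ^ 2) * ∫ w, jap w ^ af * G w, fun v hv => ?_⟩
  refine (integral_mono (hint v hv) (hi v) fun w => sing_pt ha2 hnn (hM' v hv) w).trans ?_
  rw [integral_add (((hloc_int ha).comp_sub_left v).const_mul M) (hG.const_mul _),
    integral_const_mul, integral_const_mul, integral_sub_left_eq_self (hloc a)]
  have h0 : 0 ≤ ∫ w, jap w ^ af * G w := integral_nonneg fun w => mul_nonneg (jpp w 2).le (hnn w)
  have : jap v ^ af ≤ 1 + R ^ 2 := by
    rw [rpow_two, jap_sq]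
    have := norm_nonneg v
    nlinarith
  gcongr
lemma dvg_z {γ ε : ℝ} (hε : 0 < ε) (v w : V3) :
    dvg (fun w => wt γ ε aa • aa) w =
      - bg := by
  have hsub : HasFDerivAt (fun w : V3 => v - w) (-(ContinuousLinearMap.id ℝ V3)) w :=
    (hasFDerivAt_id w).const_sub v
  have h1 : HasFDerivAt (fun w => wt γ ε aa) _ w :=
    (wt_hasFDerivAt (γ := γ) hε aa).comp w hsub
  rw [dvg_smul h1.differentiableAt hsub.differentiableAt, h1.fderiv]
  unfold dvg
  rw [hsub.fderiv]
  have e5 : ∀ i : Fin 3, az i = 1 := fun i => by simp [esingle]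
  have hw : wt γ ε aa = (ε + ab ^ 2) ^ ax * (ε + ab ^ 2) := by
    have hp : 0 < ε + ab ^ 2 := by positivity
    rw [← rpow_add_one hp.ne']; unfold wt; congr 1; ring
  simp only [ContinuousLinearMap.comp_apply, _root_.smul_apply, _root_.neg_apply, ContinuousLinearMap.id_apply,
    innerSL_apply_apply, inner_neg_right, real_inner_self_eq_norm_sq, PiLp.neg_apply, e5, smul_eq_mul]
  rw [Fin.sum_univ_three, hw]
  ring
def epn (n : ℕ) : ℝ := (ag ^ 2)⁻¹
lemma epn_pos (n : ℕ) : 0 < epn n := by unfold epn; positivity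
lemma epn_tendsto : Tendsto epn atTop (nhds 0) := by
  have := (tendsto_one_div_add_atTop_nhds_zero_nat (𝕜 := ℝ)).pow 2
  simp only [ne_eq, OfNat.ofNat_ne_zero, not_false_eq_true, zero_pow] at this
  refine this.congr fun n => ?_
  simp [epn]
lemma wt_tendsto (γ : ℝ) {z : V3} (hz : z ≠ 0) :
    Tendsto (fun n => wt γ (epn n) z) atTop (nhds (wt γ 0 z)) := by
  have hp : 0 + ‖z‖ ^ 2 ≠ 0 := by have := norm_pos_iff.2 hz; positivity
  exact (epn_tendsto.add_const (‖z‖ ^ 2)).rpow_const (Or.inl hp)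
lemma wt_zero_mul (γ : ℝ) {z : V3} (hz : z ≠ 0) (k : ℝ) : ‖z‖ ^ (γ + k) = wt γ 0 z * ‖z‖ ^ k := by
  rw [wt_zero, rpow_add (norm_pos_iff.2 hz)]
lemma coulomb_mass : Integrable (fun x : V3 => 3 / br * fc ^ aj) ∧
    (∫ x : V3, 3 / br * fc ^ aj) = 1 := by
  set F : ℝ → ℝ := fun r => (r ^ 2 / ay) ^ ((3:ℝ) / 2) with hF
  have hder : ∀ r ∈ Set.Ioi cu, HasDerivAt F (3 * (r ^ 2 * ay ^ aj)) r := by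
    intro r (hr : 0 < r)
    have hq : 0 < 1 + r ^ 2 := by positivity
    have h1 : HasDerivAt (fun r : ℝ => r ^ 2 / ay) ((2 * r * ay - r ^ 2 * (2 * r)) / ay ^ 2) r := by
      have := (hasDerivAt_pow 2 r).div ((hasDerivAt_pow 2 r).const_add 1) hq.ne'
      simp only [Nat.cast_ofNat, Nat.add_one_sub_one, pow_one] at this
      exact this
    have h2 := h1.rpow_const (p := (3:ℝ)/2) (Or.inl pv)
    convert h2 using 1
    have e1 : (r ^ 2 / ay) ^ ((3:ℝ) / 2 - 1) = r * ay ^ (-(1:ℝ) / 2) := by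
      rw [div_rpow pv hq.le, ← rpow_natCast r 2, ← rpow_mul hr.le]
      norm_num
      rw [div_eq_mul_inv, ← rpow_neg hq.le]
    have e2 : ay ^ aj = ay ^ (-(1:ℝ) / 2) / ay ^ 2 := by
      rw [← rpow_natCast ay 2, ← rpow_sub hq]; norm_num
    rw [e1, e2]; field_simp; ring
  have hcont : ContinuousWithinAt F (Set.Ici 0) 0 := by
    have hc : Continuous F := by
      refine Continuous.rpow_const (Continuous.div (by fun_prop) (by fun_prop) fun x => by positivity) fun x => Or.inr bs
    exact hc.continuousWithinAt
  have hlim : Tendsto F atTop (nhds 1) := by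
    have h1 : Tendsto (fun r : ℝ => r ^ 2 / ay) atTop (nhds 1) := by
      have h2 : Tendsto (fun r : ℝ => 1 - ay⁻¹) atTop (nhds (1 - 0)) :=
        tendsto_const_nhds.sub (tendsto_inv_atTop_zero.comp
          (Filter.tendsto_atTop_add_const_left _ _ (Filter.tendsto_pow_atTop two_ne_zero)))
      rw [sub_zero] at h2
      refine h2.congr fun r => ?_
      have : 1 + r ^ 2 ≠ 0 := by positivity
      field_simp; ring
    have := h1.rpow_const (p := (3:ℝ)/2) (Or.inl one_ne_zero)
    simpa using this
  have hnn : ∀ r ∈ Set.Ioi cu, 0 ≤ 3 * (r ^ 2 * ay ^ aj) := fun r _ => by positivity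
  have hint := integrableOn_Ioi_deriv_of_nonneg hcont hder hnn hlim
  have hval := integral_Ioi_of_hasDerivAt_of_nonneg hcont hder hnn hlim
  have hF0 : F 0 = 0 := by simp [hF]
  rw [hF0, sub_zero] at hval
  have hi : Integrable (fun x : V3 => (fun r : ℝ => 3 / br * ay ^ aj) ‖x‖) := by
    refine (integrable_fun_norm_addHaar (volume : Measure V3) (f := fun r : ℝ => 3 / br * ay ^ aj)).2 ?_
    refine IntegrableOn.congr_fun (f := fun r => 1 / br * (3 * (r ^ 2 * ay ^ aj))) (hint.const_mul (1 / br)) (fun r _ => ?_) measurableSet_Ioi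
    simp only [finrank_euclideanSpace, Fintype.card_fin, smul_eq_mul]
    norm_num; ring
  refine ⟨hi, ?_⟩
  have := integral_fun_norm_addHaar (volume : Measure V3) (fun r : ℝ => 3 / br * ay ^ aj)
  rw [this]
  simp only [finrank_euclideanSpace, Fintype.card_fin, smul_eq_mul, nsmul_eq_mul]
  have e : (∫ r in Set.Ioi cu, r ^ (3 - 1) * (3 / br * ay ^ aj)) = 1 / br := by
    have : (fun r : ℝ => r ^ (3 - 1) * (3 / br * ay ^ aj)) =
      fun r => 1 / br * (3 * (r ^ 2 * ay ^ aj)) := by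
      ext r; norm_num; ring
    rw [this, integral_const_mul, hval, mul_one]
  rw [e]
  have hb : (volume : Measure V3).real (Metric.ball 0 1) = 4 / 3 * π := by
    rw [Measure.real, EuclideanSpace.volume_ball_fin_three]
    have := pi_pos
    simp only [ENNReal.ofReal_one, one_pow, one_mul]
    rw [ENNReal.toReal_ofReal pv]; ring
  rw [hb]
  have := pi_pos.ne'
  field_simp
  norm_num
lemma wt_eps_le {γ ε : ℝ} (hγ : γ ≤ 0) (hε : 0 < ε) (z : V3) : wt γ ε z ≤ ε ^ ev := by
  unfold wt
  exact rpow_le_rpow_of_nonpos hε (by nlinarith [sq_nonneg ‖z‖]) ac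
lemma measurable_wt_sub (γ ε : ℝ) (v : V3) : Measurable (fun w : V3 => wt γ ε aa) :=
  (mwt γ ε).comp (measurable_const.sub measurable_id)
def trS (z : V3) (A : V3 →L[ℝ] V3) : ℝ := ∑ i, (So z (A az)) i
lemma abs_trS_le (z : V3) (A : V3 →L[ℝ] V3) : |trS z A| ≤ 3 * (‖z‖ ^ 2 * ‖A‖) := by
  have h : ∀ i, |(So z (A az)) i| ≤ ‖z‖ ^ 2 * ‖A‖ := fun i => by
    have h1 : ‖(So z (A az)) i‖ ≤ ‖So z (A az)‖ := PiLp.norm_apply_le _ i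
    rw [norm_eq_abs] at h1
    have h2 : ‖A az‖ ≤ ‖A‖ := by simpa [esingle] using A.le_opNorm az
    exact h1.trans ((norm_So_le _ _).trans (mll h2 (sq_nonneg _)))
  refine (Finset.abs_sum_le_sum_abs _ _).trans ((Finset.sum_le_sum fun i _ => h i).trans cz)
lemma continuous_trS {α : Type*} [TopologicalSpace α] {z : α → V3} {A : α → (V3 →L[ℝ] V3)} (hz : Continuous z)
    (hA : Continuous A) : Continuous (fun x => trS (z x) (A x)) := by
  unfold trS
  refine continuous_finsetSum _ fun i _ => ?_
  have h := continuous_So.comp (hz.prodMk (hA.clm_apply (continuous_const (y := esingle i))))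
  exact (EuclideanSpace.proj i : V3 →L[ℝ] ℝ).continuous.comp h
namespace GS
variable {γ κ ζ ν p K1 K2 K3 : ℝ} {g q : V3 → ℝ}
local notation "𝔾" => GS γ κ ζ ν p K1 K2 K3 g q
lemma di (G : 𝔾) {F : Type*} [NormedAddCommGroup F] [NormedSpace ℝ F] [MeasurableSpace F] [BorelSpace F]
    [SecondCountableTopology F] {Φ : V3 → F} (hΦ : Measurable Φ) {a C : ℝ} (ha : a ≤ p) (hC : 0 ≤ C)
    (hb : ∀ w, ‖Φ w‖ ≤ C * jap w ^ a) : Integrable (fun w => g w • Φ w) :=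
  dom_int G.gcont.measurable bk G.mom hΦ
    (fun w => (hb w).trans (mll (jpm w ha) hC))
lemma int0 (G : 𝔾) : Integrable g := by
  have := momle G.gcont.measurable bk G.mom
    (show cu ≤ p by linarith [G.par.p0, G.par.hκ])
  simpa using this
lemma lg_mom (G : 𝔾) : Continuous (fun w => fp * g w) ∧
    (∀ w, 0 ≤ fp * g w) ∧ Integrable (fun w => jap w ^ af * (fp * g w)) := by
  refine ⟨G.lcont.norm.mul G.gcont, fun w => mul_nonneg (norm_nonneg _) (G.pos w).le, ?_⟩
  have := G.di (Φ := fun w => jap w ^ af * fp) (a := 2 + κ) (C := K1)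
    ((continuous_jap_rpow 2).measurable.mul G.lcont.measurable.norm) (by linarith [G.par.p0, G.par.hκ]) G.K1n
    (fun w => by
      rw [norm_of_nonneg (mul_nonneg (jpp _ _).le (norm_nonneg _)), rpow_add (jap_pos w)]
      nlinarith [mll (G.lb w) (jpp w 2).le])
  exact this.congr (aeo fun w => by simp only [smul_eq_mul]; ring)
lemma g_mom2 (G : 𝔾) : Integrable (fun w => jap w ^ af * g w) :=
  momle G.gcont.measurable bk G.mom (by linarith [G.par.p0, G.par.hκ])
lemma i_z (G : 𝔾) {ε : ℝ} (hε : 0 ≤ ε) (v : V3) :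
    Integrable (fun w => g w * (wt γ ε aa * ⟪v - w, logGrad g w⟫)) := by
  obtain ⟨h1, h2, h3⟩ := G.lg_mom
  have hs := (sing (a := γ + 1) (by linarith [G.par.hγ.1]) (by linarith [G.par.hγ.2]) h1 h2 h3 ‖v‖).1 v le_rfl
  have hz : Measurable (fun w : V3 => v - w) := measurable_const.sub measurable_id
  refine hs.mono' (G.gcont.measurable.mul ((measurable_wt_sub γ ε v).mul (hz.inner G.lcont.measurable))).aestronglyMeasurable ?_
  filter_upwards [ae_sub_ne' v] with w hw
  rw [norm_eq_abs, abs_mul, abs_mul, abs_of_pos (G.pos w), abs_of_nonneg (wtn hε _), wt_zero_mul γ hw, rpow_one]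
  have a1 := wt_le G.par.hγ.2.le hε hw
  have a2 := abs_real_inner_le_norm aa eg
  have := mul_le_mul a1 a2 (abs_nonneg _) (wtn le_rfl _)
  nlinarith [mll this (G.pos w).le]
lemma ibp_z (G : 𝔾) {ε : ℝ} (hε : 0 < ε) (v : V3) :
    (∫ w, g w * (wt γ ε aa * ⟪v - w, logGrad g w⟫)) =
      ∫ w, g w * bg := by
  have hz : Measurable (fun w : V3 => v - w) := measurable_const.sub measurable_id
  have hγ0 := G.par.hγ.2.le
  have hp := G.par.p0
  have hκ := G.par.hκ
  have hzn : ∀ w, ab ≤ 2 * jap v * jap w := fun w => by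
    have := (nlj _).trans (peetre v w); linarith
  have e1 : ∀ w, ⟪g w • logGrad g w, wt γ ε aa • aa⟫ = g w * (wt γ ε aa * ⟪v - w, logGrad g w⟫) := fun w => by
    rw [real_inner_smul_left, real_inner_smul_right, real_inner_comm]
  have hw1 : ∀ w, ε * (ε + ab ^ 2) ^ ax ≤ ε ^ ev := fun w => by
    have : (ε + ab ^ 2) ^ ax ≤ ε ^ ax :=
      rpow_le_rpow_of_nonpos hε (by nlinarith [sq_nonneg ab]) ac
    calc _ ≤ ε * ε ^ ax := mll this hε.le
      _ = _ := by rw [mul_comm, ← rpow_add_one hε.ne']; congr 1; ring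
  have i2 : Integrable (fun w => g w * bg) := by
    refine G.di (Φ := fun w => bg) (a := 0)
      (C := 3 * ε ^ ev) ?_ ac pv fun w => ?_
    · exact ((measurable_wt_sub γ ε v).const_mul _).sub
        ((((((hz.norm.pow_const 2).const_add ε)).pow_const _).const_mul _).const_mul _)
    · have h1 := wtn (γ := γ) hε.le aa
      have h2 : 0 ≤ ε * (ε + ab ^ 2) ^ ax := by positivity
      have h3 := wt_eps_le hγ0 hε aa
      have h4 := hw1 w
      rw [rpow_zero, mul_one, norm_of_nonneg (by nlinarith [G.par.hγ.1])]
      nlinarith [G.par.hγ.1, G.par.hγ.2]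
  have i3 : Integrable (fun w => g w • (wt γ ε aa • aa)) := by
    refine G.di (a := 1) (C := ε ^ ev * (2 * jap v)) ((measurable_wt_sub γ ε v).smul hz) ac
      (by have := jap_pos v; positivity) fun w => ?_
    rw [norm_smul, norm_of_nonneg (wtn hε.le _), rpow_one, mul_assoc]
    exact mul_le_mul (wt_eps_le hγ0 hε _) (hzn w) (norm_nonneg _) pv
  have := G.wg.ibp (Φ := fun w => wt γ ε aa • aa)
    (((wt_contDiff hε).comp df).smul df)
    (by simp only [e1]; exact G.i_z hε.le v)
    (by simp only [dvg_z hε, mul_neg]; exact i2.neg) i3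
  simp only [e1, dvg_z hε, mul_neg, integral_neg, neg_neg] at this
  exact this
lemma lim_z (G : 𝔾) (v : V3) :
    Tendsto (fun n => ∫ w, g w * (wt γ (epn n) aa * ⟪v - w, logGrad g w⟫)) atTop
      (nhds (∫ w, g w * (wt γ 0 aa * ⟪v - w, logGrad g w⟫))) := by
  obtain ⟨h1, h2, h3⟩ := G.lg_mom
  have hs := (sing (a := γ + 1) (by linarith [G.par.hγ.1]) (by linarith [G.par.hγ.2]) h1 h2 h3 ‖v‖).1 v le_rfl
  refine tendsto_integral_of_dominated_convergence _ (fun n => (G.i_z (epn_pos n).le v).aestronglyMeasurable) hs (fun n => ?_) ?_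
  · filter_upwards [ae_sub_ne' v] with w hw
    rw [norm_eq_abs, abs_mul, abs_mul, abs_of_pos (G.pos w), abs_of_nonneg (wtn (epn_pos n).le _), wt_zero_mul γ hw, rpow_one]
    have a1 := wt_le G.par.hγ.2.le (epn_pos n).le hw
    have a2 := abs_real_inner_le_norm aa eg
    have := mul_le_mul a1 a2 (abs_nonneg _) (wtn le_rfl _)
    nlinarith [mll this (G.pos w).le]
  · filter_upwards [ae_sub_ne' v] with w hw
    exact ((wt_tendsto γ hw).mul_const _).const_mul _
lemma cbar_eq (G : 𝔾) (v : V3) :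
    cbar γ g v = 2 * ∫ w, g w * (wt γ 0 aa * ⟪v - w, logGrad g w⟫) := by
  have hl := G.lim_z v
  simp only [G.ibp_z (epn_pos _)] at hl
  unfold cbar
  by_cases h3 : γ = -3
  · subst h3
    rw [if_pos rfl]
    obtain ⟨c1, c2⟩ := coulomb_mass
    have ht : Tendsto (fun x : V3 => ‖x‖ ^ Module.finrank ℝ V3 * (3 / br * fc ^ aj))
        (Bornology.cobounded V3) (nhds 0) := by
      have h1 : Tendsto (fun x : V3 => 3 / br * ‖x‖⁻¹) (Bornology.cobounded V3) (nhds 0) := by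
        have := (tendsto_inv_atTop_zero.comp (tendsto_norm_cobounded_atTop (E := V3))).const_mul (3 / br)
        simpa using this
      refine squeeze_zero' (aeo fun x => by positivity) ?_ h1
      filter_upwards [(tendsto_norm_cobounded_atTop (E := V3)).eventually_ge_atTop 1] with x hx
      have hx0 : 0 < ‖x‖ := by linarith
      have : fc ^ aj ≤ (‖x‖ ^ 2) ^ aj :=
        rpow_le_rpow_of_nonpos pv ac bs
      have e : (‖x‖ ^ 2) ^ aj = (‖x‖ ^ 5)⁻¹ := by
        rw [← rpow_natCast ‖x‖ 2, ← rpow_mul hx0.le, ← rpow_natCast ‖x‖ 5, ← rpow_neg hx0.le]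
        norm_num
      rw [e] at this
      have hpi := pi_pos
      simp only [finrank_euclideanSpace, Fintype.card_fin]
      have h5 : ‖x‖ ^ 3 * (‖x‖ ^ 5)⁻¹ ≤ ‖x‖⁻¹ := by
        rw [← div_eq_mul_inv, div_le_iff₀ pv, inv_mul_eq_div, le_div_iff₀ hx0]
        nlinarith [pow_pos hx0 3, pow_pos hx0 4, mul_pos (pow_pos hx0 4) hx0]
      calc ‖x‖ ^ 3 * (3 / br * fc ^ aj) ≤ ‖x‖ ^ 3 * (3 / br * (‖x‖ ^ 5)⁻¹) := by gcongr
        _ = 3 / br * (‖x‖ ^ 3 * (‖x‖ ^ 5)⁻¹) := by ring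
        _ ≤ _ := by gcongr
    have hpk := tendsto_integral_comp_smul_smul_of_integrable' (fun x => by positivity) c2 ht G.int0 (G.gcont.continuousAt (x := v))
    have hn : Tendsto (fun n : ℕ => (n : ℝ) + 1) atTop atTop :=
      Filter.tendsto_atTop_add_const_right _ _ tendsto_natCast_atTop_atTop
    have hpk2 := (hpk.comp hn).const_mul br
    have e : ∀ n : ℕ, (∫ w, g w * ((-3 + 3) * wt (-3) (epn n) aa - -3 * (epn n * dg ^ (-(3:ℝ) / 2 - 1)))) =
        4 * π * (∫ w, (ag ^ Module.finrank ℝ V3 * (3 / br * (1 + ‖ag • aa‖ ^ 2) ^ aj)) • g w) := fun n => by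
      rw [← integral_const_mul]
      congr 1; ext w
      have hc : cu < (n : ℝ) + 1 := by positivity
      set c := (n : ℝ) + 1
      have e1 : epn n + ab ^ 2 = (c ^ 2)⁻¹ * (1 + ‖c • aa‖ ^ 2) := by
        have e0 : epn n = (c ^ 2)⁻¹ := rfl
        rw [e0, norm_smul, norm_of_nonneg hc.le]; field_simp
      have e2 : ((c ^ 2)⁻¹) ^ aj = c ^ 5 := by
        rw [inv_rpow pv, ← rpow_neg pv, ← rpow_natCast c 2, ← rpow_mul hc.le, ← rpow_natCast c 5]
        norm_num
      have e3 : (-(3:ℝ) / 2 - 1) = -5 / 2 := by norm_num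
      rw [e3, e1, mul_rpow pv pv, e2]
      simp only [epn, finrank_euclideanSpace, Fintype.card_fin, smul_eq_mul]
      have := pi_pos.ne'
      have hc' := hc.ne'
      change g w * ((-3 + 3) * wt (-3) (c ^ 2)⁻¹ aa - -3 * ((c ^ 2)⁻¹ * _)) = _
      field_simp
      ring
    have := tendsto_nhds_unique (hl.congr e) hpk2
    rw [this]; ring
  · rw [if_neg h3]
    have hγ3 : -3 < γ := lt_of_le_of_ne G.par.hγ.1 (Ne.symm h3)
    have hs := (sing hγ3 (by linarith [G.par.hγ.2]) G.gcont bk G.g_mom2 ‖v‖).1 v le_rfl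
    have hz : Measurable (fun w : V3 => v - w) := measurable_const.sub measurable_id
    have hlim : Tendsto (fun n => ∫ w, g w * ((γ + 3) * wt γ (epn n) aa - γ * (epn n * dg ^ ax)))
        atTop (nhds (∫ w, (γ + 3) * (ab ^ γ * g w))) := by
      refine tendsto_integral_of_dominated_convergence _ (fun n => ?_) (hs.const_mul 3) (fun n => ?_) ?_
      · exact (G.gcont.measurable.mul (((measurable_wt_sub γ _ v).const_mul _).sub
          ((((((hz.norm.pow_const 2).const_add _)).pow_const _).const_mul _).const_mul _))).aestronglyMeasurable
      · filter_upwards [ae_sub_ne' v] with w hw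
        have hε := epn_pos n
        have h1 := wtn (γ := γ) hε.le aa
        have h2 : 0 ≤ epn n * dg ^ ax := by positivity
        have h3 := wt_le G.par.hγ.2.le hε.le hw
        rw [wt_zero] at h3
        have hp : 0 < epn n + ab ^ 2 := by positivity
        have h4 : epn n * dg ^ ax ≤ wt γ (epn n) aa := by
          have : wt γ (epn n) aa = dg * dg ^ ax := by
            rw [mul_comm, ← rpow_add_one hp.ne']; unfold wt; congr 1; ring
          rw [this]; gcongr; nlinarith [sq_nonneg ab]
        have h5 : 0 ≤ (γ + 3) * wt γ (epn n) aa - γ * (epn n * dg ^ ax) := by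
          nlinarith [G.par.hγ.2]
        rw [norm_of_nonneg (mul_nonneg (G.pos w).le h5)]
        have h6 : (γ + 3) * wt γ (epn n) aa - γ * (epn n * dg ^ ax) ≤ 3 * ab ^ γ := by
          nlinarith [G.par.hγ.2]
        nlinarith [mll h6 (G.pos w).le]
      · filter_upwards [ae_sub_ne' v] with w hw
        have hp : 0 + ab ^ 2 ≠ 0 := by have := norm_pos_iff.2 hw; positivity
        have h1 := (epn_tendsto.add_const (ab ^ 2)).rpow_const (p := γ / 2 - 1) (Or.inl hp)
        have h2 := ((((wt_tendsto γ hw).const_mul (γ + 3)).sub ((epn_tendsto.mul h1).const_mul γ)).const_mul (g w))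
        convert h2 using 2
        rw [wt_zero]; ring
    have := tendsto_nhds_unique hl hlim
    rw [this, integral_const_mul]; ring
end GS
def qt (g : V3 → ℝ) (v w : V3) : ℝ :=
  Sb aa fa fa + trS aa (fderiv ℝ lg v) + 2 * ⟪v - w, logGrad g w⟫
def qe (γ : ℝ) (g : V3 → ℝ) (ε : ℝ) (v : V3) : ℝ := ∫ w, g w * fh
def qd (γ : ℝ) (g : V3 → ℝ) (v w : V3) : ℝ :=
  (‖logGrad g v‖ ^ 2 + 3 * ‖fderiv ℝ lg v‖) * (ab ^ ah * g w) + 2 * (ab ^ (γ + 1) * (fp * g w))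
lemma msub (v : V3) : Measurable (fun w : V3 => v - w) := measurable_const.sub measurable_id
namespace GS
variable {γ κ ζ ν p K1 K2 K3 : ℝ} {g q : V3 → ℝ}
local notation "𝔾" => GS γ κ ζ ν p K1 K2 K3 g q
lemma Dlcont (G : 𝔾) : Continuous (fderiv ℝ lg) := G.lC1.continuous_fderiv one_ne_zero
lemma s2 (G : 𝔾) (R : ℝ) : (∀ v, ‖v‖ ≤ R → Integrable (fun w => ab ^ ah * g w)) ∧
    ∃ C, ∀ v, ‖v‖ ≤ R → (∫ w, ab ^ ah * g w) ≤ C := sing (a := γ + 2) (by linarith [G.par.hγ.1]) (by linarith [G.par.hγ.2])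
  G.gcont bk G.g_mom2 R
lemma s1 (G : 𝔾) (R : ℝ) : (∀ v, ‖v‖ ≤ R → Integrable (fun w => ab ^ (γ + 1) * (fp * g w))) ∧
    ∃ C, ∀ v, ‖v‖ ≤ R → (∫ w, ab ^ (γ + 1) * (fp * g w)) ≤ C := sing (a := γ + 1) (by linarith [G.par.hγ.1]) (by linarith [G.par.hγ.2])
  G.lg_mom.1 G.lg_mom.2.1 G.lg_mom.2.2 R
lemma qd_int (G : 𝔾) (v : V3) : Integrable (qd γ g v) :=
  (((G.s2 ‖v‖).1 v le_rfl).const_mul _).add (((G.s1 ‖v‖).1 v le_rfl).const_mul 2)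
lemma qd_bd (G : 𝔾) (R : ℝ) : ∃ C, ∀ v, ‖v‖ ≤ R → (∫ w, qd γ g v w) ≤ C := by
  obtain ⟨C2, h2⟩ := (G.s2 R).2
  obtain ⟨C1, h1⟩ := (G.s1 R).2
  obtain ⟨A, hA⟩ := (isCompact_closedBall ar R).exists_bound_of_continuousOn
    (((G.lcont.norm.pow 2).add (continuous_const.mul G.Dlcont.norm)).continuousOn (f := fun v => ‖logGrad g v‖ ^ 2 + 3 * ‖fderiv ℝ lg v‖))
  refine ⟨A * C2 + 2 * C1, fun v hv => ?_⟩
  have e : (∫ w, qd γ g v w) = _ := integral_add (((G.s2 ‖v‖).1 v le_rfl).const_mul _) (((G.s1 ‖v‖).1 v le_rfl).const_mul 2)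
  rw [e, integral_const_mul, integral_const_mul]
  have := (le_norm_self _).trans (hA v (by simpa using hv))
  have h0 : 0 ≤ ∫ w, ab ^ ah * g w := integral_nonneg fun w => mul_nonneg (rpow_nonneg (norm_nonneg _) _) (G.pos w).le
  refine add_le_add (mul_le_mul this (h2 v hv) h0 (this.trans' pv)) (by linarith [h1 v hv])
lemma q_le (G : 𝔾) {ε : ℝ} (hε : 0 ≤ ε) {v w : V3} (hw : v - w ≠ 0) :
    ‖g w * fh‖ ≤ qd γ g v w := by
  rw [norm_eq_abs, abs_mul, abs_mul, abs_of_pos (G.pos w), abs_of_nonneg (wtn hε _)]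
  have h1 := wt_le G.par.hγ.2.le hε hw
  have h2 : |qt g v w| ≤ ab ^ 2 * (‖logGrad g v‖ ^ 2 + 3 * ‖fderiv ℝ lg v‖) + 2 * (ab * fp) := by
    have a1 := abs_Sb_le aa fa fa
    have a2 := abs_trS_le aa (fderiv ℝ lg v)
    have a3 := abs_real_inner_le_norm aa eg
    unfold qt
    refine (abs_add_le _ _).trans ((add_le_add (abs_add_le _ _) le_rfl).trans ?_)
    rw [abs_mul 2, abs_two]; nlinarith
  have h3 := mul_le_mul h1 h2 (abs_nonneg _) (wtn le_rfl _)
  refine (mll h3 (G.pos w).le).trans (le_of_eq ?_)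
  rw [qd, wt_zero_mul γ hw, wt_zero_mul γ hw, rpow_one, rpow_two]; ring
lemma qt_meas (G : 𝔾) : Measurable (fun x : V3 × V3 => qt g x.1 x.2) := by
  have h1 : Continuous (fun x : V3 × V3 => x.1 - x.2) := continuous_fst.sub continuous_snd
  have hl := G.lcont
  have hD := G.Dlcont
  have c := ((continuous_Sb.comp (h1.prodMk ((hl.comp continuous_fst).prodMk (hl.comp continuous_fst)))).add
    (continuous_trS h1 (hD.comp continuous_fst))).add ((continuous_const (y := af)).mul (h1.inner (hl.comp continuous_snd)))
  exact c.measurable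
lemma q_int (G : 𝔾) {ε : ℝ} (hε : 0 ≤ ε) (v : V3) :
    Integrable (fun w => g w * fh) := by
  refine (G.qd_int v).mono' (G.gcont.measurable.mul ((measurable_wt_sub γ ε v).mul
    (G.qt_meas.comp measurable_prodMk_left))).aestronglyMeasurable ?_
  filter_upwards [ae_sub_ne' v] with w hw using G.q_le hε hw
lemma qe_bd (G : 𝔾) {ε : ℝ} (hε : 0 ≤ ε) (v : V3) : ‖qe γ g ε v‖ ≤ ∫ w, qd γ g v w := by
  refine norm_integral_le_of_norm_le (G.qd_int v) ?_
  filter_upwards [ae_sub_ne' v] with w hw using G.q_le hε hw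
lemma qe_meas (G : 𝔾) (ε : ℝ) : Measurable (qe γ g ε) := by
  have : StronglyMeasurable (fun x : V3 × V3 => g x.2 * (wt γ ε xd * qt g x.1 x.2)) :=
    ((G.gcont.measurable.comp measurable_snd).mul (((mwt γ ε).comp ch).mul G.qt_meas)).stronglyMeasurable
  exact this.integral_prod_right.measurable
lemma qe_lim (G : 𝔾) (v : V3) :
    Tendsto (fun n => qe γ g (epn n) v) atTop (nhds (qe γ g 0 v)) := by
  refine tendsto_integral_of_dominated_convergence _ (fun n => (G.q_int (epn_pos n).le v).aestronglyMeasurable) (G.qd_int v) (fun n => ?_) ?_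
  · filter_upwards [ae_sub_ne' v] with w hw using G.q_le (epn_pos n).le hw
  · filter_upwards [ae_sub_ne' v] with w hw using ((wt_tendsto γ hw).mul_const _).const_mul _
lemma q_eq (G : 𝔾) (v : V3) : q v = qe γ g 0 v := by
  have hb : ∀ i j : Fin 3, Integrable (fun w => g w * (wt γ 0 aa * Sb aa az (esingle j))) := fun i j => by
    refine ((G.s2 ‖v‖).1 v le_rfl).mono' (G.gcont.measurable.mul ((measurable_wt_sub γ 0 v).mul
      (mSb (msub v) measurable_const measurable_const))).aestronglyMeasurable ?_
    filter_upwards [ae_sub_ne' v] with w hw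
    rw [norm_eq_abs, abs_mul, abs_mul, abs_of_pos (G.pos w), abs_of_nonneg (wtn le_rfl _), wt_zero_mul γ hw, rpow_two]
    have := abs_Sb_le aa az (esingle j)
    have en : ∀ i, ‖esingle i‖ = 1 := fun i => by simp [esingle]
    simp only [en, mul_one, one_mul] at this
    have := mll (mll this (wtn (γ := γ) le_rfl aa)) (G.pos w).le
    linarith
  have ha : ∀ i j, abar γ g v i j = ∫ w, g w * (wt γ 0 aa * Sb aa az (esingle j)) := fun i j => by
    refine integral_congr_ae ?_
    filter_upwards [ae_sub_ne' v] with w hw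
    rw [← bilin_landau γ hw]
    simp [bilin, esingle, mul_comm]
  have h := G.eq v
  have hm : matDot (abar γ g v) (hess g v) = g v * ∫ w, g w * (wt γ 0 aa *
      (Sb aa fa fa + trS aa (fderiv ℝ lg v))) := by
    unfold matDot
    simp only [ha, G.hessg, ← integral_mul_const]
    simp_rw [← integral_finsetSum _ (fun j _ => (hb _ j).mul_const _)]
    rw [← integral_finsetSum _ (fun i _ => integrable_finsetSum _ fun j _ => (hb i j).mul_const _), ← integral_const_mul]
    congr 1; ext w
    have hn : ab ^ 2 = ∑ i, aa i ^ 2 := by rw [EuclideanSpace.norm_sq_eq]; simp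
    simp only [trS, So, Sb, inner_eq_sum, hn]
    simp [Fin.sum_univ_three, esingle]
    ring
  rw [hm, G.cbar_eq] at h
  have e : (∫ w, g w * (wt γ 0 aa * (Sb aa fa fa + trS aa (fderiv ℝ lg v)))) +
      2 * (∫ w, g w * (wt γ 0 aa * ⟪v - w, logGrad g w⟫)) = qe γ g 0 v := by
    have i2 := (G.i_z le_rfl v).const_mul 2
    have i1 := (G.q_int le_rfl v).sub i2
    rw [← integral_const_mul, ← integral_add (i1.congr (aeo fun w => ?_)) i2]
    · refine integral_congr_ae (aeo fun w => ?_)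
      simp only [qt]; ring
    · simp only [qt, Pi.sub_apply]; ring
  rw [← e]
  have := (G.pos v).ne'
  exact mul_right_cancel₀ this (by rw [h]; ring)
lemma q_meas (G : 𝔾) : Measurable q := by
  rw [show q = qe γ g 0 from funext G.q_eq]; exact G.qe_meas 0
lemma ibpS (G : 𝔾) {ε : ℝ} (hε : 0 < ε) (v ξ : V3) :
    Integrable (fun w => g w * (wt γ ε aa * (2 * ⟪v - w, ξ⟫ + Sb aa ξ eg))) ∧
    (∫ w, g w * (wt γ ε aa * (2 * ⟪v - w, ξ⟫ + Sb aa ξ eg))) = 0 := by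
  have hγ0 := G.par.hγ.2.le
  have hp := G.par.p0
  have hκ := G.par.hκ
  have hjv := jap_pos v
  have hzn : ∀ w, ab ≤ 2 * jap v * jap w := fun w => by
    have := (nlj _).trans (peetre v w); linarith
  have hzn2 : ∀ w, ab ^ 2 ≤ (2 * jap v) ^ 2 * jap w ^ af := fun w => by
    rw [rpow_two, ← mul_pow]; exact pow_le_pow_left₀ (norm_nonneg _) (hzn w) 2
  have e1 : ∀ w, ⟪g w • logGrad g w, wt γ ε aa • So aa ξ⟫ = g w * (wt γ ε aa * Sb aa ξ eg) := fun w => by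
    rw [real_inner_smul_left, real_inner_smul_right, inner_So, Sb_comm]
  have i1 : Integrable (fun w => g w * (wt γ ε aa * Sb aa ξ eg)) := by
    refine G.di (a := 2 + κ) (C := ε ^ ev * (‖ξ‖ * ((2 * jap v) ^ 2 * K1)))
      ((measurable_wt_sub γ ε v).mul (mSb (msub v) measurable_const G.lcont.measurable)) ac
      (by have := G.K1n; positivity) fun w => ?_
    rw [norm_eq_abs, abs_mul, abs_of_nonneg (wtn hε.le _), rpow_add (jap_pos w), mul_assoc]
    refine mul_le_mul (wt_eps_le hγ0 hε _) ((abs_Sb_le _ _ _).trans ?_) (abs_nonneg _) (rpow_nonneg hε.le _)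
    have := mul_le_mul (hzn2 w) (G.lb w) (norm_nonneg _) ((sq_nonneg _).trans (hzn2 w))
    nlinarith [mll this (norm_nonneg ξ)]
  have i2 : Integrable (fun w => g w * (2 * (wt γ ε aa * ⟪v - w, ξ⟫))) := by
    refine G.di (a := 1) (C := 2 * (ε ^ ev * (2 * jap v * ‖ξ‖)))
      (((measurable_wt_sub γ ε v).mul ((msub v).inner measurable_const)).const_mul 2) ac
      pv fun w => ?_
    rw [norm_eq_abs, abs_mul, abs_mul, abs_two, abs_of_nonneg (wtn hε.le _), rpow_one, mul_assoc, mul_assoc]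
    refine mll (mul_le_mul (wt_eps_le hγ0 hε _) ((abs_real_inner_le_norm _ _).trans ?_) (abs_nonneg _) pv) two_pos.le
    nlinarith [mlr (hzn w) (norm_nonneg ξ)]
  have i3 : Integrable (fun w => g w • (wt γ ε aa • So aa ξ)) := by
    refine G.di (a := 2) (C := ε ^ ev * ((2 * jap v) ^ 2 * ‖ξ‖)) ((measurable_wt_sub γ ε v).smul (measurable_So (msub v) measurable_const))
      ac pv fun w => ?_
    rw [norm_smul, norm_of_nonneg (wtn hε.le _), mul_assoc]
    refine mul_le_mul (wt_eps_le hγ0 hε _) ((norm_So_le _ _).trans ?_) (norm_nonneg _) pv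
    nlinarith [mlr (hzn2 w) (norm_nonneg ξ)]
  have := G.wg.ibp (Φ := fun w => wt γ ε aa • So aa ξ)
    (((wt_contDiff hε).comp df).smul (So_contDiff df contDiff_const))
    (by simp only [e1]; exact i1) (by simp only [dvg_kernel' hε]; exact i2) i3
  simp only [e1, dvg_kernel' hε] at this
  have e : (fun w => g w * (wt γ ε aa * (2 * ⟪v - w, ξ⟫ + Sb aa ξ eg))) =
    fun w => g w * (2 * (wt γ ε aa * ⟪v - w, ξ⟫)) + g w * (wt γ ε aa * Sb aa ξ eg) := by
    ext w; ring
  rw [e]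
  exact ⟨i2.add i1, by rw [integral_add i2 i1, this]; ring⟩
lemma NN_int (G : 𝔾) (v : V3) : Integrable (fun w => g w • NN γ lg v w) :=
  dom_int G.gcont.measurable bk G.mom (measurable_NN_right G.lcont.measurable v)
    (NN_dom G.par.hγ G.K1n G.par.hκ G.par.p0 G.lb v)
lemma NN_zero (G : 𝔾) (v : V3) : (∫ w, g w • NN γ lg v w) = 0 := by
  refine ext_inner_right ℝ fun ξ => ?_
  rw [inner_zero_left, real_inner_comm, ← integral_inner (G.NN_int v) ξ, ← (G.ibpS one_pos v ξ).2]
  congr 1; ext w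
  simp only [NN, real_inner_smul_right, inner_add_right, inner_So, real_inner_comm aa ξ]; ring
end GS
lemma int_prod_dom {Ψ : V3 × V3 → ℝ} {a b : V3 → ℝ} (hΨ : AEStronglyMeasurable Ψ) (ha : Integrable a) (hb : Integrable b)
    (h : ∀ v w, |Ψ (v, w)| ≤ a v * b w) : Integrable Ψ :=
  (ha.mul_prod hb).mono' hΨ (aeo fun x => h x.1 x.2)
def A1 (γ : ℝ) (g φ : V3 → ℝ) (V : V3 → V3) (ε : ℝ) (x : V3 × V3) : ℝ :=
  g x.2 * (wt γ ε xd * Sb xd (V x.1 - φ x.1 • logGrad g x.1) ba)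
lemma cont_DSo {l : V3 → V3} {D : V3 → (V3 →L[ℝ] ℝ)} (hD : Continuous D) (lc : Continuous l) :
    Continuous (fun x : V3 × V3 => D x.1 (So xd ao)) := by
  have c : Continuous (fun x : V3 × V3 => l x.1 - l x.2) := by fun_prop
  have h := continuous_So.comp ((continuous_fst.sub continuous_snd).prodMk c)
  exact (hD.comp continuous_fst).clm_apply h
lemma int4 {F1 F2 F3 F4 : V3 × V3 → ℝ} (I1 : Integrable F1) (I2 : Integrable F2) (I3 : Integrable F3) (I4 : Integrable F4)
    (key : ∀ᵐ w, ((∫ v, F1 (v, w)) + ∫ v, F2 (v, w)) + ((∫ v, F3 (v, w)) + ∫ v, F4 (v, w)) = 0) :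
    ((∫ x, F1 x) + ∫ x, F2 x) + ((∫ x, F3 x) + ∫ x, F4 x) = 0 := by
  have e : ∀ {F : V3 × V3 → ℝ}, Integrable F → ∫ x, F x = ∫ w, ∫ v, F (v, w) := fun hF => integral_prod_symm _ hF
  have j : ∀ {F : V3 × V3 → ℝ}, Integrable F → Integrable (fun w => ∫ v, F (v, w)) := fun hF => hF.integral_prod_right
  have k1 := integral_add (j I1) (j I2)
  have k2 := integral_add (j I3) (j I4)
  have k3 := integral_add ((j I1).add (j I2)) ((j I3).add (j I4))
  rw [e I1, e I2, e I3, e I4, ← k1, ← k2]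
  exact k3.symm.trans ((integral_congr_ae key).trans (integral_zero _ _))
namespace GS
variable {γ κ ζ ν p K1 K2 K3 : ℝ} {g q : V3 → ℝ}
local notation "𝔾" => GS γ κ ζ ν p K1 K2 K3 g q
lemma kb1 (G : 𝔾) {ε : ℝ} (hε : 0 ≤ ε) (v w : V3) :
    wt γ ε aa * (ab ^ 2 * dn) ≤ jap v ^ bc * (4 * ad * jap w ^ bc) := by
  have hk1 := G.K1n
  have hk3 := G.K3n
  have hj1 := jap_pos v
  have hj2 := jap_pos w
  by_cases h : v - w = 0
  · simp [h]; positivity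
  have h1 := (G.kb h).1
  have h2 : 1 ≤ mx v w ^ bu := one_le_rpow (one_le_mx v w) (by linarith [G.par.hγ.2])
  have h3 := mx_rpow_le_mul v w (a := p / 2) (by linarith [G.par.p0, G.par.hκ])
  have h4 := mlr (wt_le G.par.hγ.2.le hε h) (show 0 ≤ ab ^ 2 * dn by positivity)
  have h5 : 0 ≤ wt γ 0 aa * ab ^ 2 * dn :=
    mul_nonneg (mul_nonneg (wtn le_rfl _) pv) (norm_nonneg _)
  have h6 := mll h3 (show 0 ≤ 4 * ad by positivity)
  nlinarith
lemma A1_dom (G : 𝔾) {φ : V3 → ℝ} {V : V3 → V3} (h : WG φ V) (hφm : Measurable φ)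
    (hφ0 : ∀ v, 0 ≤ φ v) (hm : Integrable dj) {R : ℝ} (hR : 0 < R) :
    ∃ D : V3 × V3 → ℝ, Integrable D ∧ ∀ ε, 0 ≤ ε → ∀ x, ‖chi R x.1 * A1 γ g φ V ε x‖ ≤ D x := by
  have hp := G.par.p0
  have hκ := G.par.hκ
  have gm : Measurable g := G.gcont.measurable
  have hg0 := fun v => (G.pos v).le
  have gi : Integrable (fun w => 4 * ad * jap w ^ bc * g w) := by
    have := (momle gm hg0 G.mom (a := p / 2) ac).const_mul bv
    exact this.congr (aeo fun w => by simp only; ring)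
  have hUl : LocallyIntegrable (fun v => V v - φ v • logGrad g v) := h.lV.sub
    (dom_int (C := K1) hφm hφ0 hm G.lcont.measurable fun v => (G.lb v).trans (mll (jpm v ac) G.K1n)).locallyIntegrable
  have Ui : Integrable (fun v => ‖V v - φ v • logGrad g v‖ * (chi R v * jap v ^ bc)) :=
    locInt_mul_cpt (fun x => (hUl x).norm) ((chi_contDiff R (n := 1)).continuous.mul (continuous_jap_rpow _)) (chi_cpt hR).mul_right
  refine ⟨_, Ui.mul_prod gi, fun ε hε x => ?_⟩
  obtain ⟨v, w⟩ := x
  have hkb := G.kb1 hε v w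
  simp only [A1, norm_eq_abs]
  simp only [abs_mul, abs_of_nonneg (chi_nonneg R v), abs_of_nonneg (hg0 w), abs_of_nonneg (wtn (γ := γ) hε aa)]
  set U := V v - φ v • logGrad g v
  have := mll (abs_Sb_le aa U (logGrad g v - logGrad g w)) (wtn (γ := γ) hε aa)
  have h2 := mll hkb (norm_nonneg U)
  calc _ ≤ chi R v * (g w * (‖U‖ * (jap v ^ bc * (4 * ad * jap w ^ bc)))) := by
        refine mll (mll ac (hg0 w)) (chi_nonneg R v)
    _ = _ := by ring
lemma A1_meas (G : 𝔾) {φ : V3 → ℝ} {V : V3 → V3} (hφm : Measurable φ) (hVm : Measurable V) (ε : ℝ) :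
    Measurable (A1 γ g φ V ε) := by
  have lm : Measurable lg := G.lcont.measurable
  have zm : Measurable (fun x : V3 × V3 => x.1 - x.2) := measurable_fst.sub measurable_snd
  exact (G.gcont.measurable.comp measurable_snd).mul (((mwt γ ε).comp zm).mul
    (mSb zm ((hVm.sub (hφm.smul lm)).comp measurable_fst) ((lm.comp measurable_fst).sub (lm.comp measurable_snd))))
lemma chi_meas (R : ℝ) : Measurable (fun x : V3 × V3 => chi R x.1) :=
  ((chi_contDiff R (n := 1)).continuous.measurable).comp measurable_fst
set_option maxHeartbeats 800000 in
lemma ident_R (G : 𝔾) {φ : V3 → ℝ} {V : V3 → V3} (h : WG φ V) (hφm : Measurable φ)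
    (hφ0 : ∀ v, 0 ≤ φ v) (hVm : Measurable V) (hm : Integrable dj) {ε R : ℝ} (hε : 0 < ε) (hR : 0 < R) :
    |(∫ x : V3 × V3, chi R x.1 * A1 γ g φ V ε x) + ∫ v, chi R v * (φ v * qe γ g ε v)| ≤
      Cchi / R * ∫ x : V3 × V3, dk * bo := by
  set l := logGrad g with hl
  have hp := G.par.p0
  have hκ := G.par.hκ
  have hk1 := G.K1n
  have hk3 := G.K3n
  have lc : Continuous l := G.lcont
  have lm : Measurable l := lc.measurable
  have hg0 := fun v => (G.pos v).le
  have zm : Measurable (fun x : V3 × V3 => x.1 - x.2) := measurable_fst.sub measurable_snd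
  have zc : Continuous (fun x : V3 × V3 => x.1 - x.2) := continuous_fst.sub continuous_snd
  have um : Measurable (fun x : V3 × V3 => l x.1 - l x.2) := (lm.comp measurable_fst).sub (lm.comp measurable_snd)
  have wm : Measurable (fun x : V3 × V3 => wt γ ε xd) := (mwt γ ε).comp zm
  have cm := chi_meas R
  have gm2 : Measurable (fun x : V3 × V3 => g x.2) := G.gcont.measurable.comp measurable_snd
  have fm1 : Measurable (fun x : V3 × V3 => φ x.1) := hφm.comp measurable_fst
  have w0 := fun z => wtn (γ := γ) hε.le z
  have jm : ∀ v : V3, jap v ^ bc ≤ jap v ^ p := fun v => jpm v ac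
  have jp : ∀ v : V3, 0 < jap v ^ bc := fun v => jpp v _
  have kb2 : ∀ v w, wt γ ε aa * (ab ^ 2 * dy) ≤ jap v ^ p * (4 * ad * jap w ^ p) := fun v w =>
    (G.kb1 hε.le v w).trans (mul_le_mul (jm v) (mll (jm w) pv) (by have := jp w; positivity) (jpp v _).le)
  have I1 : Integrable (fun x : V3 × V3 => chi R x.1 * A1 γ g φ V ε x) := by
    obtain ⟨D, hD, hb⟩ := G.A1_dom h hφm hφ0 hm hR
    exact hD.mono' (cm.mul (G.A1_meas hφm hVm ε)).aestronglyMeasurable (aeo (hb ε hε.le))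
  have IB1 : Integrable (fun x : V3 × V3 => chi R x.1 * fl) := by
    refine int_prod_dom (cm.mul (fm1.mul (gm2.mul (wm.mul (mSb zm (lm.comp measurable_fst) um))))).aestronglyMeasurable
      (hm.const_mul K1) (G.mom.const_mul bv) fun v w => ?_
    simp only [abs_mul, abs_of_nonneg (chi_nonneg R v), abs_of_nonneg ei, abs_of_nonneg (hg0 w), abs_of_nonneg (w0 aa)]
    have h1 := mll (abs_Sb_le aa (l v) bl) (w0 aa)
    have h2 := mul_le_mul (G.lb v) (G.kb1 hε.le v w) (mul_nonneg (w0 _) pv) (by have := jpp v κ; positivity)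
    have h3 : jap v ^ κ * jap v ^ bc ≤ jap v ^ p := by
      rw [← rpow_add (jap_pos v)]; exact jpm v ac
    have h4 : wt γ ε aa * |Sb aa (l v) bl| ≤ K1 * jap v ^ p * (4 * ad * jap w ^ p) := by
      have h5 : K1 * (jap v ^ κ * jap v ^ bc) * (4 * ad * jap w ^ bc) ≤ K1 * jap v ^ p * (4 * ad * jap w ^ p) :=
        mul_le_mul (mll h3 hk1) (mll (jm w) pv)
          (by have := jp w; positivity) (by have := jpp v p; positivity)
      linarith
    have h6 : 0 ≤ φ v * (g w * (wt γ ε aa * |Sb aa (l v) bl|)) :=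
      mul_nonneg ei (mul_nonneg (hg0 w) (mul_nonneg (w0 _) (abs_nonneg _)))
    refine (mul_le_of_le_one_left h6 (chi_le_one R v)).trans ?_
    refine (mll (mll h4 (hg0 w)) ei).trans (le_of_eq (by ring))
  have IB2 : Integrable (fun x : V3 × V3 => chi R x.1 * (φ x.1 * (g x.2 * (wt γ ε xd *
      (-2 * ⟪x.1 - x.2, l x.1 - l x.2⟫ + trS xd (fderiv ℝ l x.1)))))) := by
    refine int_prod_dom (cm.mul (fm1.mul (gm2.mul (wm.mul (((zm.inner um).const_mul _).add
      (continuous_trS zc (G.Dlcont.comp continuous_fst)).measurable))))).aestronglyMeasurable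
      (hm.const_mul (ε ^ ev)) (G.mom.const_mul (8 * K1 + 12 * K3)) fun v w => ?_
    simp only [abs_mul, abs_of_nonneg (chi_nonneg R v), abs_of_nonneg ei, abs_of_nonneg (hg0 w), abs_of_nonneg (w0 aa)]
    have h1 : |-2 * ⟪v - w, l v - l w⟫ + trS aa (fderiv ℝ l v)| ≤ (8 * K1 + 12 * K3) * mx v w ^ p := by
      have hmx := mx_pos v w
      have a1 := abs_real_inner_le_norm aa bl
      have a2 := abs_trS_le aa (fderiv ℝ l v)
      have a3 := (norm_fderiv_grad_le G.logC2 v).trans (G.Lb v)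
      have a4 : jap v ^ ζ ≤ mx v w ^ ζ := rpow_le_rpow (jap_pos v).le (jap_le_mx v w) G.par.hζ
      have a5 := norm_sub_le_mx v w
      have a6 := G.ub v w
      have b1 : ab * dy ≤ 2 * mx v w * (2 * K1 * mx v w ^ κ) := mul_le_mul a5 a6 (norm_nonneg _) pv
      have b2 : mx v w * mx v w ^ κ ≤ mx v w ^ p := by
        rw [← rpow_one_add' hmx.le ac]; exact mx_rpow_mono v w ac
      have b3 : ab ^ 2 * ‖fderiv ℝ l v‖ ≤ (2 * mx v w) ^ 2 * (K3 * mx v w ^ ζ) :=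
        mul_le_mul (pow_le_pow_left₀ (norm_nonneg _) a5 2) (a3.trans (mll a4 hk3)) (norm_nonneg _) pv
      have b4 : mx v w ^ 2 * mx v w ^ ζ ≤ mx v w ^ p := by
        rw [← rpow_two, ← rpow_add hmx]; exact mx_rpow_mono v w (by linarith [G.par.p3, G.par.p1, G.par.hγ.2])
      refine (abs_add_le _ _).trans ?_
      rw [abs_mul, abs_neg, abs_two]
      nlinarith [mll b2 hk1, mll b4 hk3]
    have h2 := mll (mx_rpow_le_mul v w (a := p) ac) (show 0 ≤ 8 * K1 + 12 * K3 by positivity)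
    have h4 := mul_le_mul (wt_eps_le G.par.hγ.2.le hε aa) (h1.trans h2) (abs_nonneg _) (rpow_nonneg hε.le _)
    refine (mul_le_of_le_one_left (mul_nonneg ei (mul_nonneg (hg0 w) (mul_nonneg (w0 _) (abs_nonneg _)))) (chi_le_one R v)).trans ?_
    refine (mll (mll h4 (hg0 w)) ei).trans (le_of_eq (by ring))
  have b3 : ∀ x : V3 × V3, ‖φ x.1 * dh‖ ≤
      Cchi / R * (dk * bo) := fun x => by
    obtain ⟨v, w⟩ := x
    simp only [norm_eq_abs]
    simp only [abs_mul, abs_of_nonneg ei, abs_of_nonneg (hg0 w), abs_of_nonneg (w0 aa)]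
    have h1 : |fderiv ℝ bt v (So aa bl)| ≤ Cchi / R * (ab ^ 2 * dy) :=
      ((fderiv ℝ bt v).le_opNorm _).trans (mul_le_mul (chi_fderiv_le hR v) (norm_So_le _ _) (norm_nonneg _) (div_nonneg Cchi_pos.le hR.le))
    have h2 := mll h1 (w0 aa)
    have h3 := mll (kb2 v w) (div_nonneg Cchi_pos.le hR.le)
    refine (mll (mll (c := Cchi / R * (jap v ^ p * (4 * ad * jap w ^ p))) ac (hg0 w)) ei).trans (le_of_eq (by ring))
  have I3 : Integrable (fun x : V3 × V3 => φ x.1 * dh) := by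
    refine ((hm.mul_prod (G.mom.const_mul bv)).const_mul (Cchi / R)).mono' (fm1.mul (gm2.mul (wm.mul ?_))).aestronglyMeasurable
      (aeo b3)
    have c1 := cont_DSo ((chi_contDiff R (n := 1)).continuous_fderiv one_ne_zero) lc
    exact c1.measurable
  have key : ∀ᵐ w : V3, ((∫ v, chi R v * A1 γ g φ V ε (v, w)) +
      (∫ v, chi R v * (φ v * (g w * (wt γ ε aa * Sb aa (l v) bl))))) +
      ((∫ v, chi R v * (φ v * (g w * (wt γ ε aa * (-2 * ⟪v - w, l v - l w⟫ + trS aa (fderiv ℝ l v)))))) +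
      ∫ v, φ v * (g w * (wt γ ε aa * fderiv ℝ bt v (So aa bl)))) = 0 := by
    filter_upwards [I1.prod_left_ae, IB1.prod_left_ae, IB2.prod_left_ae, I3.prod_left_ae] with w j1 j2 j3 j4
    rw [← integral_add j1 j2, ← integral_add j3 j4]
    have cd : ContDiff ℝ 1 (fun v => wt γ ε aa • So aa bl) :=
      ((wt_contDiff hε).comp (contDiff_id.sub contDiff_const)).smul (So_contDiff (contDiff_id.sub contDiff_const) (G.lC1.sub contDiff_const))
    have hib := h.ibp_cpt (Φ := fun v => chi R v • (wt γ ε aa • So aa bl))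
      ((chi_contDiff R (n := 1)).smul cd) (chi_cpt hR).smul_right
    have e1 : (fun v => chi R v * A1 γ g φ V ε (v, w) + chi R v * (φ v * (g w * (wt γ ε aa * Sb aa (l v) bl)))) =
        fun v => g w * ⟪V v, chi R v • (wt γ ε aa • So aa bl)⟫ := by
      ext v; simp only [A1, Sb_sub_left, Sb_smul_left, inner_smul_right, inner_So, ← hl]; ring
    have e2 : (fun v => chi R v * (φ v * (g w * (wt γ ε aa * (-2 * ⟪v - w, l v - l w⟫ + trS aa (fderiv ℝ l v))))) +
        φ v * (g w * (wt γ ε aa * fderiv ℝ bt v (So aa bl)))) =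
        fun v => g w * (φ v * dvg (fun v => chi R v • (wt γ ε aa • So aa bl)) v) := by
      ext v
      rw [dvg_smul ((chi_contDiff R (n := 1)).differentiable one_ne_zero v) (cd.differentiable one_ne_zero v),
        dvg_kernel hε w ((G.lC1.sub contDiff_const).differentiable one_ne_zero v), fderiv_sub_const, map_smul]
      simp only [trS, smul_eq_mul]; ring
    rw [e1, e2, integral_const_mul, integral_const_mul, hib]; ring
  have tot := int4 I1 IB1 IB2 I3 key
  have s5 : (∫ v, chi R v * (φ v * qe γ g ε v)) = (∫ x : V3 × V3, chi R x.1 * fl) +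
      ∫ x : V3 × V3, chi R x.1 * (φ x.1 * (g x.2 * (wt γ ε xd *
      (-2 * ⟪x.1 - x.2, l x.1 - l x.2⟫ + trS xd (fderiv ℝ l x.1))))) := by
    rw [← integral_add IB1 IB2]
    refine Eq.symm ((integral_prod _ (IB1.add IB2)).trans ?_)
    congr 1; ext v
    obtain ⟨k1, k2⟩ := G.ibpS hε v (l v)
    have k3 : qe γ g ε v = ∫ w, (g w * fh - g w * (wt γ ε aa * (2 * ⟪v - w, l v⟫ + Sb aa (l v) eg))) := by
      rw [integral_sub (G.q_int hε.le v) k1, k2, sub_zero]; rfl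
    rw [k3, ← integral_const_mul, ← integral_const_mul]
    congr 1; ext w
    simp only [qt, Pi.add_apply, Sb_sub_right, inner_sub_right, ← hl]; ring
  have fin : (∫ x : V3 × V3, chi R x.1 * A1 γ g φ V ε x) + (∫ v, chi R v * (φ v * qe γ g ε v)) =
      - ∫ x : V3 × V3, φ x.1 * dh := by
    rw [s5]; linarith
  rw [fin, abs_neg, ← integral_const_mul]
  exact norm_integral_le_of_norm_le ((hm.mul_prod (G.mom.const_mul bv)).const_mul (Cchi / R)) (aeo b3)
lemma ident_k (G : 𝔾) {φ : V3 → ℝ} {V : V3 → V3} (h : WG φ V) (hφm : Measurable φ)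
    (hφ0 : ∀ v, 0 ≤ φ v) (hVm : Measurable V) (hm : Integrable dj) {R : ℝ} (hR : 0 < R) :
    |(∫ x : V3 × V3, chi R x.1 * A1 γ g φ V 0 x) + ∫ v, chi R v * (φ v * q v)| ≤
      Cchi / R * ∫ x : V3 × V3, dk * bo := by
  obtain ⟨D, hD, hb⟩ := G.A1_dom h hφm hφ0 hm hR
  obtain ⟨C, hC⟩ := G.qd_bd (2 * R)
  have t1 : Tendsto (fun n => ∫ x : V3 × V3, chi R x.1 * A1 γ g φ V (epn n) x) atTop
      (nhds (∫ x : V3 × V3, chi R x.1 * A1 γ g φ V 0 x)) := by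
    refine tendsto_integral_of_dominated_convergence D (fun n => ((chi_meas R).mul (G.A1_meas hφm hVm _)).aestronglyMeasurable) hD
      (fun n => aeo (hb _ (epn_pos n).le)) ?_
    filter_upwards [ae_sub_ne] with x hx
    exact (((wt_tendsto γ hx).mul_const _).const_mul _).const_mul _
  have fi : Integrable (fun v => |C| * φ v) := by
    have := (momle hφm hφ0 hm (a := 0) (by linarith [G.par.p0, G.par.hκ])).const_mul |C|
    simpa using this
  have t2 : Tendsto (fun n => ∫ v, chi R v * (φ v * qe γ g (epn n) v)) atTop
      (nhds (∫ v, chi R v * (φ v * q v))) := by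
    refine tendsto_integral_of_dominated_convergence (fun v => |C| * φ v) (fun n => ((chi_contDiff R (n := 1)).continuous.measurable.mul
      (hφm.mul (G.qe_meas _))).aestronglyMeasurable) fi (fun n => aeo fun v => ?_)
      (aeo fun v => ?_)
    · by_cases hv : ‖v‖ ≤ 2 * R
      · have h1 := (G.qe_bd (epn_pos n).le v).trans ((hC v hv).trans (le_abs_self C))
        rw [norm_mul, norm_mul, norm_of_nonneg (chi_nonneg R v), norm_of_nonneg ei]
        have h2 := mll h1 ei
        have h3 := mul_le_of_le_one_left (mul_nonneg ei (norm_nonneg (qe γ g (epn n) v))) (chi_le_one R v)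
        linarith
      · rw [chi_eq_zero hR (not_le.1 hv).le]; simp; exact mul_nonneg (abs_nonneg _) ei
    · rw [G.q_eq v]; exact ((G.qe_lim v).const_mul _).const_mul _
  exact le_of_tendsto (t1.add t2).abs (aeo fun n => G.ident_R h hφm hφ0 hVm hm (epn_pos n) hR)
lemma phiq_int (G : 𝔾) {φ : V3 → ℝ} (hφm : Measurable φ)
    (hφ0 : ∀ v, 0 ≤ φ v) (hm : Integrable dj) : Integrable (fun v => φ v * q v) := by
  refine ((momle hφm hφ0 hm (a := ν) (by linarith [G.par.p4, G.par.hγ.2])).const_mul K2).mono' (hφm.mul G.q_meas).aestronglyMeasurable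
    (aeo fun v => ?_)
  rw [norm_mul, norm_of_nonneg ei]
  have := mll (G.qb v) ei
  rw [norm_eq_abs]; linarith
lemma ident (G : 𝔾) {φ : V3 → ℝ} {V : V3 → V3} (h : WG φ V) (hφm : Measurable φ)
    (hφ0 : ∀ v, 0 ≤ φ v) (hVm : Measurable V) (hm : Integrable dj) (hI : Integrable (A1 γ g φ V 0)) :
    (∫ v, φ v * q v) = - ∫ x, A1 γ g φ V 0 x := by
  have t1 : Tendsto (fun n : ℕ => ∫ x : V3 × V3, chi (n + 1) x.1 * A1 γ g φ V 0 x) atTop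
      (nhds (∫ x : V3 × V3, A1 γ g φ V 0 x)) := by
    refine tendsto_integral_of_dominated_convergence (fun x => ‖A1 γ g φ V 0 x‖) (fun n => ((chi_meas _).mul (G.A1_meas hφm hVm _)).aestronglyMeasurable) hI.norm
      (fun n => aeo fun x => ?_) (aeo fun x => ?_)
    · rw [norm_mul, norm_of_nonneg (chi_nonneg _ _)]; exact mul_le_of_le_one_left (norm_nonneg _) (chi_le_one _ _)
    · simpa using (chi_tendsto x.1).mul_const (A1 γ g φ V 0 x)
  have t2 : Tendsto (fun n : ℕ => ∫ v, chi (n + 1) v * (φ v * q v)) atTop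
      (nhds (∫ v, φ v * q v)) := by
    refine tendsto_integral_of_dominated_convergence (fun v => ‖φ v * q v‖) (fun n => ((chi_contDiff _ (n := 1)).continuous.measurable.mul
      (hφm.mul G.q_meas)).aestronglyMeasurable) (G.phiq_int hφm hφ0 hm).norm (fun n => aeo fun v => ?_)
      (aeo fun v => ?_)
    · rw [norm_mul, norm_of_nonneg (chi_nonneg _ _)]; exact mul_le_of_le_one_left (norm_nonneg _) (chi_le_one _ _)
    · simpa using (chi_tendsto v).mul_const (φ v * q v)
  have t3 : Tendsto (fun n : ℕ => Cchi / ag * ∫ x : V3 × V3, dk * bo)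
      atTop (nhds 0) := by
    have := (tendsto_one_div_add_atTop_nhds_zero_nat (𝕜 := ℝ)).const_mul Cchi
    simpa [div_eq_mul_inv] using this.mul_const (∫ x : V3 × V3, dk * bo)
  have := le_of_tendsto_of_tendsto' (t1.add t2).abs t3 fun n => G.ident_k h hφm hφ0 hVm hm pv
  have := abs_nonpos_iff.1 this
  linarith
lemma int_gq (G : 𝔾) : (∫ v, g v * q v) = 0 := by
  have e : A1 γ g g (fun v => g v • logGrad g v) 0 = 0 := by
    ext x; simp [A1, Sb]
  have := G.ident G.wg G.gcont.measurable bk (G.gcont.smul G.lcont).measurable G.mom (by rw [e]; exact integrable_zero _ _ _)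
  rw [this, e]; simp
end GS
lemma GS.virial {γ κ ζ ν p K1 K2 K3 : ℝ} {g q : V3 → ℝ} (G : GS γ κ ζ ν p K1 K2 K3 g q) {a : ℝ} (ha : 0 ≤ a) (hap : a + 1 + κ ≤ p) :
    3 * (∫ v, jap v ^ a * g v) ≤ K1 * ∫ v, jap v ^ (a + 1 + κ) * g v := by
  have hκ := G.par.hκ
  have hg0 := fun v => (G.pos v).le
  have jc := continuous_jap_rpow a
  have ew : ∀ w : V3, wt a 1 bw = jap w ^ a := fun w => by rw [wt_one, zero_sub, jap_neg]
  have hr : ∀ w : V3, ds ≤ jap w ^ a := fun w => by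
    rw [one_mul, ← ew w]; exact rpow_le_rpow_of_exponent_le (by nlinarith [sq_nonneg ‖ar - w‖]) ac
  have hr0 : ∀ w : V3, 0 ≤ ds := fun w => by positivity
  have ha' : ∀ w : V3, jap w ^ (a + 1) = jap w ^ a * jap w := fun w => rpow_add_one (jap_pos w).ne' a
  have cw : Continuous (fun w => wt a 1 bw) := (wt_contDiff (n := 0) one_pos).continuous.comp (by fun_prop)
  have iΦ : ∀ w : V3, ‖wt a 1 bw • bw‖ ≤ 1 * jap w ^ (a + 1) := fun w => by
    rw [norm_smul, ew, norm_of_nonneg (jpp w a).le, one_mul, ha', zero_sub, norm_neg]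
    exact mll (nlj w) (jpp w a).le
  have iV : ∀ w : V3, ‖⟪logGrad g w, wt a 1 bw • bw⟫‖ ≤ K1 * jap w ^ (a + 1 + κ) := fun w => by
    refine (norm_inner_le_norm _ _).trans ((mul_le_mul (G.lb w) (iΦ w) (norm_nonneg _) (mul_nonneg G.K1n (jpp w κ).le)).trans (le_of_eq ?_))
    rw [rpow_add (jap_pos w) (a + 1) κ]; ring
  have eV : (fun w => ⟪g w • logGrad g w, wt a 1 bw • bw⟫) = fun w => g w • ⟪logGrad g w, wt a 1 bw • bw⟫ := by
    ext w; rw [real_inner_smul_left, smul_eq_mul]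
  have cV : Continuous (fun w => ⟪logGrad g w, wt a 1 bw • bw⟫) := G.lcont.inner (cw.smul (by fun_prop))
  have cr : Continuous (fun w : V3 => ds) :=
    continuous_const.mul (Continuous.rpow_const (by fun_prop) fun w => Or.inl pv)
  have iD := G.di (Φ := fun w => dvg (fun w => wt a 1 bw • bw) w) (a := a) (C := 2 * a + 3)
    (by simp only [dvg_z one_pos]; exact ((((continuous_const.mul cw)).sub (continuous_const.mul cr)).neg).measurable) ac ac (fun w => by
      rw [dvg_z one_pos, norm_neg, norm_eq_abs, ew, abs_le]
      have := mll (hr w) ha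
      have h2 := mul_nonneg ha (hr0 w)
      have := jpp w a
      constructor <;> nlinarith)
  have I1 := G.di cV.measurable (a := a + 1 + κ) ac G.K1n iV
  have hib := G.wg.ibp (Φ := fun w => wt a 1 bw • bw)
    (((wt_contDiff one_pos).comp df).smul df)
    (by rw [eV]; exact I1) iD (G.di (cw.smul (by fun_prop)).measurable (a := a + 1) ac zero_le_one iΦ)
  rw [eV] at hib
  have m1 := momle G.gcont.measurable hg0 G.mom (a := a) ac
  have m2 := momle G.gcont.measurable hg0 G.mom hap
  have l1 : (∫ v, 3 * (jap v ^ a * g v)) ≤ ∫ v, - (g v * dvg (fun w => wt a 1 bw • bw) v) := by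
    refine integral_mono (m1.const_mul 3) iD.neg fun w => ?_
    beta_reduce; rw [dvg_z one_pos, ew]
    have := mll (hr w) (mul_nonneg ha (hg0 w))
    nlinarith
  have l2 : (∫ v, g v • ⟪logGrad g v, wt a 1 (0 - v) • (0 - v)⟫) ≤ ∫ v, K1 * (jap v ^ (a + 1 + κ) * g v) := by
    refine integral_mono I1 (m2.const_mul K1) fun w => ?_
    have := mll ((le_abs_self _).trans (iV w)) (hg0 w)
    simp only [smul_eq_mul]; nlinarith
  rw [integral_const_mul] at l1 l2
  rw [integral_neg] at l1
  linarith
def Hd (f g : V3 → ℝ) (v : V3) : ℝ := f v * log ak - f v * log em - f v + g v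
lemma Hd_ge {x y : ℝ} (hx : 0 ≤ x) (hy : 0 < y) : (√x - √y) ^ 2 ≤ x * log x - x * log y - x + y := by
  rcases hx.eq_or_lt with rfl | hx
  · simp [sq_sqrt hy.le]
  have h1 : log (√y / √x) ≤ √y / √x - 1 := log_le_sub_one_of_pos pv
  rw [log_div pv pv, log_sqrt hy.le, log_sqrt hx.le] at h1
  have h2 := mll h1 (show 0 ≤ 2 * x by positivity)
  have h3 : x * (√y / √x) = √x * √y := by
    field_simp; nlinarith [sq_sqrt hx.le]
  nlinarith [sq_sqrt hx.le, sq_sqrt hy.le]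
lemma Hd_nonneg {x y : ℝ} (hx : 0 ≤ x) (hy : 0 < y) : 0 ≤ x * log x - x * log y - x + y :=
  (sq_nonneg _).trans (Hd_ge hx hy)
lemma Hd_sq {x y : ℝ} (hx : 0 ≤ x) (hy : 0 < y) : (x - y) ^ 2 ≤ 2 * (x + y) * (x * log x - x * log y - x + y) := by
  have h := mll (Hd_ge hx hy) (show 0 ≤ 2 * (x + y) by positivity)
  refine le_trans ?_ h
  obtain ⟨a, ha⟩ : ∃ a, a = √x := ⟨_, rfl⟩
  obtain ⟨b, hb⟩ : ∃ b, b = √y := ⟨_, rfl⟩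
  rw [← ha, ← hb, ← sq_sqrt hx, ← sq_sqrt hy.le, ← ha, ← hb]
  nlinarith [mul_nonneg (sq_nonneg (a - b)) (sq_nonneg (a - b))]
lemma Hd_low {x y : ℝ} (hx : 0 ≤ x) (hy : 0 < y) : x * log 2 - y ≤ x * log x - x * log y - x + y := by
  rcases hx.eq_or_lt with rfl | hx
  · simp; linarith
  have h1 : log (2 * y / x) ≤ 2 * y / x - 1 := log_le_sub_one_of_pos pv
  rw [log_div pv pv, log_mul two_ne_zero hy.ne'] at h1
  have h2 := mll h1 hx.le
  have h3 : x * (2 * y / x) = 2 * y := by field_simp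
  nlinarith
lemma sq_le_of_forall {A H B : ℝ} (hA : 0 ≤ A) (hH : 0 ≤ H) (hB : 0 ≤ B) (h : ∀ s, 0 < s → A ≤ s * H + B / ff) : A ^ 2 ≤ 2 * H * B := by
  refine le_of_forall_pos_le_add fun e he => ?_
  obtain ⟨d, hd, hd2⟩ : ∃ d, 0 < d ∧ 2 * (H + d) * (B + d) ≤ 2 * H * B + e := by
    refine ⟨min 1 du, by positivity, ?_⟩
    have h1 : min 1 du * (2 * (H + B + 1)) ≤ e := by
      rw [← le_div_iff₀ pv]; exact min_le_right _ _
    have h0 : 0 < min 1 du := by positivity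
    nlinarith [min_le_left 1 du]
  have hs := h (√((B + d) / (2 * (H + d)))) pv
  set s := √((B + d) / (2 * (H + d)))
  have s0 : 0 < s := by positivity
  have s2 : s ^ 2 * (2 * (H + d)) = B + d := by rw [sq_sqrt pv]; field_simp
  have h3 : B / ff ≤ s * (H + d) := by
    rw [div_le_iff₀ pv]; nlinarith
  have h4 : A ≤ 2 * s * (H + d) := by nlinarith
  have := pow_le_pow_left₀ hA h4 2
  nlinarith
lemma pinsker {f g k : V3 → ℝ} (hf : ∀ v, 0 ≤ f v) (hg : ∀ v, 0 < g v) (hk : ∀ v, 0 ≤ k v)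
    (iH : Integrable (Hd f g)) (ik : Integrable (fun v => ep * k v ^ 2)) :
    (∫ v, |f v - g v| * k v) ^ 2 ≤ 2 * dm * ∫ v, ep * k v ^ 2 := by
  refine sq_le_of_forall (integral_nonneg fun v => mul_nonneg (abs_nonneg _) (hk v)) (integral_nonneg fun v => Hd_nonneg (hf v) (hg v))
    (integral_nonneg fun v => mul_nonneg (add_nonneg (hf v) (hg v).le) (sq_nonneg _)) fun s hs => ?_
  rw [← integral_const_mul, ← integral_div, ← integral_add (iH.const_mul s) (ik.div_const _)]
  refine integral_mono_of_nonneg (aeo fun v => mul_nonneg (abs_nonneg _) (hk v)) ((iH.const_mul s).add (ik.div_const _))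
    (aeo fun v => ?_)
  have h1 := Hd_sq (hf v) (hg v)
  have h2 := Hd_nonneg (hf v) (hg v)
  simp only [Hd]
  set P := f v * log ak - f v * log em - f v + g v
  have hS : 0 ≤ f v + g v := add_nonneg (hf v) (hg v).le
  refine abs_le_of_sq_le_sq' ?_ (by have := hk v; positivity) |>.2
  rw [mul_pow, sq_abs]
  have h3 := mlr h1 (sq_nonneg (k v))
  have h4 : 4 * (s * P) * (ep * k v ^ 2 / ff) = 2 * ep * P * k v ^ 2 := by field_simp; ring
  nlinarith [sq_nonneg (s * P - ep * k v ^ 2 / ff)]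
structure SS (γ κ ζ ν p K1 K2 K3 E Hb Mf Mg c : ℝ) (f g q : V3 → ℝ) (Y : V3 → V3) : Prop where
  G : GS γ κ ζ ν p K1 K2 K3 g q
  S : Stat γ E Hb f Y
  mf : Integrable bb
  Mfb : (∫ v, jap v ^ p * f v) ≤ Mf
  Mgb : (∫ v, jap v ^ p * g v) ≤ Mg
  c0 : 0 < c
  ell : ∀ v ξ, c * jap v ^ γ * ‖ξ‖ ^ 2 ≤ ∫ w, f w * aw
  iH : Integrable (Hd f g)
def Dk (γ : ℝ) (f : V3 → ℝ) (Y : V3 → V3) (x : V3 × V3) : ℝ :=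
  wt γ 0 xd * Sb xd bh bh
def Ik (γ : ℝ) (f : V3 → ℝ) (Y l : V3 → V3) (x : V3 × V3) : ℝ :=
  √(f x.1) * √(f x.2) * (wt γ 0 xd * Sb xd bh ao)
def Fk (γ : ℝ) (f : V3 → ℝ) (l : V3 → V3) (x : V3 × V3) : ℝ :=
  f x.1 * (f x.2 * (wt γ 0 xd * Sb xd ao ao))
def Tb (γ : ℝ) (f : V3 → ℝ) (Y l : V3 → V3) (b : V3 → ℝ) (x : V3 × V3) : ℝ :=
  b x.2 * (wt γ 0 xd * Sb xd (√(f x.1) • PP f Y l x.1) ao)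
def au (γ : ℝ) (l : V3 → V3) (v w : V3) : ℝ := wt γ 0 aa * (ab ^ 2 * dy)
lemma wv_PP (f : V3 → ℝ) (Y l : V3 → V3) (v w : V3) :
    wv f (PP f Y l) v w = al • wv f Y v w - (√ak * √de) • bl := by
  simp only [wv, PP]; module
lemma au_nonneg (γ : ℝ) (l : V3 → V3) (v w : V3) : 0 ≤ au γ l v w := mul_nonneg (wtn le_rfl _) pv
lemma au_meas {γ : ℝ} {l : V3 → V3} (hl : Measurable l) : Measurable (fun x : V3 × V3 => au γ l x.1 x.2) :=
  ((mwt γ 0).comp ch).mul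
    (((measurable_fst.sub measurable_snd).norm.pow_const 2).mul ((hl.comp measurable_fst).sub (hl.comp measurable_snd)).norm)
lemma mean_sq {F : Type*} [NormedAddCommGroup F] [NormedSpace ℝ F] {f : V3 → ℝ} {N : V3 → F} (hf : ∀ v, 0 ≤ f v) (hf1 : (∫ v, f v) = 1)
    (fi : Integrable f) (i2 : Integrable (fun w => f w * ‖N w‖ ^ 2)) :
    ‖∫ w, f w • N w‖ ^ 2 ≤ ∫ w, f w * ‖N w‖ ^ 2 := by
  have := sq_le_of_forall (A := ‖∫ w, f w • N w‖) (H := 1 / 2) (B := ∫ w, f w * ‖N w‖ ^ 2) (norm_nonneg _) bs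
    (integral_nonneg fun w => mul_nonneg (hf w) (sq_nonneg _)) fun s hs => ?_
  · linarith
  have h1 : (∫ w, (f w * (s * (1 / 2)) + f w * ‖N w‖ ^ 2 / ff)) = s * (1 / 2) + (∫ w, f w * ‖N w‖ ^ 2) / ff := by
    rw [integral_add (fi.mul_const _) (i2.div_const _), integral_mul_const, hf1, integral_div, one_mul]
  rw [← h1]
  refine norm_integral_le_of_norm_le ((fi.mul_const _).add (i2.div_const _)) (aeo fun w => ?_)
  rw [norm_smul, norm_of_nonneg (hf w)]
  have : ‖N w‖ ≤ s * (1 / 2) + ‖N w‖ ^ 2 / ff := by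
    have : s * (1 / 2) + ‖N w‖ ^ 2 / ff - ‖N w‖ = (s - ‖N w‖) ^ 2 / ff := by field_simp; ring
    have : 0 ≤ (s - ‖N w‖) ^ 2 / ff := by positivity
    linarith
  have := mll this (hf w)
  rwa [mul_add, ← mul_div_assoc de] at this
lemma jz_le {γ : ℝ} (hγ : γ ∈ Ico ct 0) (v w : V3) :
    jap v ^ ap * (wt γ 1 aa * ab) ^ 2 ≤ 4 * ea := by
  obtain ⟨h1, h2⟩ := hγ
  have jv := jap_pos v
  have jw := jap_pos w
  have jz := jap_pos aa
  have a1 : (wt γ 1 aa * ab) ^ 2 ≤ jap aa ^ dx := by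
    rw [wt_one, rpow_add jz, mul_comm 2 γ, rpow_mul jz.le, rpow_two, rpow_two, mul_pow]
    exact mll (pow_le_pow_left₀ (norm_nonneg _) (nlj _) 2) pv
  refine (mll a1 (jpp v _).le).trans ?_
  rcases le_or_gt 0 dx with h | h
  · have a2 : jap aa ^ dx ≤ 4 * (jap v ^ dx * jap w ^ al) := by
      refine (rpow_le_rpow jz.le (peetre v w) h).trans ?_
      rw [mul_rpow bs pv, mul_rpow jv.le jw.le]
      refine mul_le_mul ?_ (mll (jpm w ac) pv) pv bs
      calc al ^ dx ≤ 2 ^ al := rpow_le_rpow_of_exponent_le bs ac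
        _ = 4 := by norm_num
    calc _ ≤ jap v ^ ap * (4 * (jap v ^ dx * jap w ^ al)) := mll a2 (jpp v _).le
      _ = 4 * (jap v ^ (-γ + dx) * jap w ^ al) := by rw [rpow_add jv ap]; ring
      _ ≤ _ := by have := jpm v (show -γ + dx ≤ 2 by linarith); gcongr
  · set s := max 0 (-γ - 2)
    have s0 : 0 ≤ s := le_max_left _ _
    have s1 : s ≤ 1 := max_le bs ac
    have s2 : 2 * γ + 2 ≤ -s := by rw [le_neg]; exact max_le ac ac
    have s3 : -γ ≤ 2 + s := by have := le_max_right 0 (-γ - 2); linarith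
    have a2 : jap v ^ s ≤ 4 * (jap aa ^ s * jap w ^ al) := by
      refine (rpow_le_rpow jv.le (peetre' v w) s0).trans ?_
      rw [mul_rpow bs pv, mul_rpow jz.le jw.le]
      refine mul_le_mul ?_ (mll (jpm w ac) pv) pv bs
      calc al ^ s ≤ 2 ^ al := rpow_le_rpow_of_exponent_le bs ac
        _ = 4 := by norm_num
    calc _ ≤ (jap v ^ al * jap v ^ s) * jap aa ^ (-s) := by
          rw [← rpow_add jv]
          exact mul_le_mul (jpm v s3) (jpm _ s2) (jpp _ _).le (jpp _ _).le
      _ ≤ (jap v ^ al * (4 * (jap aa ^ s * jap w ^ al))) * jap aa ^ (-s) := by gcongr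
      _ = _ := by rw [rpow_neg jz.le]; field_simp
namespace SS
variable {γ κ ζ ν p K1 K2 K3 E Hb Mf Mg c : ℝ} {f g q : V3 → ℝ} {Y : V3 → V3}
local notation "𝕊" => SS γ κ ζ ν p K1 K2 K3 E Hb Mf Mg c f g q Y
lemma au_le (A : 𝕊) (v w : V3) :
    jap v ^ ap * au γ lg v w ^ 2 ≤ 0 * ea + bv ^ 2 * mx v w ^ p := by
  have hk1 := A.G.K1n
  have hk3 := A.G.K3n
  have hm := mx_pos v w
  have hj := jap_pos v
  by_cases h : v - w = 0
  · simp [au, h]; positivity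
  have h1 := (A.G.kb h).1
  have h2 : jap v ^ bu ≤ mx v w ^ bu := rpow_le_rpow hj.le (jap_le_mx v w) (by linarith [A.G.par.hγ.2])
  have h3 : jap v ^ bu * au γ lg v w ≤ 4 * ad * mx v w ^ bc := by
    refine (mlr h2 (au_nonneg _ _ _ _)).trans (le_trans (le_of_eq ?_) h1); unfold au; ring
  have h4 := pow_le_pow_left₀ (mul_nonneg (jpp v _).le (au_nonneg _ _ _ _)) h3 2
  have e1 : (jap v ^ bu) ^ 2 = jap v ^ ap := by rw [← rpow_natCast, ← rpow_mul hj.le]; norm_num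
  have e2 : (mx v w ^ bc) ^ 2 = mx v w ^ p := by rw [← rpow_natCast, ← rpow_mul hm.le]; norm_num
  rw [mul_pow, mul_pow, e1, e2] at h4
  linarith
lemma NN_le (A : 𝕊) (v w : V3) :
    jap v ^ ap * ‖NN γ lg v w‖ ^ 2 ≤ 32 * ea + 32 * K1 ^ 2 * mx v w ^ p := by
  have hm := mx_pos v w
  have hj := jap_pos v
  obtain ⟨g1, g2⟩ := A.G.par.hγ
  have h1 := norm_NN_le (γ := γ) lg v w
  have h2 := jz_le A.G.par.hγ v w
  have h3 : wt γ 1 aa * ab ^ 2 * fp ≤ 4 * mx v w ^ (max ah 0) * (K1 * mx v w ^ κ) := by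
    refine mul_le_mul (kb_cut A.G.par.hγ v w) ((A.G.lb w).trans (mll (rpow_le_rpow (jap_pos w).le (jap_le_mx' v w)
      (by linarith [A.G.par.hκ])) A.G.K1n)) (norm_nonneg _) pv
  have h5 : jap v ^ ap * (wt γ 1 aa * ab ^ 2 * fp) ^ 2 ≤ 16 * K1 ^ 2 * mx v w ^ p := by
    have h4 := pow_le_pow_left₀ (mul_nonneg (mul_nonneg (wtn zero_le_one _) pv) (norm_nonneg _)) h3 2
    have h6 : jap v ^ ap ≤ mx v w ^ ap := rpow_le_rpow hj.le (jap_le_mx v w) ac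
    refine (mul_le_mul h6 h4 pv pv).trans ?_
    have e : ∀ a : ℝ, (mx v w ^ a) ^ 2 = mx v w ^ (a * 2) := fun a => by rw [← rpow_natCast, ← rpow_mul hm.le]; norm_num
    have h7 : mx v w ^ ap * (mx v w ^ (max ah 0 * 2) * mx v w ^ (κ * 2)) ≤ mx v w ^ p := by
      rw [← rpow_add hm, ← rpow_add hm]
      refine mx_rpow_mono v w ?_
      rcases max_cases ah 0 with h | h <;> rw [h.1] <;> linarith [A.G.par.p1, A.G.par.p2]
    calc _ = 16 * K1 ^ 2 * (mx v w ^ ap * (mx v w ^ (max ah 0 * 2) * mx v w ^ (κ * 2))) := by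
          rw [← e, ← e]; ring
      _ ≤ _ := mll h7 pv
  set x := wt γ 1 aa * ab
  set y := wt γ 1 aa * ab ^ 2 * fp
  have h8 : ‖NN γ lg v w‖ ^ 2 ≤ 8 * x ^ 2 + 2 * y ^ 2 := by
    have := pow_le_pow_left₀ (norm_nonneg _) h1 2
    nlinarith [sq_nonneg (2 * x - y)]
  have h9 := mll h8 (jpp v ap).le
  nlinarith
end SS
def ZZ (p α β : ℝ) (v w : V3) : ℝ := α * ea + β * mx v w ^ p
lemma ZZ_cont (p α β : ℝ) : Continuous (fun x : V3 × V3 => ZZ p α β x.1 x.2) :=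
  (continuous_const.mul (((continuous_jap_rpow 2).comp continuous_fst).mul ((continuous_jap_rpow 2).comp continuous_snd))).add
    (continuous_const.mul (continuous_mx.rpow_const fun x => Or.inl (mx_pos x.1 x.2).ne'))
lemma int_mul_right {F : V3 × V3 → ℝ} {a : V3 → ℝ} (hF : Integrable (fun x : V3 × V3 => a x.1 * F x)) :
    Integrable (fun v => a v * ∫ w, F (v, w)) ∧ (∫ v, a v * ∫ w, F (v, w)) = ∫ x : V3 × V3, a x.1 * F x := by
  have e : (fun v => a v * ∫ w, F (v, w)) = fun v => ∫ w, a v * F (v, w) := by ext v; rw [integral_const_mul]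
  rw [e]; exact ⟨hF.integral_prod_left, (integral_prod _ hF).symm⟩
namespace SS
variable {γ κ ζ ν p K1 K2 K3 E Hb Mf Mg c : ℝ} {f g q : V3 → ℝ} {Y : V3 → V3}
local notation "𝕊" => SS γ κ ζ ν p K1 K2 K3 E Hb Mf Mg c f g q Y
lemma hp2 (A : 𝕊) : 4 ≤ p := by linarith [A.G.par.p0, A.G.par.hκ]
lemma f2 (A : 𝕊) : (∫ v, jap v ^ al * f v) ≤ 1 + E := by
  have e : (fun v => jap v ^ al * f v) = fun v => f v + ‖v‖ ^ 2 * f v := by ext v; rw [rpow_two, jap_sq]; ring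
  rw [e, integral_add A.S.dens.int A.S.dens.enInt, A.S.dens.mass]; linarith [A.S.dens.en]
lemma Zint (A : 𝕊) {b : V3 → ℝ} (bm : Measurable b) (b0 : ∀ v, 0 ≤ b v)
    (bi : Integrable (fun v => jap v ^ p * b v)) {α β : ℝ} (hα : 0 ≤ α) (hβ : 0 ≤ β) :
    Integrable (fun x : V3 × V3 => f x.1 * ci) ∧ (∫ x : V3 × V3, f x.1 * ci) ≤
      α * (bf * ∫ v, jap v ^ al * b v) + β * (Mf * (∫ v, b v) + ∫ v, jap v ^ p * b v) := by
  have hp := A.hp2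
  have fm := A.S.dens.meas
  have f0 := A.S.dens.nn
  have f2 := GS.momle fm f0 A.mf (a := 2) ac
  have b2 := GS.momle bm b0 bi (a := 2) ac
  have bz : Integrable b := by simpa using GS.momle bm b0 bi (a := 0) ac
  have i1 := (f2.mul_prod b2).const_mul α
  have i2 : Integrable (fun x : V3 × V3 => β * eh) (volume.prod volume) :=
    ((A.mf.mul_prod bz).add (A.S.dens.int.mul_prod bi)).const_mul β
  have i3 := i1.add i2
  have hle : ∀ x : V3 × V3, f x.1 * ci ≤ α * ((jap x.1 ^ af * f x.1) * (jap x.2 ^ af * b x.2)) +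
      β * eh := fun x => by
    have h1 := mll (mx_rpow_le x.1 x.2 (a := p) ac) (mul_nonneg hβ (mul_nonneg (f0 x.1) (b0 x.2)))
    unfold ZZ; nlinarith
  have h0 : ∀ x : V3 × V3, 0 ≤ f x.1 * ci := fun x => mul_nonneg (f0 _) (mul_nonneg (b0 _) (by
    unfold ZZ; have := jpp x.1 2; have := jpp x.2 2; have := mx_pos x.1 x.2; positivity))
  have I : Integrable (fun x : V3 × V3 => f x.1 * ci) :=
    i3.mono' ((fm.comp measurable_fst).mul ((bm.comp measurable_snd).mul (ZZ_cont p α β).measurable)).aestronglyMeasurable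
      (aeo fun x => by rw [norm_of_nonneg (h0 x)]; exact hle x)
  refine ⟨I, ?_⟩
  refine (integral_mono I i3 hle).trans ?_
  have e1 := integral_add i1 i2
  have e2 := integral_add (A.mf.mul_prod bz) (A.S.dens.int.mul_prod bi)
  refine (le_of_eq e1).trans ?_
  rw [integral_const_mul, integral_const_mul, e2]
  have p1 := integral_prod_mul (μ := volume) (ν := volume) (fun v => jap v ^ af * f v) (fun w => jap w ^ af * b w)
  have p2 := integral_prod_mul (μ := volume) (ν := volume) bb b
  have p3 := integral_prod_mul (μ := volume) (ν := volume) f (fun w => jap w ^ p * b w)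
  rw [A.S.dens.mass, one_mul] at p3
  have q1 : 0 ≤ ∫ v, jap v ^ af * b v := integral_nonneg fun v => mul_nonneg (jpp v _).le (b0 v)
  have q2 : 0 ≤ ∫ v, b v := integral_nonneg b0
  refine add_le_add (mll ?_ hα) (mll (add_le_add ?_ p3.le) hβ)
  · exact p1.le.trans (mlr A.f2 q1)
  · exact p2.le.trans (mlr A.Mfb q2)
lemma Zrow (A : 𝕊) {b : V3 → ℝ} (bm : Measurable b) (b0 : ∀ v, 0 ≤ b v)
    (bi : Integrable (fun v => jap v ^ p * b v)) {α β : ℝ} (hα : 0 ≤ α) (hβ : 0 ≤ β) {k : V3 → V3 → ℝ} (v : V3) (km : Measurable (k v))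
    (hk : ∀ w, jap v ^ ap * k v w ^ 2 ≤ ZZ p α β v w) :
    Integrable (fun w => b w * k v w ^ 2) ∧ jap v ^ ap * (∫ w, b w * k v w ^ 2) ≤ ∫ w, b w * ZZ p α β v w := by
  have hp := A.hp2
  have jv := jpp v p
  have jv2 := jpp v 2
  have z0 : ∀ w, 0 ≤ ZZ p α β v w := fun w => by
    unfold ZZ; have := jpp w 2; have := mx_pos v w; positivity
  have iZ : Integrable (fun w => b w * ZZ p α β v w) := by
    refine dom_int (C := α * jap v ^ af + β * jap v ^ p) bm b0 bi (Φ := ZZ p α β v) ((ZZ_cont p α β).comp (by fun_prop : Continuous fun w : V3 => (v, w))).measurable fun w => ?_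
    rw [norm_of_nonneg (z0 w)]
    have h1 := mll (mx_rpow_le_mul v w (a := p) ac) hβ
    have h2 := mll (jpm w (show af ≤ p by linarith)) (mul_nonneg hα jv2.le)
    unfold ZZ; nlinarith
  have hb : ∀ w, jap v ^ ap * (b w * k v w ^ 2) ≤ b w * ZZ p α β v w := fun w => by
    have := mll (hk w) (b0 w); linarith
  have h0 : ∀ w, 0 ≤ b w * k v w ^ 2 := fun w => mul_nonneg (b0 w) (sq_nonneg _)
  have iK : Integrable (fun w => b w * k v w ^ 2) := iZ.mono' (bm.mul (km.pow_const 2)).aestronglyMeasurable (aeo fun w => by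
    rw [norm_of_nonneg (h0 w)]
    exact (le_mul_of_one_le_left (h0 w) (ojp v (by linarith [A.G.par.hγ.2]))).trans (hb w))
  refine ⟨iK, ?_⟩
  rw [← integral_const_mul]
  exact integral_mono (iK.const_mul _) iZ hb
lemma pk (A : 𝕊) {α β : ℝ} (hα : 0 ≤ α) (hβ : 0 ≤ β) {k : V3 → V3 → ℝ}
    (km : Measurable (fun x : V3 × V3 => k x.1 x.2)) (k0 : ∀ v w, 0 ≤ k v w) (hk : ∀ v w, jap v ^ ap * k v w ^ 2 ≤ ZZ p α β v w) :
    Integrable (fun v => f v * (jap v ^ ap * dq ^ 2)) ∧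
    (∫ v, f v * (jap v ^ ap * dq ^ 2)) ≤ 2 * dm *
      (α * (bf * (1 + E + ∫ v, jap v ^ al * g v)) + β * (2 * Mf + (Mf * es + Mg))) := by
  have hp := A.hp2
  have fm := A.S.dens.meas
  have f0 := A.S.dens.nn
  have gm := A.G.gcont.measurable
  have g0 := fun v => (A.G.pos v).le
  have E1 := A.f2
  have hH : 0 ≤ ∫ v, Hd f g v := integral_nonneg fun v => Hd_nonneg (f0 v) (A.G.pos v)
  have bi : Integrable (fun v => jap v ^ p * ep) := (A.mf.add A.G.mom).congr (aeo fun v => by simp only [Pi.add_apply]; ring)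
  have b0 : ∀ v, 0 ≤ f v + g v := fun v => add_nonneg (f0 v) (g0 v)
  obtain ⟨Z1, -⟩ := A.Zint (fm.add gm) b0 bi hα hβ
  obtain ⟨Zf, Zf2⟩ := A.Zint fm f0 A.mf hα hβ
  obtain ⟨Zg, Zg2⟩ := A.Zint gm g0 A.G.mom hα hβ
  obtain ⟨R1, R2⟩ := int_mul_right (a := f) (F := fun x => (f x.2 + g x.2) * ZZ p α β x.1 x.2) Z1
  have hle : ∀ v, f v * (jap v ^ ap * dq ^ 2) ≤ 2 * dm * (f v * ∫ w, (f w + g w) * ZZ p α β v w) := fun v => by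
    obtain ⟨r1, r2⟩ := A.Zrow (fm.add gm) b0 bi hα hβ v (km.comp (by fun_prop : Measurable fun w : V3 => (v, w))) (hk v)
    simp only [Pi.add_apply] at r1 r2
    have h1 := pinsker f0 A.G.pos (k0 v) A.iH r1
    have h2 := mll h1 (jpp v ap).le
    have h3 := mll r2 (mul_nonneg zero_le_two hH)
    have h4 := mll (h2.trans (le_trans (le_of_eq (by ring)) h3)) (f0 v)
    linarith
  have mm : Measurable (fun v => ∫ w, |f w - g w| * k v w) :=
    (StronglyMeasurable.integral_prod_right' (f := fun x : V3 × V3 => |f x.2 - g x.2| * k x.1 x.2)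
      ((((fm.comp measurable_snd).sub (gm.comp measurable_snd)).abs).mul km).stronglyMeasurable).measurable
  have I : Integrable (fun v => f v * (jap v ^ ap * dq ^ 2)) :=
    (R1.const_mul _).mono' (fm.mul ((continuous_jap_rpow _).measurable.mul (mm.pow_const 2))).aestronglyMeasurable
      (aeo fun v => by
        rw [norm_of_nonneg (mul_nonneg (f0 v) (mul_nonneg (jpp v _).le (sq_nonneg _)))]; exact hle v)
  refine ⟨I, (integral_mono I (R1.const_mul _) hle).trans ?_⟩
  rw [integral_const_mul, R2]
  refine mll ?_ (mul_nonneg zero_le_two hH)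
  have e : (∫ x : V3 × V3, f x.1 * ((f x.2 + g x.2) * ZZ p α β x.1 x.2)) =
      (∫ x : V3 × V3, f x.1 * (f x.2 * ZZ p α β x.1 x.2)) + ∫ x : V3 × V3, f x.1 * (g x.2 * ZZ p α β x.1 x.2) := by
    rw [← integral_add Zf Zg]; congr 1; ext x; ring
  rw [e]
  have hE : 0 ≤ 1 + E := le_trans (integral_nonneg fun v => mul_nonneg (jpp v _).le (f0 v)) E1
  have h5 := mll (mll E1 hE) hα
  rw [A.S.dens.mass] at Zf2
  have h6 := mll A.Mfb hβ
  have h7 := mll A.Mgb hβ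
  nlinarith
end SS
def Xk (γ : ℝ) (f : V3 → ℝ) (Y l : V3 → V3) (x : V3 × V3) : ℝ :=
  wt γ 0 xd * Sb xd (wv f (PP f Y l) x.1 x.2) (wv f (PP f Y l) x.1 x.2)
def N2 (γ : ℝ) (f : V3 → ℝ) (l : V3 → V3) (v : V3) : ℝ := f v * jap v ^ ap * ‖∫ w, f w • NN γ l v w‖ ^ 2
def Qk (γ : ℝ) (f : V3 → ℝ) (Y l : V3 → V3) (v : V3) : ℝ := jap v ^ γ * ‖PP f Y l v‖ ^ 2
lemma sqf {f : V3 → ℝ} (hf : ∀ v, 0 ≤ f v) (v : V3) : √ak * √ak = f v := mul_self_sqrt (hf v)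
namespace SS
variable {γ κ ζ ν p K1 K2 K3 E Hb Mf Mg c : ℝ} {f g q : V3 → ℝ} {Y : V3 → V3}
local notation "𝕊" => SS γ κ ζ ν p K1 K2 K3 E Hb Mf Mg c f g q Y
lemma PPm (A : 𝕊) : Measurable (PP f Y lg) :=
  (A.S.Ym.const_smul af).sub (A.S.dens.meas.sqrt.smul A.G.lcont.measurable)
lemma um (A : 𝕊) : Measurable (fun x : V3 × V3 => logGrad g x.1 - logGrad g x.2) :=
  (A.G.lcont.measurable.comp measurable_fst).sub (A.G.lcont.measurable.comp measurable_snd)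
lemma Fki (A : 𝕊) :
    Integrable (Fk γ f lg) ∧ (∫ x, Fk γ f lg x) ≤ 4 * bp * (2 * Mf) := by
  have f0 := A.S.dens.nn
  have fm := A.S.dens.meas
  obtain ⟨Z1, Z2⟩ := A.Zint fm f0 A.mf (α := 0) (β := 4 * bp) le_rfl pv
  have hle : ∀ x, Fk γ f lg x ≤ f x.1 * (f x.2 * ZZ p 0 (4 * bp) x.1 x.2) := fun x => by
    refine mll (mll ?_ (f0 _)) (f0 _)
    have hm := mx_pos x.1 x.2
    by_cases h : x.1 - x.2 = 0
    · have : Sb xd ba ba ≤ 0 := (Sb_le _ _).trans (by simp [h])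
      refine (mul_nonpos_of_nonneg_of_nonpos (wtn le_rfl _) this).trans ?_
      unfold ZZ; simp only [zero_mul, zero_add]; positivity
    · have := mll (Sb_le xd ba) (wtn (γ := γ) le_rfl xd)
      have h2 := (A.G.kb h).2
      unfold ZZ; linarith
  have h0 : ∀ x, 0 ≤ Fk γ f lg x := fun x => mul_nonneg (f0 _) (mul_nonneg (f0 _) (mul_nonneg (wtn le_rfl _) (Sbn _ _)))
  have I : Integrable (Fk γ f lg) := Z1.mono' ((fm.comp measurable_fst).mul ((fm.comp measurable_snd).mul
    (((mwt γ 0).comp ch).mul (mSb ch A.um A.um)))).aestronglyMeasurable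
      (aeo fun x => by rw [norm_of_nonneg (h0 x)]; exact hle x)
  refine ⟨I, (integral_mono I Z1 hle).trans (Z2.trans ?_)⟩
  rw [A.S.dens.mass]
  have := A.Mfb
  have hk : 0 ≤ 4 * bp := by positivity
  nlinarith
lemma Xeq (A : 𝕊) (x : V3 × V3) :
    Xk γ f Y lg x = 4 * Dk γ f Y x - 4 * Ik γ f Y lg x + Fk γ f lg x := by
  have f0 := A.S.dens.nn
  unfold Xk Dk Ik Fk
  rw [wv_PP]
  simp only [Sb_sub_left, Sb_sub_right, Sb_smul_left, Sb_smul_right]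
  rw [Sb_comm _ (logGrad g x.1) bh, Sb_comm _ (logGrad g x.2) bh]
  have e : aq * aq = f x.1 * f x.2 := by rw [mul_mul_mul_comm, sqf f0, sqf f0]
  linear_combination (wt γ 0 xd * (Sb xd (logGrad g x.1) (logGrad g x.1) - Sb xd (logGrad g x.2) (logGrad g x.1) -
    Sb xd (logGrad g x.1) (logGrad g x.2) + Sb xd (logGrad g x.2) (logGrad g x.2))) * e
lemma Iki (A : 𝕊) : Integrable (Ik γ f Y lg) := by
  have f0 := A.S.dens.nn
  have fm := A.S.dens.meas
  have wm := measurable_wv fm A.S.Ym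
  have hD : Integrable (Dk γ f Y) := A.S.dis
  refine (hD.add A.Fki.1).mono' ((((fm.comp measurable_fst).sqrt).mul ((fm.comp measurable_snd).sqrt)).mul
    (((mwt γ 0).comp ch).mul (mSb ch wm A.um))).aestronglyMeasurable
    (aeo fun x => ?_)
  have e1 : Ik γ f Y lg x = wt γ 0 xd * Sb xd bh (aq • ba) := by
    rw [Sb_smul_right]; unfold Ik; ring
  have e2 : Fk γ f lg x = wt γ 0 xd * Sb xd (aq • ba) (aq • ba) := by
    rw [Sb_smul_right, Sb_smul_left]; unfold Fk
    nth_rewrite 1 [← sqf f0 x.1]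
    nth_rewrite 1 [← sqf f0 x.2]
    ring
  show |_| ≤ Dk γ f Y x + Fk γ f lg x
  rw [e1, e2]; unfold Dk
  generalize wv f Y x.1 x.2 = a
  generalize aq • ba = b
  have hw := wtn (γ := γ) le_rfl xd
  have h1 := mll (Sb_young xd a b) hw
  have h2 := mll (Sb_young xd a ((-1:ℝ) • b)) hw
  rw [Sb_smul_right, Sb_smul_right, Sb_smul_left] at h2
  have := mul_nonneg hw (Sbn xd a)
  have := mul_nonneg hw (Sbn xd b)
  rw [abs_le]; constructor <;> nlinarith
lemma Xki (A : 𝕊) : Integrable (Xk γ f Y lg) ∧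
    (∫ x, Xk γ f Y lg x) = 4 * cx - 4 * bj + ∫ x, Fk γ f lg x := by
  have hD : Integrable (Dk γ f Y) := A.S.dis
  have e : Xk γ f Y lg = fun x => 4 * Dk γ f Y x - 4 * Ik γ f Y lg x + Fk γ f lg x := funext A.Xeq
  have i1 : Integrable (fun x => 4 * Dk γ f Y x - 4 * Ik γ f Y lg x) := (hD.const_mul 4).sub (A.Iki.const_mul 4)
  rw [e]
  refine ⟨i1.add A.Fki.1, ?_⟩
  rw [integral_add i1 A.Fki.1, integral_sub (hD.const_mul 4) (A.Iki.const_mul 4), integral_const_mul, integral_const_mul]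
lemma NNkm (A : 𝕊) : Measurable (fun x : V3 × V3 => ‖NN γ lg x.1 x.2‖) :=
  (measurable_NN A.G.lcont.measurable).norm
lemma N2m (A : 𝕊) : Measurable (N2 γ f lg) := by
  have fm := A.S.dens.meas
  have : Measurable (fun v => ∫ w, f w • NN γ lg v w) :=
    (StronglyMeasurable.integral_prod_right' (f := fun x : V3 × V3 => f x.2 • NN γ lg x.1 x.2)
      ((fm.comp measurable_snd).smul (measurable_NN A.G.lcont.measurable)).stronglyMeasurable).measurable
  exact (fm.mul (continuous_jap_rpow _).measurable).mul (this.norm.pow_const 2)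
lemma N2n (A : 𝕊) (v : V3) : 0 ≤ N2 γ f lg v :=
  mul_nonneg (mul_nonneg (A.S.dens.nn v) (jpp v _).le) (sq_nonneg _)
lemma N2A (A : 𝕊) : Integrable (N2 γ f lg) ∧ (∫ v, N2 γ f lg v) ≤
    2 * dm * (32 * (bf * (1 + E + ∫ v, jap v ^ al * g v)) + 32 * K1 ^ 2 * (2 * Mf + (Mf * es + Mg))) := by
  have f0 := A.S.dens.nn
  have fm := A.S.dens.meas
  obtain ⟨P1, P2⟩ := A.pk (α := 32) (β := 32 * K1 ^ 2) bs pv A.NNkm (fun v w => norm_nonneg _) A.NN_le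
  have hle : ∀ v, N2 γ f lg v ≤ f v * (jap v ^ ap * (∫ w, |f w - g w| * ‖NN γ lg v w‖) ^ 2) := fun v => by
    have i1 : Integrable (fun w => f w • NN γ lg v w) := dom_int fm f0 A.mf (measurable_NN_right A.G.lcont.measurable v)
      (NN_dom A.G.par.hγ A.G.K1n A.G.par.hκ A.G.par.p0 A.G.lb v)
    have e : (∫ w, f w • NN γ lg v w) = ∫ w, (f w - g w) • NN γ lg v w := by
      simp_rw [sub_smul]; rw [integral_sub i1 (A.G.NN_int v), A.G.NN_zero, sub_zero]
    have h1 : ‖∫ w, f w • NN γ lg v w‖ ≤ ∫ w, |f w - g w| * ‖NN γ lg v w‖ := by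
      rw [e]; refine (norm_integral_le_integral_norm _).trans (le_of_eq ?_)
      simp_rw [norm_smul, norm_eq_abs]
    unfold N2
    rw [mul_assoc]
    exact mll (mll (pow_le_pow_left₀ (norm_nonneg _) h1 2) (jpp v _).le) (f0 v)
  have I := P1.mono' A.N2m.aestronglyMeasurable (aeo fun v => by rw [norm_of_nonneg (A.N2n v)]; exact hle v)
  exact ⟨I, (integral_mono I P1 hle).trans P2⟩
lemma N2B (A : 𝕊) : (∫ v, N2 γ f lg v) ≤ 32 * bf ^ 2 + 64 * K1 ^ 2 * Mf := by
  have f0 := A.S.dens.nn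
  have fm := A.S.dens.meas
  obtain ⟨Z1, Z2⟩ := A.Zint fm f0 A.mf (α := 32) (β := 32 * K1 ^ 2) bs pv
  obtain ⟨R1, R2⟩ := int_mul_right (a := f) (F := fun x => f x.2 * ZZ p 32 (32 * K1 ^ 2) x.1 x.2) Z1
  refine (integral_mono A.N2A.1 R1 fun v => ?_).trans ((le_of_eq R2).trans (Z2.trans ?_))
  · obtain ⟨r1, r2⟩ := A.Zrow fm f0 A.mf (α := 32) (β := 32 * K1 ^ 2) bs pv (k := fun v w => ‖NN γ lg v w‖) v
      (measurable_NN_right A.G.lcont.measurable v).norm (A.NN_le v)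
    have := mean_sq f0 A.S.dens.mass A.S.dens.int r1
    unfold N2
    rw [mul_assoc]
    exact mll ((mll this (jpp v _).le).trans r2) (f0 v)
  · rw [A.S.dens.mass]
    have := A.Mfb
    have := A.f2
    have : 0 ≤ ∫ v, jap v ^ af * f v := integral_nonneg fun v => mul_nonneg (jpp v _).le (f0 v)
    have : 0 ≤ K1 ^ 2 := by positivity
    nlinarith
lemma Qki (A : 𝕊) : Integrable (Qk γ f Y lg) ∧
    c * fk ≤ 4 / c * (∫ v, N2 γ f lg v) + 2 * ∫ x, Xk γ f Y lg x := by
  have hc := A.c0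
  have wm := measurable_wv A.S.dens.meas A.PPm
  have hX1 := int_wt_mono A.G.par.hγ.2.le zero_le_one wm A.Xki.1
  have F := fisher_pt A.G.par.hγ A.S A.G.lcont.measurable A.G.K1n A.G.par.hκ A.G.par.p0 A.G.lb A.mf hc A.ell hX1
  have hX2 := hX1.integral_prod_left
  have I3 : Integrable (fun v => 4 / c * N2 γ f lg v + 2 * ∫ w, wt γ 1 aa * Sb aa eu eu) :=
    (A.N2A.1.const_mul _).add (hX2.const_mul 2)
  have hle : ∀ᵐ v, c * Qk γ f Y lg v ≤ 4 / c * N2 γ f lg v + 2 * ∫ w, wt γ 1 aa * Sb aa eu eu := by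
    filter_upwards [F] with v hv
    refine le_trans (le_of_eq ?_) hv; unfold Qk; ring
  have q0 : ∀ v, 0 ≤ Qk γ f Y lg v := fun v => mul_nonneg (jpp v _).le (sq_nonneg _)
  have I : Integrable (fun v => c * Qk γ f Y lg v) := I3.mono' (((continuous_jap_rpow _).measurable.mul (A.PPm.norm.pow_const 2)).const_mul c).aestronglyMeasurable (by
    filter_upwards [hle] with v hv
    rw [norm_of_nonneg (mul_nonneg hc.le (q0 v))]; exact hv)
  refine ⟨(integrable_const_mul_iff (IsUnit.mk0 c hc.ne') _).1 I, ?_⟩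
  have h := integral_mono_ae I I3 hle
  rw [integral_const_mul, integral_add (A.N2A.1.const_mul _) (hX2.const_mul 2), integral_const_mul, integral_const_mul] at h
  refine h.trans (add_le_add_right (mll ?_ zero_le_two) _)
  have e := integral_prod _ hX1
  refine (le_of_eq e.symm).trans ?_
  refine integral_mono_ae hX1 A.Xki.1 ?_
  filter_upwards [ae_sub_ne] with x hx
  exact mlr (wt_le A.G.par.hγ.2.le zero_le_one hx) (Sbn _ _)
end SS
lemma au_meas' {γ : ℝ} {l : V3 → V3} (hl : Measurable l) (v : V3) : Measurable (au γ l v) :=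
  ((mwt γ 0).comp (measurable_const.sub measurable_id)).mul
    (((measurable_const.sub measurable_id).norm.pow_const 2).mul (measurable_const.sub hl).norm)
namespace SS
variable {γ κ ζ ν p K1 K2 K3 E Hb Mf Mg c : ℝ} {f g q : V3 → ℝ} {Y : V3 → V3}
local notation "𝕊" => SS γ κ ζ ν p K1 K2 K3 E Hb Mf Mg c f g q Y
lemma am (A : 𝕊) {θ : ℝ} (hθ : 0 < θ) (v : V3) (M : ℝ) :
    √ak * ‖PP f Y lg v‖ * M ≤ θ * Qk γ f Y lg v + 1 / (4 * θ) * (f v * (jap v ^ ap * M ^ 2)) := by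
  have hj := jpp v γ
  unfold Qk
  nth_rewrite 2 [← sqf A.S.dens.nn v]
  rw [rpow_neg (jap_pos v).le]
  set J := jap v ^ γ
  set P := ‖PP f Y lg v‖
  set s := √ak
  have : θ * (J * P ^ 2) + 1 / (4 * θ) * (s * s * (J⁻¹ * M ^ 2)) - s * P * M = (2 * θ * J * P - s * M) ^ 2 / (4 * θ * J) := by
    field_simp; ring
  have : 0 ≤ (2 * θ * J * P - s * M) ^ 2 / (4 * θ * J) := by positivity
  linarith
lemma Tb_abs (_ : SS γ κ ζ ν p K1 K2 K3 E Hb Mf Mg c f g q Y) {b : V3 → ℝ} (x : V3 × V3) :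
    |Tb γ f Y lg b x| ≤ |b x.2| * (√(f x.1) * ‖PP f Y lg x.1‖ * au γ lg x.1 x.2) := by
  unfold Tb au
  rw [abs_mul, abs_mul, abs_of_nonneg (wtn (γ := γ) le_rfl xd)]
  refine mll ((mll (abs_Sb_le _ _ _) (wtn le_rfl _)).trans (le_of_eq ?_)) (abs_nonneg _)
  rw [norm_smul, norm_of_nonneg (sqrt_nonneg _)]; ring
lemma Tbm (A : 𝕊) {b : V3 → ℝ} (bm : Measurable b) : Measurable (Tb γ f Y lg b) :=
  (bm.comp measurable_snd).mul (((mwt γ 0).comp ch).mul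
    (mSb ch (((A.S.dens.meas.comp measurable_fst).sqrt).smul (A.PPm.comp measurable_fst)) A.um))
lemma Tbi (A : 𝕊) {b : V3 → ℝ} (bm : Measurable b) (b0 : ∀ v, 0 ≤ b v)
    (bi : Integrable (fun v => jap v ^ p * b v)) {θ : ℝ} (hθ : 0 < θ) : Integrable (Tb γ f Y lg b) ∧
    (∫ x, Tb γ f Y lg b x) ≤ θ * (fk * ∫ v, b v) +
      1 / (4 * θ) * (bv ^ 2 * (Mf * (∫ v, b v) + ∫ v, jap v ^ p * b v)) := by
  have hp := A.hp2
  have bz : Integrable b := by simpa using GS.momle bm b0 bi (a := 0) ac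
  obtain ⟨Z1, Z2⟩ := A.Zint bm b0 bi (α := 0) (β := bv ^ 2) le_rfl pv
  have i1 : Integrable (fun x : V3 × V3 => θ * (Qk γ f Y lg x.1 * b x.2)) (volume.prod volume) := (A.Qki.1.mul_prod bz).const_mul θ
  have i2 := Z1.const_mul (1 / (4 * θ))
  have hle : ∀ x, |Tb γ f Y lg b x| ≤ θ * (Qk γ f Y lg x.1 * b x.2) + 1 / (4 * θ) * (f x.1 * (b x.2 * ZZ p 0 (bv ^ 2) x.1 x.2)) := fun x => by
    refine A.Tb_abs x |>.trans ?_
    rw [abs_of_nonneg (b0 _)]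
    have h1 := mll (A.am hθ x.1 (au γ lg x.1 x.2)) (b0 x.2)
    have h2 := mll (A.au_le x.1 x.2) (mul_nonneg (mul_nonneg (b0 x.2) (A.S.dens.nn x.1)) (by positivity : 0 ≤ 1 / (4 * θ)))
    unfold ZZ; linarith
  have I := (i1.add i2).mono' (A.Tbm bm).aestronglyMeasurable (aeo hle)
  refine ⟨I, (integral_mono I (i1.add i2) fun x => (le_abs_self _).trans (hle x)).trans ?_⟩
  have e := integral_add i1 i2
  refine (le_of_eq e).trans ?_
  have e2 := integral_prod_mul (μ := volume) (ν := volume) (Qk γ f Y lg) b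
  rw [integral_const_mul, integral_const_mul, e2]
  refine add_le_add_right (mll (Z2.trans (le_of_eq (by ring))) pv) _
lemma Rform (A : 𝕊) :
    -2 * cx + bj - eo = -(1 / 2) * (∫ x, Xk γ f Y lg x) -
      ((∫ x, Tb γ f Y lg f x) - ∫ x, Tb γ f Y lg g x) ∧
    2 * (∫ x, Tb γ f Y lg f x) = 2 * bj - ∫ x, Fk γ f lg x := by
  have f0 := A.S.dens.nn
  have fm := A.S.dens.meas
  have gm := A.G.gcont.measurable
  have g0 := fun v => (A.G.pos v).le
  have If := (A.Tbi fm f0 A.mf one_pos).1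
  have Ig := (A.Tbi gm g0 A.G.mom one_pos).1
  have e1 : A1 γ g f (fun v => (2 * √ak) • Y v) 0 = Tb γ f Y lg g := by
    ext x; unfold A1 Tb
    congr 3
    simp only [PP]
    rw [smul_sub, smul_smul, smul_smul, sqf f0, mul_comm 2]
  have h1 := A.G.ident (A.S.wgf A.G.par.hγ) fm f0 ((measurable_const.mul fm.sqrt).smul A.S.Ym) A.mf (e1 ▸ Ig)
  rw [e1] at h1
  have e2 : ∀ x : V3 × V3, 2 * Ik γ f Y lg x - Fk γ f lg x = Tb γ f Y lg f x + Tb γ f Y lg f x.swap := fun x => by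
    have hw : wt γ 0 (x.2 - x.1) = wt γ 0 xd := by rw [← wt_neg, neg_sub]
    have hS : ∀ a b, Sb (x.2 - x.1) a b = Sb xd a b := fun a b => by rw [← Sb_neg_z, neg_sub]
    have s1 := sqf f0 x.1
    have s2 := sqf f0 x.2
    unfold Ik Fk Tb
    simp only [Prod.fst_swap, Prod.snd_swap]
    rw [hw, hS]
    simp only [PP, wv, Sb_sub_left, Sb_sub_right, Sb_smul_left, Sb_smul_right]
    rw [← s1, ← s2]
    simp only [sqrt_mul_self (sqrt_nonneg _)]
    ring
  have h2 : 2 * bj - (∫ x, Fk γ f lg x) = 2 * ∫ x, Tb γ f Y lg f x := by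
    have a1 := integral_sub (A.Iki.const_mul 2) A.Fki.1
    have a2 := integral_add If If.swap
    have a3 := integral_prod_swap (μ := volume) (ν := volume) (Tb γ f Y lg f)
    rw [integral_const_mul] at a1
    rw [← a1]
    refine (integral_congr_ae (aeo e2)).trans (a2.trans ?_)
    rw [two_mul]
    exact congrArg (_ + ·) a3
  have h3 := A.Xki.2
  exact ⟨by rw [h1, h3]; linarith, h2.symm⟩
lemma caseA (A : 𝕊) :
    -2 * cx + bj - eo ≤ 2 * dm / c *
      (32 * (bf * (1 + E + ∫ v, jap v ^ al * g v)) + (32 * K1 ^ 2 + bv ^ 2) * (2 * Mf + (Mf * es + Mg))) := by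
  have hc := A.c0
  have f0 := A.S.dens.nn
  have fm := A.S.dens.meas
  have gm := A.G.gcont.measurable
  have g0 := fun v => (A.G.pos v).le
  have If := (A.Tbi fm f0 A.mf one_pos).1
  have Ig := (A.Tbi gm g0 A.G.mom one_pos).1
  rw [A.Rform.1]
  obtain ⟨P1, P2⟩ := A.pk (α := 0) (β := bv ^ 2) le_rfl pv (au_meas A.G.lcont.measurable) (fun v w => au_nonneg _ _ v w) A.au_le
  have e1 := integral_sub If Ig
  have e2 := integral_prod _ (If.sub Ig)
  have h1 : -((∫ x, Tb γ f Y lg f x) - ∫ x, Tb γ f Y lg g x) ≤ c / 4 * fk +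
      1 / (4 * (c / 4)) * ∫ v, f v * (jap v ^ ap * (∫ w, |f w - g w| * au γ lg v w) ^ 2) := by
    rw [← e1]
    have e3 := integral_add (A.Qki.1.const_mul (c / 4)) (P1.const_mul (1 / (4 * (c / 4))))
    rw [integral_const_mul, integral_const_mul] at e3
    rw [← e3]
    have i1 := (If.sub Ig).integral_prod_left
    have e4 := e2
    refine (le_of_eq (congrArg Neg.neg e4)).trans ?_
    rw [← integral_neg]
    refine integral_mono i1.neg ((A.Qki.1.const_mul (c / 4)).add (P1.const_mul (1 / (4 * (c / 4))))) fun v => ?_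
    refine le_trans ?_ (A.am (by positivity : 0 < c / 4) v (∫ w, |f w - g w| * au γ lg v w))
    refine (neg_le_abs _).trans (le_trans (norm_integral_le_integral_norm (fun w => (Tb γ f Y lg f - Tb γ f Y lg g) (v, w))) ?_)
    rw [← integral_const_mul]
    have b0 : ∀ v, 0 ≤ f v + g v := fun v => add_nonneg (f0 v) (g0 v)
    have bi : Integrable (fun v => jap v ^ p * ep) := (A.mf.add A.G.mom).congr (aeo fun v => by simp only [Pi.add_apply]; ring)
    have r1 := (A.Zrow (fm.add gm) b0 bi (α := 0) (β := bv ^ 2) le_rfl pv v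
      (au_meas' A.G.lcont.measurable v) (A.au_le v)).1
    have bz : Integrable (fun v => f v + g v) := by
      have gz : Integrable g := by simpa using GS.momle gm g0 A.G.mom (a := 0) (by linarith [A.hp2])
      exact A.S.dens.int.add gz
    have am' : Measurable (fun w => au γ lg v w) := au_meas' A.G.lcont.measurable v
    have ik : Integrable (fun w => |f w - g w| * au γ lg v w) := by
      have hm1 : Measurable (fun w => |f w - g w|) := measurable_norm.comp (fm.sub gm)
      have hm2 : Measurable (fun w => |f w - g w| * au γ lg v w) := hm1.mul am'
      have i5 : Integrable (fun w => f w + g w + (f w + g w) * au γ lg v w ^ 2) := bz.add r1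
      refine i5.mono' hm2.aestronglyMeasurable (aeo fun w => ?_)
      have ha := au_nonneg γ lg v w
      rw [norm_of_nonneg (mul_nonneg (abs_nonneg _) ha)]
      have : |f w - g w| ≤ f w + g w := abs_le.2 ⟨by linarith [f0 w, g0 w], by linarith [f0 w, g0 w]⟩
      have h2 : au γ lg v w ≤ 1 + au γ lg v w ^ 2 := by nlinarith [sq_nonneg (au γ lg v w - 1)]
      refine (mul_le_mul this h2 ha (b0 w)).trans (le_of_eq ?_)
      ring
    refine integral_mono_of_nonneg (aeo fun w => norm_nonneg _) (ik.const_mul _) (aeo fun w => ?_)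
    have hsub : Tb γ f Y lg f (v, w) - Tb γ f Y lg g (v, w) = Tb γ f Y lg (fun x => f x - g x) (v, w) := by
      unfold Tb; ring
    show |Tb γ f Y lg f (v, w) - Tb γ f Y lg g (v, w)| ≤ _
    rw [hsub]
    refine (A.Tb_abs (v, w)).trans (le_of_eq ?_)
    ring
  have h2 := A.Qki.2
  have h3 := A.N2A.2
  rw [show 1 / (4 * (c / 4)) = 1 / c by field_simp] at h1
  have h4 : c / 4 * fk ≤ 1 / c * (∫ v, N2 γ f lg v) + 1 / 2 * ∫ x, Xk γ f Y lg x := by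
    rw [show (4:ℝ) / c = 4 * (1 / c) by ring] at h2
    linarith
  have hc' : 0 ≤ 1 / c := by positivity
  have h5 := mll h3 hc'
  have h6 := mll P2 hc'
  rw [div_eq_mul_one_div _ c]
  linarith
lemma caseB (A : 𝕊) (hm : 0 < ∫ v, g v) {δ : ℝ} (hδ : 0 < δ) (hδc : δ ≤ c / 8) :
    -2 * cx + bj - eo ≤ 4 * bp * Mf +
      δ * cy * (32 * bf ^ 2 + 64 * K1 ^ 2 * Mf) +
      es / (4 * δ) * (bv ^ 2 * (Mf * es + Mg)) := by
  have hc := A.c0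
  have f0 := A.S.dens.nn
  have gm := A.G.gcont.measurable
  have g0 := fun v => (A.G.pos v).le
  rw [A.Rform.1]
  set m := ∫ v, g v
  have T1 := (A.Tbi gm g0 A.G.mom (θ := δ / m) pv).2
  have T2 := A.Rform.2
  have X1 := A.Xki
  have h1 : -(2 * bj - ∫ x, Fk γ f lg x) ≤ 1 / 4 * (∫ x, Xk γ f Y lg x) + ∫ x, Fk γ f lg x := by
    have hD : Integrable (Dk γ f Y) := A.S.dis
    have a0 := integral_nonneg (f := Dk γ f Y) (μ := volume) fun x => mul_nonneg (wtn le_rfl _) (Sbn _ _)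
    rw [X1.2]
    have a1 : 0 ≤ ∫ x, (1 * Dk γ f Y x + 1 * Ik γ f Y lg x + 1 / 4 * Fk γ f lg x) := by
      refine integral_nonneg fun x => ?_
      have e : 1 * Dk γ f Y x + 1 * Ik γ f Y lg x + 1 / 4 * Fk γ f lg x = wt γ 0 xd *
        Sb xd ez ez := by
        unfold Dk Ik Fk
        generalize logGrad g x.1 - logGrad g x.2 = u
        simp only [Sb_add_left, Sb_add_right, Sb_smul_left, Sb_smul_right]
        rw [Sb_comm _ u bh]
        have e : aq * aq = f x.1 * f x.2 := by rw [mul_mul_mul_comm, sqf f0, sqf f0]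
        linear_combination (-(1/4) * (wt γ 0 xd * Sb xd u u)) * e
      show 0 ≤ 1 * Dk γ f Y x + 1 * Ik γ f Y lg x + 1 / 4 * Fk γ f lg x
      rw [e]; exact mul_nonneg (wtn le_rfl _) (Sbn _ _)
    have i1 : Integrable (fun x => 1 * Dk γ f Y x + 1 * Ik γ f Y lg x) := (hD.const_mul 1).add (A.Iki.const_mul 1)
    rw [integral_add i1 (A.Fki.1.const_mul _), integral_add (hD.const_mul 1) (A.Iki.const_mul 1), integral_const_mul, integral_const_mul, integral_const_mul] at a1
    have a2 := integral_nonneg (f := Fk γ f lg) (μ := volume) fun x => mul_nonneg (f0 _) (mul_nonneg (f0 _) (mul_nonneg (wtn le_rfl _) (Sbn _ _)))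
    linarith
  have h2 := A.Qki.2
  have h3 := A.N2B
  have hF := A.Fki.2
  set Q := ∫ v, Qk γ f Y lg v
  set X := ∫ x, Xk γ f Y lg x
  have hX : 0 ≤ X := integral_nonneg fun x => mul_nonneg (wtn le_rfl _) (Sbn _ _)
  set N := ∫ v, N2 γ f lg v
  have e1 : δ / m * (Q * m) = δ * Q := by field_simp
  have e2 : 1 / (4 * (δ / m)) = m / (4 * δ) := by field_simp
  rw [e1, e2] at T1
  have h4 : δ * Q ≤ δ * cy * N + X / 4 := by
    have : Q ≤ 4 / c ^ 2 * N + 2 / c * X := by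
      rw [show 4 / c ^ 2 * N + 2 / c * X = (4 / c * N + 2 * X) / c by field_simp, le_div_iff₀ hc]; linarith
    have h5 := mll this hδ.le
    have h6 : δ * (2 / c * X) ≤ X / 4 := by
      have : δ * (2 / c * X) ≤ c / 8 * (2 / c * X) := mlr hδc pv
      rw [show c / 8 * (2 / c * X) = X / 4 by field_simp; ring] at this
      exact this
    linarith
  have h5 := mll h3 (by positivity : 0 ≤ δ * cy)
  have h6 : m / (4 * δ) * (bv ^ 2 * (Mf * m + ∫ v, jap v ^ p * g v)) ≤ m / (4 * δ) * (bv ^ 2 * (Mf * m + Mg)) := by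
    have := A.Mgb; gcongr
  linarith
end SS
def CE (E c : ℝ) : ℝ := 1024 * bf ^ 2 / c + 6 * av
lemma CE_pos {E c : ℝ} (hc : 0 < c) : 0 < CE E c := by unfold CE; positivity
lemma nM (x y : ℝ) : x ≤ 1 + x ^ 2 + y ^ 2 ∧ y + y ^ 2 ≤ 2 * (1 + x ^ 2 + y ^ 2) ∧ 2 * x + (x * y + y) ≤ 3 * (1 + x ^ 2 + y ^ 2) ∧
    x / 2 + y ≤ 1 + x ^ 2 + y ^ 2 ∧ y / 36 * (x / 2 + y) ≤ 1 + x ^ 2 + y ^ 2 ∧ 1 ≤ 1 + x ^ 2 + y ^ 2 := by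
  have h1 := sq_nonneg (x - 1)
  have h2 := sq_nonneg (y - 1)
  have h3 := sq_nonneg (x - y)
  have h4 := sq_nonneg x
  have h5 := sq_nonneg y
  refine ⟨?_, ?_, ?_, ?_, ?_, ?_⟩ <;> nlinarith
lemma nK {x y : ℝ} : (4 * (2 * x + y)) ^ 2 ≤ 128 * (x ^ 2 + y ^ 2) ∧ 4 * ((2 * x) ^ 2 + y ^ 2) ≤ 16 * (x ^ 2 + y ^ 2) := by
  have h1 := sq_nonneg (2 * x - y)
  have h4 := sq_nonneg x
  have h5 := sq_nonneg y
  have h6 := sq_nonneg (x - 2 * y)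
  constructor <;> nlinarith
lemma nE {E G : ℝ} (hE : 0 ≤ E) (hG : 0 ≤ G) : bf * (1 + E + G) ≤ bf ^ 2 * (1 + G) ∧ 1 ≤ bf ^ 2 := by
  have h1 := mul_nonneg hE hG
  have h2 := mul_nonneg hE h1
  constructor <;> nlinarith
lemma n3 {m K G M : ℝ} (hK : 0 ≤ K) (h0 : 3 * m ≤ K * G) (h1 : 3 * G ≤ K * M) : 9 * m ≤ K ^ 2 * M := by
  have := mll h1 hK
  nlinarith
namespace SS
variable {γ κ ζ ν p K1 K2 K3 E Hb Mf Mg c : ℝ} {f g q : V3 → ℝ} {Y : V3 → V3}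
local notation "𝕊" => SS γ κ ζ ν p K1 K2 K3 E Hb Mf Mg c f g q Y
set_option maxHeartbeats 1000000 in
theorem main (A : SS γ κ ζ ν p K1 K2 K3 E Hb Mf Mg c f g q Y) :
    -2 * cx + bj - eo ≤
      CE E c * (1 + Mf ^ 2 + Mg ^ 2) * (K1 ^ 2 + K3 ^ 2) * ∫ v, Hd f g v := by
  have hc := A.c0
  have hp := A.hp2
  have f0 := A.S.dens.nn
  have fm := A.S.dens.meas
  have gm := A.G.gcont.measurable
  have g0 := fun v => (A.G.pos v).le
  have hk1 := A.G.K1n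
  have hk3 := A.G.K3n
  have p0 := A.G.par.p0
  have hκ := A.G.par.hκ
  have gz : Integrable g := by simpa using GS.momle gm g0 A.G.mom (a := 0) ac
  have mono : ∀ a b : ℝ, a ≤ b → b ≤ p → (∫ v, jap v ^ a * g v) ≤ ∫ v, jap v ^ b * g v := fun a b h1 h2 =>
    integral_mono (GS.momle gm g0 A.G.mom (h1.trans h2)) (GS.momle gm g0 A.G.mom h2) fun v => mlr (jpm v h1) (g0 v)
  have hm0 : 0 < ∫ v, g v := by
    rw [integral_pos_iff_support_of_nonneg g0 gz]
    rw [show Function.support g = Set.univ from Set.eq_univ_of_forall fun v => (A.G.pos v).ne']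
    simp
  have v0 := A.G.virial (a := 0) le_rfl ac
  have v1 := A.G.virial (a := p / 2) ac ac
  have m1 := mono (0 + 1 + κ) bc ac ac
  have m2 := mono (p / 2 + 1 + κ) p ac le_rfl
  have m3 := mono 2 bc ac ac
  have m4 := mono bc p ac le_rfl
  have m5 := mono 0 bc ac ac
  have hMg := A.Mgb
  simp only [rpow_zero, one_mul] at v0 m5
  have hA := A.caseA
  have hB := fun {δ : ℝ} => A.caseB hm0 (δ := δ)
  have hE : 0 ≤ E := (integral_nonneg fun v => mul_nonneg (sq_nonneg _) (f0 v)).trans A.S.dens.en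
  have hMf : 1 ≤ Mf := by
    rw [← A.S.dens.mass]
    refine (integral_mono A.S.dens.int A.mf fun v => le_mul_of_one_le_left (f0 v) (ojp v ac)).trans A.Mfb
  have hH : 0 ≤ ∫ v, Hd f g v := integral_nonneg fun v => Hd_nonneg (f0 v) (A.G.pos v)
  have hH2 : log 2 - es ≤ ∫ v, Hd f g v := by
    have := integral_mono ((A.S.dens.int.mul_const (log 2)).sub gz) A.iH fun v => Hd_low (f0 v) (A.G.pos v)
    have e := integral_sub (A.S.dens.int.mul_const (log 2)) gz
    rw [integral_mul_const, A.S.dens.mass, one_mul] at e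
    rw [← e]; exact this
  have hG2 : 0 ≤ ∫ v, jap v ^ af * g v := integral_nonneg fun v => mul_nonneg (jpp v _).le (g0 v)
  generalize -2 * cx + bj - eo = R at *
  generalize dm = H at *
  generalize (∫ v, jap v ^ af * g v) = G2 at *
  generalize es = m at *
  have w0 : 3 * m ≤ K1 * (∫ v, jap v ^ bc * g v) := v0.trans (mll m1 hk1)
  have w1 : 3 * (∫ v, jap v ^ bc * g v) ≤ K1 * Mg := v1.trans (mll (m2.trans hMg) hk1)
  have w2 := m4.trans hMg
  generalize (∫ v, jap v ^ bc * g v) = G at *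
  clear v0 v1 m1 m2 m4 mono
  have hG : 0 < G := by linarith
  have hMg0 : 0 ≤ Mg := by linarith
  have w3 : 9 * m ≤ K1 ^ 2 * Mg := n3 hk1 w0 w1
  have hL : bv ^ 2 ≤ 128 * (K1 ^ 2 + K3 ^ 2) := nK.1
  have hL2 := (nK (x := K1) (y := K3)).2
  set K := K1 ^ 2 + K3 ^ 2 with hK
  have hK1 : K1 ^ 2 ≤ K := le_add_of_nonneg_right (sq_nonneg _)
  have hK0 : 0 ≤ K := by positivity
  obtain ⟨z1, z2, z3, z4, z5, hM0⟩ := nM Mf Mg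
  set M := 1 + Mf ^ 2 + Mg ^ 2 with hM
  have hKM : 0 ≤ K * M := by positivity
  obtain ⟨E2, E1⟩ := nE hE hG2
  rcases le_or_gt (1 / 2) m with h | h
  · have a1 : 1 + G2 ≤ K * M := by
      have b1 : 1 ≤ K1 ^ 2 * Mg := by linarith
      have b2 : G ≤ (2 / 9) * (K1 ^ 2 * Mg * Mg) := by
        have : 1 ≤ 2 / 9 * (K1 ^ 2 * Mg) := by linarith
        calc G ≤ Mg := w2
          _ ≤ (2 / 9 * (K1 ^ 2 * Mg)) * Mg := le_mul_of_one_le_left hMg0 this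
          _ = _ := by ring
      have b3 : 1 ≤ 2 / 9 * (K1 ^ 2 * Mg) := by linarith
      have b5 : 1 + G2 ≤ 2 / 9 * (K1 ^ 2 * (Mg + Mg ^ 2)) := by linarith
      have b6 : K1 ^ 2 * (Mg + Mg ^ 2) ≤ K * (2 * M) := mul_le_mul hK1 z2 pv hK0
      linarith
    have a2 : 2 * Mf + (Mf * m + Mg) ≤ 3 * M := by
      have : Mf * m ≤ Mf * Mg := mll ac ac
      linarith
    have a3 : bf * (1 + E + G2) ≤ bf ^ 2 * bx := by
      exact E2.trans (mll a1 pv)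
    have a4 : (32 * K1 ^ 2 + bv ^ 2) * (2 * Mf + (Mf * m + Mg)) ≤ 160 * K * (3 * M) :=
      mul_le_mul ac a2 (by have := mul_nonneg (by linarith : 0 ≤ Mf) hm0.le; linarith) ac
    have a5 : 32 * (bf * (1 + E + G2)) + (32 * K1 ^ 2 + bv ^ 2) * (2 * Mf + (Mf * m + Mg)) ≤ 512 * bf ^ 2 * bx := by
      have := mlr E1 hKM
      linarith
    refine hA.trans ((mll a5 pv).trans ?_)
    have : 2 * H / c * (512 * bf ^ 2 * bx) = 1024 * bf ^ 2 / c * M * K * H := by ring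
    rw [this]; unfold CE
    gcongr
    exact le_add_of_nonneg_right pv
  · have k1 : 0 < K1 := by
      rcases hk1.lt_or_eq with h | h
      · exact h
      · rw [← h] at w0; linarith
    have hk2 : 0 < K1 ^ 2 := by positivity
    set δ := min (c / 8) (K1 ^ 2) with hδ
    have d0 : 0 < δ := lt_min pv hk2
    have d1 : δ ≤ c / 8 := min_le_left _ _
    have d2 : δ ≤ K1 ^ 2 := min_le_right _ _
    have d3 : 1 / δ ≤ 8 / c + 1 / K1 ^ 2 := by
      rcases min_cases (c / 8) (K1 ^ 2) with h | h
      · rw [hδ, h.1]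
        have : 1 / (c / 8) = 8 / c := by field_simp
        rw [this]; exact le_add_of_nonneg_right pv
      · rw [hδ, h.1]; exact le_add_of_nonneg_left pv
    have hB := hB d0 d1
    have t1 : 4 * bp * Mf ≤ 16 * bx := by
      calc _ ≤ 16 * K * Mf := mlr hL2 ac
        _ ≤ 16 * K * M := mll z1 ac
        _ = _ := by ring
    have t2 : δ * cy * (32 * bf ^ 2 + 64 * K1 ^ 2 * Mf) ≤ 128 * bf ^ 2 / c ^ 2 * bx + 32 / c * bx := by
      have u1 : δ * cy * (32 * bf ^ 2) ≤ K * M * cy * (32 * bf ^ 2) := by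
        have : δ ≤ K * M := d2.trans (hK1.trans (le_mul_of_one_le_right hK0 hM0))
        gcongr
      have u2 : δ * cy * (64 * K1 ^ 2 * Mf) ≤ c / 8 * cy * (64 * K * M) := by
        gcongr
      have u3 : c / 8 * cy * (64 * K * M) = 32 / c * bx := by field_simp; ring
      have u4 : K * M * cy * (32 * bf ^ 2) = 128 * bf ^ 2 / c ^ 2 * bx := by ring
      linarith
    have t3 : m / (4 * δ) * (bv ^ 2 * (Mf * m + Mg)) ≤ (1 / c + 1) * (128 * bx) := by
      have u1 : m / (4 * δ) ≤ 1 / c + Mg / 36 := by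
        have e : m / (4 * δ) = m / 4 * (1 / δ) := by field_simp
        have u2 := mll d3 (by positivity : 0 ≤ m / 4)
        have u3 : m / 4 * (1 / K1 ^ 2) ≤ Mg / 36 := by
          rw [mul_one_div, div_le_iff₀ hk2]; linarith
        have u4 : m / 4 * (8 / c) ≤ 1 / c := by
          rw [show m / 4 * (8 / c) = 2 * m / c by ring]; gcongr; linarith
        rw [e]; linarith
      have u5 : Mf * m + Mg ≤ Mf / 2 + Mg := by have := mll h.le (by linarith : 0 ≤ Mf); linarith
      have u6 : (1 / c + Mg / 36) * (Mf / 2 + Mg) ≤ (1 / c + 1) * M := by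
        have x1 : 1 / c * (Mf / 2 + Mg) ≤ 1 / c * M := mll z4 pv
        linarith
      calc _ ≤ (1 / c + Mg / 36) * (128 * K * (Mf / 2 + Mg)) := by gcongr
        _ = 128 * K * ((1 / c + Mg / 36) * (Mf / 2 + Mg)) := by ring
        _ ≤ 128 * K * ((1 / c + 1) * M) := mll u6 pv
        _ = _ := by ring
    have hH3 : 1 ≤ 6 * H := by linarith [log_two_gt_d9]
    have t4 : R ≤ av * bx := by
      have : av * bx = 16 * bx + (128 * bf ^ 2 / c ^ 2 * bx + 32 / c * bx) + (1 / c + 1) * (128 * bx) := by ring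
      linarith
    refine t4.trans ?_
    have t5 : av * bx ≤ av * bx * (6 * H) :=
      le_mul_of_one_le_right pv hH3
    refine t5.trans ?_
    have : av * bx * (6 * H) = 6 * av * M * K * H := by ring
    rw [this]; unfold CE
    gcongr
    exact le_add_of_nonneg_left pv
end SS
def cl (T t : ℝ) : ℝ := max 0 (min t T)
lemma cl_mem {T : ℝ} (hT : 0 < T) (t : ℝ) : cl T t ∈ Icc 0 T := ⟨le_max_left _ _, max_le hT.le (min_le_right _ _)⟩
lemma cl_eq {T t : ℝ} (h : t ∈ Icc 0 T) : cl T t = t := by rw [cl, min_eq_left h.2, max_eq_right h.1]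
lemma cl_cont (T : ℝ) : Continuous (cl T) := by unfold cl; fun_prop
lemma locInt_congr {F : Type*} [NormedAddCommGroup F] {u u' : V3 → F} (h : u =ᵐ[volume] u') (hu : LocallyIntegrable u) : LocallyIntegrable u' := fun x => by
  obtain ⟨s, hs, hi⟩ := hu x
  exact ⟨s, hs, hi.congr (ae_restrict_of_ae h)⟩
lemma WG.congr {u u' : V3 → ℝ} {Y Y' : V3 → V3} (h : WG u Y) (hu : u =ᵐ[volume] u') (hY : Y =ᵐ[volume] Y') : WG u' Y' := by
  refine ⟨locInt_congr hu h.lf, locInt_congr hY h.lV, fun φ h1 h2 e => ?_⟩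
  have := h.wg φ h1 h2 e
  rwa [integral_congr_ae (g := fun v => u' v * fderiv ℝ φ v e) (hu.mono fun v hv => by simp only [hv]),
    integral_congr_ae (f := fun v => ⟪Y v, e⟫ * φ v) (g := fun v => ⟪Y' v, e⟫ * φ v) (hY.mono fun v hv => by simp only [hv])] at this
lemma cv_ae {g : V3 → ℝ} (hg : LocallyIntegrable g) : ∀ᵐ x, Tendsto (fun n => cv n g x) atTop (nhds (g x)) :=
  ContDiffBump.ae_convolution_tendsto_right_of_locallyIntegrable bmp_tendsto (aeo bmp_ratio) hg
def fb (T : ℝ) (f : ℝ → V3 → ℝ) (t : ℝ) (v : V3) : ℝ := max 0 (Filter.limsup (fun n => cv n (f ck) v) atTop)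
lemma fb_nn (T : ℝ) (f : ℝ → V3 → ℝ) (t : ℝ) (v : V3) : 0 ≤ fb T f t v := le_max_left _ _
lemma fb_meas {γ T : ℝ} {f : ℝ → V3 → ℝ} {fG : ℝ → V3 × V3 → V3 × V3} (H : IsHSolution γ T f fG) (hT : 0 < T) : Measurable (fun x : ℝ × V3 => fb T f x.1 x.2) := by
  refine measurable_const.max (Measurable.limsup fun n => ?_)
  refine measurable_uncurry_of_continuous_of_measurable (u := fun t v => cv n (f ck) v) (fun v => ?_) fun t =>
    (cv_contDiff n (H.integrable _ (cl_mem hT t)).locallyIntegrable).continuous.measurable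
  simp only [cv_apply]
  exact (H.contDistrib (fun t => mol n (v - t)) ((mol_contDiff n).comp df)
    ((mol_cpt n).comp_homeomorph (Homeomorph.subLeft v))).comp_continuous (cl_cont T) (cl_mem hT)
lemma fb_ae {γ T : ℝ} {f : ℝ → V3 → ℝ} {fG : ℝ → V3 × V3 → V3 × V3} (H : IsHSolution γ T f fG) (hT : 0 < T) (t : ℝ) : fb T f t =ᵐ[volume] f ck := by
  have h := cl_mem hT t
  filter_upwards [cv_ae (H.integrable _ h).locallyIntegrable] with v hv
  rw [fb, hv.limsup_eq, max_eq_right (H.nonneg _ h v)]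
attribute [irreducible] fb
lemma fb_dens {γ T : ℝ} {f : ℝ → V3 → ℝ} {fG : ℝ → V3 × V3 → V3 × V3} (H : IsHSolution γ T f fG) (hT : 0 < T) {E Hb : ℝ} (hE : (∫ v, ‖v‖ ^ 2 * f 0 v) ≤ E) (hH : entropy (f 0) ≤ Hb) (t : ℝ) : Dens E Hb (fb T f t) := by
  have h := cl_mem hT t
  have e := fb_ae H hT t
  have e1 : (fun v => ‖v‖ ^ 2 * fb T f t v) =ᵐ[volume] fun v => ‖v‖ ^ 2 * f ck v := by
    filter_upwards [e] with v hv; rw [hv]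
  have e2 : (fun v => fb T f t v * log (fb T f t v)) =ᵐ[volume] fun v => f ck v * log (f ck v) := by
    filter_upwards [e] with v hv; rw [hv]
  have m : Measurable (fun v => fb T f t v) := (fb_meas H hT).comp (measurable_prodMk_left (x := t))
  have a1 : Integrable (fb T f t) := (H.integrable _ h).congr e.symm
  have a2 : (∫ v, fb T f t v) = 1 := by rw [integral_congr_ae e, H.mass _ h]
  have a3 := (H.energyIntegrable _ h).congr e1.symm
  have a4 : (∫ v, ‖v‖ ^ 2 * fb T f t v) ≤ E := by rw [integral_congr_ae e1, H.energy _ h]; exact hE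
  have a5 := (H.entIntegrable _ h).congr e2.symm
  have a6 : (∫ v, fb T f t v * log (fb T f t v)) ≤ Hb := by
    rw [integral_congr_ae e2]
    have := H.entropyProd _ h
    have : 0 ≤ (∫⁻ s in Ioc cq ck, dissipation γ (fG s)).toReal := ENNReal.toReal_nonneg
    change entropy (f ck) ≤ Hb
    linarith
  exact ⟨m, fb_nn T f t, a1, a2, a3, a4, a5, a6⟩
def Yb (f : ℝ → V3 → ℝ) (t : ℝ) (v : V3) : V3 := WithLp.toLp 2 fun i : Fin 3 =>
  Filter.limsup (fun n => ∫ w, fderiv ℝ (mol n) aa az * √(f t w)) atTop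
lemma Yb_meas {f : ℝ → V3 → ℝ} (hf : Measurable (fun x : ℝ × V3 => f x.1 x.2)) : Measurable (fun x : ℝ × V3 => Yb f x.1 x.2) := by
  refine (PiLp.continuous_toLp 2 _).measurable.comp (measurable_pi_lambda _ fun i => Measurable.limsup fun n => ?_)
  have : StronglyMeasurable (fun y : (ℝ × V3) × V3 => fderiv ℝ (mol n) (y.1.2 - y.2) az * √(f y.1.1 y.2)) := by
    refine Measurable.stronglyMeasurable (Measurable.mul ?_ ?_)
    · have : Continuous (fun z => fderiv ℝ (mol n) z az) := ((mol_contDiff n).continuous_fderiv cz).clm_apply continuous_const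
      exact this.measurable.comp ((measurable_snd.comp measurable_fst).sub measurable_snd)
    · exact (hf.comp ((measurable_fst.comp measurable_fst).prodMk measurable_snd)).sqrt
  exact this.integral_prod_right'.measurable
lemma Yb_ae {f : ℝ → V3 → ℝ} {t : ℝ} {Y : V3 → V3} (h : WG (fun v => √(f t v)) Y) : Yb f t =ᵐ[volume] Y := by
  have := fun i => cv_ae (locInt_inner h.lV az)
  filter_upwards [ae_all_iff.2 this] with v hv
  ext i
  have e := (hv i).limsup_eq
  rw [inner_esingle] at e
  rw [← e]
  show Filter.limsup _ _ = _
  congr 1; funext n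
  rw [← h.cv_fderiv, cv_hasFDerivAt _ h.lf]
lemma sqrt_int {f : V3 → ℝ} {p : ℝ} (hp : 4 ≤ p) (hf : Measurable f) (hn : ∀ v, 0 ≤ f v)
    (hm : Integrable bb) : Integrable (fun v => √ak) := by
  have h4 : Integrable (fun v : V3 => jap v ^ (-4 : ℝ)) := by
    have := integrable_rpow_neg_one_add_norm_sq (E := V3) (μ := volume) (r := 4) (by simp; norm_num)
    refine this.congr (aeo fun v => ?_)
    simp only [jap, sqrt_eq_rpow]
    rw [← rpow_mul pv]; norm_num
  refine (hm.add h4).mono' hf.sqrt.aestronglyMeasurable (aeo fun v => ?_)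
  rw [norm_of_nonneg (sqrt_nonneg _)]
  have h1 : jap v ^ fj * f v ≤ jap v ^ p * f v := mlr (jpm v hp) (hn v)
  have h2 : jap v ^ (-4 : ℝ) = (jap v ^ fj)⁻¹ := rpow_neg (jap_pos v).le _
  show _ ≤ jap v ^ p * f v + jap v ^ (-4 : ℝ)
  have j := jpp v 4
  rw [h2]
  have : √ak ≤ jap v ^ fj * f v + (jap v ^ fj)⁻¹ := by
    have e : jap v ^ fj * f v + (jap v ^ fj)⁻¹ - 2 * √ak = (jap v ^ fj * √ak - 1) ^ 2 / jap v ^ fj := by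
      nth_rw 1 [← mul_self_sqrt (hn v)]
      field_simp; ring
    have : 0 ≤ (jap v ^ fj * √ak - 1) ^ 2 / jap v ^ fj := by positivity
    linarith [sqrt_nonneg ak]
  linarith
attribute [irreducible] Yb
section
variable {γ : ℝ} {f : ℝ → V3 → ℝ} {Y : ℝ → V3 → V3}
lemma wv_jm (hf : Measurable (fun x : ℝ × V3 => f x.1 x.2)) (hY : Measurable (fun x : ℝ × V3 => Y x.1 x.2)) :
    Measurable (fun y : ℝ × ec => wv (f y.1) (Y y.1) y.2.1 y.2.2) := by
  have m1 : Measurable (fun y : ℝ × ec => (y.1, y.2.1)) := by fun_prop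
  have m2 : Measurable (fun y : ℝ × ec => (y.1, y.2.2)) := by fun_prop
  exact ((hf.comp m2).sqrt.smul (hY.comp m1)).sub ((hf.comp m1).sqrt.smul (hY.comp m2))
lemma Dk_jm (hf : Measurable (fun x : ℝ × V3 => f x.1 x.2)) (hY : Measurable (fun x : ℝ × V3 => Y x.1 x.2)) :
    Measurable (fun y : ℝ × ec => Dk γ (f y.1) (Y y.1) y.2) := by
  have m : Measurable (fun y : ℝ × ec => y.2.1 - y.2.2) := by fun_prop
  exact ((mwt γ 0).comp m).mul (mSb m (wv_jm hf hY) (wv_jm hf hY))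
lemma Ik_jm (hf : Measurable (fun x : ℝ × V3 => f x.1 x.2)) (hY : Measurable (fun x : ℝ × V3 => Y x.1 x.2)) {l : V3 → V3}
    (hl : Measurable l) : Measurable (fun y : ℝ × ec => Ik γ (f y.1) (Y y.1) l y.2) := by
  have m : Measurable (fun y : ℝ × ec => y.2.1 - y.2.2) := by fun_prop
  have m1 : Measurable (fun y : ℝ × ec => (y.1, y.2.1)) := by fun_prop
  have m2 : Measurable (fun y : ℝ × ec => (y.1, y.2.2)) := by fun_prop
  exact ((hf.comp m1).sqrt.mul (hf.comp m2).sqrt).mul (((mwt γ 0).comp m).mul (mSb m (wv_jm hf hY)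
    ((hl.comp (measurable_fst.comp measurable_snd)).sub (hl.comp (measurable_snd.comp measurable_snd)))))
lemma Dk_m {f : V3 → ℝ} {Y : V3 → V3} (hf : Measurable f) (hY : Measurable Y) : Measurable (Dk γ f Y) :=
  ((mwt γ 0).comp ch).mul
    (mSb ch (measurable_wv hf hY) (measurable_wv hf hY))
lemma Dk_nn (γ : ℝ) (f : V3 → ℝ) (Y : V3 → V3) (x : V3 × V3) : 0 ≤ Dk γ f Y x := mul_nonneg (wtn le_rfl _) (Sbn _ _)
end
section
variable {γ T E Hb p : ℝ} {f : ℝ → V3 → ℝ} {fG : ℝ → V3 × V3 → V3 × V3}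
lemma ysplit (H : IsHSolution γ T f fG) (hT : 0 < T) (hp : 4 ≤ p) (hm : ∀ t, Integrable fd) :
    ∀ᵐ s ∂(volume.restrict dp), WG (fun v => √(fb T f s v)) (Yb fn s) ∧
      ∀ᵐ x : V3 × V3, fG s x = (√(fb T f s x.2) • Yb fn s x.1, √(fb T f s x.1) • Yb fn s x.2) ∧
        √(f s x.1 * f s x.2) = √(fb T f s x.1) * √(fb T f s x.2) := by
  filter_upwards [H.weakGrad, ae_restrict_mem measurableSet_Icc] with s hs h
  have ef := fb_ae H hT s
  rw [cl_eq h] at ef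
  have m : Measurable (fun v => fb T f s v) := (fb_meas H hT).comp (measurable_prodMk_left (x := s))
  have i := sqrt_int hp m (fb_nn T f s) (hm s)
  have e2 : ∀ᵐ x : V3 × V3, √(f s x.1 * f s x.2) = √(fb T f s x.1) * √(fb T f s x.2) := by
    filter_upwards [Measure.quasiMeasurePreserving_fst.ae ef, Measure.quasiMeasurePreserving_snd.ae ef] with x h1 h2
    rw [h1, h2, sqrt_mul (H.nonneg s h _)]
  have hG : IsWeakGrad6 (fun x => √(fb T f s x.1) * √(fb T f s x.2)) (fG s) := fun φ a b e => by
    rw [← hs φ a b e]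
    exact integral_congr_ae (e2.mono fun x hx => by simp only [hx])
  have hn : ¬ ((fun v => √(fb T f s v)) =ᵐ[volume] 0) := fun h0 => by
    have h1 := H.mass s h
    rw [← integral_congr_ae ef, integral_eq_zero_of_ae] at h1
    · exact zero_ne_one h1
    · filter_upwards [h0] with v hv
      exact (sqrt_eq_zero (fb_nn T f s v)).1 hv
  obtain ⟨Y, hY, hYG⟩ := weakGrad6_split (u := fun v => √(fb T f s v)) i hn hG
  have eY := Yb_ae hY
  refine ⟨hY.congr (ae_eq_refl _) eY.symm, ?_⟩
  filter_upwards [hYG, e2, Measure.quasiMeasurePreserving_fst.ae eY, Measure.quasiMeasurePreserving_snd.ae eY] with x h1 h2 h3 h4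
  rw [h3, h4]; exact ⟨h1, h2⟩
lemma dis_eq {G : V3 × V3 → V3 × V3} {u : V3 → ℝ} {Y : V3 → V3} (h : ∀ᵐ x : V3 × V3, G x = (√(u x.2) • Y x.1, √(u x.1) • Y x.2)) :
    dissipation γ G = ∫⁻ x, ENNReal.ofReal (Dk γ u Y x) := by
  refine lintegral_congr_ae ?_
  filter_upwards [h, ae_sub_ne] with x hx hz
  rw [quadForm, bilin_landau γ hz, hx]; rfl
def Dd (γ : ℝ) (f : ℝ → V3 → ℝ) (Y : ℝ → V3 → V3) (s : ℝ) : ℝ := ∫ x, Dk γ (f s) (Y s) x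
lemma statD (H : IsHSolution γ T f fG) (hT : 0 < T) (hp : 4 ≤ p) (hm : ∀ t, Integrable fd)
    (hE : (∫ v, ‖v‖ ^ 2 * f 0 v) ≤ E) (hH : entropy (f 0) ≤ Hb) :
    (∀ᵐ s ∂(volume.restrict ca), Stat γ E Hb (fb T f s) (Yb fn s)) ∧
    IntegrableOn (Dd γ fn (Yb fn)) ca ∧
    ∀ t ∈ Icc 0 T, entropy (fb T f t) + 2 * (∫ s in (0 : ℝ)..t, Dd γ fn (Yb fn) s) ≤ entropy (fb T f 0) := by
  have hy := ae_restrict_of_ae_restrict_of_subset (Set.Ioc_subset_Icc_self (a := cu) (b := T)) (ysplit H hT hp hm)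
  have fm := fb_meas H hT
  have Ym := Yb_meas fm
  have fsm : ∀ s, Measurable (fb T f s) := fun s => fm.comp (measurable_prodMk_left (x := s))
  have Ysm : ∀ s, Measurable (Yb fn s) := fun s => Ym.comp (measurable_prodMk_left (x := s))
  have dens := fb_dens H hT hE hH
  set F := fb T f
  set Y := Yb F
  have jm : Measurable (fun y : ℝ × ec => ENNReal.ofReal (Dk γ (F y.1) (Y y.1) y.2)) := (Dk_jm fm Ym).ennreal_ofReal
  have Lm : Measurable (fun s => ∫⁻ x, ENNReal.ofReal el) := jm.lintegral_prod_right'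
  have eq : ∀ t ∈ Icc 0 T, (∫⁻ s in Ioc cq t, dissipation γ (fG s)) = ∫⁻ s in Ioc cq t, ∫⁻ x, ENNReal.ofReal el := fun t ht => by
    refine lintegral_congr_ae ?_
    filter_upwards [ae_restrict_of_ae_restrict_of_subset (Set.Ioc_subset_Ioc_right ht.2) hy] with s hs
    exact dis_eq (hs.2.mono fun x hx => hx.1)
  have fin := H.dissipationFinite T ⟨hT.le, le_rfl⟩
  rw [eq T ⟨hT.le, le_rfl⟩] at fin
  have eD : Dd γ F Y = fun s => (∫⁻ x, ENNReal.ofReal el).toReal := funext fun s =>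
    integral_eq_lintegral_of_nonneg_ae (aeo fun x => Dk_nn _ _ _ x)
      (Dk_m (fsm s) (Ysm s)).aestronglyMeasurable
  refine ⟨?_, ?_, fun t ht => ?_⟩
  · filter_upwards [hy, ae_lt_top Lm fin.ne] with s hs h
    refine ⟨dens s, Ysm s, hs.1,
      (Dk_m (fsm s) (Ysm s)).aestronglyMeasurable, ?_⟩
    change HasFiniteIntegral (Dk γ (F s) (Y s)) volume
    rw [hasFiniteIntegral_iff_ofReal (aeo fun x => Dk_nn γ (F s) (Y s) x)]
    exact h
  · rw [eD]
    exact integrable_toReal_of_lintegral_ne_top Lm.aemeasurable fin.ne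
  · have h1 := H.entropyProd t ht
    have ft : (∫⁻ s in Ioc cq t, ∫⁻ x, ENNReal.ofReal el) < ⊤ :=
      (lintegral_mono_set (Set.Ioc_subset_Ioc_right ht.2)).trans_lt fin
    have ee : ∀ t ∈ Icc 0 T, entropy (F t) = entropy (f t) := fun t ht => by
      refine integral_congr_ae ?_
      filter_upwards [fb_ae H hT t] with v hv
      rw [show F t v = f t v from by rw [show F t v = _ from hv, cl_eq ht]]
    rw [intervalIntegral.integral_of_le ht.1, eD, integral_toReal Lm.aemeasurable (ae_lt_top Lm ft.ne), ← eq t ht, ee t ht,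
      ee 0 ⟨le_rfl, hT.le⟩]
    exact h1
lemma wf0 (H : IsHSolution γ T f fG) (hT : 0 < T) (hp : 4 ≤ p) (hm : ∀ t, Integrable fd)
    {φ : V3 → ℝ} (hφ : ContDiff ℝ 2 φ) (hc : HasCompactSupport φ) {t : ℝ} (ht : t ∈ Icc 0 T) :
    (∫ v, φ v * fb T f t v) - (∫ v, φ v * fb T f 0 v) = - ∫ s in (0:ℝ)..t, ∫ x, Ik γ (fb T f s) (Yb fn s) (gradient φ) x := by
  let η : ContDiffBump cq := ⟨T + 1, T + 2, by linarith, by linarith⟩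
  have η1 : ∀ s ∈ Icc 0 T, η =ᶠ[nhds s] 1 := fun s hs => by
    refine η.eventuallyEq_one_of_mem_ball ?_
    rw [Metric.mem_ball, dist_zero_right, norm_of_nonneg hs.1]
    show s < T + 1
    linarith [hs.2]
  have η1' : ∀ s ∈ Icc 0 T, η s = 1 := fun s hs => (η1 s hs).eq_of_nhds
  have h := H.weakForm (fun s v => η s * φ v) ((η.contDiff.comp contDiff_fst).mul (hφ.comp contDiff_snd))
    (HasCompactSupport.intro (η.hasCompactSupport.isCompact.prod hc.isCompact) fun x hx => by
      by_cases h1 : x.1 ∈ tsupport η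
      · rw [image_eq_zero_of_notMem_tsupport (f := φ) fun h2 => hx ⟨h1, h2⟩, mul_zero]
      · rw [image_eq_zero_of_notMem_tsupport h1, zero_mul]) t ht
  have h0 : cu ∈ Icc 0 T := ⟨le_rfl, hT.le⟩
  have ef : ∀ s ∈ Icc 0 T, (∫ v, η s * φ v * f s v) = ∫ v, φ v * fb T f s v := fun s hs => by
    refine integral_congr_ae ?_
    filter_upwards [fb_ae H hT s] with v hv
    rw [hv, cl_eq hs, η1' s hs, one_mul]
  have ed : (∫ s in (0 : ℝ)..t, ∫ v, deriv (fun r => η r * φ v) s * f s v) = 0 := by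
    rw [intervalIntegral.integral_congr (g := fun _ => 0), intervalIntegral.integral_zero]
    intro s hs
    rw [Set.uIcc_of_le ht.1] at hs
    have hs' : s ∈ Icc 0 T := ⟨hs.1, hs.2.trans ht.2⟩
    have : ∀ v, deriv (fun r => η r * φ v) s = 0 := fun v => by
      rw [Filter.EventuallyEq.deriv_eq (f := fun _ => φ v) ((η1 s hs').mono fun r hr => by simp [hr])]; simp
    simp [this]
  rw [ef t ht, ef 0 h0, ed, zero_sub] at h
  rw [h]; congr 1
  rw [intervalIntegral.integral_of_le ht.1, intervalIntegral.integral_of_le ht.1]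
  refine integral_congr_ae ?_
  have hy := ae_restrict_of_ae_restrict_of_subset ((Set.Ioc_subset_Ioc_right ht.2).trans (Set.Ioc_subset_Icc_self (a := cu) (b := T))) (ysplit H hT hp hm)
  filter_upwards [hy, ae_restrict_mem measurableSet_Ioc] with s hs hs'
  refine integral_congr_ae ?_
  filter_upwards [hs.2, ae_sub_ne] with x hx hz
  have : (fun v => η s * φ v) = φ := funext fun v => by rw [η1' s ⟨hs'.1.le, hs'.2.trans ht.2⟩, one_mul]
  rw [this, bilin_landau γ hz, hx.1, hx.2, Sb_comm]
  simp only [Ik, wv]; ring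
end
structure LB (κ ζ A B : ℝ) (l : V3 → V3) : Prop where
  m : Measurable l
  A0 : 0 ≤ A
  B0 : 0 ≤ B
  a : ∀ v w, dy ≤ A * mx v w ^ κ
  b : ∀ v w, dy ≤ B * ab * mx v w ^ ζ
lemma lip_of {l : V3 → V3} {B ζ : ℝ} (hB : 0 ≤ B) (hζ : 0 ≤ ζ) (hl : ContDiff ℝ 1 l) (h : ∀ v, ‖fderiv ℝ l v‖ ≤ B * jap v ^ ζ) (v w : V3) :
    dy ≤ B * ab * mx v w ^ ζ := by
  set r := max ‖v‖ ‖w‖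
  have hb : ∀ x ∈ Metric.closedBall ar r, ‖fderiv ℝ l x‖ ≤ B * mx v w ^ ζ := fun x hx => by
    refine (h x).trans (mll (rpow_le_rpow (jap_pos x).le ?_ hζ) hB)
    rw [mem_closedBall_zero_iff] at hx
    rcases le_max_iff.1 hx with h | h
    · refine le_max_of_le_left (sqrt_le_sqrt ?_); gcongr
    · refine le_max_of_le_right (sqrt_le_sqrt ?_); gcongr
  have := (convex_closedBall ar r).norm_image_sub_le_of_norm_fderiv_le
    (fun x _ => hl.differentiable one_ne_zero x) hb (x := w) (y := v) (by simp [r]) (by simp [r])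
  linarith
lemma ub_of {l : V3 → V3} {A κ : ℝ} (hA : 0 ≤ A) (hk : 0 ≤ κ) (h : ∀ v, ‖l v‖ ≤ A * jap v ^ κ) (v w : V3) :
    dy ≤ 2 * A * mx v w ^ κ := by
  have h1 := (h v).trans (mll (rpow_le_rpow (jap_pos v).le (jap_le_mx v w) hk) hA)
  have h2 := (h w).trans (mll (rpow_le_rpow (jap_pos w).le (jap_le_mx' v w) hk) hA)
  linarith [norm_sub_le (l v) (l w)]
lemma GS.LB {γ κ ζ ν p K1 K2 K3 : ℝ} {g q : V3 → ℝ} (G : GS γ κ ζ ν p K1 K2 K3 g q) : LB κ ζ (2 * K1) K3 lg :=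
  ⟨G.lcont.measurable, by linarith [G.K1n], G.K3n, G.ub, G.lip⟩
lemma GS.logb {γ κ ζ ν p K1 K2 K3 : ℝ} {g q : V3 → ℝ} (G : GS γ κ ζ ν p K1 K2 K3 g q) (v : V3) :
    |log em| ≤ (|log (g 0)| + K1) * jap v ^ (κ + 1) := by
  have hk : 0 ≤ κ := by linarith [G.par.hκ]
  have hb : ∀ x ∈ Metric.closedBall ar ‖v‖, ‖fderiv ℝ (fun w => log (g w)) x‖ ≤ K1 * jap v ^ κ := fun x hx => by
    have : ‖fderiv ℝ (fun w => log (g w)) x‖ = ‖logGrad g x‖ := by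
      rw [logGrad, gradient, LinearIsometryEquiv.norm_map]
    rw [this]
    refine (G.lb x).trans (mll (rpow_le_rpow (jap_pos x).le (sqrt_le_sqrt ?_) hk) G.K1n)
    rw [mem_closedBall_zero_iff] at hx
    gcongr
  have h1 := (convex_closedBall ar ‖v‖).norm_image_sub_le_of_norm_fderiv_le
    (fun x _ => G.logC2.differentiable two_ne_zero x) hb (x := 0) (y := v) cz cz
  rw [sub_zero, norm_eq_abs] at h1
  have h2 := abs_sub_abs_le_abs_sub (log em) (log (g 0))
  have h3 : K1 * jap v ^ κ * ‖v‖ ≤ K1 * jap v ^ (κ + 1) := by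
    rw [rpow_add (jap_pos v), rpow_one, ← mul_assoc]
    exact mll (nlj v) (mul_nonneg G.K1n (jpp v _).le)
  have h4 := mll (ojp v (a := κ + 1) ac) (abs_nonneg (log (g 0)))
  linarith
def mm (p : ℝ) (f : V3 → ℝ) (x : V3 × V3) : ℝ := f x.1 * (f x.2 * mx x.1 x.2 ^ p)
lemma Ik_m {γ : ℝ} {f : V3 → ℝ} {Y l : V3 → V3} (fm : Measurable f) (Ym : Measurable Y) (lm : Measurable l) : Measurable (Ik γ f Y l) :=
  (((fm.comp measurable_fst).sqrt).mul ((fm.comp measurable_snd).sqrt)).mul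
    (((mwt γ 0).comp ch).mul (mSb ch (measurable_wv fm Ym)
      ((lm.comp measurable_fst).sub (lm.comp measurable_snd))))
namespace SS
variable {γ κ ζ ν p K1 K2 K3 E Hb Mf Mg c : ℝ} {f g q : V3 → ℝ} {Y : V3 → V3}
local notation "𝕊" => SS γ κ ζ ν p K1 K2 K3 E Hb Mf Mg c f g q Y
lemma mmi (A : 𝕊) : Integrable (mm p f) ∧ (∫ x, mm p f x) ≤ 2 * Mf := by
  obtain ⟨Z1, Z2⟩ := A.Zint A.S.dens.meas A.S.dens.nn A.mf (α := 0) (β := 1) le_rfl zero_le_one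
  simp only [ZZ, zero_mul, zero_add, one_mul, A.S.dens.mass] at Z1 Z2
  exact ⟨Z1, Z2.trans (by linarith [A.Mfb])⟩
lemma Ib (A : 𝕊) {ζ' a b : ℝ} (hz : 0 ≤ ζ') (hzp : 2 * ζ' - γ ≤ p) {l : V3 → V3}
    (L : LB κ ζ' a b l) (x : V3 × V3) : |Ik γ f Y l x| ≤ Dk γ f Y x + 4 * bq * mm p f x := by
  have f0 := A.S.dens.nn
  have hw := wtn (γ := γ) le_rfl xd
  set B := aq • ao with hB
  have e1 : Ik γ f Y l x = wt γ 0 xd * Sb xd bh B := by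
    rw [hB, Sb_smul_right]; unfold Ik; ring
  have e2 : wt γ 0 xd * Sb xd B B ≤ 4 * bq * mm p f x := by
    have : wt γ 0 xd * Sb xd B B = f x.1 * (f x.2 * (wt γ 0 xd * Sb xd ao ao)) := by
      rw [hB, Sb_smul_right, Sb_smul_left]
      linear_combination (wt γ 0 xd * Sb xd ao ao) *
        (√(f x.2) * √(f x.2) * sqf f0 x.1 + f x.1 * sqf f0 x.2)
    rw [this, mm, mul_left_comm (4 * bq), mul_left_comm (4 * bq)]
    refine mll (mll ?_ (f0 _)) (f0 _)
    have hm := mx_pos x.1 x.2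
    have h1 := mll (Sb_le xd ao) hw
    by_cases h : x.1 - x.2 = 0
    · refine h1.trans (le_trans (b := 0) (le_of_eq (by simp [h])) pv)
    · have h2 := (kb_aux A.G.par.hγ A.G.par.hκ hz A.G.par.p1 A.G.par.p2 hzp L.A0 L.B0 h (L.a _ _) (L.b _ _)).2
      rw [rpow_add_two_eq (norm_pos_iff.2 h), ← wt_zero, mul_assoc] at h2
      exact h1.trans h2
  rw [e1]; unfold Dk
  clear_value B
  generalize wv f Y x.1 x.2 = a at *
  have h1 := mll (Sb_young xd a B) hw
  have h2 := mll (Sb_young xd a ((-1:ℝ) • B)) hw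
  simp only [Sb_smul_right, Sb_smul_left] at h2
  have h3 := mul_nonneg hw (Sbn xd a)
  have h4 := mul_nonneg hw (Sbn xd B)
  rw [abs_le]; constructor <;> linarith
lemma IbI (A : 𝕊) (a : ℝ) : Integrable (fun x => Dk γ f Y x + a * mm p f x) :=
  Integrable.add (f := Dk γ f Y) A.S.dis (A.mmi.1.const_mul a)
lemma Iabs (A : 𝕊) {ζ' a b : ℝ} (hz : 0 ≤ ζ') (hzp : 2 * ζ' - γ ≤ p) {l : V3 → V3}
    (L : LB κ ζ' a b l) : |∫ x, Ik γ f Y l x| ≤ cx + 4 * bq * (2 * Mf) := by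
  have h := norm_integral_le_of_norm_le (f := Ik γ f Y l) (A.IbI (4 * bq)) (aeo (A.Ib hz hzp L))
  rw [integral_add (f := Dk γ f Y) A.S.dis (A.mmi.1.const_mul _), integral_const_mul] at h
  refine h.trans ?_
  have := mll A.mmi.2 (show 0 ≤ 4 * bq by positivity)
  linarith
lemma Ilim (A : 𝕊) {ζ' a b : ℝ} (hz : 0 ≤ ζ') (hzp : 2 * ζ' - γ ≤ p) {l : ℕ → V3 → V3} {l0 : V3 → V3}
    (L : ∀ n, LB κ ζ' a b (l n)) (hl : ∀ v, Tendsto (fun n => l n v) atTop (nhds (l0 v))) :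
    Tendsto (fun n => ∫ x, Ik γ f Y (l n) x) atTop (nhds (∫ x, Ik γ f Y l0 x)) := by
  refine tendsto_integral_of_dominated_convergence (fun x => Dk γ f Y x + 4 * bq * mm p f x)
    (fun n => (Ik_m A.S.dens.meas A.S.Ym (L n).m).aestronglyMeasurable) (A.IbI _)
    (fun n => aeo (A.Ib hz hzp (L n))) (aeo fun x => ?_)
  refine Tendsto.const_mul _ (Tendsto.const_mul _ ?_)
  have hc : Continuous fun u : V3 => Sb xd bh u := by unfold Sb; fun_prop
  exact (hc.tendsto _).comp ((hl x.1).sub (hl x.2))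
end SS
structure TS (γ κ ζ ν p T E Hb Mf Mg c : ℝ) (K1 K2 K3 : ℝ → ℝ) (f g q : ℝ → V3 → ℝ) (Y : ℝ → V3 → V3) : Prop where
  hT : 0 < T
  fm : Measurable (fun x : ℝ × V3 => f x.1 x.2)
  Ym : Measurable (fun x : ℝ × V3 => Y x.1 x.2)
  D : ∀ t, Dens E Hb (f t)
  mf : ∀ t, Integrable (fun v => jap v ^ p * f t v)
  Mfb : ∀ t, (∫ v, jap v ^ p * f t v) ≤ Mf
  G : ∀ t, GS γ κ ζ ν p (K1 t) (K2 t) (K3 t) (g t) (q t)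
  Mgb : ∀ t, (∫ v, jap v ^ p * g t v) ≤ Mg
  c0 : 0 < c
  ell : ∀ t v ξ, c * jap v ^ γ * ‖ξ‖ ^ 2 ≤ ∫ w, f t w * aw
  km : Measurable (fun t => K1 t ^ 2 + K3 t ^ 2)
  ki : IntegrableOn (fun t => K1 t ^ 2 + K3 t ^ 2) ca
  K2m : Measurable K2
  K2i : IntegrableOn K2 ca
  St : ∀ᵐ s ∂(volume.restrict ca), Stat γ E Hb (f s) (Y s)
  Di : IntegrableOn (Dd γ f Y) ca
  ent : ∀ t ∈ Icc 0 T, entropy (f t) + 2 * (∫ s in (0 : ℝ)..t, Dd γ f Y s) ≤ entropy (f 0)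
  wf : ∀ φ : V3 → ℝ, ContDiff ℝ 2 φ → HasCompactSupport φ → ∀ t ∈ Icc 0 T,
    (∫ v, φ v * f t v) - (∫ v, φ v * f 0 v) = - ∫ s in (0:ℝ)..t, ∫ x, Ik γ (f s) (Y s) (gradient φ) x
  cd : ∀ φ : V3 → ℝ, ContDiff ℝ bn φ → HasCompactSupport φ → Continuous (fun t => ∫ v, φ v * f t v)
  qc : ∀ v, Continuous (fun t => q t v)
  ftc : ∀ v, ∀ r ∈ Icc 0 T, ∀ t ∈ Icc 0 T, log (g t v) - log (g r v) = ∫ s in r..t, q s v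
  gc : ∀ v, Continuous (fun t => g t v)
  ftg : ∀ v, ∀ r ∈ Icc 0 T, ∀ t ∈ Icc 0 T, g t v - g r v = ∫ s in r..t, g s v * q s v
namespace TS
variable {γ κ ζ ν p T E Hb Mf Mg c : ℝ} {K1 K2 K3 : ℝ → ℝ} {f g q : ℝ → V3 → ℝ} {Y : ℝ → V3 → V3}
local notation "𝕋" => TS γ κ ζ ν p T E Hb Mf Mg c K1 K2 K3 f g q Y
lemma logInt (A : 𝕋) (r t : ℝ) : Integrable (fun v => f t v * log (g r v)) := by
  have h := (A.G r).par.p0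
  have hk := (A.G r).par.hκ
  exact dom_int (A.D t).meas (A.D t).nn (A.mf t) (measurable_log.comp (A.G r).gcont.measurable)
    (C := |log (g r 0)| + K1 r) fun v => ((A.G r).logb v).trans
      (mll (jpm v ac) (add_nonneg (abs_nonneg _) (A.G r).K1n))
lemma gInt (A : 𝕋) (r : ℝ) : Integrable (g r) := by
  have := GS.momle (A.G r).gcont.measurable (fun v => ((A.G r).pos v).le) (A.G r).mom (a := 0) (by linarith [(A.G r).par.p0, (A.G r).par.hκ])
  simpa using this
lemma iH (A : 𝕋) (r t : ℝ) : Integrable (Hd (f t) (g r)) :=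
  (((A.D t).entInt.sub (A.logInt r t)).sub (A.D t).int).add (A.gInt r)
lemma ss (A : 𝕋) (r : ℝ) {t : ℝ} (S : Stat γ E Hb (f t) (Y t)) :
    SS γ κ ζ ν p (K1 r) (K2 r) (K3 r) E Hb Mf Mg c (f t) (g r) (q r) (Y t) :=
  ⟨A.G r, S, A.mf t, A.Mfb t, A.Mgb r, A.c0, A.ell t, A.iH r t⟩
lemma Im (A : 𝕋) {l : V3 → V3} (hl : Measurable l) :
    Measurable (fun s => ∫ x, Ik γ (f s) (Y s) l x) :=
  (Ik_jm A.fm A.Ym hl).stronglyMeasurable.integral_prod_right'.measurable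
lemma Ii (A : 𝕋) {ζ' a b : ℝ} (hz : 0 ≤ ζ') (hzp : 2 * ζ' - γ ≤ p) {l : V3 → V3}
    (L : LB κ ζ' a b l) : IntegrableOn (fun s => ∫ x, Ik γ (f s) (Y s) l x) ca := by
  refine Integrable.mono' (A.Di.add (integrable_const (4 * bq * (2 * Mf)))) (A.Im L.m).aestronglyMeasurable ?_
  filter_upwards [A.St] with s hs
  exact (A.ss 0 hs).Iabs hz hzp L
end TS
lemma chi_grad (R : ℝ) : gradient bt = fun v => R⁻¹ • gradient chi0 (R⁻¹ • v) := by
  funext v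
  rw [gradient, chi_fderiv, map_smul]; rfl
lemma chi0_grad_C1 : ContDiff ℝ 1 (gradient chi0) := grad_contDiff (chi0.contDiff (n := 2))
lemma chi_hess : ∃ C : ℝ, 0 ≤ C ∧ ∀ R : ℝ, 0 < R → ∀ v, ‖fderiv ℝ (gradient bt) v‖ ≤ C / R ^ 2 := by
  have hc : HasCompactSupport (gradient chi0) := by
    have := (chi0.hasCompactSupport).fderiv (𝕜 := ℝ)
    exact this.comp_left (g := fun L => (InnerProductSpace.toDual ℝ V3).symm L) (map_zero _)
  obtain ⟨C, hC⟩ := (hc.fderiv (𝕜 := ℝ)).exists_bound_of_continuous (chi0_grad_C1.continuous_fderiv cz)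
  refine ⟨C, (norm_nonneg _).trans (hC 0), fun R hR v => ?_⟩
  rw [chi_grad, fderiv_fun_const_smul, fderiv_comp_smul, smul_smul, norm_smul, norm_mul, norm_inv, norm_of_nonneg hR.le]
  · have := hC (R⁻¹ • v)
    rw [div_eq_inv_mul, pow_two, mul_inv]
    exact mll this pv
  · exact (chi0_grad_C1.differentiable one_ne_zero).differentiableAt.comp v ((differentiable_id.const_smul R⁻¹) v)
lemma far {φ : V3 → ℝ} {R : ℝ} (hR : 0 < R) {v : V3} (h : 2 * R < ‖v‖) : gradient (fun w => chi R w * φ w) =ᶠ[nhds v] fun _ => 0 := by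
  have ho : IsOpen {w : V3 | 2 * R < ‖w‖} := isOpen_lt continuous_const continuous_norm
  filter_upwards [ho.mem_nhds h] with w hw
  have : (fun w => chi R w * φ w) =ᶠ[nhds w] fun _ => 0 := by
    filter_upwards [ho.mem_nhds hw] with z hz
    rw [chi_eq_zero hR (le_of_lt hz), zero_mul]
  rw [gradient, this.fderiv_eq]; simp
lemma near {φ : V3 → ℝ} {R : ℝ} (hR : 0 < R) {v : V3} (h : ‖v‖ < R) : gradient (fun w => chi R w * φ w) v = gradient φ v := by
  have : (fun w => chi R w * φ w) =ᶠ[nhds v] φ := by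
    filter_upwards [(isOpen_lt continuous_norm continuous_const).mem_nhds h] with z hz
    rw [chi_eq_one hR (le_of_lt hz), one_mul]
  rw [gradient, this.fderiv_eq]; rfl
lemma grad_mul {a b : V3 → ℝ} (ha : ContDiff ℝ 2 a) (hb : ContDiff ℝ 2 b) :
    gradient (fun w => a w * b w) = fun v => a v • gradient b v + b v • gradient a v := by
  funext v
  rw [gradient, fderiv_fun_mul (ha.differentiable two_ne_zero v) (hb.differentiable two_ne_zero v), map_add, map_smul, map_smul]; rfl
lemma grad_norm (φ : V3 → ℝ) (v : V3) : ‖gradient φ v‖ = ‖fderiv ℝ φ v‖ := by rw [gradient, LinearIsometryEquiv.norm_map]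
lemma GS.cut {γ κ ζ ν p K1 K2 K3 : ℝ} {g q : V3 → ℝ} (G : GS γ κ ζ ν p K1 K2 K3 g q) :
    ∃ a b, ∀ n : ℕ, _root_.LB κ (max ζ κ) a b (gradient (fun v => chi ag v * log em)) := by
  obtain ⟨C, hC, hh⟩ := chi_hess
  have hk : 0 ≤ κ := by linarith [G.par.hκ]
  have k1 := G.K1n
  have k3 := G.K3n
  have cc := Cchi_pos
  set K0 := |log (g 0)| + K1
  have hK0 : 0 ≤ K0 := add_nonneg (abs_nonneg _) k1
  refine ⟨2 * (K1 + 3 * K0 * Cchi), K3 + 2 * Cchi * K1 + 3 * K0 * C, fun n => ?_⟩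
  set R := (n : ℝ) + 1
  have R1 : 1 ≤ R := by simp [R]
  have R0 : 0 < R := by linarith
  have c2 : ContDiff ℝ 2 bt := chi_contDiff R (n := 2)
  have hl : gradient (fun v => chi R v * log em) = fun v => chi R v • logGrad g v + log em • gradient bt v :=
    grad_mul c2 G.logC2
  have l1 : ContDiff ℝ 1 (gradient (fun v => chi R v * log em)) := grad_contDiff (c2.mul G.logC2)
  have i1 : Cchi / R ≤ Cchi := div_le_self cc.le R1
  have e1 : ∀ v : V3, ‖v‖ ≤ 2 * R → |log em| ≤ K0 * ey := fun v hv => by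
    refine (G.logb v).trans (mll ?_ hK0)
    rw [rpow_add (jap_pos v), rpow_one]
    exact mll ((jap_le_one_add v).trans ac) (jpp v _).le
  refine ⟨l1.continuous.measurable, by positivity, by positivity, ub_of pv hk fun v => ?_,
    lip_of pv (le_max_of_le_right hk) l1 fun v => ?_⟩
  · rcases le_or_gt ‖v‖ (2 * R) with hv | hv
    · rw [hl]
      have j := jpp v κ
      have h1 : ‖chi R v • logGrad g v‖ ≤ K1 * jap v ^ κ := by
        rw [norm_smul, norm_of_nonneg (chi_nonneg R v)]
        exact (mul_le_of_le_one_left (norm_nonneg _) (chi_le_one R v)).trans (G.lb v)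
      have h2 : ‖log em • gradient bt v‖ ≤ K0 * ey * (Cchi / R) := by
        rw [norm_smul, grad_norm]
        exact mul_le_mul (e1 v hv) (chi_fderiv_le R0 v) (norm_nonneg _) pv
      have h3 : K0 * ey * (Cchi / R) = 3 * K0 * Cchi * jap v ^ κ := by field_simp
      refine (norm_add_le _ _).trans ?_
      linarith
    · rw [(far R0 hv).eq_of_nhds, norm_zero]
      have j := jpp v κ
      positivity
  · rcases le_or_gt ‖v‖ (2 * R) with hv | hv
    · have j := jpp v κ
      have jm : jap v ^ κ ≤ jap v ^ (max ζ κ) := jpm v (le_max_right _ _)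
      have jz : jap v ^ ζ ≤ jap v ^ (max ζ κ) := jpm v (le_max_left _ _)
      have d1 : HasFDerivAt bt (fderiv ℝ bt v) v := (c2.differentiable two_ne_zero v).hasFDerivAt
      have d2 : HasFDerivAt lg (fderiv ℝ lg v) v := (G.lC1.differentiable one_ne_zero v).hasFDerivAt
      have d3 : HasFDerivAt (fun v => log em) (fderiv ℝ (fun v => log em) v) v := (G.logC2.differentiable two_ne_zero v).hasFDerivAt
      have d4 : HasFDerivAt (gradient bt) (fderiv ℝ (gradient bt) v) v := ((grad_contDiff c2).differentiable one_ne_zero v).hasFDerivAt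
      rw [hl, ((d1.fun_smul d2).fun_add (d3.fun_smul d4)).fderiv]
      have n1 : ‖chi R v • fderiv ℝ lg v‖ ≤ K3 * jap v ^ (max ζ κ) := by
        rw [norm_smul, norm_of_nonneg (chi_nonneg R v)]
        exact ((mul_le_of_le_one_left (norm_nonneg _) (chi_le_one R v)).trans ((norm_fderiv_grad_le G.logC2 v).trans (G.Lb v))).trans
          (mll jz k3)
      have n2 : ‖(fderiv ℝ bt v).smulRight fa‖ ≤ Cchi * (K1 * jap v ^ (max ζ κ)) := by
        rw [ContinuousLinearMap.norm_smulRight_apply]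
        exact mul_le_mul ((chi_fderiv_le R0 v).trans i1) ((G.lb v).trans (mll jm k1)) (norm_nonneg _) cc.le
      have n3 : ‖log em • fderiv ℝ (gradient bt) v‖ ≤ 3 * K0 * C * jap v ^ (max ζ κ) := by
        rw [norm_smul, norm_eq_abs]
        refine (mul_le_mul (e1 v hv) (hh R R0 v) (norm_nonneg _) pv).trans ?_
        have : K0 * ey * (C / R ^ 2) = 3 * K0 * C * jap v ^ κ / R := by field_simp
        rw [this]
        exact (div_le_self pv R1).trans (mll jm pv)
      have n4 : ‖(fderiv ℝ (fun v => log em) v).smulRight (gradient bt v)‖ ≤ K1 * jap v ^ (max ζ κ) * Cchi := by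
        rw [ContinuousLinearMap.norm_smulRight_apply, ← grad_norm, grad_norm bt]
        exact mul_le_mul ((G.lb v).trans (mll jm k1)) ((chi_fderiv_le R0 v).trans i1) (norm_nonneg _) (mul_nonneg k1 (jpp v _).le)
      refine (norm_add_le _ _).trans ((add_le_add (norm_add_le _ _) (norm_add_le _ _)).trans ?_)
      linarith
    · rw [(far R0 hv).fderiv_eq]
      have j := jpp v (max ζ κ)
      simp only [fderiv_fun_const, Pi.zero_apply, norm_zero]
      positivity
namespace TS
variable {γ κ ζ ν p T E Hb Mf Mg c : ℝ} {K1 K2 K3 : ℝ → ℝ} {f g q : ℝ → V3 → ℝ} {Y : ℝ → V3 → V3}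
local notation "𝕋" => TS γ κ ζ ν p T E Hb Mf Mg c K1 K2 K3 f g q Y
def Aa (f g : ℝ → V3 → ℝ) (r t : ℝ) : ℝ := ∫ v, f t v * log (g r v)
def II (γ : ℝ) (f g : ℝ → V3 → ℝ) (Y : ℝ → V3 → V3) (r s : ℝ) : ℝ := ∫ x, Ik γ (f s) (Y s) (logGrad (g r)) x
lemma wf0t (A : 𝕋) (r : ℝ) {t : ℝ} (ht : t ∈ Icc 0 T) :
    Aa f g r t - Aa f g r 0 = - ∫ s in (0:ℝ)..t, II γ f g Y r s := by
  obtain ⟨a, b, L⟩ := (A.G r).cut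
  have hz : 0 ≤ max ζ κ := le_max_of_le_left (A.G r).par.hζ
  have hzp : 2 * max ζ κ - γ ≤ p := by
    rcases max_cases ζ κ with h | h <;> rw [h.1]
    · exact (A.G r).par.p3
    · exact (A.G r).par.p1
  have hA : ∀ t, Tendsto (fun n : ℕ => ∫ v, chi ag v * log (g r v) * f t v) atTop (nhds (Aa f g r t)) := fun t => by
    refine tendsto_integral_of_dominated_convergence (fun v => |f t v * log (g r v)|) (fun n => ?_) (A.logInt r t).abs
      (fun n => aeo fun v => ?_) (aeo fun v => ?_)
    · exact (((chi_contDiff _ (n := 0)).continuous.measurable.mul (measurable_log.comp (A.G r).gcont.measurable)).mul (A.D t).meas).aestronglyMeasurable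
    · rw [mul_assoc, norm_mul, norm_of_nonneg (chi_nonneg _ v), mul_comm (log _)]
      exact mul_le_of_le_one_left (norm_nonneg _) (chi_le_one _ v)
    · have := ((chi_tendsto v).mul_const (log (g r v))).mul_const (f t v)
      rwa [one_mul, mul_comm (log _)] at this
  have hI : Tendsto (fun n : ℕ => ∫ s in (0:ℝ)..t, ∫ x, Ik γ (f s) (Y s) (gradient (fun v => chi ag v * log (g r v))) x)
      atTop (nhds (∫ s in (0:ℝ)..t, II γ f g Y r s)) := by
    have sub : Ioc 0 t ⊆ Ioc 0 T := Set.Ioc_subset_Ioc_right ht.2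
    simp only [intervalIntegral.integral_of_le ht.1]
    refine tendsto_integral_of_dominated_convergence (fun s => Dd γ f Y s + 4 * bq * (2 * Mf))
      (fun n => (A.Im (L n).m).aestronglyMeasurable) (Integrable.add (f := Dd γ f Y) (A.Di.mono_set sub) (integrable_const _)) (fun n => ?_) ?_
    · filter_upwards [ae_restrict_of_ae_restrict_of_subset sub A.St] with s hs
      exact (A.ss r hs).Iabs hz hzp (L n)
    · filter_upwards [ae_restrict_of_ae_restrict_of_subset sub A.St] with s hs
      refine (A.ss r hs).Ilim hz hzp L fun v => tendsto_const_nhds.congr' ?_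
      filter_upwards [Filter.eventually_gt_atTop ⌈‖v‖⌉₊] with n hn
      have : ‖v‖ < (n : ℝ) + 1 := ((Nat.le_ceil _).trans (Nat.cast_le.2 hn.le)).trans_lt (lt_add_one _)
      exact (near pv this).symm
  refine tendsto_nhds_unique ((hA t).sub (hA 0)) (hI.neg.congr fun n => ?_)
  exact (A.wf _ ((chi_contDiff _ (n := 2)).mul (A.G r).logC2) ((chi_cpt pv).mul_right) t ht).symm
lemma IIm (A : 𝕋) (r : ℝ) : Measurable (II γ f g Y r) := A.Im (A.G r).lcont.measurable
lemma IIb (A : 𝕋) : ∀ᵐ s ∂(volume.restrict ca), ∀ r,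
    |II γ f g Y r s| ≤ Dd γ f Y s + 32 * Mf * (K1 r ^ 2 + K3 r ^ 2) := by
  filter_upwards [A.St] with s hs r
  have h := (A.ss r hs).Iabs (A.G r).par.hζ (A.G r).par.p3 (A.G r).LB
  have : 0 ≤ Mf := (integral_nonneg fun v => mul_nonneg (jpp v p).le fo).trans (A.Mfb 0)
  refine h.trans ?_
  unfold Dd
  nlinarith [mul_nonneg this (sq_nonneg (K3 r))]
lemma IIi (A : 𝕋) (r : ℝ) : IntegrableOn (II γ f g Y r) ca :=
  A.Ii (A.G r).par.hζ (A.G r).par.p3 (A.G r).LB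
end TS
lemma pick {k : ℝ → ℝ} (k0 : ∀ r, 0 ≤ k r) {a b : ℝ} (h : a ≤ b) : ∃ t ∈ Icc a b, ∀ s ∈ Icc a b, k t ≤ k s + 1 := by
  have hne : (Icc a b).Nonempty := Set.nonempty_Icc.2 h
  refine ⟨_, Function.argminOn_mem (fun s => ⌊k s⌋₊) _ hne, fun s hs => ?_⟩
  have := Function.argminOn_le (fun s => ⌊k s⌋₊) (Icc a b) hs
  refine (Nat.lt_floor_add_one _).le.trans (add_le_add_left ((Nat.cast_le.2 this).trans (Nat.floor_le (k0 s))) 1)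
lemma cmeas {F : ℝ → ℕ → ℝ} (hF : ∀ j, Measurable (fun x => F x j)) {i : ℝ → ℕ} (hi : Measurable i) : Measurable (fun x => F x (i x)) :=
  (measurable_from_prod_countable_left (f := fun x : ℝ × ℕ => F x.1 x.2) hF).comp (measurable_id.prodMk hi)
lemma tele {τ C : ℝ} (hτ : 0 < τ) (hC : 0 ≤ C) {A Q I : ℝ → ℝ → ℝ} {BQ BI k : ℝ → ℝ}
    (h1 : ∀ r ∈ Icc 0 τ, ∀ r' ∈ Icc 0 τ, ∀ t, A r' t - A r t = ∫ ρ in r..r', Q ρ t)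
    (h2 : ∀ r, ∀ t ∈ Icc 0 τ, ∀ t' ∈ Icc 0 τ, A r t' - A r t = - ∫ σ in t..t', I r σ)
    (Qm : ∀ t, Measurable (fun ρ => Q ρ t)) (Im : ∀ r, Measurable (I r))
    (Qb : ∀ ρ t, |Q ρ t| ≤ BQ ρ) (Qi : IntegrableOn BQ cf) (Qc : ∀ ρ, Continuous (Q ρ))
    (Ib : ∀ᵐ σ ∂(volume.restrict cf), ∀ r, |I r σ| ≤ BI σ + C * k r)
    (Bi : IntegrableOn BI cf) (ki : IntegrableOn k cf) (k0 : ∀ r, 0 ≤ k r)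
    (Ic : ∀ᵐ σ ∂(volume.restrict cf), ∀ r : ℕ → ℝ, (∀ n, r n ∈ Icc 0 τ) → (∀ n, k (r n) ≤ k σ + 1) →
      Tendsto r atTop (nhds σ) → Tendsto (fun n => I (r n) σ) atTop (nhds (I σ σ))) :
    IntegrableOn (fun σ => Q σ σ) cf ∧ IntegrableOn (fun σ => I σ σ) cf ∧
      A τ τ - A 0 0 = (∫ σ in (0:ℝ)..τ, Q σ σ) - ∫ σ in (0:ℝ)..τ, I σ σ := by
  let h : ℕ → ℝ := fun n => τ / (n + 1 : ℝ)
  have hp : ∀ n, 0 < h n := fun n => by positivity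
  have hl : Tendsto h atTop (nhds 0) := by
    have := (tendsto_one_div_add_atTop_nhds_zero_nat (𝕜 := ℝ)).const_mul τ
    simpa [h, div_eq_mul_inv] using this
  let x : ℕ → ℕ → ℝ := fun n i => i * h n
  have xs : ∀ n i, x n dd = x n i + h n := fun n i => by simp [x]; ring
  have xle : ∀ n i, x n i ≤ x n dd := fun n i => by rw [xs]; linarith [hp n]
  have xN : ∀ n, x n (n + 1) = τ := fun n => by simp only [x, h]; push_cast; field_simp
  have xm : ∀ n i, i ≤ n + 1 → x n i ∈ Icc 0 τ := fun n i hi => by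
    refine ⟨by have := hp n; positivity, ?_⟩
    rw [← xN n]; exact mlr (Nat.cast_le.2 hi) (hp n).le
  choose t tm tk using fun n i => pick k0 (xle n i)
  let ix : ℕ → ℝ → ℕ := fun n s => ⌈s / h n⌉₊ - 1
  have ixm : ∀ n, Measurable (ix n) := fun n => (measurable_of_countable (fun m : ℕ => m - 1)).comp (Nat.measurable_ceil.comp (measurable_id.div_const _))
  have ixe : ∀ n i s, s ∈ Ioc (x n i) (x n dd) → ix n s = i := fun n i s hs => by
    have : ⌈s / h n⌉₊ = i + 1 := by
      rw [Nat.ceil_eq_iff (by omega)]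
      refine ⟨?_, ?_⟩
      · rw [lt_div_iff₀ (hp n)]; exact hs.1
      · rw [div_le_iff₀ (hp n)]; exact hs.2
    simp [ix, this]
  have ixc : ∀ n s, s ∈ Ioc 0 τ → ix n s ≤ n ∧ s ∈ Icc (x n (ix n s)) (x n (ix n s + 1)) := fun n s hs => by
    have h0 : 0 < s / h n := div_pos hs.1 (hp n)
    have h1 : 1 ≤ ⌈s / h n⌉₊ := Nat.one_le_ceil_iff.2 h0
    obtain ⟨j, hj⟩ : ∃ j, ⌈s / h n⌉₊ = j + 1 := ⟨_, (Nat.sub_add_cancel h1).symm⟩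
    have hi : ix n s = j := by simp [ix, hj]
    have h2 := (Nat.ceil_eq_iff (by omega)).1 hj
    rw [lt_div_iff₀ (hp n), div_le_iff₀ (hp n)] at h2
    rw [hi]
    refine ⟨?_, h2.1.le, h2.2⟩
    by_contra hc
    have : (n + 1 : ℝ) ≤ j := by exact_mod_cast (not_le.1 hc)
    have := mlr this (hp n).le
    have e := xN n
    simp only [x] at e
    push_cast at e
    have h3 : (j : ℝ) * h n < s := h2.1
    linarith [hs.2]
  let sn : ℕ → ℝ → ℝ := fun n s => t n (ix n s)
  let yn : ℕ → ℝ → ℝ := fun n s => if s ≤ t n (ix n s) then x n (ix n s) else x n (ix n s + 1)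
  have lim : ∀ (z : ℕ → ℝ → ℝ), (∀ n s, s ∈ Ioc 0 τ → z n s ∈ Icc (x n (ix n s)) (x n (ix n s + 1))) →
      ∀ s ∈ Ioc 0 τ, Tendsto (fun n => z n s) atTop (nhds s) := fun z hz s hs => by
    rw [tendsto_iff_dist_tendsto_zero]
    refine squeeze_zero (fun _ => dist_nonneg) (fun n => ?_) hl
    have a := hz n s hs
    have b := (ixc n s hs).2
    rw [xs] at a b
    rw [dist_eq, abs_le]
    constructor <;> linarith [a.1, a.2, b.1, b.2]
  have sl := lim sn fun n s hs => tm n _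
  have yl := lim yn fun n s hs => by
    simp only [yn]; split_ifs
    · exact ⟨le_rfl, xle n _⟩
    · exact ⟨xle n _, le_rfl⟩
  have Qnm : ∀ n, Measurable (fun s => Q s (yn n s)) := fun n => by
    have := cmeas (F := fun s j => if s ≤ t n j then Q s (x n j) else Q s (x n (j + 1)))
      (fun j => Measurable.ite (measurableSet_le measurable_id measurable_const) (Qm _) (Qm _)) (ixm n)
    convert this using 2 with s
    simp only [yn]
    split_ifs <;> rfl
  have Inm : ∀ n, Measurable (fun s => I (sn n s) s) := fun n => cmeas (F := fun s j => I (t n j) s) (fun j => Im _) (ixm n)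
  have Qni : ∀ n, IntegrableOn (fun s => Q s (yn n s)) cf := fun n =>
    Qi.mono' (Qnm n).aestronglyMeasurable (aeo fun s => Qb s _)
  have mem : ∀ᵐ s ∂(volume.restrict cf), s ∈ Ioc 0 τ := ae_restrict_mem measurableSet_Ioc
  have Inb : ∀ n, ∀ᵐ s ∂(volume.restrict cf), ‖I (sn n s) s‖ ≤ BI s + C * (k s + 1) := fun n => by
    filter_upwards [Ib, mem] with s hb hs
    exact (hb _).trans (by linarith [mll (tk n _ s (ixc n s hs).2) hC])
  have bi : IntegrableOn (fun s => BI s + C * (k s + 1)) cf :=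
    Integrable.add (f := BI) Bi (Integrable.const_mul (Integrable.add (f := k) ki (integrable_const 1)) C)
  have Ini : ∀ n, IntegrableOn (fun s => I (sn n s) s) cf := fun n =>
    Integrable.mono' bi (Inm n).aestronglyMeasurable (Inb n)
  have Ql : ∀ᵐ s ∂(volume.restrict cf), Tendsto (fun n => Q s (yn n s)) atTop (nhds (Q s s)) := by
    filter_upwards [mem] with s hs
    exact ((Qc s).tendsto s).comp (yl s hs)
  have Il : ∀ᵐ s ∂(volume.restrict cf), Tendsto (fun n => I (sn n s) s) atTop (nhds (I s s)) := by
    filter_upwards [mem, Ic] with s hs hc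
    refine hc _ (fun n => ?_) (fun n => tk n _ s (ixc n s hs).2) (sl s hs)
    have a := tm n (ix n s)
    have b := (ixc n s hs).1
    exact ⟨(xm n _ (by omega)).1.trans a.1, a.2.trans (xm n _ (by omega)).2⟩
  have key : ∀ n, A τ τ - A 0 0 = (∫ s in (0:ℝ)..τ, Q s (yn n s)) - ∫ s in (0:ℝ)..τ, I (sn n s) s := fun n => by
    have sub : ∀ i < n + 1, Ioc (x n i) (x n dd) ⊆ Ioc 0 τ := fun i hi =>
      Set.Ioc_subset_Ioc (xm n i (by omega)).1 (xm n _ (by omega)).2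
    have sumf : ∀ F : ℝ → ℝ, IntegrableOn F cf → (∫ s in (0:ℝ)..τ, F s) = ∑ i ∈ Finset.range (n + 1), ∫ s in (x n i)..(x n dd), F s := fun F hF => by
      rw [intervalIntegral.sum_integral_adjacent_intervals fun i hi => (intervalIntegrable_iff_integrableOn_Ioc_of_le (xle n i)).2 (hF.mono_set (sub i hi)), xN]
      simp [x]
    rw [sumf _ (Qni n), sumf _ (Ini n), ← Finset.sum_sub_distrib]
    have : A τ τ - A 0 0 = ∑ i ∈ Finset.range (n + 1), (A (x n dd) (x n dd) - A (x n i) (x n i)) := by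
      rw [Finset.sum_range_sub (fun i => A (x n i) (x n i)), xN]; simp [x]
    rw [this]
    refine Finset.sum_congr rfl fun i hi => ?_
    rw [Finset.mem_range] at hi
    have m0 := xm n i (by omega)
    have m1 := xm n dd (by omega)
    have a := tm n i
    have mt : t n i ∈ Icc 0 τ := ⟨m0.1.trans a.1, a.2.trans m1.2⟩
    have e1 : (∫ s in (x n i)..(x n dd), I (sn n s) s) = ∫ s in (x n i)..(x n dd), I (t n i) s := by
      rw [intervalIntegral.integral_of_le (xle n i), intervalIntegral.integral_of_le (xle n i)]
      refine setIntegral_congr_fun measurableSet_Ioc fun s hs => ?_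
      simp only [sn, ixe n i s hs]
    have ii : ∀ a b, x n i ≤ a → b ≤ x n dd → a ≤ b → IntervalIntegrable (fun s => Q s (yn n s)) volume a b := fun a b h1 h2 h3 =>
      (intervalIntegrable_iff_integrableOn_Ioc_of_le h3).2 ((Qni n).mono_set ((Set.Ioc_subset_Ioc h1 h2).trans (sub i hi)))
    have e2 : (∫ s in (x n i)..(t n i), Q s (yn n s)) = ∫ s in (x n i)..(t n i), Q s (x n i) := by
      rw [intervalIntegral.integral_of_le a.1, intervalIntegral.integral_of_le a.1]
      refine setIntegral_congr_fun measurableSet_Ioc fun s hs => ?_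
      simp only [yn, ixe n i s ⟨hs.1, hs.2.trans a.2⟩, hs.2, if_true]
    have e3 : (∫ s in (t n i)..(x n dd), Q s (yn n s)) = ∫ s in (t n i)..(x n dd), Q s (x n dd) := by
      rw [intervalIntegral.integral_of_le a.2, intervalIntegral.integral_of_le a.2]
      refine setIntegral_congr_fun measurableSet_Ioc fun s hs => ?_
      simp only [yn, ixe n i s ⟨a.1.trans_lt hs.1, hs.2⟩, not_le.2 hs.1, if_false]
    rw [← intervalIntegral.integral_add_adjacent_intervals (ii _ _ le_rfl a.2 a.1) (ii _ _ a.1 le_rfl a.2), e1, e2, e3,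
      ← h1 _ m0 _ mt, ← h1 _ mt _ m1]
    have := h2 (t n i) _ m0 _ m1
    linarith
  have dQ : IntegrableOn (fun s => Q s s) cf := Qi.mono' (aestronglyMeasurable_of_tendsto_ae atTop (fun n => (Qnm n).aestronglyMeasurable) Ql)
    (aeo fun s => Qb s _)
  refine ⟨dQ, ?_, ?_⟩
  · refine Integrable.mono' bi (aestronglyMeasurable_of_tendsto_ae atTop (fun n => (Inm n).aestronglyMeasurable) Il) ?_
    filter_upwards [Ib] with s hb
    exact (hb s).trans ac
  · simp only [intervalIntegral.integral_of_le hτ.le] at key ⊢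
    refine tendsto_nhds_unique ((tendsto_const_nhds (f := (atTop : Filter ℕ))).congr key) (Tendsto.sub ?_ ?_)
    · exact tendsto_integral_of_dominated_convergence BQ (fun n => (Qnm n).aestronglyMeasurable) Qi (fun n => aeo fun s => Qb s _) Ql
    · exact tendsto_integral_of_dominated_convergence _ (fun n => (Inm n).aestronglyMeasurable) bi Inb Il
namespace TS
variable {γ κ ζ ν p T E Hb Mf Mg c : ℝ} {K1 K2 K3 : ℝ → ℝ} {f g q : ℝ → V3 → ℝ} {Y : ℝ → V3 → V3}
local notation "𝕋" => TS γ κ ζ ν p T E Hb Mf Mg c K1 K2 K3 f g q Y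
lemma qm (A : 𝕋) : Measurable (fun x : ℝ × V3 => q x.1 x.2) :=
  measurable_uncurry_of_continuous_of_measurable A.qc fun t => (A.G t).q_meas
lemma gm (A : 𝕋) : Measurable (fun x : ℝ × V3 => g x.1 x.2) :=
  measurable_uncurry_of_continuous_of_measurable A.gc fun t => (A.G t).gcont.measurable
lemma hq (A : 𝕋) {h : V3 → ℝ} {M : ℝ} (hm : Measurable h)
    (h0 : ∀ v, 0 ≤ h v) (hi : Integrable (fun v => jap v ^ p * h v)) (hM : (∫ v, jap v ^ p * h v) ≤ M) (s : ℝ) :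
    Integrable (fun v => h v * q s v) ∧ (∫ v, ‖h v * q s v‖) ≤ K2 s * M := by
  have G := A.G s
  have I := G.phiq_int hm h0 hi
  refine ⟨I, (integral_mono I.norm (hi.const_mul (K2 s)) fun v => ?_).trans ?_⟩
  · simp only [norm_mul, norm_of_nonneg (h0 v)]
    have a := mll ((G.qb v).trans (mll (jpm v (show ν ≤ p by linarith [G.par.p4, G.par.hγ.2])) G.K2n)) (h0 v)
    rw [norm_eq_abs]; linarith
  · rw [integral_const_mul]; exact mll hM G.K2n
lemma swap (A : 𝕋) {h : ℝ → V3 → ℝ} {M : ℝ} (hm : Measurable (fun x : ℝ × V3 => h x.1 x.2))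
    (h0 : ∀ s v, 0 ≤ h s v) (hi : ∀ s, Integrable (fun v => jap v ^ p * h s v)) (hM : ∀ s, (∫ v, jap v ^ p * h s v) ≤ M) {a b : ℝ}
    (ha : a ∈ Icc 0 T) (hb : b ∈ Icc 0 T) :
    (∫ v, ∫ s in a..b, h s v * q s v) = ∫ s in a..b, ∫ v, h s v * q s v := by
  refine (intervalIntegral_integral_swap ?_).symm
  have hs : Set.uIoc a b ⊆ Ioc 0 T := Set.Ioc_subset_Ioc (le_min ha.1 hb.1) (max_le ha.2 hb.2)
  have m : AEStronglyMeasurable (Function.uncurry fun s v => h s v * q s v) ((volume.restrict (Set.uIoc a b)).prod volume) := (hm.mul A.qm).aestronglyMeasurable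
  rw [integrable_prod_iff m]
  have hs' := fun s => A.hq (hm.comp measurable_prodMk_left) (h0 s) (hi s) (hM s) s
  refine ⟨aeo fun s => (hs' s).1, ((A.K2i.mono_set hs).mul_const M).mono' m.norm.integral_prod_right' (aeo fun s => ?_)⟩
  rw [norm_of_nonneg (integral_nonneg fun v => norm_nonneg _)]
  exact (hs' s).2
lemma mass (A : 𝕋) {t : ℝ} (ht : t ∈ Icc 0 T) : (∫ v, g t v) = ∫ v, g 0 v := by
  have h0 : cu ∈ Icc 0 T := ⟨le_rfl, A.hT.le⟩
  have := A.swap A.gm (fun s v => ((A.G s).pos v).le) (fun s => (A.G s).mom) A.Mgb h0 ht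
  simp only [(A.G _).int_gq, intervalIntegral.integral_zero, ← A.ftg _ 0 h0 t ht] at this
  rw [integral_sub (A.gInt t) (A.gInt 0)] at this
  linarith
def QQ (f q : ℝ → V3 → ℝ) (s t : ℝ) : ℝ := ∫ v, f t v * q s v
lemma tA (A : 𝕋) (r : ℝ) (hr : r ∈ Icc 0 T) (r' : ℝ) (hr' : r' ∈ Icc 0 T) (t : ℝ) :
    Aa f g r' t - Aa f g r t = ∫ s in r..r', QQ f q s t := by
  have := A.swap (h := fun _ => f t) ((A.D t).meas.comp measurable_snd) (fun _ => (A.D t).nn) (fun _ => A.mf t) (fun _ => A.Mfb t) hr hr'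
  unfold QQ
  rw [← this, Aa, Aa, ← integral_sub (A.logInt r' t) (A.logInt r t)]
  congr 1; funext v
  rw [intervalIntegral.integral_const_mul, ← A.ftc v r hr r' hr', mul_sub]
lemma Qm (A : 𝕋) (t : ℝ) : Measurable (fun s => QQ f q s t) :=
  (((A.D t).meas.comp measurable_snd).mul A.qm).stronglyMeasurable.integral_prod_right'.measurable
lemma Qb (A : 𝕋) (s t : ℝ) : |QQ f q s t| ≤ K2 s * Mf :=
  (norm_integral_le_integral_norm _).trans (A.hq (A.D t).meas (A.D t).nn (A.mf t) (A.Mfb t) s).2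
lemma c1 (A : 𝕋) {φ : V3 → ℝ} (hm : Measurable φ) {M : ℝ} (hM : ∀ v, |φ v| ≤ M) {R : ℝ}
    (hR : ∀ v, R < ‖v‖ → φ v = 0) : Continuous (fun t => ∫ v, f t v * φ v) := by
  have M0 : 0 ≤ M := (abs_nonneg _).trans (hM 0)
  have hs : Function.support φ ⊆ Metric.closedBall 0 R := fun v hv => by
    rw [mem_closedBall_zero_iff]; by_contra hc; exact hv (hR v (not_le.1 hc))
  have hc : HasCompactSupport φ := HasCompactSupport.intro (isCompact_closedBall 0 R) fun v hv => by
    by_contra h; exact hv (hs h)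
  have fin : volume (Metric.closedBall ar (R + 1)) ≠ ⊤ := measure_closedBall_lt_top.ne
  have pi : Integrable φ := by
    refine Integrable.mono' (g := Set.indicator (Metric.closedBall ar R) fun _ => M) ?_ hm.aestronglyMeasurable (aeo fun v => ?_)
    · exact (integrable_indicator_iff measurableSet_closedBall).2 (integrableOn_const measure_closedBall_lt_top.ne)
    · by_cases hv : v ∈ Metric.closedBall ar R
      · rw [Set.indicator_of_mem hv]; exact hM v
      · rw [Set.indicator_of_notMem hv, show φ v = 0 by by_contra h; exact hv (hs h)]; simp
  have li : LocallyIntegrable φ := pi.locallyIntegrable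
  have cb : ∀ n x, |cv n φ x| ≤ M := fun n x => by
    rw [cv_apply, ← norm_eq_abs]
    have i : Integrable (fun t => mol n (x - t)) := (mol_integrable n).comp_sub_left x
    refine (norm_integral_le_of_norm_le (i.mul_const M) (aeo fun t => ?_)).trans (le_of_eq ?_)
    · rw [norm_mul, norm_of_nonneg (mol_nonneg n _)]
      exact mll (hM t) (mol_nonneg n _)
    · rw [integral_mul_const, integral_sub_left_eq_self (mol n), mol_integral, one_mul]
  have cs : ∀ n x, x ∉ Metric.closedBall ar (R + 1) → cv n φ x = 0 := fun n x hx => by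
    refine cv_support n fun h => hx ?_
    have h1 : tsupport φ ⊆ Metric.closedBall 0 R := closure_minimal hs Metric.isClosed_closedBall
    rcases Set.eq_empty_or_nonempty (tsupport φ) with he | ⟨y, hy⟩
    · rw [he, Metric.cthickening_empty] at h; exact h.elim
    · have R0 : 0 ≤ R := dist_nonneg.trans (h1 hy)
      have := Metric.cthickening_subset_of_subset 1 h1 h
      rwa [cthickening_closedBall zero_le_one R0, add_comm] at this
  have cc : ∀ n, Continuous (cv n φ) := fun n => (cv_contDiff n li).continuous
  have dl : Tendsto (fun n => ∫ x, |cv n φ x - φ x|) atTop (nhds 0) := by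
    have := tendsto_integral_of_dominated_convergence (F := fun n x => |cv n φ x - φ x|) (f := fun _ => 0)
      (Set.indicator (Metric.closedBall ar (R + 1)) fun _ => 2 * M)
      (fun n => ((cc n).measurable.sub hm).norm.aestronglyMeasurable)
      ((integrable_indicator_iff measurableSet_closedBall).2 (integrableOn_const fin)) (fun n => aeo fun x => ?_) ?_
    · simpa using this
    · rw [norm_eq_abs, abs_abs]
      by_cases hv : x ∈ Metric.closedBall ar (R + 1)
      · rw [Set.indicator_of_mem hv]; exact (abs_sub _ _).trans (by linarith [hM x, cb n x])
      · rw [Set.indicator_of_notMem hv, cs n x hv, show φ x = 0 by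
          by_contra h; exact hv (Metric.closedBall_subset_closedBall ac (hs h))]; simp
    · filter_upwards [cv_ae li] with x hx
      simpa using (hx.sub_const (φ x)).abs
  have ai : ∀ n, Integrable (fun x => |cv n φ x - φ x|) := fun n =>
    (((cc n).integrable_of_hasCompactSupport (cv_compact n hc)).sub pi).abs
  have fb : ∀ {ψ : V3 → ℝ} (t : ℝ), Measurable ψ → (∀ v, |ψ v| ≤ M) → Integrable (fun v => f t v * ψ v) := fun {ψ} t h1 h2 =>
    (A.D t).int.mul_bdd (c := M) h1.aestronglyMeasurable (aeo h2)
  refine TendstoUniformly.continuous (F := fun (n : ℕ) t => ∫ v, f t v * cv n φ v) (p := atTop) ?_ (Filter.Frequently.of_forall fun n => ?_)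
  · rw [Metric.tendstoUniformly_iff]
    intro ε hε
    set X := 2 * M * |CUI E Hb| * 4 / ε + 1
    have X0 : 0 < X := by positivity
    have k0 := exp_pos X
    have := (dl.const_mul (exp X)).eventually (gt_mem_nhds (show exp X * 0 < ε / 2 by simp [hε]))
    filter_upwards [this] with n hn t
    have tl := (A.D t).tail_k (k := exp X) (by simpa using X0)
    rw [log_exp] at tl
    have tl2 : 2 * M * (∫ v in {v | exp X < f t v}, f t v) ≤ ε / 4 := by
      have := mll (tl.trans (le_abs_self _)) (show 0 ≤ 2 * M by positivity)
      have h5 : 0 ≤ ∫ v in {v | exp X < f t v}, f t v := integral_nonneg fun v => (A.D t).nn v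
      set Z := ∫ v in {v | exp X < f t v}, f t v
      by_contra hcon
      push Not at hcon
      have : X * (ε / 4) < X * (2 * M * Z) := mul_lt_mul_of_pos_left hcon X0
      have e : X * (ε / 4) = 2 * M * |CUI E Hb| + ε / 4 := by simp only [X]; field_simp
      nlinarith
    have ms : MeasurableSet {v | exp X < f t v} := measurableSet_lt measurable_const (A.D t).meas
    rw [dist_comm, dist_eq, ← norm_eq_abs, ← integral_sub (fb t (cc n).measurable (cb n)) (fb t hm hM)]
    have ib : Integrable (fun v => exp X * |cv n φ v - φ v| + 2 * M * Set.indicator {v | exp X < f t v} (f t) v) :=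
      ((ai n).const_mul _).add (((A.D t).int.indicator ms).const_mul _)
    refine (norm_integral_le_of_norm_le ib (aeo fun v => ?_)).trans_lt ?_
    · rw [← mul_sub, norm_mul, norm_of_nonneg ((A.D t).nn v), norm_eq_abs]
      by_cases hv : exp X < f t v
      · rw [Set.indicator_of_mem (by exact hv)]
        have : |cv n φ v - φ v| ≤ 2 * M := (abs_sub _ _).trans (by linarith [hM v, cb n v])
        have := mll this ((A.D t).nn v)
        have := mul_nonneg k0.le (abs_nonneg (cv n φ v - φ v))
        linarith
      · rw [Set.indicator_of_notMem (by exact hv), mul_zero, add_zero]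
        exact mlr (not_lt.1 hv) (abs_nonneg _)
    · rw [integral_add ((ai n).const_mul _) (((A.D t).int.indicator ms).const_mul _), integral_const_mul, integral_const_mul, integral_indicator ms]
      linarith
  · simp only [mul_comm (f _ _)]
    exact A.cd _ (cv_contDiff n li) (cv_compact n hc)
lemma Qc (A : 𝕋) (s : ℝ) : Continuous (QQ f q s) := by
  have G := A.G s
  have hpn : 0 < p - ν := by linarith [G.par.p4, G.par.hγ.2]
  have Mf0 : 0 ≤ Mf := (integral_nonneg fun v => mul_nonneg (jpp v p).le fo).trans (A.Mfb 0)
  have mS : ∀ n : ℕ, MeasurableSet {v : V3 | ‖v‖ ≤ (n : ℝ)} := fun n => measurableSet_le measurable_norm measurable_const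
  refine TendstoUniformly.continuous (F := fun (n : ℕ) t => ∫ v, f t v * Set.indicator {v | ‖v‖ ≤ (n : ℝ)} (q s) v) (p := atTop) ?_ (Filter.Frequently.of_forall fun n => ?_)
  · rw [Metric.tendstoUniformly_iff]
    intro ε hε
    have l : Tendsto (fun n : ℕ => K2 s * (n : ℝ) ^ dw * Mf) atTop (nhds (K2 s * 0 * Mf)) :=
      (((tendsto_rpow_neg_atTop hpn).comp tendsto_natCast_atTop_atTop).const_mul _).mul_const _
    filter_upwards [l.eventually (gt_mem_nhds (show K2 s * 0 * Mf < ε by simp [hε])), Filter.eventually_gt_atTop 0] with n hn n0 t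
    have qi := (A.hq (A.D t).meas (A.D t).nn (A.mf t) (A.Mfb t) s).1
    have qi' : Integrable (fun v => f t v * Set.indicator {v | ‖v‖ ≤ (n : ℝ)} (q s) v) := by
      simp only [← Set.indicator_mul_right]; exact qi.indicator (mS n)
    rw [dist_eq, ← norm_eq_abs, QQ, ← integral_sub qi qi']
    refine (norm_integral_le_of_norm_le ((A.mf t).const_mul (K2 s * (n : ℝ) ^ dw)) (aeo fun v => ?_)).trans_lt ?_
    · have j := jpp v p
      have f0 := (A.D t).nn v
      have := G.K2n
      rw [← mul_sub, norm_mul, norm_of_nonneg f0]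
      by_cases hv : ‖v‖ ≤ (n : ℝ)
      · rw [Set.indicator_of_mem (by exact hv), sub_self, norm_zero, mul_zero]; positivity
      · rw [Set.indicator_of_notMem (by exact hv), sub_zero]
        have nn : cq < n := Nat.cast_pos.2 n0
        have h1 : jap v ^ dw ≤ (n : ℝ) ^ dw :=
          rpow_le_rpow_of_nonpos nn ((not_le.1 hv).le.trans (nlj v)) ac
        have h2 : jap v ^ ν = jap v ^ dw * jap v ^ p := by rw [← rpow_add (jap_pos v)]; congr 1; ring
        have h3 : ‖q s v‖ ≤ K2 s * ((n : ℝ) ^ dw * jap v ^ p) :=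
          (G.qb v).trans (mll (by rw [h2]; exact mlr h1 j.le) this)
        linarith [mll h3 f0]
    · rw [integral_const_mul]
      have : 0 ≤ K2 s * (n : ℝ) ^ dw := mul_nonneg G.K2n pv
      exact (mll (A.Mfb t) this).trans_lt hn
  · refine A.c1 (G.q_meas.indicator (mS n)) (M := K2 s * (1 + n) ^ ν) (fun v => ?_) (R := n) fun v hv => Set.indicator_of_notMem (by simpa using hv) _
    have hn := G.par.hν
    have := G.K2n
    by_cases hv : ‖v‖ ≤ (n : ℝ)
    · rw [Set.indicator_of_mem (by exact hv)]
      exact (G.qb v).trans (mll (rpow_le_rpow (jap_pos v).le ((jap_le_one_add v).trans ac) ac) this)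
    · rw [Set.indicator_of_notMem (by exact hv), abs_zero]; positivity
end TS
lemma gl1 {φ : V3 → ℝ} (hd : Differentiable ℝ φ) {C : ℝ} (hC : 0 ≤ C) {v e : V3} (he : ‖e‖ = 1)
    (hL : ∀ w ∈ Metric.closedBall v 1, ‖gradient φ w - gradient φ v‖ ≤ C * ‖w - v‖) {s : ℝ} (s0 : 0 < s) (s1 : s ≤ 1) :
    |φ (v + s • e) - φ v - s * fderiv ℝ φ v e| ≤ C * s ^ 2 := by
  have hse : ‖s • e‖ = s := by rw [norm_smul, he, mul_one, norm_of_nonneg s0.le]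
  have := Convex.norm_image_sub_le_of_norm_hasFDerivWithin_le' (𝕜 := ℝ) (f := φ) (f' := fderiv ℝ φ) (φ := fderiv ℝ φ v) (C := C * s)
    (s := Metric.closedBall v s) (x := v) (y := v + s • e) (fun w _ => (hd w).hasFDerivAt.hasFDerivWithinAt) (fun w hw => ?_)
    (convex_closedBall v s) (Metric.mem_closedBall_self s0.le) (by simp [hse])
  · rw [add_sub_cancel_left, hse, map_smul, smul_eq_mul, norm_eq_abs] at this
    linarith
  · have h := hL w (Metric.closedBall_subset_closedBall s1 hw)
    rw [gradient, gradient, ← map_sub, LinearIsometryEquiv.norm_map] at h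
    rw [mem_closedBall_iff_norm] at hw
    exact h.trans (mll hw hC)
lemma gl {φ : ℕ → V3 → ℝ} {φ0 : V3 → ℝ} (hd : ∀ n, Differentiable ℝ (φ n)) (hd0 : Differentiable ℝ φ0) {C : ℝ} (hC : 0 ≤ C) {v : V3}
    (hL : ∀ n, ∀ w ∈ Metric.closedBall v 1, ‖gradient (φ n) w - gradient (φ n) v‖ ≤ C * ‖w - v‖)
    (hL0 : ∀ w ∈ Metric.closedBall v 1, ‖gradient φ0 w - gradient φ0 v‖ ≤ C * ‖w - v‖)
    (h : ∀ w, Tendsto (fun n => φ n w) atTop (nhds (φ0 w))) :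
    Tendsto (fun n => gradient (φ n) v) atTop (nhds (gradient φ0 v)) := by
  have key : ∀ e : V3, ‖e‖ = 1 → Tendsto (fun n => fderiv ℝ (φ n) v e) atTop (nhds (fderiv ℝ φ0 v e)) := fun e he => by
    rw [Metric.tendsto_nhds]
    intro ε hε
    set s := min 1 (ε / (4 * (C + 1)))
    have s0 : 0 < s := lt_min one_pos pv
    have s2 : 4 * (C * s) < 2 * ε := by
      have : s * (4 * (C + 1)) ≤ ε := (le_div_iff₀ pv).1 (min_le_right _ _)
      nlinarith
    have t := ((h (v + s • e)).sub (h v)).sub_const (φ0 (v + s • e) - φ0 v)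
    rw [sub_self] at t
    filter_upwards [(Metric.tendsto_nhds.1 t) (s * (ε - 2 * (C * s))) (mul_pos s0 ac)] with n hn
    rw [dist_eq, sub_zero] at hn
    have a := gl1 (hd n) hC he (hL n) s0 (min_le_left _ _)
    have b := gl1 hd0 hC he hL0 s0 (min_le_left _ _)
    rw [abs_lt] at hn
    rw [abs_le] at a b
    rw [dist_eq, abs_lt]
    constructor <;> refine lt_of_mul_lt_mul_left ?_ s0.le <;> nlinarith [a.1, a.2, b.1, b.2, hn.1, hn.2]
  let b := EuclideanSpace.basisFun (Fin 3) ℝ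
  have e : ∀ ψ : V3 → ℝ, gradient ψ v = ∑ i, (fderiv ℝ ψ v (b i)) • b i := fun ψ => by
    conv_lhs => rw [← b.sum_repr' (gradient ψ v)]
    refine Finset.sum_congr rfl fun i _ => ?_
    rw [real_inner_comm, gradient, InnerProductSpace.toDual_symm_apply]
  simp only [e]
  exact tendsto_finsetSum _ fun i _ => (key (b i) (b.orthonormal.1 i)).smul_const (b i)
lemma gron {T u0 : ℝ} {u R a : ℝ → ℝ} (hR : IntegrableOn R ca) (ha : IntegrableOn a ca) (a0 : ∀ s, 0 ≤ a s)
    (u00 : 0 ≤ u0) (h1 : ∀ t ∈ Icc 0 T, u t ≤ u0 + ∫ s in (0:ℝ)..t, R s)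
    (h2 : ∀ᵐ s ∂(volume.restrict ca), R s ≤ a s * u s) {t : ℝ} (ht : t ∈ Icc 0 T) :
    u t ≤ u0 * exp (∫ s in (0:ℝ)..t, a s) := by
  let P : ℝ → ℝ := fun s => max (R s) 0
  have hP : IntegrableOn P ca := hR.pos_part
  have T0 : 0 ≤ T := ht.1.trans ht.2
  have ii : ∀ {F : ℝ → ℝ}, IntegrableOn F ca → ∀ x ∈ Icc 0 T, ∀ y ∈ Icc 0 T, IntervalIntegrable F volume x y := fun hF x hx y hy =>
    intervalIntegrable_iff.2 (hF.mono_set (Set.Ioc_subset_Ioc (le_min hx.1 hy.1) (max_le hx.2 hy.2)))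
  have z : cu ∈ Icc 0 T := ⟨le_rfl, T0⟩
  let v : ℝ → ℝ := fun t => u0 + ∫ s in (0:ℝ)..t, P s
  let K : ℝ → ℝ := fun t => ∫ s in (0:ℝ)..t, a s
  have co : ∀ {F : ℝ → ℝ}, IntegrableOn F ca → ContinuousOn (fun t => ∫ s in (0:ℝ)..t, F s) dp := fun {F} hF => by
    have := intervalIntegral.continuousOn_primitive_interval (f := F) (μ := volume) (a := 0) (b := T) (by rwa [Set.uIcc_of_le T0, integrableOn_Icc_iff_integrableOn_Ioc])
    rwa [Set.uIcc_of_le T0] at this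
  have vc : ContinuousOn v dp := continuousOn_const.add (co hP)
  have uv : ∀ t ∈ Icc 0 T, u t ≤ v t := fun t ht => (h1 t ht).trans (add_le_add_right
    (intervalIntegral.integral_mono_on ht.1 (ii hR _ z _ ht) (ii hP _ z _ ht) fun s _ => le_max_left _ _) _)
  have vd : ∀ x ∈ Icc 0 T, ∀ y ∈ Icc 0 T, v y - v x = ∫ s in x..y, P s := fun x hx y hy => by
    rw [← intervalIntegral.integral_interval_sub_left (ii hP _ z _ hy) (ii hP _ z _ hx)]; simp only [v]; ring
  have mono : ∀ x ∈ Icc 0 T, ∀ y ∈ Icc 0 T, x ≤ y → v x ≤ v y := fun x hx y hy h => by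
    have := vd x hx y hy
    have := intervalIntegral.integral_nonneg (f := P) (μ := volume) h fun s _ => le_max_right _ _
    linarith
  have v0 : v 0 = u0 := by simp [v]
  have vn : ∀ x ∈ Icc 0 T, 0 ≤ v x := fun x hx => u00.trans (v0 ▸ mono 0 z x hx hx.1)
  have st : ∀ x ∈ Icc 0 T, ∀ y ∈ Icc 0 T, x ≤ y → v y - v x ≤ (K y - K x) * v y := fun x hx y hy h => by
    have sub : Ioc x y ⊆ Ioc 0 T := Set.Ioc_subset_Ioc hx.1 hy.2
    rw [vd x hx y hy, intervalIntegral.integral_interval_sub_left (ii ha _ z _ hy) (ii ha _ z _ hx), ← intervalIntegral.integral_mul_const,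
      intervalIntegral.integral_of_le h, intervalIntegral.integral_of_le h]
    refine integral_mono_ae (hP.mono_set sub) ((ha.mono_set sub).mul_const _) ?_
    filter_upwards [ae_restrict_of_ae_restrict_of_subset sub h2, ae_restrict_mem measurableSet_Ioc] with s hs hm
    have sm : s ∈ Icc 0 T := Set.Ioc_subset_Icc_self (sub hm)
    exact max_le (hs.trans (mll ((uv s sm).trans (mono s sm y hy hm.2)) (a0 s))) (mul_nonneg (a0 s) (vn y hy))
  have main : ∀ ε : ℝ, 0 < ε → v t ≤ u0 * exp (cn * K t) := fun ε hε => by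
    have cl : IsClosed ({x | v x ≤ u0 * exp (cn * K x)} ∩ Icc 0 T) := by
      rw [Set.inter_comm]
      exact (isClosed_Icc).isClosed_le vc (continuousOn_const.mul (continuous_exp.comp_continuousOn (continuousOn_const.mul (co ha))))
    refine cl.Icc_subset_of_forall_exists_gt (by simp [v, K]) (fun x hx y hy => ?_) ht
    have hxm : x ∈ Icc 0 T := ⟨hx.2.1, hx.2.2.le⟩
    have kc : ContinuousWithinAt K dp x := co ha x hxm
    have kc2 := (kc.mono (Set.Ioc_subset_Icc_self.trans (Set.Icc_subset_Icc_left hx.2.1) : Ioc x T ⊆ _)).tendsto.eventually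
      (gt_mem_nhds (show K x < K x + ε / cn by linarith [show 0 < ε / cn by positivity]))
    rw [nhdsWithin_Ioc_eq_nhdsGT hx.2.2] at kc2
    obtain ⟨w, hw1, hw2, hw3⟩ := (kc2.and (Ioc_mem_nhdsGT (lt_min hy hx.2.2))).exists
    have wm : w ∈ Icc 0 T := ⟨hx.2.1.trans hw2.le, hw3.trans (min_le_right _ _)⟩
    refine ⟨w, ?_, hw2, hw3.trans (min_le_left _ _)⟩
    have s1 := st x hxm w wm hw2.le
    set d := K w - K x
    have d0 : 0 ≤ d := by
      simp only [d, K]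
      rw [intervalIntegral.integral_interval_sub_left (ii ha _ z _ wm) (ii ha _ z _ hxm)]
      exact intervalIntegral.integral_nonneg hw2.le fun s _ => a0 s
    have d1 : d * cn < ε := (lt_div_iff₀ pv).1 (by simp only [d]; linarith)
    have e1 := add_one_le_exp (cn * d)
    have h3 : 1 ≤ exp (cn * d) * (1 - d) := by
      have : 0 ≤ 1 - d := by nlinarith
      nlinarith [mlr e1 this, mul_nonneg d0 (show 0 ≤ ε - d * cn by linarith)]
    have ek : exp (cn * K w) = exp (cn * K x) * exp (cn * d) := by
      rw [← exp_add]; congr 1; simp only [d]; ring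
    have hx1 : v x ≤ u0 * exp (cn * K x) := hx.1
    show v w ≤ _
    rw [ek]
    have vw := vn w wm
    have e0 := exp_pos (cn * d)
    calc v w ≤ v w * (exp (cn * d) * (1 - d)) := le_mul_of_one_le_right vw h3
      _ = (v w * (1 - d)) * exp (cn * d) := by ring
      _ ≤ v x * exp (cn * d) := mlr ac e0.le
      _ ≤ _ := by rw [← mul_assoc]; exact mlr hx1 e0.le
  have l : Tendsto (fun ε : ℝ => u0 * exp (cn * K t)) (nhdsWithin 0 (Set.Ioi 0)) (nhds (u0 * exp ((1 + 0) * K t))) :=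
    (Continuous.tendsto (by fun_prop) 0).mono_left nhdsWithin_le_nhds
  rw [add_zero, one_mul] at l
  exact (uv t ht).trans (ge_of_tendsto l (eventually_mem_nhdsWithin.mono fun ε hε => main ε hε))
lemma LB.mono {κ ζ a b a' b' : ℝ} {l : V3 → V3} (L : LB κ ζ a b l) (ha : a ≤ a') (hb : b ≤ b') : LB κ ζ a' b' l :=
  ⟨L.m, L.A0.trans ha, L.B0.trans hb, fun v w => (L.a v w).trans (mlr ha (rpow_nonneg (mx_pos v w).le _)),
    fun v w => (L.b v w).trans (mlr (mlr hb (norm_nonneg _)) (rpow_nonneg (mx_pos v w).le _))⟩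
lemma LB.loc {κ ζ a b : ℝ} {l : V3 → V3} (hz : 0 ≤ ζ) (L : LB κ ζ a b l) (v : V3) :
    ∀ w ∈ Metric.closedBall v 1, ‖l w - l v‖ ≤ b * (2 + ‖v‖) ^ ζ * ‖w - v‖ := fun w hw => by
  rw [mem_closedBall_iff_norm] at hw
  have h1 : mx w v ≤ 2 + ‖v‖ := by
    have : ‖w‖ ≤ 1 + ‖v‖ := by linarith [norm_le_norm_sub_add w v]
    exact max_le ((jap_le_one_add w).trans ac) ((jap_le_one_add v).trans ac)
  have h2 := mll (rpow_le_rpow (mx_pos w v).le h1 hz) (mul_nonneg L.B0 (norm_nonneg (w - v)))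
  linarith [L.b w v]
namespace TS
variable {γ κ ζ ν p T E Hb Mf Mg c : ℝ} {K1 K2 K3 : ℝ → ℝ} {f g q : ℝ → V3 → ℝ} {Y : ℝ → V3 → V3}
local notation "𝕋" => TS γ κ ζ ν p T E Hb Mf Mg c K1 K2 K3 f g q Y
lemma Ic (A : 𝕋) {s : ℝ} (S : Stat γ E Hb (f s) (Y s)) (r : ℕ → ℝ)
    (hk : ∀ n, K1 (r n) ^ 2 + K3 (r n) ^ 2 ≤ K1 s ^ 2 + K3 s ^ 2 + 1) (hr : Tendsto r atTop (nhds s)) :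
    Tendsto (fun n => II γ f g Y (r n) s) atTop (nhds (II γ f g Y s s)) := by
  have hz := (A.G s).par.hζ
  set m := √(K1 s ^ 2 + K3 s ^ 2 + 1)
  have L : ∀ x, K1 x ^ 2 + K3 x ^ 2 ≤ K1 s ^ 2 + K3 s ^ 2 + 1 → LB κ ζ (2 * m) m (logGrad (g x)) := fun x hx =>
    (A.G x).LB.mono (by linarith [le_sqrt_of_sq_le (show K1 x ^ 2 ≤ K1 s ^ 2 + K3 s ^ 2 + 1 by linarith [sq_nonneg (K3 x)])])
      (le_sqrt_of_sq_le (by linarith [sq_nonneg (K1 x)]))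
  refine (A.ss s S).Ilim hz (A.G s).par.p3 (fun n => L _ (hk n)) fun v => ?_
  have hd := fun x => (A.G x).logC2.differentiable two_ne_zero
  refine gl (fun n => hd (r n)) (hd s) (C := m * (2 + ‖v‖) ^ ζ) pv (fun n => (L _ (hk n)).loc hz v) ((L s ac).loc hz v) fun w => ?_
  exact (((A.gc w).tendsto s).comp hr).log ((A.G s).pos w).ne'
def RR (γ : ℝ) (f g q : ℝ → V3 → ℝ) (Y : ℝ → V3 → V3) (s : ℝ) : ℝ := -2 * Dd γ f Y s + II γ f g Y s s - QQ f q s s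
lemma tel (A : 𝕋) {τ : ℝ} (h0 : 0 < τ) (hT : τ ≤ T) :
    IntegrableOn (fun s => QQ f q s s) cf ∧ IntegrableOn (fun s => II γ f g Y s s) cf ∧
      Aa f g τ τ - Aa f g 0 0 = (∫ s in (0:ℝ)..τ, QQ f q s s) - ∫ s in (0:ℝ)..τ, II γ f g Y s s := by
  have sub : Ioc 0 τ ⊆ Ioc 0 T := Set.Ioc_subset_Ioc_right hT
  have up : ∀ {x}, x ∈ Icc 0 τ → x ∈ Icc 0 T := fun h => ⟨h.1, h.2.trans hT⟩
  have Mf0 : 0 ≤ Mf := (integral_nonneg fun v => mul_nonneg (jpp v p).le fo).trans (A.Mfb 0)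
  have z : cu ∈ Icc 0 T := ⟨le_rfl, A.hT.le⟩
  have ij : ∀ r x, x ∈ Icc 0 T → IntervalIntegrable (II γ f g Y r) volume 0 x := fun r x hx =>
    (intervalIntegrable_iff_integrableOn_Ioc_of_le hx.1).2 ((A.IIi r).mono_set (Set.Ioc_subset_Ioc_right hx.2))
  refine tele (C := 32 * Mf) (k := fun t => K1 t ^ 2 + K3 t ^ 2) (BQ := fun s => K2 s * Mf) h0 pv
    (fun r hr r' hr' t => A.tA r (up hr) r' (up hr') t) (fun r t ht t' ht' => ?_) A.Qm A.IIm A.Qb ((A.K2i.mono_set sub).mul_const _) A.Qc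
    (ae_restrict_of_ae_restrict_of_subset sub A.IIb) (A.Di.mono_set sub) (A.ki.mono_set sub) (fun r => by positivity) ?_
  · have a := A.wf0t r (up ht)
    have b := A.wf0t r (up ht')
    rw [← intervalIntegral.integral_interval_sub_left (ij r _ (up ht')) (ij r _ (up ht))]
    linarith
  · filter_upwards [ae_restrict_of_ae_restrict_of_subset sub A.St] with s S r _ hk hr
    exact A.Ic S r hk hr
lemma main (A : 𝕋) {t : ℝ} (ht : t ∈ Icc 0 T) :
    (∫ v, Hd (f t) (g t) v) ≤ (∫ v, Hd (f 0) (g 0) v) * exp (CE E c * (1 + Mf ^ 2 + Mg ^ 2) * ∫ s in (0:ℝ)..t, (K1 s ^ 2 + K3 s ^ 2)) := by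
  have c0 := CE_pos (E := E) A.c0
  obtain ⟨iq, iI, -⟩ := A.tel A.hT le_rfl
  have iD : IntegrableOn (fun s => -2 * Dd γ f Y s) ca := A.Di.const_mul _
  have iR : IntegrableOn (RR γ f g q Y) ca := (iD.add iI).sub iq
  have u : ∀ t, (∫ v, Hd (f t) (g t) v) = entropy (f t) - Aa f g t t - 1 + ∫ v, g t v := fun t => by
    have h1 : Integrable (fun v => f t v * log (f t v) - f t v * log (g t v)) := (A.D t).entInt.sub (A.logInt t t)
    have h2 : Integrable (fun v => f t v * log (f t v) - f t v * log (g t v) - f t v) := h1.sub (A.D t).int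
    unfold Hd
    rw [integral_add h2 (A.gInt t), integral_sub h1 (A.D t).int, integral_sub (A.D t).entInt (A.logInt t t), (A.D t).mass]; rfl
  rw [← intervalIntegral.integral_const_mul]
  refine gron (u0 := ∫ v, Hd (f 0) (g 0) v) (u := fun t => ∫ v, Hd (f t) (g t) v) (a := fun s => CE E c * (1 + Mf ^ 2 + Mg ^ 2) * (K1 s ^ 2 + K3 s ^ 2)) iR (A.ki.const_mul _) (fun s => by positivity)
    (integral_nonneg fun v => Hd_nonneg fo ((A.G 0).pos v)) (fun t ht => ?_) ?_ ht
  · rcases ht.1.eq_or_lt with rfl | h0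
    · simp
    · have e := (A.tel h0 ht.2).2.2
      have en := A.ent t ht
      have m := A.mass ht
      have ii : ∀ {F : ℝ → ℝ}, IntegrableOn F ca → IntervalIntegrable F volume 0 t := fun h =>
        (intervalIntegrable_iff_integrableOn_Ioc_of_le ht.1).2 (h.mono_set (Set.Ioc_subset_Ioc_right ht.2))
      simp only [u]
      unfold RR
      rw [intervalIntegral.integral_sub ((ii iD).add (ii iI)) (ii iq), intervalIntegral.integral_add (ii iD) (ii iI), intervalIntegral.integral_const_mul]
      linarith
  · filter_upwards [A.St] with s S
    exact (A.ss s S).main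
end TS
lemma ell_full {γ : ℝ} (hγ : γ ∈ Ico ct 0) (E Hb : ℝ) : ∃ c : ℝ, 0 < c ∧ ∀ (p : ℝ) f, 2 ≤ p → Dens E Hb f →
    Integrable bb → ∀ v ξ : V3, c * jap v ^ γ * ‖ξ‖ ^ 2 ≤ ∫ w, f w * aw := by
  obtain ⟨c, R, k, hc, -, -, h⟩ := ellipticity_strong hγ E Hb
  refine ⟨c, hc, fun p f hp D hm v ξ => (h f D v ξ).trans ?_⟩
  simp only [mul_comm _ (f _)]
  exact setIntegral_le_integral (wt_Sb_int hγ D.meas D.nn hp hm v ξ) (aeo fun w =>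
    mul_nonneg (D.nn w) (mul_nonneg (wtn zero_le_one _) (Sbn _ _)))
lemma cut_entry (γ : ℝ) (z : V3) (i j : Fin 3) : cutoffKernel γ z i j = wt γ 1 z * Sb z az (esingle j) := by
  rw [← bilin_cutoff]
  simp [bilin, esingle]
lemma cut_int {γ : ℝ} (hγ : γ ∈ Ico ct 0) {f : V3 → ℝ} {p : ℝ} (hf : Measurable f)
    (hnn : ∀ v, 0 ≤ f v) (hp : 2 ≤ p) (hm : Integrable bb) (v ξ : V3) :
    quadForm (cutoffConv γ f v) ξ = ∫ w, f w * aw := by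
  have I := wt_Sb_int hγ hf hnn hp hm v
  have h : ∀ i j, Integrable (fun w => cutoffKernel γ aa i j * f w) := fun i j => by
    refine ((((I (esingle i + esingle j)).sub (I az)).sub (I (esingle j))).const_mul (1/2)).congr (aeo fun w => ?_)
    simp only [cut_entry, Pi.sub_apply, Sb_add_left, Sb_add_right, Sb_comm _ (esingle j) az]
    ring
  have h' : ∀ i j, Integrable (fun w => f w * (cutoffKernel γ aa i j * ξ i * ξ j)) := fun i j =>
    ((h i j).mul_const (ξ i * ξ j)).congr (aeo fun w => by ring)
  simp only [← bilin_cutoff, quadForm, bilin, cutoffConv, Finset.mul_sum]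
  rw [integral_finsetSum _ fun i _ => integrable_finsetSum _ fun j _ => h' i j]
  refine Finset.sum_congr rfl fun i _ => ?_
  rw [integral_finsetSum _ fun j _ => h' i j]
  refine Finset.sum_congr rfl fun j _ => ?_
  rw [mul_assoc, ← integral_mul_const]
  congr 1; ext w; ring
lemma dw_cont {T : ℝ} (hT : 0 < T) {u : ℝ → ℝ} (hu : ContDiffOn ℝ 1 u dp) :
    Continuous (fun t => derivWithin u dp ck) :=
  (hu.continuousOn_derivWithin (uniqueDiffOn_Icc hT) le_rfl).comp_continuous (cl_cont T) (cl_mem hT)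
lemma dw_ftc {T : ℝ} (hT : 0 < T) {u : ℝ → ℝ} (hu : ContDiffOn ℝ 1 u dp) {r t : ℝ} (hr : r ∈ Icc 0 T) (ht : t ∈ Icc 0 T) :
    u t - u r = ∫ s in r..t, derivWithin u dp (cl T s) := by
  have hs : Set.uIcc r t ⊆ Icc 0 T := Set.uIcc_subset_Icc hr ht
  rw [intervalIntegral.integral_eq_sub_of_hasDeriv_right (hu.continuousOn.mono hs) (fun x hx => ?_) ((dw_cont hT hu).intervalIntegrable _ _)]
  have hx' : x ∈ Set.Ioo 0 T := ⟨(le_min hr.1 ht.1).trans_lt hx.1, hx.2.trans_le (max_le hr.2 ht.2)⟩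
  have hm := Set.Ioo_subset_Icc_self hx'
  rw [cl_eq hm]
  exact (((hu.differentiableOn one_ne_zero x hm).hasDerivWithinAt).hasDerivAt (Icc_mem_nhds hx'.1 hx'.2)).hasDerivWithinAt
namespace Setting
variable {γ T : ℝ} (S : Setting γ T)
def P (S : Setting γ T) : ℝ := rhoExp γ S.κ S.ζ S.ν - γ
lemma par : Par γ S.κ S.ζ S.ν S.P := by
  have h1 : max (2 * S.κ) (2 * S.κ + 2 * γ + 4) ≤ rhoExp γ S.κ S.ζ S.ν := le_max_left _ _
  have h2 : max (2 * S.ζ) S.ν ≤ rhoExp γ S.κ S.ζ S.ν := le_max_right _ _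
  rw [max_le_iff] at h1 h2
  refine ⟨S.hγ, S.hκ, S.hζ, S.hν, ?_, ?_, ?_, ?_⟩ <;> unfold P <;> linarith
def Q (S : Setting γ T) (t : ℝ) (v : V3) : ℝ := derivWithin (fun s => log (S.g s v)) dp ck
lemma logC (v : V3) : ContDiffOn ℝ 1 (fun s => log (S.g s v)) dp :=
  (S.hg.timeC1 v).log fun t ht => (S.hg.pos t ht v).ne'
lemma qg (t : ℝ) (v : V3) : S.g ck v * S.Q t v = derivWithin (fun s => S.g s v) dp ck := by
  have h := cl_mem S.hT t
  have hp := S.hg.pos _ h v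
  unfold Q
  rw [derivWithin.log ((S.hg.timeC1 v).differentiableOn one_ne_zero _ h) hp.ne' (uniqueDiffOn_Icc S.hT _ h)]
  field_simp
lemma ki' : IntegrableOn S.K2 dp ∧ IntegrableOn (fun t => S.K1 t ^ 2 + S.K3 t ^ 2) dp := by
  constructor <;> refine S.Kint.mono' ?_ (aeo fun t => ?_)
  · exact S.K2meas.aestronglyMeasurable
  · rw [norm_of_nonneg (S.K2nonneg t)]; nlinarith [sq_nonneg (S.K1 t), sq_nonneg (S.K3 t)]
  · exact ((S.K1meas.pow_const 2).add (S.K3meas.pow_const 2)).aestronglyMeasurable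
  · rw [norm_of_nonneg pv]; linarith [S.K2nonneg t]
lemma fm (t : ℝ) : Integrable (fun v => jap v ^ S.P * fb T S.f t v) :=
  (S.fMomentInt _ (cl_mem S.hT t)).congr (by filter_upwards [fb_ae S.hf S.hT t] with v h; rw [h]; rfl)
lemma mkTS {E Hb c : ℝ} (hE : (∫ v, ‖v‖ ^ 2 * S.f 0 v) ≤ E) (hH : entropy (S.f 0) ≤ Hb) (hc : 0 < c)
    (ell : ∀ t v ξ, c * jap v ^ γ * ‖ξ‖ ^ 2 ≤ ∫ w, fb T S.f t w * aw) :
    TS γ S.κ S.ζ S.ν S.P T E Hb S.Mf S.Mg c (fun t => S.K1 ck) (fun t => S.K2 ck) (fun t => S.K3 ck)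
      (fb T S.f) (fun t => S.g ck) S.Q (Yb (fb T S.f)) := by
  have p4 : 4 ≤ S.P := by linarith [S.par.p0, S.hκ]
  obtain ⟨a, b, d⟩ := statD S.hf S.hT p4 S.fm hE hH
  have cm := fun t => cl_mem S.hT t
  have ce : ∀ t ∈ Ioc 0 T, cl T t = t := fun t ht => cl_eq (Set.Ioc_subset_Icc_self ht)
  have cm' := (cl_cont T).measurable
  have fe := fun t (φ : V3 → ℝ) => integral_congr_ae (f := fun v => φ v * fb T S.f t v) (g := fun v => φ v * S.f ck v)
    (by filter_upwards [fb_ae S.hf S.hT t] with v h; rw [h])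
  exact {
    hT := S.hT, fm := fb_meas S.hf S.hT, Ym := Yb_meas (fb_meas S.hf S.hT)
    D := fb_dens S.hf S.hT hE hH, mf := S.fm
    Mfb := fun t => by rw [fe]; exact S.fMoment _ (cm t)
    G := fun t => ⟨S.par, S.hg.pos _ (cm t), S.hg.velC2 _ (cm t), S.K1nonneg _, S.K2nonneg _, S.K3nonneg _, S.K1bound _ (cm t), S.K3bound _ (cm t),
      S.gMomentInt _ (cm t), S.K2bound _ (cm t), fun v => by rw [mul_comm, S.qg]; exact S.hg.eqn _ (cm t) v⟩
    Mgb := fun t => S.gMoment _ (cm t)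
    c0 := hc, ell := ell
    km := ((S.K1meas.comp cm').pow_const 2).add ((S.K3meas.comp cm').pow_const 2)
    ki := (S.ki'.2.mono_set Set.Ioc_subset_Icc_self).congr_fun (fun t ht => by simp only [ce t ht]) measurableSet_Ioc
    K2m := S.K2meas.comp cm'
    K2i := (S.ki'.1.mono_set Set.Ioc_subset_Icc_self).congr_fun (fun t ht => by simp only [ce t ht]) measurableSet_Ioc
    St := a, Di := b, ent := d
    wf := fun φ h1 h2 t ht => wf0 S.hf S.hT p4 S.fm h1 h2 ht
    cd := fun φ h1 h2 => by
      simp only [fe]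
      exact (S.hf.contDistrib φ h1 h2).comp_continuous (cl_cont T) cm
    qc := fun v => dw_cont S.hT (S.logC v)
    ftc := fun v r hr t ht => by
      simp only [cl_eq hr, cl_eq ht]
      exact dw_ftc S.hT (S.logC v) hr ht
    gc := fun v => (S.hg.timeC1 v).continuousOn.comp_continuous (cl_cont T) cm
    ftg := fun v r hr t ht => by
      simp only [cl_eq hr, cl_eq ht, S.qg]
      exact dw_ftc S.hT (S.hg.timeC1 v) hr ht }
lemma re {f f' g : V3 → ℝ} (hf : ∀ v, 0 ≤ f v) (hg : ∀ v, 0 < g v) (e : f =ᵐ[volume] f') (i : Integrable (Hd f g)) :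
    relEntropy f' g = ENNReal.ofReal dm := by
  rw [ofReal_integral_eq_lintegral_ofReal i (aeo fun v => Hd_nonneg (hf v) (hg v)), relEntropy]
  refine lintegral_congr_ae ?_
  filter_upwards [e] with v h
  rw [← h, Hd]
  congr 1
  have g0 := hg v
  rcases (hf v).eq_or_lt with h0 | h0
  · simp [← h0]
  · rw [log_div h0.ne' g0.ne']
    field_simp
end Setting
/-- Gronwall conclusion in Setting (⋆) (Proposition 1 of the paper):
H(f_t|g_t) ≤ H(f₀|g₀) exp(𝒞 ∫₀ᵗ (K₁² + K₃²)), with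
𝒞 = C_γ (1 + M_f² + M_g²)(1 + c₀⁻¹), C_γ depending only on γ and c₀ the
ellipticity constant of the cut-off kernel, depending only on γ and on upper
bounds on the energy and entropy of f₀. -/
theorem relative_entropy_gronwall (γ : ℝ) (hγ : γ ∈ Set.Ico (-3 : ℝ) 0) :
    ∃ Cγ : ℝ, 0 < Cγ ∧
      ∀ E Hb : ℝ, ∃ c₀ : ℝ, 0 < c₀ ∧
        ∀ (T : ℝ) (S : Setting γ T),
          (∫ v, ‖v‖ ^ 2 * S.f 0 v) ≤ E → entropy (S.f 0) ≤ Hb →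
          -- c₀ is the ellipticity constant of the cut-off kernel for the f_s
          (∀ s ∈ Set.Icc (0 : ℝ) T, ∀ v ξ : V3,
            c₀ * jap v ^ γ * ‖ξ‖ ^ 2 ≤ quadForm (cutoffConv γ (S.f s) v) ξ) ∧
          ∀ t ∈ Set.Icc (0 : ℝ) T,
            relEntropy (S.f t) (S.g t) ≤
              relEntropy (S.f 0) (S.g 0) *
                ENNReal.ofReal (Real.exp
                  ((Cγ * (1 + S.Mf ^ 2 + S.Mg ^ 2) * (1 + c₀⁻¹)) *
                    ∫ s in (0 : ℝ)..t, (S.K1 s ^ 2 + S.K3 s ^ 2))) := by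
  refine ⟨1, one_pos, fun E Hb => ?_⟩
  obtain ⟨c, hc, hell⟩ := ell_full hγ E Hb
  have hC := CE_pos (E := E) hc
  refine ⟨min c (CE E c)⁻¹, lt_min hc (inv_pos.2 hC), fun T S hE hH => ?_⟩
  have D := fb_dens S.hf S.hT hE hH
  have p2 : 2 ≤ S.P := by linarith [S.par.p0, S.hκ]
  have ell := fun t => hell S.P (fb T S.f t) p2 (D t) (S.fm t)
  have A := S.mkTS hE hH hc ell
  constructor
  · intro s hs v ξ
    have e : cutoffConv γ (S.f s) v = cutoffConv γ (fb T S.f s) v := by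
      ext i j
      refine integral_congr_ae ?_
      filter_upwards [fb_ae S.hf S.hT s] with w h
      rw [h, cl_eq hs]
    rw [e, cut_int hγ (D s).meas (D s).nn p2 (S.fm s)]
    refine le_trans ?_ (ell s v ξ)
    gcongr
    · exact (jpp v γ).le
    · exact min_le_left _ _
  · intro t ht
    have h0 : (0:ℝ) ∈ Icc 0 T := ⟨le_rfl, S.hT.le⟩
    have ae : ∀ t ∈ Icc 0 T, fb T S.f t =ᵐ[volume] S.f t := fun t ht => by simpa only [cl_eq ht] using fb_ae S.hf S.hT t
    have r : ∀ t ∈ Icc 0 T, relEntropy (S.f t) (S.g t) = ENNReal.ofReal (∫ v, Hd (fb T S.f t) (S.g t) v) := fun t ht =>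
      Setting.re (fb_nn T S.f t) (S.hg.pos t ht) (ae t ht) (by simpa only [cl_eq ht] using A.iH t t)
    have m := A.main ht
    simp only [cl_eq ht, cl_eq h0] at m
    rw [intervalIntegral.integral_congr (g := fun s => S.K1 s ^ 2 + S.K3 s ^ 2) fun s hs => by
      rw [Set.uIcc_of_le ht.1] at hs
      simp only [cl_eq (⟨hs.1, hs.2.trans ht.2⟩ : s ∈ Icc 0 T)]] at m
    have n0 : 0 ≤ ∫ v, Hd (fb T S.f 0) (S.g 0) v := integral_nonneg fun v => Hd_nonneg (fb_nn T S.f 0 v) (S.hg.pos 0 h0 v)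
    rw [r t ht, r 0 h0, ← ENNReal.ofReal_mul n0]
    refine ENNReal.ofReal_le_ofReal (m.trans (mll (exp_le_exp.2 (mlr ?_
      (intervalIntegral.integral_nonneg ht.1 fun s _ => by positivity))) n0))
    have h1 : CE E c ≤ (min c (CE E c)⁻¹)⁻¹ := by
      rw [le_inv_comm₀ hC (lt_min hc (inv_pos.2 hC))]; exact min_le_right _ _
    rw [one_mul, mul_comm]
    exact mll (by linarith) (by positivity)

end
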